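/- Let e : ℝ → [0,∞) be a smooth, compactly supported function and let ζ ∈ (0, 1/5). Then there exist a function Ψ : ℝ × 𝕋³ → ℝ whose spatial gradient ∇Ψ belongs to the Hölder class C^ζ(ℝ × 𝕋³) (Hölder continuous jointly in time and space with exponent ζ) and a vector field Q ∈ L^∞(ℝ; C^{2ζ}(𝕋³; ℝ³)) such that ∇Ψ is a weak solution of the 3D quasi-geostrophic system, i.e. for every φ ∈ C^∞(ℝ × 𝕋³) which is compactly supported in time, ∫_ℝ ∫_{𝕋³} [ ∂_t(∇φ) · ∇Ψ + ∇Ψ · ((∇̄⊥Ψ · ∇) ∇φ) ] dx dt = 0, and moreover ∫_{𝕋³} |∇Ψ(t,x)|² dx = e(t) for every t ∈ ℝ. -/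

import Mathlib

open Real MeasureTheory

noncomputable section

/-- Partial derivative of a scalar function in the `i`-th coordinate direction. -/
def pd3 (i : Fin 3) (f : (Fin 3 → ℝ) → ℝ) (x : Fin 3 → ℝ) : ℝ :=
  fderiv ℝ f x (Pi.single i 1)

/-- The fundamental domain `[0,2π]³` of the torus `𝕋³ = (ℝ/2πℤ)³`. -/
def box3 : Set (Fin 3 → ℝ) := Set.Icc 0 (fun _ => 2 * Real.pi)

/-- `2π`-periodicity in each of the three spatial variables. -/
def Periodic3 {E : Type*} (f : (Fin 3 → ℝ) → E) : Prop :=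
  ∀ (x : Fin 3 → ℝ) (i : Fin 3), f (x + Pi.single i (2 * Real.pi)) = f x

/-- The integrand of the weak formulation of the 3D quasi-geostrophic system:
`∂ₜ(∇φ) · ∇Ψ + ∇Ψ · ((∇̄⊥Ψ · ∇)∇φ)`, where `∇̄⊥Ψ = (-∂_yΨ, ∂_xΨ, 0)`. -/
def qgWeakIntegrand (Ψ φ : ℝ → (Fin 3 → ℝ) → ℝ) (t : ℝ) (x : Fin 3 → ℝ) : ℝ :=
  (∑ i, deriv (fun s => pd3 i (φ s) x) t * pd3 i (Ψ t) x) +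
    ∑ i, pd3 i (Ψ t) x *
      (-(pd3 1 (Ψ t) x) * pd3 0 (fun y => pd3 i (φ t) y) x +
        pd3 0 (Ψ t) x * pd3 1 (fun y => pd3 i (φ t) y) x)

namespace QG

open Filter Topology Metric
open scoped ComplexConjugate

section

section OneVariable
variable {X : Type*} [TopologicalSpace X]

/-- Uniform closeness of slices over a compact set. -/
theorem eventually_slice_close {f : X → ℂ → ℂ} {x₀ : X} {K : Set ℂ} (hK : IsCompact K)
    (hf : ∀ y ∈ K, ContinuousAt (Function.uncurry f) (x₀, y)) {ε : ℝ} (hε : 0 < ε) :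
    ∀ᶠ x in 𝓝 x₀, ∀ y ∈ K, ‖f x y - f x₀ y‖ ≤ ε := by
  apply hK.eventually_forall_of_forall_eventually (P := fun x y => ‖f x y - f x₀ y‖ ≤ ε)
  intro y hy
  have h1 := hf y hy
  have h2 : ContinuousAt (fun p : X × ℂ => Function.uncurry f (x₀, p.2)) (x₀, y) :=
    ContinuousAt.comp (x := (x₀, y)) (g := Function.uncurry f)
      (f := fun p : X × ℂ => (x₀, p.2)) h1 (by fun_prop)
  have h3 := (h1.sub h2).norm
  have h4 : ∀ᶠ p in 𝓝 (x₀, y), ‖Function.uncurry f p - Function.uncurry f (x₀, p.2)‖ < ε := by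
    apply h3.eventually_lt_const
    simpa using hε
  exact h4.mono fun p hp => hp.le

/-- Cauchy's estimate on a closed ball of holomorphy. -/
theorem norm_deriv_le_of_closedBall {f : ℂ → ℂ} {c : ℂ} {R M : ℝ} (hR : 0 < R)
    (hf : ∀ w ∈ closedBall c R, DifferentiableAt ℂ f w) (hM : ∀ w ∈ closedBall c R, ‖f w‖ ≤ M) :
    ‖deriv f c‖ ≤ M / R := by
  apply Complex.norm_deriv_le_of_forall_mem_sphere_norm_le hR
  · apply DifferentiableOn.diffContOnCl
    rw [closure_ball c hR.ne']
    exact fun w hw => (hf w hw).differentiableWithinAt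
  · exact fun w hw => hM w (sphere_subset_closedBall hw)

theorem exists_ball_subset {x₀ : X} {ζ₀ : ℂ} {Ω : Set (X × ℂ)} (hΩ : Ω ∈ 𝓝 (x₀, ζ₀)) :
    ∃ R > 0, ∀ᶠ x in 𝓝 x₀, ∀ w ∈ closedBall ζ₀ R, (x, w) ∈ Ω := by
  rw [nhds_prod_eq, mem_prod_iff] at hΩ
  obtain ⟨s, hs, t, ht, hst⟩ := hΩ
  obtain ⟨R, hR, hRt⟩ := Metric.nhds_basis_closedBall.mem_iff.1 ht
  exact ⟨R, hR, (eventually_mem_set.2 hs).mono fun x hx w hw => hst ⟨hx, hRt hw⟩⟩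

theorem continuousAt_deriv_param {f : X → ℂ → ℂ} {x₀ : X} {ζ₀ : ℂ}
    (hc : ∀ᶠ p in 𝓝 (x₀, ζ₀), ContinuousAt (Function.uncurry f) p)
    (hd : ∀ᶠ p : X × ℂ in 𝓝 (x₀, ζ₀), DifferentiableAt ℂ (f p.1) p.2) :
    ContinuousAt (fun p : X × ℂ => deriv (f p.1) p.2) (x₀, ζ₀) := by
  obtain ⟨R, hR, hΩ⟩ := exists_ball_subset (hc.and hd)
  have hΩ0 := hΩ.self_of_nhds
  have hcont : ContinuousAt (deriv (f x₀)) ζ₀ := by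
    have hdo : DifferentiableOn ℂ (f x₀) (ball ζ₀ R) := fun w hw =>
      (hΩ0 w (ball_subset_closedBall hw)).2.differentiableWithinAt
    exact ((hdo.deriv isOpen_ball).differentiableAt
      (isOpen_ball.mem_nhds (mem_ball_self hR))).continuousAt
  rw [Metric.continuousAt_iff'] at hcont ⊢
  intro ε hε
  have e1 := eventually_slice_close (f := f) (x₀ := x₀) (isCompact_closedBall ζ₀ R)
    (fun y hy => (hΩ0 y hy).1) (show 0 < ε / 4 * (R / 2) by positivity)
  have e2 : ∀ᶠ w in 𝓝 ζ₀, w ∈ ball ζ₀ (R / 2) := isOpen_ball.mem_nhds (mem_ball_self (by positivity))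
  have := ((hΩ.and e1).prod_nhds ((hcont (ε / 2) (by positivity)).and e2))
  filter_upwards [this] with p hp
  obtain ⟨⟨h1, h2⟩, h3, h4⟩ := hp
  have hsub : closedBall p.2 (R / 2) ⊆ closedBall ζ₀ R := by
    apply closedBall_subset_closedBall'
    have := mem_ball.1 h4
    linarith
  have hp2 : p.2 ∈ closedBall ζ₀ R := hsub (mem_closedBall_self (by positivity))
  have key : ‖deriv (fun w => f p.1 w - f x₀ w) p.2‖ ≤ ε / 4 * (R / 2) / (R / 2) := by
    apply norm_deriv_le_of_closedBall (by positivity)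
    · exact fun w hw => (h1 w (hsub hw)).2.sub (hΩ0 w (hsub hw)).2
    · exact fun w hw => h2 w (hsub hw)
  rw [deriv_fun_sub (h1 _ hp2).2 (hΩ0 _ hp2).2, mul_div_assoc, div_self (by positivity),
    mul_one] at key
  rw [dist_eq_norm] at h3 ⊢
  calc ‖deriv (f p.1) p.2 - deriv (f x₀) ζ₀‖
      = ‖(deriv (f p.1) p.2 - deriv (f x₀) p.2) + (deriv (f x₀) p.2 - deriv (f x₀) ζ₀)‖ := by
        congr 1; ring
    _ ≤ _ := norm_add_le _ _
    _ < ε := by linarith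

/-- Interchange of a parameter derivative with a complex derivative. -/
theorem hasDerivAt_deriv_param {𝕜 : Type*} [RCLike 𝕜] [NormedSpace 𝕜 ℂ]
    {F G : 𝕜 → ℂ → ℂ} {s₀ : 𝕜} {ζ₀ : ℂ}
    (hF : ∀ᶠ p : 𝕜 × ℂ in 𝓝 (s₀, ζ₀), HasDerivAt (fun s => F s p.2) (G p.1 p.2) p.1)
    (hG : ∀ᶠ p in 𝓝 (s₀, ζ₀), ContinuousAt (Function.uncurry G) p)
    (hFd : ∀ᶠ p : 𝕜 × ℂ in 𝓝 (s₀, ζ₀), DifferentiableAt ℂ (F p.1) p.2)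
    (hGd : ∀ᶠ p : 𝕜 × ℂ in 𝓝 (s₀, ζ₀), DifferentiableAt ℂ (G p.1) p.2)
    [SMulCommClass ℂ 𝕜 ℂ] :
    HasDerivAt (fun s => deriv (F s) ζ₀) (deriv (G s₀) ζ₀) s₀ := by
  obtain ⟨R, hR, hΩ⟩ := exists_ball_subset (hF.and (hG.and (hFd.and hGd)))
  have hΩ0 := hΩ.self_of_nhds
  rw [hasDerivAt_iff_isLittleO, Asymptotics.isLittleO_iff]
  intro ε hε
  have e1 := eventually_slice_close (f := G) (x₀ := s₀) (isCompact_closedBall ζ₀ R)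
    (fun y hy => (hΩ0 y hy).2.1) (show 0 < ε * R by positivity)
  obtain ⟨δ, hδ, hball⟩ := Metric.nhds_basis_ball.mem_iff.1 (hΩ.and e1)
  filter_upwards [isOpen_ball.mem_nhds (mem_ball_self hδ)] with s hs
  have hζ : ζ₀ ∈ closedBall ζ₀ R := mem_closedBall_self hR.le
  have hs0 : s₀ ∈ ball s₀ δ := mem_ball_self hδ
  have key : ‖deriv (fun w => F s w - F s₀ w - (s - s₀) • G s₀ w) ζ₀‖ ≤ ε * R * ‖s - s₀‖ / R := by
    apply norm_deriv_le_of_closedBall hR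
    · intro w hw
      exact (((hball hs).1 w hw).2.2.1.sub (hΩ0 w hw).2.2.1).sub
        ((hΩ0 w hw).2.2.2.const_smul (s - s₀))
    · intro w hw
      have hmv := (convex_ball s₀ δ).norm_image_sub_le_of_norm_hasDerivWithin_le
        (𝕜 := 𝕜) (f := fun s => F s w - (s - s₀) • G s₀ w)
        (f' := fun s => G s w - G s₀ w) (x := s₀) (y := s) (C := ε * R) ?_ ?_ hs0 hs
      · refine le_trans (le_of_eq (congrArg norm ?_)) hmv
        simp only [sub_self, zero_smul]
        abel
      · intro x hx
        have h1 := ((hball hx).1 w hw).1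
        have h2 : HasDerivAt (fun s : 𝕜 => (s - s₀) • G s₀ w) ((1 : 𝕜) • G s₀ w) x :=
          ((hasDerivAt_id x).sub_const s₀).smul_const _
        rw [one_smul] at h2
        exact (h1.sub h2).hasDerivWithinAt
      · intro x hx
        exact (hball hx).2 w hw
  have hd : deriv (fun w => F s w - F s₀ w - (s - s₀) • G s₀ w) ζ₀
      = deriv (F s) ζ₀ - deriv (F s₀) ζ₀ - (s - s₀) • deriv (G s₀) ζ₀ := by
    have a1 := ((hball hs).1 _ hζ).2.2.1.hasDerivAt
    have a2 := (hΩ0 _ hζ).2.2.1.hasDerivAt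
    have a3 := (hΩ0 _ hζ).2.2.2.hasDerivAt.const_smul (s - s₀)
    exact ((a1.sub a2).sub a3).deriv
  rw [hd] at key
  refine key.trans (le_of_eq ?_)
  field_simp

end OneVariable

abbrev E := ℂ × ℂ

/-- Osgood: a continuous separately holomorphic function is holomorphic. -/
theorem differentiableAt_of_separate {f : E → ℂ} {z : E}
    (hc : ∀ᶠ w in 𝓝 z, ContinuousAt f w)
    (h1 : ∀ᶠ w in 𝓝 z, DifferentiableAt ℂ (fun ζ => f (ζ, w.2)) w.1)
    (h2 : ∀ᶠ w in 𝓝 z, DifferentiableAt ℂ (fun η => f (w.1, η)) w.2) :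
    DifferentiableAt ℂ f z := by
  have hsw : Tendsto (Prod.swap : E → E) (𝓝 (z.2, z.1)) (𝓝 z) := by
    have : Continuous (Prod.swap : E → E) := continuous_swap
    exact this.tendsto (z.2, z.1)
  have c1 : ContinuousAt (fun p : ℂ × ℂ => deriv (fun ζ => f (ζ, p.1)) p.2) (z.2, z.1) := by
    apply continuousAt_deriv_param (f := fun η ζ => f (ζ, η))
    · filter_upwards [hsw.eventually hc] with p hp
      exact ContinuousAt.comp (f := Prod.swap) (g := f) hp continuous_swap.continuousAt
    · exact hsw.eventually h1
  have c2 : ContinuousAt (fun p : ℂ × ℂ => deriv (fun η => f (p.1, η)) p.2) (z.1, z.2) := by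
    apply continuousAt_deriv_param (f := fun ζ η => f (ζ, η)) _ h2
    exact hc
  have c1' : ContinuousAt (fun p : ℂ × ℂ => deriv (fun ζ => f (ζ, p.2)) p.1) z := by
    have : ContinuousAt (Prod.swap : E → E) z := continuous_swap.continuousAt
    exact ContinuousAt.comp (f := Prod.swap)
      (g := fun p : ℂ × ℂ => deriv (fun ζ => f (ζ, p.1)) p.2) c1 this
  have := hasStrictFDerivAt_uncurry_coprod (𝕜 := ℂ) (u := z) (f := fun a b => f (a, b))
    (f₁ := fun a b => ContinuousLinearMap.toSpanSingleton ℂ (deriv (fun ζ => f (ζ, b)) a))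
    (f₂ := fun a b => ContinuousLinearMap.toSpanSingleton ℂ (deriv (fun η => f (a, η)) b))
    (by
      filter_upwards [h1] with v hv
      exact hv.hasDerivAt.hasFDerivAt)
    (by
      filter_upwards [h2] with v hv
      exact hv.hasDerivAt.hasFDerivAt)
    ((ContinuousLinearMap.toSpanSingletonCLE (𝕜 := ℂ) (E := ℂ)).continuous.continuousAt.comp c1')
    ((ContinuousLinearMap.toSpanSingletonCLE (𝕜 := ℂ) (E := ℂ)).continuous.continuousAt.comp c2)
  exact this.hasFDerivAt.differentiableAt

end

section

/-- The reflection whose fixed points are the real points `(ζ, conj ζ)`. -/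
def st (z : E) : E := (conj z.2, conj z.1)

/-- Complex neighbourhood of the real points. -/
def Strip (r : ℝ) : Set E := {z | ‖z.2 - conj z.1‖ < 2 * r}

def p1 : E := (2 * π, 2 * π)
def p2 : E := (2 * π * Complex.I, -(2 * π * Complex.I))

def dz (F : ℝ → E → ℂ) (t : ℝ) (z : E) : ℂ := deriv (fun ζ => F t (ζ, z.2)) z.1
def db (F : ℝ → E → ℂ) (t : ℝ) (z : E) : ℂ := deriv (fun η => F t (z.1, η)) z.2
def dt (F : ℝ → E → ℂ) (t : ℝ) (z : E) : ℂ := deriv (fun s => F s z) t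
/-- The function conjugate to `F` on real points. -/
def sm (F : ℝ → E → ℂ) (t : ℝ) (z : E) : ℂ := conj (F t (st z))

theorem continuous_st : Continuous st := by unfold st; fun_prop

theorem st_st (z : E) : st (st z) = z := by simp [st]

theorem isOpen_strip (r : ℝ) : IsOpen (Strip r) := by
  apply isOpen_lt _ continuous_const
  fun_prop

theorem st_mem {r : ℝ} {z : E} (hz : z ∈ Strip r) : st z ∈ Strip r := by
  simp only [Strip, Set.mem_ofPred_eq, st, Complex.conj_conj] at *
  rwa [norm_sub_rev]

theorem strip_mono {r s : ℝ} (h : r ≤ s) : Strip r ⊆ Strip s := fun z hz => by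
  simp only [Strip, Set.mem_ofPred_eq] at *
  linarith

theorem strip_add {r s : ℝ} {z v : E} (hz : z ∈ Strip r) (hv : ‖v‖ ≤ s) : z + v ∈ Strip (r + s) := by
  simp only [Strip, Set.mem_ofPred_eq] at *
  have h1 := (norm_fst_le v).trans hv
  have h2 := (norm_snd_le v).trans hv
  rw [← Complex.norm_conj] at h1
  calc ‖(z + v).2 - conj (z + v).1‖ = ‖(z.2 - conj z.1) + v.2 - conj v.1‖ := by
        congr 1; simp; ring
    _ ≤ ‖z.2 - conj z.1‖ + ‖v.2‖ + ‖conj v.1‖ :=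
        (norm_sub_le _ _).trans (add_le_add_left (norm_add_le _ _) _)
    _ < _ := by linarith

theorem strip_p1 {r : ℝ} {z : E} (hz : z ∈ Strip r) : z + p1 ∈ Strip r := by
  simp only [Strip, Set.mem_ofPred_eq] at *
  convert hz using 2
  simp [p1, Complex.conj_ofNat]

theorem strip_p2 {r : ℝ} {z : E} (hz : z ∈ Strip r) : z + p2 ∈ Strip r := by
  simp only [Strip, Set.mem_ofPred_eq] at *
  convert hz using 2
  simp [p2, Complex.conj_ofNat]

theorem st_add (z w : E) : st (z + w) = st z + st w := by simp [st]
theorem st_p1 : st p1 = p1 := by simp [st, p1, Complex.conj_ofNat]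
theorem st_p2 : st p2 = p2 := by simp [st, p2, Complex.conj_ofNat]

theorem convex_strip (r : ℝ) : Convex ℝ (Strip r) := by
  intro x hx y hy a b ha hb hab
  simp only [Strip, Set.mem_ofPred_eq] at *
  calc ‖(a • x + b • y).2 - conj (a • x + b • y).1‖
      = ‖(a : ℂ) * (x.2 - conj x.1) + (b : ℂ) * (y.2 - conj y.1)‖ := by
        congr 1; simp; ring
    _ ≤ a * ‖x.2 - conj x.1‖ + b * ‖y.2 - conj y.1‖ := by
        refine (norm_add_le _ _).trans (le_of_eq ?_)
        rw [norm_mul, norm_mul, Complex.norm_real, Complex.norm_real, Real.norm_of_nonneg ha,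
          Real.norm_of_nonneg hb]
    _ < 2 * r := by
        rcases ha.lt_or_eq with h | h
        · have h1 := mul_lt_mul_of_pos_left hx h
          have h2 := mul_le_mul_of_nonneg_left hy.le hb
          have h3 : a * (2 * r) + b * (2 * r) = 2 * r := by rw [← add_mul, hab, one_mul]
          linarith
        · subst h
          have : b = 1 := by linarith
          subst this; linarith

/-- Continuous in time and space, holomorphic in space, periodic. -/
structure Rg (J : Set ℝ) (r : ℝ) (F : ℝ → E → ℂ) : Prop where
  cont : ∀ t ∈ J, ∀ z ∈ Strip r, ContinuousAt (Function.uncurry F) (t, z)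
  hol : ∀ t ∈ J, ∀ z ∈ Strip r, DifferentiableAt ℂ (F t) z
  per : ∀ t ∈ J, ∀ z ∈ Strip r, F t (z + p1) = F t z ∧ F t (z + p2) = F t z

variable {J : Set ℝ} {r s : ℝ} {F G : ℝ → E → ℂ} {t : ℝ} {z : E}

theorem Rg.mono (hF : Rg J r F) (h : s ≤ r) : Rg J s F where
  cont t ht z hz := hF.cont t ht z (strip_mono h hz)
  hol t ht z hz := hF.hol t ht z (strip_mono h hz)
  per t ht z hz := hF.per t ht z (strip_mono h hz)

theorem Rg.monoJ {J' : Set ℝ} (hF : Rg J r F) (h : J' ⊆ J) : Rg J' r F where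
  cont t ht z hz := hF.cont t (h ht) z hz
  hol t ht z hz := hF.hol t (h ht) z hz
  per t ht z hz := hF.per t (h ht) z hz

theorem mem_nhds_JS (hJ : IsOpen J) (ht : t ∈ J) (hz : z ∈ Strip r) : J ×ˢ Strip r ∈ 𝓝 (t, z) :=
  (hJ.prod (isOpen_strip r)).mem_nhds ⟨ht, hz⟩

theorem Rg.congr (hJ : IsOpen J) (hF : Rg J r F) (h : ∀ t ∈ J, ∀ z ∈ Strip r, G t z = F t z) :
    Rg J r G where
  cont t ht z hz := by
    refine (hF.cont t ht z hz).congr ?_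
    filter_upwards [mem_nhds_JS hJ ht hz] with p hp
    exact (h _ hp.1 _ hp.2).symm
  hol t ht z hz := by
    refine (hF.hol t ht z hz).congr_of_eventuallyEq ?_
    filter_upwards [(isOpen_strip r).mem_nhds hz] with p hp
    exact h _ ht _ hp
  per t ht z hz := by
    rw [h _ ht _ (strip_p1 hz), h _ ht _ (strip_p2 hz), h _ ht _ hz]
    exact hF.per t ht z hz

theorem Rg.add (hF : Rg J r F) (hG : Rg J r G) : Rg J r (F + G) where
  cont t ht z hz := (hF.cont t ht z hz).add (hG.cont t ht z hz)
  hol t ht z hz := (hF.hol t ht z hz).add (hG.hol t ht z hz)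
  per t ht z hz := by
    simp only [Pi.add_apply, hF.per t ht z hz, hG.per t ht z hz, and_self]

theorem Rg.sub (hF : Rg J r F) (hG : Rg J r G) : Rg J r (F - G) where
  cont t ht z hz := (hF.cont t ht z hz).sub (hG.cont t ht z hz)
  hol t ht z hz := (hF.hol t ht z hz).sub (hG.hol t ht z hz)
  per t ht z hz := by
    simp only [Pi.sub_apply, hF.per t ht z hz, hG.per t ht z hz, and_self]

theorem Rg.mul (hF : Rg J r F) (hG : Rg J r G) : Rg J r (F * G) where
  cont t ht z hz := (hF.cont t ht z hz).mul (hG.cont t ht z hz)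
  hol t ht z hz := (hF.hol t ht z hz).mul (hG.hol t ht z hz)
  per t ht z hz := by
    simp only [Pi.mul_apply, hF.per t ht z hz, hG.per t ht z hz, and_self]

/-- Functions of time alone. -/
def tf (c : ℝ → ℂ) : ℝ → E → ℂ := fun t _ => c t

theorem Rg.tf {c : ℝ → ℂ} (hc : Continuous c) : Rg J r (tf c) where
  cont _ _ _ _ := (hc.comp continuous_fst).continuousAt
  hol _ _ _ _ := differentiableAt_const _
  per _ _ _ _ := ⟨rfl, rfl⟩

theorem Rg.smul (hF : Rg J r F) (c : ℂ) : Rg J r (c • F) where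
  cont t ht z hz := (hF.cont t ht z hz).const_smul c
  hol t ht z hz := (hF.hol t ht z hz).const_smul c
  per t ht z hz := by
    simp only [Pi.smul_apply, hF.per t ht z hz, and_self]

theorem Rg.zero : Rg J r 0 := Rg.tf (c := 0) continuous_const

theorem Rg.sum {ι : Type*} {A : Finset ι} {F : ι → ℝ → E → ℂ} (h : ∀ i ∈ A, Rg J r (F i)) :
    Rg J r (∑ i ∈ A, F i) := by
  classical
  induction A using Finset.induction_on with
  | empty => simpa using Rg.zero
  | insert a A ha ih =>
    rw [Finset.sum_insert ha]
    exact (h a (by simp)).add (ih fun i hi => h i (by simp [hi]))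

theorem hasFDerivAt_conj_st {f : E → ℂ} {z : E} (h : DifferentiableAt ℂ f (st z)) :
    DifferentiableAt ℂ (fun w => conj (f (st w))) z := by
  have hev := h.hasFDerivAt
  rw [hasFDerivAt_iff_isLittleO] at hev
  let L := fderiv ℂ f (st z)
  let M : E →L[ℂ] ℂ :=
    (ContinuousLinearMap.toSpanSingleton ℂ (conj (L (0, 1)))).coprod
      (ContinuousLinearMap.toSpanSingleton ℂ (conj (L (1, 0))))
  have hM : ∀ v, M v = conj (L (st v)) := by
    intro v
    have : st v = conj v.2 • ((1 : ℂ), (0 : ℂ)) + conj v.1 • ((0 : ℂ), (1 : ℂ)) := by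
      simp [st]
    rw [this, map_add, map_smul, map_smul]
    simp [M, add_comm]
  refine ⟨M, ?_⟩
  rw [hasFDerivAt_iff_isLittleO]
  have hst : Tendsto st (𝓝 z) (𝓝 (st z)) := continuous_st.tendsto z
  have := hev.comp_tendsto hst
  rw [Asymptotics.isLittleO_iff] at this ⊢
  intro c hc
  filter_upwards [this hc] with w hw
  rw [hM, ← map_sub, ← map_sub, Complex.norm_conj]
  have e1 : st (w - z) = st w - st z := by simp [st]
  have e2 : ‖st w - st z‖ = ‖w - z‖ := by
    rw [← e1, Prod.norm_def, Prod.norm_def]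
    simp only [st, Complex.norm_conj, max_comm]
  rw [e1, ← e2]
  simpa using hw

theorem Rg.sm (hF : Rg J r F) : Rg J r (sm F) where
  cont t ht z hz := by
    have h1 := hF.cont t ht _ (st_mem hz)
    have h2 : ContinuousAt (fun p : ℝ × E => (p.1, st p.2)) (t, z) := by
      have := continuous_st
      fun_prop
    exact Complex.continuous_conj.continuousAt.comp
      (ContinuousAt.comp (f := fun p : ℝ × E => (p.1, st p.2)) (x := (t, z)) h1 h2)
  hol t ht z hz := hasFDerivAt_conj_st (hF.hol t ht _ (st_mem hz))
  per t ht z hz := by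
    have := hF.per t ht _ (st_mem hz)
    simp only [QG.sm, st_add, st_p1, st_p2, this, and_self]

theorem sm_sm (F : ℝ → E → ℂ) : sm (sm F) = F := by
  ext t z; simp [sm, st_st]
theorem sm_add (F G : ℝ → E → ℂ) : sm (F + G) = sm F + sm G := by
  ext t z; simp [sm]
theorem sm_sub (F G : ℝ → E → ℂ) : sm (F - G) = sm F - sm G := by
  ext t z; simp [sm]
theorem sm_mul (F G : ℝ → E → ℂ) : sm (F * G) = sm F * sm G := by
  ext t z; simp [sm]
theorem sm_smul (c : ℂ) (F : ℝ → E → ℂ) : sm (c • F) = conj c • sm F := by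
  ext t z; simp [sm]
theorem sm_sum {ι : Type*} (A : Finset ι) (F : ι → ℝ → E → ℂ) :
    sm (∑ i ∈ A, F i) = ∑ i ∈ A, sm (F i) := by
  ext t z; simp [sm]

theorem deriv_conj_comp (f : ℂ → ℂ) (x : ℂ) :
    deriv (fun w => conj (f (conj w))) x = conj (deriv f (conj x)) := by
  exact congrFun (deriv_conj_conj (f := f)) x

theorem dz_sm (F : ℝ → E → ℂ) : dz (sm F) = sm (db F) := by
  ext t z; exact deriv_conj_comp (fun η => F t (conj z.2, η)) z.1
theorem db_sm (F : ℝ → E → ℂ) : db (sm F) = sm (dz F) := by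
  ext t z; exact deriv_conj_comp (fun η => F t (η, conj z.1)) z.2

theorem slice_mem1 (hz : z ∈ Strip r) : ∀ᶠ ζ in 𝓝 z.1, (ζ, z.2) ∈ Strip r := by
  have : ContinuousAt (fun ζ : ℂ => ((ζ, z.2) : E)) z.1 := by fun_prop
  exact this.eventually ((isOpen_strip r).mem_nhds hz)
theorem slice_mem2 (hz : z ∈ Strip r) : ∀ᶠ ζ in 𝓝 z.2, (z.1, ζ) ∈ Strip r := by
  have : ContinuousAt (fun ζ : ℂ => ((z.1, ζ) : E)) z.2 := by fun_prop
  exact this.eventually ((isOpen_strip r).mem_nhds hz)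

theorem slice1 {f : E → ℂ} (h : DifferentiableAt ℂ f z) :
    DifferentiableAt ℂ (fun ζ => f (ζ, z.2)) z.1 := by
  have : DifferentiableAt ℂ (fun ζ : ℂ => ((ζ, z.2) : E)) z.1 := by fun_prop
  exact DifferentiableAt.comp (g := f) z.1 h this
theorem slice2 {f : E → ℂ} (h : DifferentiableAt ℂ f z) :
    DifferentiableAt ℂ (fun ζ => f (z.1, ζ)) z.2 := by
  have : DifferentiableAt ℂ (fun ζ : ℂ => ((z.1, ζ) : E)) z.2 := by fun_prop
  exact DifferentiableAt.comp (g := f) z.2 h this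

theorem fderiv_eq (h : DifferentiableAt ℂ (F t) z) (v : E) :
    fderiv ℂ (F t) z v = v.1 * dz F t z + v.2 * db F t z := by
  have e1 : dz F t z = fderiv ℂ (F t) z (1, 0) := by
    have h1 : HasDerivAt (fun ζ : ℂ => ((ζ, z.2) : E)) (1, 0) z.1 :=
      (hasDerivAt_id z.1).prodMk (hasDerivAt_const z.1 z.2)
    exact (HasFDerivAt.comp_hasDerivAt (l := F t) z.1 h.hasFDerivAt h1).deriv
  have e2 : db F t z = fderiv ℂ (F t) z (0, 1) := by
    have h1 : HasDerivAt (fun ζ : ℂ => ((z.1, ζ) : E)) (0, 1) z.2 :=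
      (hasDerivAt_const z.2 z.1).prodMk (hasDerivAt_id z.2)
    exact (HasFDerivAt.comp_hasDerivAt (l := F t) z.2 h.hasFDerivAt h1).deriv
  rw [e1, e2, ← smul_eq_mul, ← smul_eq_mul, ← map_smul, ← map_smul, ← map_add]
  simp

theorem dz_congr (h : ∀ w ∈ Strip r, F t w = G t w) (hz : z ∈ Strip r) : dz F t z = dz G t z := by
  apply Filter.EventuallyEq.deriv_eq
  filter_upwards [slice_mem1 hz] with w hw using h _ hw
theorem db_congr (h : ∀ w ∈ Strip r, F t w = G t w) (hz : z ∈ Strip r) : db F t z = db G t z := by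
  apply Filter.EventuallyEq.deriv_eq
  filter_upwards [slice_mem2 hz] with w hw using h _ hw

section rules
variable (hF : Rg J r F) (hG : Rg J r G) (ht : t ∈ J) (hz : z ∈ Strip r)
include hF ht hz

theorem Rg.d1 : DifferentiableAt ℂ (fun ζ => F t (ζ, z.2)) z.1 := slice1 (hF.hol t ht z hz)
theorem Rg.d2 : DifferentiableAt ℂ (fun ζ => F t (z.1, ζ)) z.2 := slice2 (hF.hol t ht z hz)
theorem Rg.dz_smul (c : ℂ) : dz (c • F) t z = c * dz F t z :=
  deriv_fun_const_smul c (hF.d1 ht hz)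
theorem Rg.db_smul (c : ℂ) : db (c • F) t z = c * db F t z :=
  deriv_fun_const_smul c (hF.d2 ht hz)
include hG
theorem Rg.dz_add : dz (F + G) t z = dz F t z + dz G t z :=
  deriv_fun_add (hF.d1 ht hz) (hG.d1 ht hz)
theorem Rg.db_add : db (F + G) t z = db F t z + db G t z :=
  deriv_fun_add (hF.d2 ht hz) (hG.d2 ht hz)
theorem Rg.dz_sub : dz (F - G) t z = dz F t z - dz G t z :=
  deriv_fun_sub (hF.d1 ht hz) (hG.d1 ht hz)
theorem Rg.db_sub : db (F - G) t z = db F t z - db G t z :=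
  deriv_fun_sub (hF.d2 ht hz) (hG.d2 ht hz)
theorem Rg.dz_mul : dz (F * G) t z = dz F t z * G t z + F t z * dz G t z :=
  deriv_fun_mul (hF.d1 ht hz) (hG.d1 ht hz)
theorem Rg.db_mul : db (F * G) t z = db F t z * G t z + F t z * db G t z :=
  deriv_fun_mul (hF.d2 ht hz) (hG.d2 ht hz)
end rules

theorem dz_sum {ι : Type*} {A : Finset ι} {F : ι → ℝ → E → ℂ} (h : ∀ i ∈ A, Rg J r (F i))
    (ht : t ∈ J) (hz : z ∈ Strip r) : dz (∑ i ∈ A, F i) t z = ∑ i ∈ A, dz (F i) t z := by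
  have : (fun ζ => (∑ i ∈ A, F i) t (ζ, z.2)) = fun ζ => ∑ i ∈ A, F i t (ζ, z.2) := by
    ext; simp
  rw [dz, this, deriv_fun_sum fun i hi => (h i hi).d1 ht hz]; rfl
theorem db_sum {ι : Type*} {A : Finset ι} {F : ι → ℝ → E → ℂ} (h : ∀ i ∈ A, Rg J r (F i))
    (ht : t ∈ J) (hz : z ∈ Strip r) : db (∑ i ∈ A, F i) t z = ∑ i ∈ A, db (F i) t z := by
  have : (fun ζ => (∑ i ∈ A, F i) t (z.1, ζ)) = fun ζ => ∑ i ∈ A, F i t (z.1, ζ) := by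
    ext; simp
  rw [db, this, deriv_fun_sum fun i hi => (h i hi).d2 ht hz]; rfl

theorem Rg.contAt (hF : Rg J r F) (ht : t ∈ J) (hz : z ∈ Strip r) : ContinuousAt (F t) z :=
  (hF.hol t ht z hz).continuousAt

theorem Rg.dz_cont (hJ : IsOpen J) (hF : Rg J r F) (ht : t ∈ J) (hz : z ∈ Strip r) :
    ContinuousAt (Function.uncurry (dz F)) (t, z) := by
  have hcm : Continuous (fun p : (ℝ × ℂ) × ℂ => ((p.1.1, (p.2, p.1.2)) : ℝ × E)) := by fun_prop
  have hm : ∀ᶠ p : (ℝ × ℂ) × ℂ in 𝓝 ((t, z.2), z.1),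
      ((p.1.1, (p.2, p.1.2)) : ℝ × E) ∈ J ×ˢ Strip r :=
    hcm.continuousAt.eventually (mem_nhds_JS hJ ht hz)
  have h := continuousAt_deriv_param (f := fun (x : ℝ × ℂ) ζ => F x.1 (ζ, x.2))
    (x₀ := (t, z.2)) (ζ₀ := z.1)
    (by
      filter_upwards [hm] with p hp
      exact ContinuousAt.comp (x := p) (g := Function.uncurry F)
        (f := fun p : (ℝ × ℂ) × ℂ => ((p.1.1, (p.2, p.1.2)) : ℝ × E))
        (hF.cont _ hp.1 _ hp.2) hcm.continuousAt)
    (by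
      filter_upwards [hm] with p hp
      exact hF.d1 hp.1 hp.2)
  have hc2 : Continuous (fun p : ℝ × E => (((p.1, p.2.2), p.2.1) : (ℝ × ℂ) × ℂ)) := by fun_prop
  exact ContinuousAt.comp (x := (t, z)) (f := fun p : ℝ × E => (((p.1, p.2.2), p.2.1) : (ℝ × ℂ) × ℂ))
    (g := fun p : (ℝ × ℂ) × ℂ => deriv (fun ζ => F p.1.1 (ζ, p.1.2)) p.2) h hc2.continuousAt

/-- `dz F` is differentiable in the second variable, with derivative `dz (db F)`. -/
theorem Rg.db_dz_aux (hJ : IsOpen J) (hF : Rg J r F) (hdb : ∀ z ∈ Strip r, ContinuousAt (db F t) z)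
    (hdb1 : ∀ z ∈ Strip r, DifferentiableAt ℂ (fun ζ => db F t (ζ, z.2)) z.1)
    (ht : t ∈ J) (hz : z ∈ Strip r) :
    HasDerivAt (fun η => dz F t (z.1, η)) (dz (db F) t z) z.2 := by
  have hcm : Continuous (fun p : ℂ × ℂ => ((p.2, p.1) : E)) := by fun_prop
  have hm : ∀ᶠ p : ℂ × ℂ in 𝓝 (z.2, z.1), ((p.2, p.1) : E) ∈ Strip r :=
    hcm.continuousAt.eventually ((isOpen_strip r).mem_nhds hz)
  apply hasDerivAt_deriv_param (𝕜 := ℂ) (F := fun η ζ => F t (ζ, η)) (G := fun η ζ => db F t (ζ, η))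
  · filter_upwards [hm] with p hp
    exact (hF.d2 ht hp).hasDerivAt
  · filter_upwards [hm] with p hp
    exact ContinuousAt.comp (x := p) (g := db F t) (f := fun p : ℂ × ℂ => ((p.2, p.1) : E))
      (hdb _ hp) hcm.continuousAt
  · filter_upwards [hm] with p hp
    exact hF.d1 ht hp
  · filter_upwards [hm] with p hp
    exact hdb1 _ hp

theorem db_eq_sm (F : ℝ → E → ℂ) : db F = sm (dz (sm F)) := by
  rw [dz_sm, sm_sm]

theorem cont_slice (h : ContinuousAt (Function.uncurry F) (t, z)) : ContinuousAt (F t) z :=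
  ContinuousAt.comp (x := z) (g := Function.uncurry F) (f := fun w => (t, w)) h (by fun_prop)

theorem Rg.dz_d1 (hF : Rg J r F) (ht : t ∈ J) (hz : z ∈ Strip r) :
    DifferentiableAt ℂ (fun ζ => dz F t (ζ, z.2)) z.1 := by
  have hd : DifferentiableOn ℂ (fun ζ => F t (ζ, z.2)) {ζ | (ζ, z.2) ∈ Strip r} := fun w hw =>
    (hF.d1 (z := (w, z.2)) ht hw).differentiableWithinAt
  have ho : IsOpen {ζ | (ζ, z.2) ∈ Strip r} :=
    (isOpen_strip r).preimage (by fun_prop : Continuous fun ζ : ℂ => ((ζ, z.2) : E))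
  exact (hd.deriv ho).differentiableAt (ho.mem_nhds hz)

end

section

/-- The derivative in one variable of a jointly regular function is holomorphic in the other. -/
theorem differentiableAt_deriv_swap {F G : ℂ → ℂ → ℂ} {s₀ ζ₀ : ℂ}
    (hF : ∀ᶠ p : ℂ × ℂ in 𝓝 (s₀, ζ₀), HasDerivAt (fun s => F s p.2) (G p.1 p.2) p.1)
    (hG : ∀ᶠ p in 𝓝 (s₀, ζ₀), ContinuousAt (Function.uncurry G) p)
    (hFd : ∀ᶠ p : ℂ × ℂ in 𝓝 (s₀, ζ₀), DifferentiableAt ℂ (F p.1) p.2) :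
    DifferentiableAt ℂ (G s₀) ζ₀ := by
  obtain ⟨R, hR, hΩ⟩ := exists_ball_subset (hF.and (hG.and hFd))
  have hΩ0 := hΩ.self_of_nhds
  have hunif : TendstoUniformlyOn (fun s ζ => (s - s₀)⁻¹ * (F s ζ - F s₀ ζ)) (G s₀) (𝓝[≠] s₀)
      (ball ζ₀ R) := by
    rw [Metric.tendstoUniformlyOn_iff]
    intro ε hε
    have e1 := eventually_slice_close (f := G) (x₀ := s₀) (isCompact_closedBall ζ₀ R)
      (fun y hy => (hΩ0 y hy).2.1) (show 0 < ε / 2 by positivity)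
    obtain ⟨δ, hδ, hball⟩ := Metric.nhds_basis_ball.mem_iff.1 (hΩ.and e1)
    filter_upwards [nhdsWithin_le_nhds (isOpen_ball.mem_nhds (mem_ball_self hδ)),
      self_mem_nhdsWithin] with s hs hne w hw
    have hw' := ball_subset_closedBall hw
    have hs0 : s₀ ∈ ball s₀ δ := mem_ball_self hδ
    have hmv := (convex_ball s₀ δ).norm_image_sub_le_of_norm_hasDerivWithin_le
        (𝕜 := ℂ) (f := fun s => F s w - (s - s₀) * G s₀ w)
        (f' := fun s => G s w - G s₀ w) (x := s₀) (y := s) (C := ε / 2) ?_ ?_ hs0 hs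
    · have hne' : s - s₀ ≠ 0 := sub_ne_zero.2 hne
      rw [dist_eq_norm, norm_sub_rev]
      have : (s - s₀)⁻¹ * (F s w - F s₀ w) - G s₀ w
          = (s - s₀)⁻¹ * (F s w - (s - s₀) * G s₀ w - (F s₀ w - (s₀ - s₀) * G s₀ w)) := by
        field_simp; ring
      rw [this, norm_mul, norm_inv]
      have hp : 0 < ‖s - s₀‖ := norm_pos_iff.2 hne'
      calc _ ≤ ‖s - s₀‖⁻¹ * (ε / 2 * ‖s - s₀‖) := by gcongr
        _ = ε / 2 := by field_simp
        _ < ε := by linarith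
    · intro x hx
      have h1 := ((hball hx).1 w hw').1
      have h2 : HasDerivAt (fun s : ℂ => (s - s₀) * G s₀ w) (1 * G s₀ w) x :=
        ((hasDerivAt_id x).sub_const s₀).mul_const _
      rw [one_mul] at h2
      exact (h1.sub h2).hasDerivWithinAt
    · intro x hx
      exact (hball hx).2 w hw'
  have hdo := hunif.tendstoLocallyUniformlyOn.differentiableOn (by
    filter_upwards [nhdsWithin_le_nhds hΩ] with s hs w hw
    exact (((hs w (ball_subset_closedBall hw)).2.2.sub
      (hΩ0 w (ball_subset_closedBall hw)).2.2).const_mul _).differentiableWithinAt) isOpen_ball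
  exact hdo.differentiableAt (isOpen_ball.mem_nhds (mem_ball_self hR))

variable {J : Set ℝ} {r s : ℝ} {F G : ℝ → E → ℂ} {t : ℝ} {z : E}

theorem Rg.dz_d2 (hJ : IsOpen J) (hF : Rg J r F) (ht : t ∈ J) (hz : z ∈ Strip r) :
    DifferentiableAt ℂ (fun η => dz F t (z.1, η)) z.2 := by
  have hm : ∀ᶠ p : ℂ × ℂ in 𝓝 (z.1, z.2), ((p.1, p.2) : E) ∈ Strip r :=
    (isOpen_strip r).mem_nhds hz
  apply differentiableAt_deriv_swap (F := fun ζ η => F t (ζ, η)) (G := fun ζ η => dz F t (ζ, η))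
    (s₀ := z.1)
  · filter_upwards [hm] with p hp
    exact (hF.d1 ht hp).hasDerivAt
  · filter_upwards [hm] with p hp
    exact cont_slice (hF.dz_cont hJ ht hp)
  · filter_upwards [hm] with p hp
    exact hF.d2 ht hp

theorem Rg.dz (hJ : IsOpen J) (hF : Rg J r F) : Rg J r (dz F) where
  cont t ht z hz := hF.dz_cont hJ ht hz
  hol t ht z hz := by
    have hm : ∀ᶠ w in 𝓝 z, w ∈ Strip r := (isOpen_strip r).mem_nhds hz
    apply differentiableAt_of_separate
    · filter_upwards [hm] with w hw using cont_slice (hF.dz_cont hJ ht hw)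
    · filter_upwards [hm] with w hw using hF.dz_d1 ht hw
    · filter_upwards [hm] with w hw using hF.dz_d2 hJ ht hw
  per t ht z hz := by
    have key : ∀ p : E, (∀ w ∈ Strip r, F t (w + p) = F t w) → QG.dz F t (z + p) = QG.dz F t z := by
      intro p hp
      have h1 : QG.dz F t (z + p) = deriv (fun ζ => F t (ζ + p.1, z.2 + p.2)) z.1 :=
        (deriv_comp_add_const (f := fun ζ => F t (ζ, z.2 + p.2)) p.1 z.1).symm
      rw [h1]
      apply Filter.EventuallyEq.deriv_eq
      filter_upwards [slice_mem1 hz] with w hw using hp _ hw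
    exact ⟨key _ fun w hw => (hF.per t ht w hw).1, key _ fun w hw => (hF.per t ht w hw).2⟩

theorem Rg.db (hJ : IsOpen J) (hF : Rg J r F) : Rg J r (db F) := by
  rw [db_eq_sm]; exact (hF.sm.dz hJ).sm

theorem Rg.dz_db (hJ : IsOpen J) (hF : Rg J r F) (ht : t ∈ J) (hz : z ∈ Strip r) :
    QG.db (QG.dz F) t z = QG.dz (QG.db F) t z :=
  (hF.db_dz_aux hJ (fun _ hw => (hF.db hJ).contAt ht hw) (fun _ hw => (hF.db hJ).d1 ht hw)
    ht hz).deriv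

/-- `Rg` together with a time derivative of the same class. -/
structure R1 (J : Set ℝ) (r : ℝ) (F : ℝ → E → ℂ) : Prop extends Rg J r F where
  dt : Rg J r (QG.dt F)
  hasDt : ∀ t ∈ J, ∀ z ∈ Strip r, HasDerivAt (fun s => F s z) (QG.dt F t z) t

theorem R1.mk' (hJ : IsOpen J) (hF : Rg J r F) (hG : Rg J r G)
    (h : ∀ t ∈ J, ∀ z ∈ Strip r, HasDerivAt (fun s => F s z) (G t z) t) : R1 J r F where
  toRg := hF
  dt := hG.congr hJ fun t ht z hz => (h t ht z hz).deriv
  hasDt t ht z hz := by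
    have := h t ht z hz
    rwa [QG.dt, this.deriv]

theorem R1.mono (hF : R1 J r F) (h : s ≤ r) : R1 J s F :=
  ⟨hF.toRg.mono h, hF.dt.mono h, fun t ht z hz => hF.hasDt t ht z (strip_mono h hz)⟩
theorem R1.monoJ {J' : Set ℝ} (hF : R1 J r F) (h : J' ⊆ J) : R1 J' r F :=
  ⟨hF.toRg.monoJ h, hF.dt.monoJ h, fun t ht z hz => hF.hasDt t (h ht) z hz⟩

theorem dt_congr (hJ : IsOpen J) (h : ∀ s ∈ J, F s z = G s z) (ht : t ∈ J) :
    dt F t z = dt G t z := by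
  apply Filter.EventuallyEq.deriv_eq
  filter_upwards [hJ.mem_nhds ht] with w hw using h _ hw

theorem R1.congr (hJ : IsOpen J) (hF : R1 J r F) (h : ∀ t ∈ J, ∀ z ∈ Strip r, G t z = F t z) :
    R1 J r G :=
  R1.mk' hJ (hF.toRg.congr hJ h) hF.dt fun t ht z hz => by
    refine (hF.hasDt t ht z hz).congr_of_eventuallyEq ?_
    filter_upwards [hJ.mem_nhds ht] with w hw using h _ hw _ hz

theorem R1.add (hJ : IsOpen J) (hF : R1 J r F) (hG : R1 J r G) : R1 J r (F + G) :=
  R1.mk' hJ (hF.toRg.add hG.toRg) (hF.dt.add hG.dt)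
    fun t ht z hz => (hF.hasDt t ht z hz).add (hG.hasDt t ht z hz)
theorem R1.sub (hJ : IsOpen J) (hF : R1 J r F) (hG : R1 J r G) : R1 J r (F - G) :=
  R1.mk' hJ (hF.toRg.sub hG.toRg) (hF.dt.sub hG.dt)
    fun t ht z hz => (hF.hasDt t ht z hz).sub (hG.hasDt t ht z hz)
theorem R1.mul (hJ : IsOpen J) (hF : R1 J r F) (hG : R1 J r G) : R1 J r (F * G) :=
  R1.mk' hJ (hF.toRg.mul hG.toRg) ((hF.dt.mul hG.toRg).add (hF.toRg.mul hG.dt))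
    fun t ht z hz => (hF.hasDt t ht z hz).mul (hG.hasDt t ht z hz)
theorem R1.smul (hJ : IsOpen J) (hF : R1 J r F) (c : ℂ) : R1 J r (c • F) :=
  R1.mk' hJ (hF.toRg.smul c) (hF.dt.smul c)
    fun t ht z hz => (hF.hasDt t ht z hz).const_smul c
theorem R1.zero (hJ : IsOpen J) : R1 J r 0 :=
  R1.mk' hJ Rg.zero Rg.zero fun t _ _ _ => hasDerivAt_const t 0
theorem R1.tf (hJ : IsOpen J) {c d : ℝ → ℂ} (hd : Continuous d) (hc : ∀ t, HasDerivAt c (d t) t) :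
    R1 J r (tf c) :=
  R1.mk' hJ (Rg.tf (continuous_iff_continuousAt.2 fun t => (hc t).continuousAt)) (Rg.tf hd)
    fun t _ _ _ => hc t

theorem dt_sm_of (h : HasDerivAt (fun s => F s (st z)) (QG.dt F t (st z)) t) :
    HasDerivAt (fun s => sm F s z) (sm (dt F) t z) t :=
  HasDerivAt.star h

theorem R1.sm (hJ : IsOpen J) (hF : R1 J r F) : R1 J r (sm F) :=
  R1.mk' hJ hF.toRg.sm hF.dt.sm fun t ht _ hz => dt_sm_of (hF.hasDt t ht _ (st_mem hz))

theorem R1.hasDt_dz (hJ : IsOpen J) (hF : R1 J r F) (ht : t ∈ J) (hz : z ∈ Strip r) :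
    HasDerivAt (fun s => QG.dz F s z) (QG.dz (QG.dt F) t z) t := by
  have hcm : Continuous (fun p : ℝ × ℂ => ((p.1, (p.2, z.2)) : ℝ × E)) := by fun_prop
  have hm : ∀ᶠ p : ℝ × ℂ in 𝓝 (t, z.1), ((p.1, (p.2, z.2)) : ℝ × E) ∈ J ×ˢ Strip r :=
    hcm.continuousAt.eventually (mem_nhds_JS hJ ht hz)
  apply hasDerivAt_deriv_param (𝕜 := ℝ) (F := fun s ζ => F s (ζ, z.2))
    (G := fun s ζ => QG.dt F s (ζ, z.2))
  · filter_upwards [hm] with p hp using hF.hasDt _ hp.1 _ hp.2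
  · filter_upwards [hm] with p hp
    exact ContinuousAt.comp (x := p) (g := Function.uncurry (QG.dt F))
      (f := fun p : ℝ × ℂ => ((p.1, (p.2, z.2)) : ℝ × E))
        (hF.dt.cont _ hp.1 _ hp.2) hcm.continuousAt
  · filter_upwards [hm] with p hp using hF.d1 hp.1 hp.2
  · filter_upwards [hm] with p hp using hF.dt.d1 hp.1 hp.2

theorem R1.dz (hJ : IsOpen J) (hF : R1 J r F) : R1 J r (dz F) :=
  R1.mk' hJ (hF.toRg.dz hJ) (hF.dt.dz hJ) fun _ ht _ hz => hF.hasDt_dz hJ ht hz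

section rules
variable (hJ : IsOpen J) (hF : R1 J r F) (hG : R1 J r G) (ht : t ∈ J) (hz : z ∈ Strip r)
include hF ht hz
theorem R1.dt_smul (c : ℂ) : QG.dt (c • F) t z = c * QG.dt F t z :=
  ((hF.hasDt t ht z hz).const_smul c).deriv
theorem R1.dt_sm : QG.dt (QG.sm F) t (st z) = QG.sm (QG.dt F) t (st z) := by
  apply (dt_sm_of _).deriv
  rw [st_st]; exact hF.hasDt t ht z hz
include hJ in
theorem R1.dt_dz : QG.dt (QG.dz F) t z = QG.dz (QG.dt F) t z := (hF.hasDt_dz hJ ht hz).deriv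
include hG
theorem R1.dt_add : QG.dt (F + G) t z = QG.dt F t z + QG.dt G t z :=
  ((hF.hasDt t ht z hz).add (hG.hasDt t ht z hz)).deriv
theorem R1.dt_sub : QG.dt (F - G) t z = QG.dt F t z - QG.dt G t z :=
  ((hF.hasDt t ht z hz).sub (hG.hasDt t ht z hz)).deriv
theorem R1.dt_mul : QG.dt (F * G) t z = QG.dt F t z * G t z + F t z * QG.dt G t z :=
  ((hF.hasDt t ht z hz).mul (hG.hasDt t ht z hz)).deriv
end rules

theorem dt_sum (hJ : IsOpen J) {ι : Type*} {A : Finset ι} {F : ι → ℝ → E → ℂ}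
    (h : ∀ i ∈ A, R1 J r (F i))
    (ht : t ∈ J) (hz : z ∈ Strip r) : dt (∑ i ∈ A, F i) t z = ∑ i ∈ A, dt (F i) t z := by
  have : (fun s => (∑ i ∈ A, F i) s z) = fun s => ∑ i ∈ A, F i s z := by
    ext; simp
  rw [dt, this]
  exact (HasDerivAt.fun_sum fun i hi => (h i hi).hasDt t ht z hz).deriv

/-- Locality in time. -/
theorem R1.of_local (h : ∀ t₀ : ℝ, ∃ J : Set ℝ, IsOpen J ∧ t₀ ∈ J ∧ ∃ G, R1 J r G ∧
    ∀ t ∈ J, ∀ z ∈ Strip r, F t z = G t z) : R1 Set.univ r F := by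
  have h' : ∀ t₀ : ℝ, ∃ J : Set ℝ, IsOpen J ∧ t₀ ∈ J ∧ R1 J r F := by
    intro t₀
    obtain ⟨J, hJ, ht, G, hG, hFG⟩ := h t₀
    exact ⟨J, hJ, ht, hG.congr hJ hFG⟩
  choose J hJ hJt hR using h'
  exact ⟨⟨fun t _ => (hR t).cont t (hJt t), fun t _ => (hR t).hol t (hJt t),
    fun t _ => (hR t).per t (hJt t)⟩, ⟨fun t _ => (hR t).dt.cont t (hJt t),
    fun t _ => (hR t).dt.hol t (hJt t), fun t _ => (hR t).dt.per t (hJt t)⟩,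
    fun t _ => (hR t).hasDt t (hJt t)⟩

/-- Cauchy's estimates on strips. -/
theorem Rg.norm_dz_le {M ε : ℝ} (hF : Rg J r F) (ht : t ∈ J) (hε : 0 < ε)
    (hM : ∀ w ∈ Strip r, ‖F t w‖ ≤ M) (hz : z ∈ Strip (r - ε)) : ‖QG.dz F t z‖ ≤ M / ε := by
  have hsub : ∀ w ∈ closedBall z.1 ε, (w, z.2) ∈ Strip r := by
    intro w hw
    have := strip_add (v := (w - z.1, 0)) hz (s := ε) (by
      rw [Prod.norm_def]; simpa [mem_closedBall, dist_eq_norm, hε.le] using hw)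
    have e : z + (w - z.1, 0) = (w, z.2) := by ext <;> simp
    rwa [e, sub_add_cancel] at this
  exact norm_deriv_le_of_closedBall hε (fun w hw => hF.d1 (z := (w, z.2)) ht (hsub w hw))
    fun w hw => hM _ (hsub w hw)
theorem Rg.norm_db_le {M ε : ℝ} (hF : Rg J r F) (ht : t ∈ J) (hε : 0 < ε)
    (hM : ∀ w ∈ Strip r, ‖F t w‖ ≤ M) (hz : z ∈ Strip (r - ε)) : ‖QG.db F t z‖ ≤ M / ε := by
  rw [db_eq_sm, QG.sm, Complex.norm_conj]
  refine hF.sm.norm_dz_le ht hε (fun w hw => ?_) (st_mem hz)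
  rw [QG.sm, Complex.norm_conj]
  exact hM _ (st_mem hw)

end

section

variable {J : Set ℝ} {r s : ℝ} {F G : ℝ → E → ℂ} {t : ℝ} {z : E} {ψ : ℝ → E → ℂ}

/-- Transport derivative along the flow with stream function `ψ`. -/
def Dt (ψ F : ℝ → E → ℂ) : ℝ → E → ℂ :=
  dt F - (2 * Complex.I) • (dz ψ * db F - db ψ * dz F)

theorem Dt_apply (ψ F : ℝ → E → ℂ) (t : ℝ) (z : E) : Dt ψ F t z =
    dt F t z - 2 * Complex.I * (dz ψ t z * db F t z - db ψ t z * dz F t z) := rfl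

theorem R1.Dt (hJ : IsOpen J) (hψ : R1 J r ψ) (hF : R1 J r F) : Rg J r (Dt ψ F) :=
  hF.dt.sub ((((hψ.toRg.dz hJ).mul (hF.toRg.db hJ)).sub
    ((hψ.toRg.db hJ).mul (hF.toRg.dz hJ))).smul _)

section rules
variable (hF : R1 J r F) (hG : R1 J r G) (ht : t ∈ J) (hz : z ∈ Strip r)
include hF ht hz
theorem R1.Dt_smul (c : ℂ) : QG.Dt ψ (c • F) t z = c * QG.Dt ψ F t z := by
  simp only [Dt_apply, hF.dt_smul ht hz, hF.toRg.dz_smul ht hz, hF.toRg.db_smul ht hz]; ring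
include hG
theorem R1.Dt_add : QG.Dt ψ (F + G) t z = QG.Dt ψ F t z + QG.Dt ψ G t z := by
  simp only [Dt_apply, hF.dt_add hG ht hz, hF.toRg.dz_add hG.toRg ht hz,
    hF.toRg.db_add hG.toRg ht hz]; ring
theorem R1.Dt_sub : QG.Dt ψ (F - G) t z = QG.Dt ψ F t z - QG.Dt ψ G t z := by
  simp only [Dt_apply, hF.dt_sub hG ht hz, hF.toRg.dz_sub hG.toRg ht hz,
    hF.toRg.db_sub hG.toRg ht hz]; ring
theorem R1.Dt_mul : QG.Dt ψ (F * G) t z = QG.Dt ψ F t z * G t z + F t z * QG.Dt ψ G t z := by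
  simp only [Dt_apply, hF.dt_mul hG ht hz, hF.toRg.dz_mul hG.toRg ht hz,
    hF.toRg.db_mul hG.toRg ht hz]; ring
end rules

theorem Dt_sum (hJ : IsOpen J) {ι : Type*} {A : Finset ι} {F : ι → ℝ → E → ℂ}
    (h : ∀ i ∈ A, R1 J r (F i)) (ht : t ∈ J) (hz : z ∈ Strip r) :
    Dt ψ (∑ i ∈ A, F i) t z = ∑ i ∈ A, Dt ψ (F i) t z := by
  simp only [Dt_apply, dt_sum hJ h ht hz, dz_sum (fun i hi => (h i hi).toRg) ht hz,
    db_sum (fun i hi => (h i hi).toRg) ht hz, Finset.mul_sum, ← Finset.sum_sub_distrib]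

theorem R1.Dt_sm (hψ : QG.sm ψ = ψ) (hF : R1 J r F) (ht : t ∈ J) (hz : z ∈ Strip r) :
    QG.Dt ψ (QG.sm F) t z = QG.sm (QG.Dt ψ F) t z := by
  have h1 := hF.dt_sm ht (st_mem hz)
  rw [st_st] at h1
  have e1 : QG.dz ψ t z = conj (QG.db ψ t (st z)) := by
    conv_lhs => rw [← hψ, dz_sm]
    rfl
  have e2 : QG.db ψ t z = conj (QG.dz ψ t (st z)) := by
    conv_lhs => rw [← hψ, db_sm]
    rfl
  rw [Dt_apply, h1, dz_sm, db_sm, e1, e2]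
  simp only [QG.sm, Dt_apply, map_sub, map_mul, Complex.conj_I, Complex.conj_ofNat]
  ring

/-- Commutator of the transport derivative with `dz`. -/
theorem R1.Dt_dz (hJ : IsOpen J) (hψ : R1 J r ψ) (hF : R1 J r F) (ht : t ∈ J) (hz : z ∈ Strip r) :
    QG.Dt ψ (QG.dz F) t z = QG.dz (QG.Dt ψ F) t z
      + 2 * Complex.I * (QG.dz (QG.dz ψ) t z * QG.db F t z - QG.dz (QG.db ψ) t z * QG.dz F t z) := by
  have a1 := hψ.toRg.dz hJ
  have a2 := hψ.toRg.db hJ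
  have b1 := hF.toRg.dz hJ
  have b2 := hF.toRg.db hJ
  rw [show QG.Dt ψ F = QG.dt F - (2 * Complex.I) • (QG.dz ψ * QG.db F - QG.db ψ * QG.dz F) from rfl,
    Rg.dz_sub hF.dt (((a1.mul b2).sub (a2.mul b1)).smul _) ht hz,
    Rg.dz_smul ((a1.mul b2).sub (a2.mul b1)) ht hz, Rg.dz_sub (a1.mul b2) (a2.mul b1) ht hz,
    Rg.dz_mul a1 b2 ht hz, Rg.dz_mul a2 b1 ht hz, Dt_apply, hF.dt_dz hJ ht hz,
    hF.toRg.dz_db hJ ht hz]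
  ring

/-- A stream function with second derivatives bounded by `L` on a strip. -/
structure Env (ψ : ℝ → E → ℂ) (J : Set ℝ) (r L : ℝ) : Prop where
  reg : R1 J r ψ
  real : sm ψ = ψ
  zz : ∀ t ∈ J, ∀ z ∈ Strip r, ‖dz (dz ψ) t z‖ ≤ L
  zb : ∀ t ∈ J, ∀ z ∈ Strip r, ‖dz (db ψ) t z‖ ≤ L
  bb : ∀ t ∈ J, ∀ z ∈ Strip r, ‖db (db ψ) t z‖ ≤ L

theorem Env.mono {L : ℝ} (h : Env ψ J r L) (hs : s ≤ r) : Env ψ J s L :=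
  ⟨h.reg.mono hs, h.real, fun t ht z hz => h.zz t ht z (strip_mono hs hz),
    fun t ht z hz => h.zb t ht z (strip_mono hs hz), fun t ht z hz => h.bb t ht z (strip_mono hs hz)⟩
theorem Env.monoJ {L : ℝ} {J' : Set ℝ} (h : Env ψ J r L) (hs : J' ⊆ J) : Env ψ J' r L :=
  ⟨h.reg.monoJ hs, h.real, fun t ht => h.zz t (hs ht), fun t ht => h.zb t (hs ht),
    fun t ht => h.bb t (hs ht)⟩

/-- `F` is bounded by `M` and its transport derivative by `M * T`. -/
structure PB (ψ : ℝ → E → ℂ) (T : ℝ) (J : Set ℝ) (r M : ℝ) (F : ℝ → E → ℂ) : Prop where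
  reg : R1 J r F
  bd : ∀ t ∈ J, ∀ z ∈ Strip r, ‖F t z‖ ≤ M
  dbd : ∀ t ∈ J, ∀ z ∈ Strip r, ‖Dt ψ F t z‖ ≤ M * T

variable {T M N L : ℝ}

theorem PB.mono (hF : PB ψ T J r M F) (hs : s ≤ r) : PB ψ T J s M F :=
  ⟨hF.reg.mono hs, fun t ht z hz => hF.bd t ht z (strip_mono hs hz),
    fun t ht z hz => hF.dbd t ht z (strip_mono hs hz)⟩
theorem PB.le (hF : PB ψ T J r M F) (hT : 0 ≤ T) (hM : M ≤ N) : PB ψ T J r N F :=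
  ⟨hF.reg, fun t ht z hz => (hF.bd t ht z hz).trans hM,
    fun t ht z hz => (hF.dbd t ht z hz).trans (by gcongr)⟩
theorem PB.add (hJ : IsOpen J) (hF : PB ψ T J r M F) (hG : PB ψ T J r N G) :
    PB ψ T J r (M + N) (F + G) :=
  ⟨hF.reg.add hJ hG.reg, fun t ht z hz =>
    (norm_add_le _ _).trans (add_le_add (hF.bd t ht z hz) (hG.bd t ht z hz)),
    fun t ht z hz => by
      rw [hF.reg.Dt_add hG.reg ht hz, add_mul]
      exact (norm_add_le _ _).trans (add_le_add (hF.dbd t ht z hz) (hG.dbd t ht z hz))⟩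
theorem PB.sub (hJ : IsOpen J) (hF : PB ψ T J r M F) (hG : PB ψ T J r N G) :
    PB ψ T J r (M + N) (F - G) :=
  ⟨hF.reg.sub hJ hG.reg, fun t ht z hz =>
    (norm_sub_le _ _).trans (add_le_add (hF.bd t ht z hz) (hG.bd t ht z hz)),
    fun t ht z hz => by
      rw [hF.reg.Dt_sub hG.reg ht hz, add_mul]
      exact (norm_sub_le _ _).trans (add_le_add (hF.dbd t ht z hz) (hG.dbd t ht z hz))⟩
theorem PB.smul (hJ : IsOpen J) (hF : PB ψ T J r M F) (c : ℂ) : PB ψ T J r (‖c‖ * M) (c • F) :=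
  ⟨hF.reg.smul hJ c, fun t ht z hz => by
    rw [Pi.smul_apply, Pi.smul_apply, smul_eq_mul, norm_mul]
    exact mul_le_mul_of_nonneg_left (hF.bd t ht z hz) (norm_nonneg _), fun t ht z hz => by
    rw [hF.reg.Dt_smul ht hz, norm_mul, mul_assoc]
    exact mul_le_mul_of_nonneg_left (hF.dbd t ht z hz) (norm_nonneg _)⟩
theorem PB.mul (hJ : IsOpen J) (hF : PB ψ T J r M F) (hG : PB ψ T J r N G)
    (hM : 0 ≤ M) (hN : 0 ≤ N) (hT : 0 ≤ T) : PB ψ T J r (2 * M * N) (F * G) :=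
  ⟨hF.reg.mul hJ hG.reg, fun t ht z hz => by
    rw [Pi.mul_apply, Pi.mul_apply, norm_mul]
    calc _ ≤ M * N := mul_le_mul (hF.bd t ht z hz) (hG.bd t ht z hz) (norm_nonneg _) hM
      _ ≤ _ := by nlinarith [mul_nonneg hM hN], fun t ht z hz => by
    rw [hF.reg.Dt_mul hG.reg ht hz]
    calc _ ≤ (M * T) * N + M * (N * T) := by
          refine (norm_add_le _ _).trans ?_
          rw [norm_mul, norm_mul]
          exact add_le_add
            (mul_le_mul (hF.dbd t ht z hz) (hG.bd t ht z hz) (norm_nonneg _) (by positivity))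
            (mul_le_mul (hF.bd t ht z hz) (hG.dbd t ht z hz) (norm_nonneg _) hM)
      _ = _ := by ring⟩
theorem PB.sm (hJ : IsOpen J) (hψ : QG.sm ψ = ψ) (hF : PB ψ T J r M F) :
    PB ψ T J r M (QG.sm F) :=
  ⟨hF.reg.sm hJ, fun t ht z hz => by
    rw [QG.sm, Complex.norm_conj]; exact hF.bd t ht _ (st_mem hz), fun t ht z hz => by
    rw [hF.reg.Dt_sm hψ ht hz, QG.sm, Complex.norm_conj]; exact hF.dbd t ht _ (st_mem hz)⟩
theorem Dt_zero : Dt ψ 0 = 0 := by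
  ext t z
  simp [Dt_apply, dt, dz, db]
theorem PB.zero (hJ : IsOpen J) : PB ψ T J r 0 0 :=
  ⟨R1.zero hJ, fun t ht z hz => by simp, fun t ht z hz => by simp [Dt_zero]⟩
theorem PB.sum (hJ : IsOpen J) {ι : Type*} {A : Finset ι} {F : ι → ℝ → E → ℂ} {M : ι → ℝ}
    (h : ∀ i ∈ A, PB ψ T J r (M i) (F i)) : PB ψ T J r (∑ i ∈ A, M i) (∑ i ∈ A, F i) := by
  classical
  induction A using Finset.induction_on with
  | empty => simpa using PB.zero hJ
  | insert a A ha ih =>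
    rw [Finset.sum_insert ha, Finset.sum_insert ha]
    exact (h a (by simp)).add hJ (ih fun i hi => h i (by simp [hi]))

theorem commutator_bound {a b c d : ℂ} {K : ℝ} (ha : ‖a‖ ≤ L) (hb : ‖b‖ ≤ K) (hc : ‖c‖ ≤ L)
    (hd : ‖d‖ ≤ K) : ‖2 * Complex.I * (a * b - c * d)‖ ≤ 4 * L * K := by
  have hL : 0 ≤ L := (norm_nonneg _).trans ha
  rw [norm_mul, norm_mul, Complex.norm_I]
  have h1 : ‖a * b - c * d‖ ≤ L * K + L * K := by
    refine (norm_sub_le _ _).trans ?_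
    rw [norm_mul, norm_mul]
    exact add_le_add (mul_le_mul ha hb (norm_nonneg _) hL) (mul_le_mul hc hd (norm_nonneg _) hL)
  norm_num
  linarith

theorem PB.dz {n : ℝ} (hJ : IsOpen J) (hψ : Env ψ J r L) (hF : PB ψ T J r M F) (hLT : L ≤ T)
    (hn : 0 < n) (hs : s + 1 / n ≤ r) (hM : 0 ≤ M) : PB ψ T J s (5 * n * M) (dz F) := by
  have hss : s ≤ r := le_trans (by have : 0 < 1 / n := by positivity
                                   linarith) hs
  have hn' : (0 : ℝ) < 1 / n := by positivity
  have hsub : Strip s ⊆ Strip (r - 1 / n) := strip_mono (by linarith)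
  have h1 : ∀ t ∈ J, ∀ z ∈ Strip s, ‖QG.dz F t z‖ ≤ n * M := fun t ht z hz => by
    have := hF.reg.toRg.norm_dz_le ht hn' (hF.bd t ht) (hsub hz)
    rwa [div_div_eq_mul_div, div_one, mul_comm] at this
  have h2 : ∀ t ∈ J, ∀ z ∈ Strip s, ‖QG.db F t z‖ ≤ n * M := fun t ht z hz => by
    have := hF.reg.toRg.norm_db_le ht hn' (hF.bd t ht) (hsub hz)
    rwa [div_div_eq_mul_div, div_one, mul_comm] at this
  refine ⟨(hF.reg.dz hJ).mono hss, fun t ht z hz => (h1 t ht z hz).trans ?_, fun t ht z hz => ?_⟩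
  · nlinarith [mul_nonneg hn.le hM]
  · have hz' := strip_mono hss hz
    rw [hψ.reg.Dt_dz hJ hF.reg ht hz']
    have h3 := (hψ.reg.Dt hJ hF.reg).norm_dz_le ht hn' (hF.dbd t ht) (hsub hz)
    rw [div_div_eq_mul_div, div_one] at h3
    have h4 := commutator_bound (hψ.zz t ht z hz') (h2 t ht z hz) (hψ.zb t ht z hz') (h1 t ht z hz)
    calc _ ≤ M * T * n + 4 * L * (n * M) := (norm_add_le _ _).trans (add_le_add h3 h4)
      _ ≤ M * T * n + 4 * T * (n * M) := by gcongr
      _ = _ := by ring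

theorem PB.db {n : ℝ} (hJ : IsOpen J) (hψ : Env ψ J r L) (hF : PB ψ T J r M F) (hLT : L ≤ T)
    (hn : 0 < n) (hs : s + 1 / n ≤ r) (hM : 0 ≤ M) : PB ψ T J s (5 * n * M) (db F) := by
  rw [db_eq_sm]
  exact PB.sm hJ hψ.real (PB.dz hJ hψ (PB.sm hJ hψ.real hF) hLT hn hs hM)

/-- Almost plane waves `exp (i n Re (κ ·))`. -/
structure AW (n η : ℝ) (J : Set ℝ) (r : ℝ) (κ : ℂ) (M : ℝ) (F : ℝ → E → ℂ) : Prop where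
  reg : Rg J r F
  bd : ∀ t ∈ J, ∀ z ∈ Strip r, ‖F t z‖ ≤ M
  z : ∀ t ∈ J, ∀ z ∈ Strip r, ‖dz F t z - Complex.I * n * κ * F t z‖ ≤ M * n * η
  b : ∀ t ∈ J, ∀ z ∈ Strip r, ‖db F t z - Complex.I * n * conj κ * F t z‖ ≤ M * n * η

variable {n η : ℝ} {κ κ' : ℂ}

theorem AW.mul (hF : AW n η J r κ M F) (hG : AW n η J r κ' N G) (hM : 0 ≤ M) (hN : 0 ≤ N) :
    AW n η J r (κ + κ') (2 * M * N) (F * G) where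
  reg := hF.reg.mul hG.reg
  bd t ht z hz := by
    rw [Pi.mul_apply, Pi.mul_apply, norm_mul]
    calc _ ≤ M * N := mul_le_mul (hF.bd t ht z hz) (hG.bd t ht z hz) (norm_nonneg _) hM
      _ ≤ _ := by nlinarith [mul_nonneg hM hN]
  z t ht z hz := by
    rw [hF.reg.dz_mul hG.reg ht hz]
    calc _ = ‖(dz F t z - Complex.I * n * κ * F t z) * G t z
          + F t z * (dz G t z - Complex.I * n * κ' * G t z)‖ := by
          congr 1; simp only [Pi.mul_apply]; ring
      _ ≤ (M * n * η) * N + M * (N * n * η) := by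
          refine (norm_add_le _ _).trans ?_
          rw [norm_mul, norm_mul]
          have h1 := hF.z t ht z hz
          exact add_le_add (mul_le_mul h1 (hG.bd t ht z hz) (norm_nonneg _)
            ((norm_nonneg _).trans h1)) (mul_le_mul (hF.bd t ht z hz) (hG.z t ht z hz)
              (norm_nonneg _) hM)
      _ = _ := by ring
  b t ht z hz := by
    rw [hF.reg.db_mul hG.reg ht hz]
    calc _ = ‖(db F t z - Complex.I * n * conj κ * F t z) * G t z
          + F t z * (db G t z - Complex.I * n * conj κ' * G t z)‖ := by
          congr 1; simp only [Pi.mul_apply, map_add]; ring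
      _ ≤ (M * n * η) * N + M * (N * n * η) := by
          refine (norm_add_le _ _).trans ?_
          rw [norm_mul, norm_mul]
          have h1 := hF.b t ht z hz
          exact add_le_add (mul_le_mul h1 (hG.bd t ht z hz) (norm_nonneg _)
            ((norm_nonneg _).trans h1)) (mul_le_mul (hF.bd t ht z hz) (hG.b t ht z hz)
              (norm_nonneg _) hM)
      _ = _ := by ring

theorem AW.sm (hF : AW n η J r κ M F) : AW n η J r (-κ) M (sm F) where
  reg := hF.reg.sm
  bd t ht z hz := by rw [QG.sm, Complex.norm_conj]; exact hF.bd t ht _ (st_mem hz)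
  z t ht z hz := by
    rw [dz_sm, ← Complex.norm_conj]
    refine le_of_eq_of_le ?_ (hF.b t ht _ (st_mem hz))
    congr 1
    simp [QG.sm, sub_eq_add_neg]
  b t ht z hz := by
    rw [db_sm, ← Complex.norm_conj]
    refine le_of_eq_of_le ?_ (hF.z t ht _ (st_mem hz))
    congr 1
    simp [QG.sm, sub_eq_add_neg]

/-- Second derivatives of almost plane waves. -/
theorem AW.zz (hJ : IsOpen J) (hF : AW n η J r κ M F) (hn : 0 < n) (ht : t ∈ J)
    (hs : s + 1 / n ≤ r) (hz : z ∈ Strip s) :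
    ‖dz (dz F) t z + n ^ 2 * κ ^ 2 * F t z‖ ≤ (1 + ‖κ‖) * M * n ^ 2 * η := by
  have hn' : (0 : ℝ) < 1 / n := by positivity
  have hz' : z ∈ Strip r := strip_mono (by linarith) hz
  have hz'' : z ∈ Strip (r - 1 / n) := strip_mono (by linarith) hz
  have hR : Rg J r (dz F - (Complex.I * n * κ) • F) := (hF.reg.dz hJ).sub (hF.reg.smul _)
  have h1 := hR.norm_dz_le ht hn' (hF.z t ht) hz''
  rw [(hF.reg.dz hJ).dz_sub (hF.reg.smul _) ht hz', hF.reg.dz_smul ht hz'] at h1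
  have h2 := hF.z t ht z hz'
  calc _ = ‖(dz (dz F) t z - Complex.I * n * κ * dz F t z)
        + (Complex.I * n * κ) * (dz F t z - Complex.I * n * κ * F t z)‖ := by
        congr 1
        linear_combination (n ^ 2 * κ ^ 2 * F t z : ℂ) * Complex.I_sq
    _ ≤ M * n * η / (1 / n) + (n * ‖κ‖) * (M * n * η) := by
        refine (norm_add_le _ _).trans (add_le_add h1 ?_)
        rw [norm_mul]
        refine mul_le_mul_of_nonneg_left h2 (norm_nonneg _) |>.trans (le_of_eq ?_)
        simp [abs_of_pos hn]
    _ = _ := by field_simp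

theorem AW.zb (hJ : IsOpen J) (hF : AW n η J r κ M F) (hn : 0 < n) (ht : t ∈ J)
    (hs : s + 1 / n ≤ r) (hz : z ∈ Strip s) :
    ‖dz (db F) t z + n ^ 2 * (κ * conj κ) * F t z‖ ≤ (1 + ‖κ‖) * M * n ^ 2 * η := by
  have hn' : (0 : ℝ) < 1 / n := by positivity
  have hz' : z ∈ Strip r := strip_mono (by linarith) hz
  have hz'' : z ∈ Strip (r - 1 / n) := strip_mono (by linarith) hz
  have hR : Rg J r (db F - (Complex.I * n * conj κ) • F) := (hF.reg.db hJ).sub (hF.reg.smul _)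
  have h1 := hR.norm_dz_le ht hn' (hF.b t ht) hz''
  rw [(hF.reg.db hJ).dz_sub (hF.reg.smul _) ht hz', hF.reg.dz_smul ht hz'] at h1
  have h2 := hF.z t ht z hz'
  calc _ = ‖(dz (db F) t z - Complex.I * n * conj κ * dz F t z)
        + (Complex.I * n * conj κ) * (dz F t z - Complex.I * n * κ * F t z)‖ := by
        congr 1
        linear_combination (n ^ 2 * (κ * conj κ) * F t z : ℂ) * Complex.I_sq
    _ ≤ M * n * η / (1 / n) + (n * ‖κ‖) * (M * n * η) := by
        refine (norm_add_le _ _).trans (add_le_add h1 ?_)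
        rw [norm_mul]
        refine mul_le_mul_of_nonneg_left h2 (norm_nonneg _) |>.trans (le_of_eq ?_)
        simp [abs_of_pos hn]
    _ = _ := by field_simp

end

section

variable {J : Set ℝ} {r s : ℝ} {F G : ℝ → E → ℂ} {t : ℝ} {z : E} {ψ : ℝ → E → ℂ}

theorem Rg.hasFDerivAt (hF : Rg J r F) (ht : t ∈ J) (hz : z ∈ Strip r) :
    HasFDerivAt (F t) (QG.dz F t z • ContinuousLinearMap.fst ℂ ℂ ℂ
      + QG.db F t z • ContinuousLinearMap.snd ℂ ℂ ℂ) z := by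
  have h := (hF.hol t ht z hz).hasFDerivAt
  convert! h using 1
  ext
  · simp [fderiv_eq (hF.hol t ht z hz)]
  · simp [fderiv_eq (hF.hol t ht z hz)]

theorem exists_strip_sub (hz : z ∈ Strip r) : ∃ ε > 0, z ∈ Strip (r - ε) := by
  simp only [Strip, Set.mem_ofPred_eq] at *
  exact ⟨(2 * r - ‖z.2 - conj z.1‖) / 4, by linarith, by linarith⟩

theorem Rg.differentiableAt_integral {M a b : ℝ} (hJ : IsOpen J) (hF : Rg J r F)
    (hM : ∀ t ∈ J, ∀ z ∈ Strip r, ‖F t z‖ ≤ M) (hab : Set.uIcc a b ⊆ J) (hz : z ∈ Strip r) :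
    DifferentiableAt ℂ (fun w => ∫ σ in a..b, F σ w) z := by
  obtain ⟨ε, hε, hzε⟩ := exists_strip_sub hz
  have hcd : ∀ w ∈ Strip r, ContinuousOn (fun σ => F σ w) (Set.uIcc a b) := fun w hw σ hσ =>
    ((hF.cont σ (hab hσ) w hw).comp (f := fun σ => (σ, w)) (by fun_prop)).continuousWithinAt
  have h := intervalIntegral.hasFDerivAt_integral_of_dominated_of_fderiv_le (𝕜 := ℂ)
    (μ := volume) (F := fun w σ => F σ w) (a := a) (b := b) (x₀ := z)
    (F' := fun w σ => QG.dz F σ w • ContinuousLinearMap.fst ℂ ℂ ℂ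
      + QG.db F σ w • ContinuousLinearMap.snd ℂ ℂ ℂ)
    (bound := fun _ => M / ε * ‖ContinuousLinearMap.fst ℂ ℂ ℂ‖
      + M / ε * ‖ContinuousLinearMap.snd ℂ ℂ ℂ‖) ((isOpen_strip (r - ε)).mem_nhds hzε) ?_ ?_ ?_ ?_ ?_ ?_
  · exact h.differentiableAt
  · filter_upwards [(isOpen_strip r).mem_nhds hz] with w hw
    exact ((hcd w hw).mono Set.uIoc_subset_uIcc).aestronglyMeasurable measurableSet_uIoc
  · exact (hcd z hz).intervalIntegrable
  · refine (ContinuousOn.mono ?_ Set.uIoc_subset_uIcc).aestronglyMeasurable measurableSet_uIoc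
    intro σ hσ
    refine ContinuousAt.continuousWithinAt ?_
    have h1 := ((hF.dz hJ).cont σ (hab hσ) z hz).comp (f := fun σ => (σ, z)) (by fun_prop)
    have h2 := ((hF.db hJ).cont σ (hab hσ) z hz).comp (f := fun σ => (σ, z)) (by fun_prop)
    exact (h1.smul continuousAt_const).add (h2.smul continuousAt_const)
  · refine Eventually.of_forall fun σ hσ w hw => ?_
    have hσ' := hab (Set.uIoc_subset_uIcc hσ)
    refine (norm_add_le _ _).trans ?_
    rw [norm_smul, norm_smul]
    gcongr
    · exact hF.norm_dz_le hσ' hε (hM σ hσ') hw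
    · exact hF.norm_db_le hσ' hε (hM σ hσ') hw
  · exact intervalIntegrable_const
  · refine Eventually.of_forall fun σ hσ w hw => ?_
    exact hF.hasFDerivAt (hab (Set.uIoc_subset_uIcc hσ)) (strip_mono (by linarith) hw)

/-- A bounded holomorphic vector field. -/
structure VF (J : Set ℝ) (r B Λ : ℝ) (U : ℝ → E → E) : Prop where
  cont : ∀ t ∈ J, ∀ z ∈ Strip r, ContinuousAt (Function.uncurry U) (t, z)
  hol : ∀ t ∈ J, ∀ z ∈ Strip r, DifferentiableAt ℂ (U t) z
  per : ∀ t ∈ J, ∀ z ∈ Strip r, U t (z + p1) = U t z ∧ U t (z + p2) = U t z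
  st : ∀ t ∈ J, ∀ z ∈ Strip r, U t (st z) = st (U t z)
  bd : ∀ t ∈ J, ∀ z ∈ Strip r, ‖U t z‖ ≤ B
  lip : ∀ t ∈ J, ∀ z ∈ Strip r, ∀ w ∈ Strip r, ‖U t z - U t w‖ ≤ Λ * ‖z - w‖

/-- Properties shared by the Picard iterates and their limit. -/
structure Pre (J : Set ℝ) (r B : ℝ) (Y : ℝ → ℝ → E → E) : Prop where
  disp : ∀ s ∈ J, ∀ t ∈ J, ∀ z ∈ Strip (r / 2), ∀ w ∈ Strip (r / 2),
    ‖(Y s t z - z) - (Y s t w - w)‖ ≤ 1 * ‖z - w‖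
  st : ∀ s ∈ J, ∀ t ∈ J, ∀ z ∈ Strip (r / 2), Y s t (st z) = st (Y s t z)
  per : ∀ s ∈ J, ∀ t ∈ J, ∀ z ∈ Strip (r / 2),
    Y s t (z + p1) = Y s t z + p1 ∧ Y s t (z + p2) = Y s t z + p2
  lipS : ∀ s ∈ J, ∀ s' ∈ J, ∀ t ∈ J, ∀ z ∈ Strip (r / 2), ‖Y s t z - Y s' t z‖ ≤ B * |s - s'|
  lipT : ∀ s ∈ J, ∀ t ∈ J, ∀ t' ∈ J, ∀ z ∈ Strip (r / 2),
    ‖Y s t z - Y s t' z‖ ≤ 2 * B * |t - t'|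
  hol : ∀ s ∈ J, ∀ t ∈ J, ∀ z ∈ Strip (r / 2), DifferentiableAt ℂ (Y s t) z

/-- Picard map. -/
def picard (U : ℝ → E → E) (Y : ℝ → ℝ → E → E) (s t : ℝ) (z : E) : E :=
  z + ∫ σ in t..s, U σ (Y σ t z)

variable {a b B Λ : ℝ} {U : ℝ → E → E} {Y : ℝ → ℝ → E → E}

theorem norm_sub_st (z : E) : ‖z - st z‖ = ‖z.2 - conj z.1‖ := by
  rw [Prod.norm_def]
  simp only [st, Prod.fst_sub, Prod.snd_sub]
  rw [← Complex.norm_conj, map_sub, Complex.conj_conj, norm_sub_rev, max_self]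

theorem Pre.lipZ (h : Pre J r B Y) {s t : ℝ} (hs : s ∈ J) (ht : t ∈ J) {z w : E}
    (hz : z ∈ Strip (r / 2)) (hw : w ∈ Strip (r / 2)) : ‖Y s t z - Y s t w‖ ≤ 2 * ‖z - w‖ := by
  calc _ = ‖((Y s t z - z) - (Y s t w - w)) + (z - w)‖ := by congr 1; abel
    _ ≤ 1 * ‖z - w‖ + ‖z - w‖ := (norm_add_le _ _).trans (by gcongr; exact h.disp s hs t ht z hz w hw)
    _ = _ := by ring

theorem Pre.mem (h : Pre J r B Y) {s t : ℝ} (hs : s ∈ J) (ht : t ∈ J) {ρ : ℝ} (hρ : ρ ≤ r) {z : E}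
    (hz : z ∈ Strip (ρ / 2)) : Y s t z ∈ Strip ρ := by
  have hz' : z ∈ Strip (r / 2) := strip_mono (by linarith) hz
  have h1 := h.lipZ hs ht hz' (st_mem hz')
  rw [h.st s hs t ht z hz', norm_sub_st, norm_sub_st] at h1
  simp only [Strip, Set.mem_ofPred_eq] at *
  linarith

theorem Pre.contAt (h : Pre J r B Y) (hB : 0 ≤ B) (hJ : IsOpen J) {s t : ℝ} (hs : s ∈ J) (ht : t ∈ J)
    {z : E} (hz : z ∈ Strip (r / 2)) :
    ContinuousAt (fun p : ℝ × ℝ × E => Y p.1 p.2.1 p.2.2) (s, t, z) := by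
  rw [ContinuousAt, tendsto_iff_norm_sub_tendsto_zero]
  have hlim : Tendsto (fun p : ℝ × ℝ × E => B * |p.1 - s| + 2 * B * |p.2.1 - t| + 2 * ‖p.2.2 - z‖)
      (𝓝 (s, t, z)) (𝓝 0) := by
    have : Continuous (fun p : ℝ × ℝ × E =>
      B * |p.1 - s| + 2 * B * |p.2.1 - t| + 2 * ‖p.2.2 - z‖) := by fun_prop
    have h2 := this.tendsto (s, t, z)
    simpa using h2
  refine squeeze_zero' (Eventually.of_forall fun _ => norm_nonneg _) ?_ hlim
  have hn : J ×ˢ (J ×ˢ Strip (r / 2)) ∈ 𝓝 (s, t, z) :=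
    (hJ.prod (hJ.prod (isOpen_strip _))).mem_nhds ⟨hs, ht, hz⟩
  filter_upwards [hn] with p hp
  obtain ⟨h1, h2, h3⟩ := hp
  calc _ = ‖(Y p.1 p.2.1 p.2.2 - Y s p.2.1 p.2.2) + (Y s p.2.1 p.2.2 - Y s t p.2.2)
        + (Y s t p.2.2 - Y s t z)‖ := by congr 1; abel
    _ ≤ _ := (norm_add_le _ _).trans (add_le_add ((norm_add_le _ _).trans (add_le_add
        (h.lipS _ h1 _ hs _ h2 _ h3) (h.lipT _ hs _ h2 _ ht _ h3))) (h.lipZ hs ht h3 hz))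

section step
variable (hU : VF (Set.Ioo a b) r B Λ U)
include hU

theorem VF.contOn (h : Pre (Set.Ioo a b) r B Y) (hB : 0 ≤ B) {t : ℝ} (ht : t ∈ Set.Ioo a b) {z : E}
    (hz : z ∈ Strip (r / 2)) : ContinuousOn (fun σ => U σ (Y σ t z)) (Set.Ioo a b) := fun σ hσ => by
  have h1 : ContinuousAt (fun σ => (σ, Y σ t z)) σ := by
    refine continuousAt_id.prodMk ?_
    exact (h.contAt hB isOpen_Ioo hσ ht hz).comp (f := fun σ : ℝ => ((σ, t, z) : ℝ × ℝ × E))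
      (by fun_prop)
  exact ((hU.cont σ hσ _ (h.mem hσ ht le_rfl hz)).comp (f := fun σ => (σ, Y σ t z)) h1).continuousWithinAt

theorem VF.intInt (h : Pre (Set.Ioo a b) r B Y) (hB : 0 ≤ B) {s s' t : ℝ} (hs : s ∈ Set.Ioo a b)
    (hs' : s' ∈ Set.Ioo a b)
    (ht : t ∈ Set.Ioo a b) {z : E} (hz : z ∈ Strip (r / 2)) :
    IntervalIntegrable (fun σ => U σ (Y σ t z)) volume s s' :=
  ((hU.contOn h hB ht hz).mono (Set.ordConnected_Ioo.uIcc_subset hs hs')).intervalIntegrable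

theorem VF.comp_rg (h : Pre (Set.Ioo a b) r B Y) (hB : 0 ≤ B) {t : ℝ} (ht : t ∈ Set.Ioo a b) :
    Rg (Set.Ioo a b) (r / 2) (fun σ z => (U σ (Y σ t z)).1) ∧
    Rg (Set.Ioo a b) (r / 2) (fun σ z => (U σ (Y σ t z)).2) := by
  have hc : ∀ σ ∈ Set.Ioo a b, ∀ z ∈ Strip (r / 2),
      ContinuousAt (fun p : ℝ × E => U p.1 (Y p.1 t p.2)) (σ, z) := fun σ hσ z hz => by
    have h1 : ContinuousAt (fun p : ℝ × E => (p.1, Y p.1 t p.2)) (σ, z) := by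
      refine continuousAt_fst.prodMk ?_
      exact ContinuousAt.comp (x := (σ, z)) (f := fun p : ℝ × E => ((p.1, t, p.2) : ℝ × ℝ × E))
        (h.contAt hB isOpen_Ioo hσ ht hz) (by fun_prop)
    exact (hU.cont σ hσ _ (h.mem hσ ht le_rfl hz)).comp (f := fun p : ℝ × E => (p.1, Y p.1 t p.2)) h1
  have hd : ∀ σ ∈ Set.Ioo a b, ∀ z ∈ Strip (r / 2),
      DifferentiableAt ℂ (fun z => U σ (Y σ t z)) z := fun σ hσ z hz =>
    (hU.hol σ hσ _ (h.mem hσ ht le_rfl hz)).comp z (h.hol σ hσ t ht z hz)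
  have hp : ∀ σ ∈ Set.Ioo a b, ∀ z ∈ Strip (r / 2),
      U σ (Y σ t (z + p1)) = U σ (Y σ t z) ∧ U σ (Y σ t (z + p2)) = U σ (Y σ t z) :=
    fun σ hσ z hz => by
      have h1 := h.per σ hσ t ht z hz
      rw [h1.1, h1.2]
      exact hU.per σ hσ _ (h.mem hσ ht le_rfl hz)
  refine ⟨⟨fun σ hσ z hz => (hc σ hσ z hz).fst, fun σ hσ z hz => (hd σ hσ z hz).fst, fun σ hσ z hz => ?_⟩,
    ⟨fun σ hσ z hz => (hc σ hσ z hz).snd, fun σ hσ z hz => (hd σ hσ z hz).snd, fun σ hσ z hz => ?_⟩⟩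
  · simp only [hp σ hσ z hz, and_self]
  · simp only [hp σ hσ z hz, and_self]

theorem VF.bdInt (h : Pre (Set.Ioo a b) r B Y) {s s' t : ℝ} (hs : s ∈ Set.Ioo a b)
    (hs' : s' ∈ Set.Ioo a b) (ht : t ∈ Set.Ioo a b) {z : E} (hz : z ∈ Strip (r / 2)) :
    ‖∫ σ in s..s', U σ (Y σ t z)‖ ≤ B * |s' - s| := by
  apply intervalIntegral.norm_integral_le_of_norm_le_const
  intro σ hσ
  have hσ' := Set.ordConnected_Ioo.uIcc_subset hs hs' (Set.uIoc_subset_uIcc hσ)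
  exact hU.bd σ hσ' _ (h.mem hσ' ht le_rfl hz)

theorem VF.lipInt_mul {Y' : ℝ → ℝ → E → E} {t' : ℝ} (h : Pre (Set.Ioo a b) r B Y)
    (h' : Pre (Set.Ioo a b) r B Y') (hB : 0 ≤ B) (hΛ : 0 ≤ Λ)
    {s s' t : ℝ} (hs : s ∈ Set.Ioo a b)
    (hs' : s' ∈ Set.Ioo a b) (ht : t ∈ Set.Ioo a b) (ht' : t' ∈ Set.Ioo a b) {z w : E}
    (hz : z ∈ Strip (r / 2)) (hw : w ∈ Strip (r / 2)) {D : ℝ}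
    (hD : ∀ σ ∈ Set.Ioo a b, ‖Y σ t z - Y' σ t' w‖ ≤ D) :
    ‖(∫ σ in s..s', U σ (Y σ t z)) - ∫ σ in s..s', U σ (Y' σ t' w)‖ ≤ Λ * (b - a) * D := by
  have hD0 : 0 ≤ D := (norm_nonneg _).trans (hD s hs)
  rw [← intervalIntegral.integral_sub (hU.intInt h hB hs hs' ht hz) (hU.intInt h' hB hs hs' ht' hw)]
  have h1 : ‖∫ σ in s..s', (U σ (Y σ t z) - U σ (Y' σ t' w))‖ ≤ Λ * D * |s' - s| := by
    apply intervalIntegral.norm_integral_le_of_norm_le_const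
    intro σ hσ
    have hσ' := Set.ordConnected_Ioo.uIcc_subset hs hs' (Set.uIoc_subset_uIcc hσ)
    exact (hU.lip σ hσ' _ (h.mem hσ' ht le_rfl hz) _ (h'.mem hσ' ht' le_rfl hw)).trans
      (by gcongr; exact hD σ hσ')
  have h2 : |s' - s| ≤ b - a := by
    rw [abs_le]; constructor <;> linarith [hs.1, hs.2, hs'.1, hs'.2]
  calc _ ≤ Λ * D * |s' - s| := h1
    _ ≤ Λ * D * (b - a) := by gcongr
    _ = _ := by ring

theorem VF.lipInt {Y' : ℝ → ℝ → E → E} {t' : ℝ} (h : Pre (Set.Ioo a b) r B Y)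
    (h' : Pre (Set.Ioo a b) r B Y') (hB : 0 ≤ B) (hΛ : 0 ≤ Λ)
    (hsm : Λ * (b - a) ≤ 1 / 2) {s s' t : ℝ} (hs : s ∈ Set.Ioo a b)
    (hs' : s' ∈ Set.Ioo a b) (ht : t ∈ Set.Ioo a b) (ht' : t' ∈ Set.Ioo a b) {z w : E}
    (hz : z ∈ Strip (r / 2)) (hw : w ∈ Strip (r / 2)) {D : ℝ}
    (hD : ∀ σ ∈ Set.Ioo a b, ‖Y σ t z - Y' σ t' w‖ ≤ D) :
    ‖(∫ σ in s..s', U σ (Y σ t z)) - ∫ σ in s..s', U σ (Y' σ t' w)‖ ≤ D / 2 := by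
  have hD0 : 0 ≤ D := (norm_nonneg _).trans (hD s hs)
  refine (hU.lipInt_mul h h' hB hΛ hs hs' ht ht' hz hw hD).trans ?_
  nlinarith

omit hU in
theorem st_integral {f : ℝ → E} {s t : ℝ} :
    st (∫ σ in s..t, f σ) = ∫ σ in s..t, st (f σ) := by
  have h := fun μ : Measure ℝ => ContinuousLinearEquiv.integral_comp_comm (𝕜 := ℝ) (μ := μ)
    ((ContinuousLinearEquiv.prodComm ℝ ℂ ℂ).trans (Complex.conjCLE.prodCongr Complex.conjCLE)) f
  have e : ∀ v : E, ((ContinuousLinearEquiv.prodComm ℝ ℂ ℂ).trans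
    (Complex.conjCLE.prodCongr Complex.conjCLE)) v = st v := fun v => rfl
  simp only [e] at h
  simp only [intervalIntegral, h]
  simp [st]

theorem Pre.picard (h : Pre (Set.Ioo a b) r B Y) (hB : 0 ≤ B) (hΛ : 0 ≤ Λ)
    (hsm : Λ * (b - a) ≤ 1 / 2) : Pre (Set.Ioo a b) r B (QG.picard U Y) where
  disp s hs t ht z hz w hw := by
    rw [one_mul]
    simp only [QG.picard, add_sub_cancel_left]
    have := hU.lipInt h h hB hΛ hsm ht hs ht ht hz hw (D := 2 * ‖z - w‖)
      (fun σ hσ => h.lipZ hσ ht hz hw)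
    linarith
  st s hs t ht z hz := by
    simp only [QG.picard, st_add]
    rw [st_integral]
    congr 1
    apply intervalIntegral.integral_congr
    intro σ hσ
    have hσ' := Set.ordConnected_Ioo.uIcc_subset ht hs hσ
    simp only
    rw [h.st σ hσ' t ht z hz, hU.st σ hσ' _ (h.mem hσ' ht le_rfl hz)]
  per s hs t ht z hz := by
    simp only [QG.picard]
    have : ∀ σ ∈ Set.uIcc t s, U σ (Y σ t (z + p1)) = U σ (Y σ t z) ∧
        U σ (Y σ t (z + p2)) = U σ (Y σ t z) := fun σ hσ => by
      have hσ' := Set.ordConnected_Ioo.uIcc_subset ht hs hσ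
      have h1 := h.per σ hσ' t ht z hz
      rw [h1.1, h1.2]
      exact hU.per σ hσ' _ (h.mem hσ' ht le_rfl hz)
    rw [intervalIntegral.integral_congr (fun σ hσ => (this σ hσ).1),
      intervalIntegral.integral_congr (fun σ hσ => (this σ hσ).2)]
    constructor <;> abel
  lipS s hs s' hs' t ht z hz := by
    simp only [QG.picard, add_sub_add_left_eq_sub]
    rw [intervalIntegral.integral_interval_sub_left (hU.intInt h hB ht hs ht hz)
      (hU.intInt h hB ht hs' ht hz)]
    exact hU.bdInt h hs' hs ht hz
  lipT s hs t ht t' ht' z hz := by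
    simp only [QG.picard, add_sub_add_left_eq_sub]
    rw [← intervalIntegral.integral_add_adjacent_intervals (hU.intInt h hB ht ht' ht hz)
      (hU.intInt h hB ht' hs ht hz), add_sub_assoc]
    have h1 := hU.bdInt h ht ht' ht hz
    have h2 := hU.lipInt h h hB hΛ hsm ht' hs ht ht' hz hz (D := 2 * B * |t - t'|)
      (fun σ hσ => h.lipT σ hσ t ht t' ht' z hz)
    rw [abs_sub_comm] at h1
    refine (norm_add_le _ _).trans ?_
    linarith
  hol s hs t ht z hz := by
    have hsub := Set.ordConnected_Ioo.uIcc_subset ht hs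
    have hr := hU.comp_rg h hB ht
    have h1 := hr.1.differentiableAt_integral isOpen_Ioo (M := B) (fun σ hσ w hw =>
      (norm_fst_le _).trans (hU.bd σ hσ _ (h.mem hσ ht le_rfl hw))) hsub hz
    have h2 := hr.2.differentiableAt_integral isOpen_Ioo (M := B) (fun σ hσ w hw =>
      (norm_snd_le _).trans (hU.bd σ hσ _ (h.mem hσ ht le_rfl hw))) hsub hz
    refine differentiableAt_id.add ?_
    refine (h1.prodMk h2).congr_of_eventuallyEq ?_
    filter_upwards [(isOpen_strip _).mem_nhds hz] with w hw
    have hi := hU.intInt h hB ht hs ht hw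
    have e1 := (ContinuousLinearMap.fst ℝ ℂ ℂ).intervalIntegral_comp_comm hi
    have e2 := (ContinuousLinearMap.snd ℝ ℂ ℂ).intervalIntegral_comp_comm hi
    exact Prod.ext e1.symm e2.symm

end step

end

section

variable {J : Set ℝ} {r s : ℝ} {F G : ℝ → E → ℂ} {t : ℝ} {z : E} {ψ : ℝ → E → ℂ}
variable {a b B Λ : ℝ} {U : ℝ → E → E} {Y : ℝ → ℝ → E → E}

theorem differentiableAt_of_uniform {Ω : Set E} (hΩ : IsOpen Ω) {f : ℕ → E → ℂ} {g : E → ℂ} {C : ℝ}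
    (hf : ∀ n, ∀ z ∈ Ω, DifferentiableAt ℂ (f n) z) (h : ∀ n, ∀ z ∈ Ω, ‖f n z - g z‖ ≤ C / 2 ^ n)
    (hz : z ∈ Ω) : DifferentiableAt ℂ g z := by
  have hlim : Tendsto (fun n : ℕ => C / 2 ^ n) atTop (𝓝 0) := by
    have := (tendsto_pow_atTop_nhds_zero_of_lt_one (r := (1 / 2 : ℝ)) (by norm_num)
      (by norm_num)).const_mul C
    simpa [div_eq_mul_inv] using this
  have hu : TendstoUniformlyOn f g atTop Ω := by
    rw [Metric.tendstoUniformlyOn_iff]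
    intro ε hε
    filter_upwards [hlim.eventually (gt_mem_nhds hε)] with n hn w hw
    rw [dist_comm, dist_eq_norm]
    exact (h n w hw).trans_lt hn
  have key : ∀ (i : ℂ → E) (hi : Differentiable ℂ i) (u : ℂ), i u ∈ Ω →
      DifferentiableAt ℂ (fun ζ => g (i ζ)) u := fun i hi u hiu => by
    have ho : IsOpen (i ⁻¹' Ω) := hΩ.preimage hi.continuous
    have h1 : TendstoLocallyUniformlyOn (fun n => f n ∘ i) (g ∘ i) atTop (i ⁻¹' Ω) :=
      (hu.comp i).tendstoLocallyUniformlyOn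
    have h2 := h1.differentiableOn (Eventually.of_forall fun n w hw =>
      ((hf n _ hw).comp w (hi w)).differentiableWithinAt) ho
    exact (h2 u hiu).differentiableAt (ho.mem_nhds hiu)
  have hn := hΩ.mem_nhds hz
  refine differentiableAt_of_separate ?_ ?_ ?_
  · have hc : ContinuousOn g Ω := hu.continuousOn (Frequently.of_forall fun n w hw =>
      (hf n w hw).continuousAt.continuousWithinAt)
    filter_upwards [hn] with w hw using hc.continuousAt (hΩ.mem_nhds hw)
  · filter_upwards [hn] with w hw using key (fun ζ => (ζ, w.2)) (by fun_prop) _ hw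
  · filter_upwards [hn] with w hw using key (fun ζ => (w.1, ζ)) (by fun_prop) _ hw

theorem Pre.id (hB : 0 ≤ B) : Pre J r B (fun _ _ z => z) where
  disp s _ t _ z _ w _ := by simp
  st s _ t _ z _ := rfl
  per s _ t _ z _ := ⟨rfl, rfl⟩
  lipS s _ s' _ t _ z _ := by simp; positivity
  lipT s _ t _ t' _ z _ := by simp; positivity
  hol s _ t _ z _ := differentiableAt_id

theorem Pre.lim {Y : ℕ → ℝ → ℝ → E → E} {X : ℝ → ℝ → E → E} {C : ℝ} (h : ∀ n, Pre J r B (Y n))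
    (hX : ∀ n, ∀ s ∈ J, ∀ t ∈ J, ∀ z ∈ Strip (r / 2), ‖Y n s t z - X s t z‖ ≤ C / 2 ^ n) :
    Pre J r B X := by
  have hlim : Tendsto (fun n : ℕ => C / 2 ^ n) atTop (𝓝 0) := by
    have := (tendsto_pow_atTop_nhds_zero_of_lt_one (r := (1 / 2 : ℝ)) (by norm_num)
      (by norm_num)).const_mul C
    simpa [div_eq_mul_inv] using this
  have ht : ∀ s ∈ J, ∀ t ∈ J, ∀ z ∈ Strip (r / 2), Tendsto (fun n => Y n s t z) atTop (𝓝 (X s t z)) :=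
    fun s hs t ht z hz => by
      rw [tendsto_iff_norm_sub_tendsto_zero]
      exact squeeze_zero (fun _ => norm_nonneg _) (fun n => hX n s hs t ht z hz) hlim
  refine ⟨fun s hs t ht' z hz w hw => ?_, fun s hs t ht' z hz => ?_, fun s hs t ht' z hz => ?_,
    fun s hs s' hs' t ht' z hz => ?_, fun s hs t ht' t' ht'' z hz => ?_, fun s hs t ht' z hz => ?_⟩
  · exact le_of_tendsto' ((((ht s hs t ht' z hz).sub_const _).sub
      ((ht s hs t ht' w hw).sub_const _)).norm) fun n => (h n).disp s hs t ht' z hz w hw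
  · refine tendsto_nhds_unique (ht s hs t ht' _ (st_mem hz)) ?_
    simp only [fun n => (h n).st s hs t ht' z hz]
    exact (continuous_st.tendsto _).comp (ht s hs t ht' z hz)
  · constructor
    · refine tendsto_nhds_unique (ht s hs t ht' _ (strip_p1 hz)) ?_
      simp only [fun n => ((h n).per s hs t ht' z hz).1]
      exact (ht s hs t ht' z hz).add_const _
    · refine tendsto_nhds_unique (ht s hs t ht' _ (strip_p2 hz)) ?_
      simp only [fun n => ((h n).per s hs t ht' z hz).2]
      exact (ht s hs t ht' z hz).add_const _
  · exact le_of_tendsto' (((ht s hs t ht' z hz).sub (ht s' hs' t ht' z hz)).norm)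
      fun n => (h n).lipS s hs s' hs' t ht' z hz
  · exact le_of_tendsto' (((ht s hs t ht' z hz).sub (ht s hs t' ht'' z hz)).norm)
      fun n => (h n).lipT s hs t ht' t' ht'' z hz
  · have h1 := differentiableAt_of_uniform (isOpen_strip (r / 2)) (f := fun n z => (Y n s t z).1)
      (g := fun z => (X s t z).1) (fun n z hz => ((h n).hol s hs t ht' z hz).fst)
      (fun n z hz => (norm_fst_le (Y n s t z - X s t z)).trans (hX n s hs t ht' z hz)) hz
    have h2 := differentiableAt_of_uniform (isOpen_strip (r / 2)) (f := fun n z => (Y n s t z).2)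
      (g := fun z => (X s t z).2) (fun n z hz => ((h n).hol s hs t ht' z hz).snd)
      (fun n z hz => (norm_snd_le (Y n s t z - X s t z)).trans (hX n s hs t ht' z hz)) hz
    exact h1.prodMk h2

/-- The flow of a vector field. -/
structure Flow (a b r B : ℝ) (U : ℝ → E → E) (Y : ℝ → ℝ → E → E) : Prop where
  pre : Pre (Set.Ioo a b) r B Y
  eq : ∀ s ∈ Set.Ioo a b, ∀ t ∈ Set.Ioo a b, ∀ z ∈ Strip (r / 2), Y s t z = picard U Y s t z
  semi : ∀ s ∈ Set.Ioo a b, ∀ t ∈ Set.Ioo a b, ∀ t' ∈ Set.Ioo a b, ∀ z ∈ Strip (r / 4),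
    Y s t' (Y t' t z) = Y s t z

theorem exists_flow (hU : VF (Set.Ioo a b) r B Λ U) (hB : 0 ≤ B) (hΛ : 0 ≤ Λ)
    (hsm : Λ * (b - a) ≤ 1 / 2) : ∃ Y, Flow a b r B U Y := by
  by_cases hab : b ≤ a
  · have : ∀ s, s ∉ Set.Ioo a b := fun s hs => by linarith [hs.1, hs.2]
    exact ⟨fun _ _ z => z, Pre.id hB, fun s hs => absurd hs (this s), fun s hs => absurd hs (this s)⟩
  push Not at hab
  let y : ℕ → ℝ → ℝ → E → E := fun n => (picard U)^[n] (fun _ _ z => z)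
  have hy : ∀ n, y (n + 1) = picard U (y n) := fun n => Function.iterate_succ_apply' _ _ _
  have hp : ∀ n, Pre (Set.Ioo a b) r B (y n) := fun n => by
    induction n with
    | zero => exact Pre.id hB
    | succ n ih => rw [hy]; exact Pre.picard hU ih hB hΛ hsm
  have hC : 0 ≤ B * (b - a) := by nlinarith
  have hstep : ∀ n, ∀ s ∈ Set.Ioo a b, ∀ t ∈ Set.Ioo a b, ∀ z ∈ Strip (r / 2),
      ‖y n s t z - y (n + 1) s t z‖ ≤ 2 * (B * (b - a)) / 2 / 2 ^ n := fun n => by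
    induction n with
    | zero =>
      intro s hs t ht z hz
      rw [hy]
      simp only [picard, y, Function.iterate_zero, id, sub_add_cancel_left, norm_neg, pow_zero]
      refine (hU.bdInt (hp 0) ht hs ht hz).trans ?_
      have : |s - t| ≤ b - a := by
        rw [abs_le]; constructor <;> linarith [hs.1, hs.2, ht.1, ht.2]
      nlinarith
    | succ n ih =>
      intro s hs t ht z hz
      have e1 : ∀ n, y (n + 1) s t z = z + ∫ σ in t..s, U σ (y n σ t z) := fun n => by
        rw [hy n]; rfl
      rw [e1 (n + 1), e1 n, add_sub_add_left_eq_sub]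
      have := hU.lipInt (hp n) (hp (n + 1)) hB hΛ hsm ht hs ht ht hz hz
        (fun σ hσ => ih σ hσ t ht z hz)
      refine this.trans (le_of_eq ?_)
      rw [pow_succ]; ring
  have hlim : ∀ s t z, ∃ x, s ∈ Set.Ioo a b → t ∈ Set.Ioo a b → z ∈ Strip (r / 2) →
      ∀ n, ‖y n s t z - x‖ ≤ 2 * (B * (b - a)) / 2 ^ n := fun s t z => by
    by_cases h : s ∈ Set.Ioo a b ∧ t ∈ Set.Ioo a b ∧ z ∈ Strip (r / 2)
    · have hd : ∀ n, dist (y n s t z) (y (n + 1) s t z) ≤ 2 * (B * (b - a)) / 2 / 2 ^ n := fun n => by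
        rw [dist_eq_norm]; exact hstep n s h.1 t h.2.1 z h.2.2
      obtain ⟨x, hx⟩ := cauchySeq_tendsto_of_complete (cauchySeq_of_le_geometric_two hd)
      refine ⟨x, fun _ _ _ n => ?_⟩
      rw [← dist_eq_norm]
      exact dist_le_of_le_geometric_two_of_tendsto hd hx n
    · exact ⟨0, fun h1 h2 h3 => absurd ⟨h1, h2, h3⟩ h⟩
  choose X hX using hlim
  have hX' : ∀ n, ∀ s ∈ Set.Ioo a b, ∀ t ∈ Set.Ioo a b, ∀ z ∈ Strip (r / 2),
    ‖y n s t z - X s t z‖ ≤ 2 * (B * (b - a)) / 2 ^ n := fun n s hs t ht z hz => hX s t z hs ht hz n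
  have hXp : Pre (Set.Ioo a b) r B X := Pre.lim hp hX'
  have h0 : Tendsto (fun n : ℕ => 2 * (B * (b - a)) / 2 ^ n) atTop (𝓝 0) := by
    have := (tendsto_pow_atTop_nhds_zero_of_lt_one (r := (1 / 2 : ℝ)) (by norm_num)
      (by norm_num)).const_mul (2 * (B * (b - a)))
    simpa [div_eq_mul_inv] using this
  have htd : ∀ s ∈ Set.Ioo a b, ∀ t ∈ Set.Ioo a b, ∀ z ∈ Strip (r / 2),
      Tendsto (fun n => y n s t z) atTop (𝓝 (X s t z)) := fun s hs t ht z hz => by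
    rw [tendsto_iff_norm_sub_tendsto_zero]
    exact squeeze_zero (fun _ => norm_nonneg _) (fun n => hX' n s hs t ht z hz) h0
  have heq : ∀ s ∈ Set.Ioo a b, ∀ t ∈ Set.Ioo a b, ∀ z ∈ Strip (r / 2),
      X s t z = picard U X s t z := fun s hs t ht z hz => by
    refine tendsto_nhds_unique ((tendsto_add_atTop_iff_nat 1).2 (htd s hs t ht z hz)) ?_
    rw [tendsto_iff_norm_sub_tendsto_zero]
    refine squeeze_zero (fun _ => norm_nonneg _) (fun n => ?_) (h0.div_const 2 |>.trans (by simp))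
    rw [hy]
    simp only [picard, add_sub_add_left_eq_sub]
    exact hU.lipInt (hp n) hXp hB hΛ hsm ht hs ht ht hz hz (fun σ hσ => hX' n σ hσ t ht z hz)
  refine ⟨X, hXp, heq, fun s hs t ht t' ht' z hz => ?_⟩
  have hz2 : z ∈ Strip (r / 2) := by
    have hr : 0 < r / 4 := by
      have := (norm_nonneg _).trans_lt (show ‖z.2 - conj z.1‖ < 2 * (r / 4) from hz)
      linarith
    exact strip_mono (by linarith) hz
  have hw : X t' t z ∈ Strip (r / 2) := by
    have hr : 0 < r / 4 := by
      have := (norm_nonneg _).trans_lt (show ‖z.2 - conj z.1‖ < 2 * (r / 4) from hz)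
      linarith
    refine hXp.mem (ρ := r / 2) ht' ht (by linarith) ?_
    rwa [show r / 2 / 2 = r / 4 by ring]
  have hsg : ∀ σ ∈ Set.Ioo a b, X σ t z = X t' t z + ∫ u in t'..σ, U u (X u t z) := fun σ hσ => by
    rw [heq σ hσ t ht z hz2, heq t' ht' t ht z hz2]
    simp only [picard]
    rw [add_assoc, intervalIntegral.integral_add_adjacent_intervals (hU.intInt hXp hB ht ht' ht hz2)
      (hU.intInt hXp hB ht' hσ ht hz2)]
  have hk : ∀ n, ∀ σ ∈ Set.Ioo a b, ‖X σ t z - y n σ t' (X t' t z)‖ ≤ B * (b - a) / 2 ^ n := fun n => by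
    induction n with
    | zero =>
      intro σ hσ
      rw [hsg σ hσ]
      simp only [y, Function.iterate_zero, id, add_sub_cancel_left, pow_zero, div_one]
      refine (hU.bdInt hXp ht' hσ ht hz2).trans ?_
      have : |σ - t'| ≤ b - a := by
        rw [abs_le]; constructor <;> linarith [hσ.1, hσ.2, ht'.1, ht'.2]
      gcongr
    | succ n ih =>
      intro σ hσ
      rw [hy, hsg σ hσ]
      simp only [picard, add_sub_add_left_eq_sub]
      refine (hU.lipInt hXp (hp n) hB hΛ hsm ht' hσ ht ht' hz2 hw ih).trans (le_of_eq ?_)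
      rw [pow_succ]; ring
  refine tendsto_nhds_unique (htd s hs t' ht' _ hw) ?_
  rw [tendsto_iff_norm_sub_tendsto_zero]
  refine squeeze_zero (fun _ => norm_nonneg _) (fun n => ?_) (h0.div_const 2 |>.trans (by simp))
  rw [norm_sub_rev]
  refine (hk n s hs).trans (le_of_eq (by ring))

end

section

variable {J : Set ℝ} {r s : ℝ} {F G : ℝ → E → ℂ} {t : ℝ} {z : E} {ψ : ℝ → E → ℂ}
variable {a b B Λ : ℝ} {U : ℝ → E → E} {Y : ℝ → ℝ → E → E}

theorem Rg.lip {A : ℝ} (hF : Rg J r F) (ht : t ∈ J) (h1 : ∀ z ∈ Strip r, ‖QG.dz F t z‖ ≤ A)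
    (h2 : ∀ z ∈ Strip r, ‖QG.db F t z‖ ≤ A) {z w : E} (hz : z ∈ Strip r) (hw : w ∈ Strip r) :
    ‖F t z - F t w‖ ≤ 2 * A * ‖z - w‖ := by
  refine (convex_strip r).norm_image_sub_le_of_norm_hasFDerivWithin_le (𝕜 := ℂ)
    (fun x hx => (hF.hasFDerivAt ht hx).hasFDerivWithinAt) (fun x hx => ?_) hw hz
  have hA : 0 ≤ A := (norm_nonneg _).trans (h1 x hx)
  refine ContinuousLinearMap.opNorm_le_bound _ (by positivity) fun v => ?_
  simp only [add_apply, smul_apply,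
    ContinuousLinearMap.coe_fst', ContinuousLinearMap.coe_snd', smul_eq_mul]
  calc _ ≤ ‖QG.dz F t x‖ * ‖v.1‖ + ‖QG.db F t x‖ * ‖v.2‖ := by
        refine (norm_add_le _ _).trans ?_
        rw [norm_mul, norm_mul]
    _ ≤ A * ‖v‖ + A * ‖v‖ := by
        gcongr
        · exact h1 x hx
        · exact norm_fst_le v
        · exact h2 x hx
        · exact norm_snd_le v
    _ = _ := by ring

/-- The velocity field with stream function `ψ`. -/
def vel (ψ : ℝ → E → ℂ) (t : ℝ) (z : E) : E :=
  (2 * Complex.I * db ψ t z, -(2 * Complex.I * dz ψ t z))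

theorem Dt_eq_vel (ψ F : ℝ → E → ℂ) (t : ℝ) (z : E) :
    Dt ψ F t z = dt F t z + (vel ψ t z).1 * dz F t z + (vel ψ t z).2 * db F t z := by
  rw [Dt_apply]; simp only [vel]; ring

theorem dz_real (h : sm ψ = ψ) (t : ℝ) (z : E) : dz ψ t z = conj (db ψ t (st z)) := by
  conv_lhs => rw [← h, dz_sm]
  rfl
theorem db_real (h : sm ψ = ψ) (t : ℝ) (z : E) : db ψ t z = conj (dz ψ t (st z)) := by
  conv_lhs => rw [← h, db_sm]
  rfl

theorem Env.vf {L K : ℝ} (hJ : IsOpen J) (h : Env ψ J r L)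
    (hK : ∀ t ∈ J, ∀ z ∈ Strip r, ‖dz ψ t z‖ ≤ K) : VF J r (2 * K) (4 * L) (vel ψ) := by
  have h1 := h.reg.toRg.dz hJ
  have h2 := h.reg.toRg.db hJ
  have hK' : ∀ t ∈ J, ∀ z ∈ Strip r, ‖db ψ t z‖ ≤ K := fun t ht z hz => by
    rw [db_real h.real, Complex.norm_conj]; exact hK t ht _ (st_mem hz)
  refine ⟨fun t ht z hz => ?_, fun t ht z hz => ?_, fun t ht z hz => ?_, fun t ht z hz => ?_,
    fun t ht z hz => ?_, fun t ht z hz w hw => ?_⟩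
  · exact (continuousAt_const.mul (h2.cont t ht z hz)).prodMk
      (continuousAt_const.mul (h1.cont t ht z hz)).neg
  · exact ((h2.hol t ht z hz).const_mul _).prodMk ((h1.hol t ht z hz).const_mul _).neg
  · simp only [vel, (h1.per t ht z hz).1, (h1.per t ht z hz).2, (h2.per t ht z hz).1,
      (h2.per t ht z hz).2, and_self]
  · simp only [vel, QG.st]
    rw [db_real h.real t (conj z.2, conj z.1), dz_real h.real t (conj z.2, conj z.1)]
    simp [QG.st, Complex.conj_ofNat]
  · rw [Prod.norm_def]
    apply max_le
    · simp only [vel]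
      rw [norm_mul]
      norm_num
      linarith [hK' t ht z hz]
    · simp only [vel]
      rw [norm_neg, norm_mul]
      norm_num
      linarith [hK t ht z hz]
  · rw [Prod.norm_def]
    have e1 := h2.lip ht (h.zb t ht) (h.bb t ht) hz hw
    have e2 := h1.lip ht (h.zz t ht) (fun z hz => by
      rw [h.reg.toRg.dz_db hJ ht hz]; exact h.zb t ht z hz) hz hw
    apply max_le
    · simp only [vel, Prod.fst_sub]
      rw [← mul_sub, norm_mul]
      norm_num
      linarith
    · simp only [vel, Prod.snd_sub]
      rw [neg_sub_neg, ← mul_sub, norm_mul, norm_sub_rev]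
      norm_num
      linarith

theorem R1.hasDerivAt_comp (hJ : IsOpen J) (hF : R1 J r F) {y : ℝ → E} {v : E} (ht : t ∈ J)
    (hy : HasDerivAt y v t) (hz : y t ∈ Strip r) :
    HasDerivAt (fun s => F s (y s))
      (QG.dt F t (y t) + v.1 * QG.dz F t (y t) + v.2 * QG.db F t (y t)) t := by
  have hn := mem_nhds_JS hJ ht hz
  have hf : HasStrictFDerivAt (fun p : ℝ × E => F p.1 p.2)
      ((ContinuousLinearMap.toSpanSingleton ℝ (QG.dt F t (y t))).coprod
      ((QG.dz F t (y t) • ContinuousLinearMap.fst ℂ ℂ ℂ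
        + QG.db F t (y t) • ContinuousLinearMap.snd ℂ ℂ ℂ).restrictScalars ℝ)) (t, y t) := by
    refine hasStrictFDerivAt_uncurry_coprod (𝕜 := ℝ) (u := (t, y t)) (f := F)
      (f₁ := fun t z => ContinuousLinearMap.toSpanSingleton ℝ (QG.dt F t z))
      (f₂ := fun t z => (QG.dz F t z • ContinuousLinearMap.fst ℂ ℂ ℂ
        + QG.db F t z • ContinuousLinearMap.snd ℂ ℂ ℂ).restrictScalars ℝ) ?_ ?_ ?_ ?_
    · filter_upwards [hn] with p hp
      exact (hF.hasDt p.1 hp.1 p.2 hp.2).hasFDerivAt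
    · filter_upwards [hn] with p hp
      exact (hF.toRg.hasFDerivAt hp.1 hp.2).restrictScalars ℝ
    · have h1 := hF.dt.cont t ht _ hz
      have h2 : Continuous (fun c : ℂ => ContinuousLinearMap.toSpanSingleton ℝ c) :=
        (ContinuousLinearMap.toSpanSingletonCLE (𝕜 := ℝ) (E := ℂ)).continuous
      exact h2.continuousAt.comp h1
    · have h1 := (hF.toRg.dz hJ).cont t ht _ hz
      have h2 := (hF.toRg.db hJ).cont t ht _ hz
      have h3 : Continuous (fun A : E →L[ℂ] ℂ => A.restrictScalars ℝ) :=
        (ContinuousLinearMap.restrictScalarsL ℂ E ℂ ℝ ℝ).continuous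
      exact h3.continuousAt.comp ((h1.smul continuousAt_const).add (h2.smul continuousAt_const))
  have h := hf.hasFDerivAt.comp_hasDerivAt t ((hasDerivAt_id t).prodMk hy)
  convert! h using 1
  simp
  ring

section flow
variable (hU : VF (Set.Ioo a b) r B Λ U) (hY : Flow a b r B U Y) (hB : 0 ≤ B)
include hU hY hB

theorem Flow.hasDerivAt {s t : ℝ} (hs : s ∈ Set.Ioo a b) (ht : t ∈ Set.Ioo a b)
    (hz : z ∈ Strip (r / 2)) : HasDerivAt (fun s => Y s t z) (U s (Y s t z)) s := by
  have hc := hU.contOn hY.pre hB ht hz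
  have h1 := intervalIntegral.integral_hasDerivAt_right (hU.intInt hY.pre hB ht hs ht hz)
    (hc.stronglyMeasurableAtFilter isOpen_Ioo s hs) (hc.continuousAt (isOpen_Ioo.mem_nhds hs))
  refine (h1.const_add z).congr_of_eventuallyEq ?_
  filter_upwards [isOpen_Ioo.mem_nhds hs] with σ hσ
  exact hY.eq σ hσ t ht z hz

theorem Flow.disp (hΛ : 0 ≤ Λ) {s t : ℝ} (hs : s ∈ Set.Ioo a b) (ht : t ∈ Set.Ioo a b) {z w : E}
    (hz : z ∈ Strip (r / 2)) (hw : w ∈ Strip (r / 2)) :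
    ‖(Y s t z - z) - (Y s t w - w)‖ ≤ 2 * Λ * (b - a) * ‖z - w‖ := by
  rw [hY.eq s hs t ht z hz, hY.eq s hs t ht w hw]
  simp only [picard, add_sub_cancel_left]
  refine (hU.lipInt_mul hY.pre hY.pre hB hΛ ht hs ht ht hz hw (D := 2 * ‖z - w‖)
    (fun σ hσ => hY.pre.lipZ hσ ht hz hw)).trans (le_of_eq (by ring))

omit hU hB in
theorem Flow.self {t : ℝ} (ht : t ∈ Set.Ioo a b) (hz : z ∈ Strip (r / 2)) : Y t t z = z := by
  rw [hY.eq t ht t ht z hz]; simp [picard]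

theorem Flow.fderiv_sub_le (hΛ : 0 ≤ Λ) {s t : ℝ} (hs : s ∈ Set.Ioo a b) (ht : t ∈ Set.Ioo a b)
    (hz : z ∈ Strip (r / 2)) (v : E) :
    ‖fderiv ℂ (Y s t) z v - v‖ ≤ 2 * Λ * (b - a) * ‖v‖ := by
  have hab : 0 ≤ b - a := by linarith [hs.1, hs.2]
  have h1 : HasFDerivAt (fun w => Y s t w - w)
      (fderiv ℂ (Y s t) z - ContinuousLinearMap.id ℂ E) z :=
    (hY.pre.hol s hs t ht z hz).hasFDerivAt.sub (hasFDerivAt_id z)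
  have h2 := h1.le_of_lip' (C := 2 * Λ * (b - a)) (by positivity) (by
    filter_upwards [(isOpen_strip _).mem_nhds hz] with w hw
    exact hY.disp hU hB hΛ hs ht hw hz)
  have h3 := ContinuousLinearMap.le_of_opNorm_le _ h2 v
  simpa using h3

/-- Start-time derivative of the flow at the diagonal. -/
theorem Flow.hasDerivAt_start {t : ℝ} (ht : t ∈ Set.Ioo a b) (hz : z ∈ Strip (r / 2)) :
    HasDerivAt (fun t' => Y t t' z) (-U t z) t := by
  have hc : ContinuousAt (fun p : ℝ × ℝ => U p.1 (Y p.1 p.2 z)) (t, t) := by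
    have h1 : ContinuousAt (fun p : ℝ × ℝ => (p.1, Y p.1 p.2 z)) (t, t) := by
      refine continuousAt_fst.prodMk ?_
      exact ContinuousAt.comp (x := (t, t)) (f := fun p : ℝ × ℝ => ((p.1, p.2, z) : ℝ × ℝ × E))
        (hY.pre.contAt hB isOpen_Ioo ht ht hz) (by fun_prop)
    exact ContinuousAt.comp (x := (t, t)) (f := fun p : ℝ × ℝ => (p.1, Y p.1 p.2 z))
      (hU.cont t ht _ (hY.pre.mem ht ht le_rfl hz)) h1
  rw [hasDerivAt_iff_isLittleO, Asymptotics.isLittleO_iff]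
  intro ε hε
  have h1 := Metric.continuousAt_iff.1 hc ε hε
  obtain ⟨δ, hδ, h1⟩ := h1
  filter_upwards [Metric.ball_mem_nhds t hδ, isOpen_Ioo.mem_nhds ht] with t' ht' htJ
  rw [hY.self ht hz, hY.eq t ht t' htJ z hz]
  simp only [picard, add_sub_cancel_left]
  have e : (∫ σ in t'..t, U σ (Y σ t' z)) - (t' - t) • -U t z
      = ∫ σ in t'..t, (U σ (Y σ t' z) - U t z) := by
    rw [intervalIntegral.integral_sub (hU.intInt hY.pre hB htJ ht htJ hz) intervalIntegrable_const,
      intervalIntegral.integral_const, smul_neg, ← neg_smul, neg_sub]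
  rw [e, Real.norm_eq_abs, abs_sub_comm]
  apply intervalIntegral.norm_integral_le_of_norm_le_const
  intro σ hσ
  have hσ1 : |σ - t| ≤ |t' - t| := by
    rcases Set.mem_uIoc.1 hσ with h | h
    · rw [abs_le, abs_of_nonpos (by linarith)]; constructor <;> linarith
    · rw [abs_le, abs_of_nonneg (by linarith)]; constructor <;> linarith
  have ht'' : |t' - t| < δ := by simpa [Real.dist_eq] using ht'
  have h2 := @h1 (σ, t') (by
    rw [Prod.dist_eq, Real.dist_eq, Real.dist_eq]; exact max_lt (hσ1.trans_lt ht'') ht'')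
  rw [dist_eq_norm] at h2
  simp only [hY.self ht hz] at h2
  exact h2.le

end flow

theorem strip_half (hz : z ∈ Strip (r / 4)) : z ∈ Strip (r / 2) := by
  have := (norm_nonneg _).trans_lt (show ‖z.2 - conj z.1‖ < 2 * (r / 4) from hz)
  exact strip_mono (by linarith) hz

section comp
variable (hψ : R1 (Set.Ioo a b) r ψ) (hU : VF (Set.Ioo a b) r B Λ (vel ψ))
  (hY : Flow a b r B (vel ψ) Y) (hB : 0 ≤ B) {t₀ : ℝ} (ht₀ : t₀ ∈ Set.Ioo a b)
include hψ hU hY hB ht₀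

omit hψ in
/-- Transport along the flow. -/
theorem Flow.transport {M : ℝ} (hF : R1 (Set.Ioo a b) r F)
    (hM : ∀ t ∈ Set.Ioo a b, ∀ z ∈ Strip r, ‖Dt ψ F t z‖ ≤ M) (ht : t ∈ Set.Ioo a b)
    (hz : z ∈ Strip (r / 2)) : ‖F t z - F t₀ (Y t₀ t z)‖ ≤ M * |t - t₀| := by
  have h := (convex_Ioo a b).norm_image_sub_le_of_norm_hasDerivWithin_le (𝕜 := ℝ) (C := M)
    (f := fun s => F s (Y s t z)) (f' := fun s => Dt ψ F s (Y s t z)) (fun s hs => by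
      have h1 := hF.hasDerivAt_comp isOpen_Ioo hs (hY.hasDerivAt hU hB hs ht hz)
        (hY.pre.mem hs ht le_rfl hz)
      rw [← Dt_eq_vel] at h1
      exact h1.hasDerivWithinAt) (fun s hs => hM s hs _ (hY.pre.mem hs ht le_rfl hz)) ht₀ ht
  simpa [hY.self ht hz] using h

theorem Flow.comp {g : E → ℂ} (hg : ∀ z ∈ Strip r, DifferentiableAt ℂ g z)
    (hp : ∀ z ∈ Strip r, g (z + p1) = g z ∧ g (z + p2) = g z) :
    R1 (Set.Ioo a b) (r / 4) (fun t z => g (Y t₀ t z)) ∧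
      ∀ t ∈ Set.Ioo a b, ∀ z ∈ Strip (r / 4), Dt ψ (fun t z => g (Y t₀ t z)) t z = 0 := by
  have hR : Rg (Set.Ioo a b) (r / 2) (fun t z => g (Y t₀ t z)) := by
    refine ⟨fun t ht z hz => ?_, fun t ht z hz => ?_, fun t ht z hz => ?_⟩
    · refine ContinuousAt.comp (x := (t, z)) (f := fun p : ℝ × E => Y t₀ p.1 p.2)
        (hg _ (hY.pre.mem ht₀ ht le_rfl hz)).continuousAt ?_
      exact ContinuousAt.comp (x := (t, z)) (f := fun p : ℝ × E => ((t₀, p.1, p.2) : ℝ × ℝ × E))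
        (hY.pre.contAt hB isOpen_Ioo ht₀ ht hz) (by fun_prop)
    · exact (hg _ (hY.pre.mem ht₀ ht le_rfl hz)).comp z (hY.pre.hol t₀ ht₀ t ht z hz)
    · rw [(hY.pre.per t₀ ht₀ t ht z hz).1, (hY.pre.per t₀ ht₀ t ht z hz).2]
      exact hp _ (hY.pre.mem ht₀ ht le_rfl hz)
  set X : ℝ → E → ℂ := fun t z => g (Y t₀ t z) with hX
  have hder : ∀ t ∈ Set.Ioo a b, ∀ z ∈ Strip (r / 4), HasDerivAt (fun s => X s z)
      (((2 * Complex.I) • (dz ψ * db X - db ψ * dz X)) t z) t := fun t ht z hz => by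
    have hz2 := strip_half hz
    have h1 := hY.hasDerivAt_start hU hB ht hz2
    have h2 := (hR.hasFDerivAt ht hz2).restrictScalars ℝ
    have h3 : HasFDerivAt (X t) ((dz X t z • ContinuousLinearMap.fst ℂ ℂ ℂ
      + db X t z • ContinuousLinearMap.snd ℂ ℂ ℂ).restrictScalars ℝ) (Y t t z) := by
      rw [hY.self ht hz2]; exact h2
    have h4 := h3.comp_hasDerivAt t h1
    refine (HasDerivAt.congr_of_eventuallyEq h4 ?_).congr_deriv ?_
    · filter_upwards [isOpen_Ioo.mem_nhds ht] with t' ht'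
      simp only [hX, Function.comp]
      rw [hY.semi t₀ ht₀ t' ht' t ht z hz]
    · simp [vel]
      ring
  have hR4 : Rg (Set.Ioo a b) (r / 4) X := ⟨fun t ht z hz => hR.cont t ht z (strip_half hz),
    fun t ht z hz => hR.hol t ht z (strip_half hz), fun t ht z hz => hR.per t ht z (strip_half hz)⟩
  by_cases hr : 0 ≤ r
  · have hψ' : Rg (Set.Ioo a b) (r / 4) ψ := hψ.toRg.mono (by linarith)
    have hD : Rg (Set.Ioo a b) (r / 4) ((2 * Complex.I) • (dz ψ * db X - db ψ * dz X)) :=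
      (((hψ'.dz isOpen_Ioo).mul (hR4.db isOpen_Ioo)).sub
        ((hψ'.db isOpen_Ioo).mul (hR4.dz isOpen_Ioo))).smul _
    refine ⟨R1.mk' isOpen_Ioo hR4 hD hder, fun t ht z hz => ?_⟩
    rw [Dt_apply, QG.dt, (hder t ht z hz).deriv]
    simp
  · have he : ∀ z, z ∉ Strip (r / 4) := fun z hz => by
      have := (norm_nonneg _).trans_lt (show ‖z.2 - conj z.1‖ < 2 * (r / 4) from hz)
      linarith
    exact ⟨R1.mk' isOpen_Ioo hR4 (G := X) ⟨fun t ht z hz => absurd hz (he z),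
      fun t ht z hz => absurd hz (he z), fun t ht z hz => absurd hz (he z)⟩
      (fun t ht z hz => absurd hz (he z)), fun t ht z hz => absurd hz (he z)⟩

omit hψ in
theorem Flow.comp_fderiv_le (hΛ : 0 ≤ Λ) {g : E → ℂ} {t : ℝ} (ht : t ∈ Set.Ioo a b)
    (hg : ∀ z ∈ Strip r, DifferentiableAt ℂ g z) (hz : z ∈ Strip (r / 2)) (v : E) :
    ‖fderiv ℂ (fun z => g (Y t₀ t z)) z v - fderiv ℂ g (Y t₀ t z) v‖
      ≤ ‖fderiv ℂ g (Y t₀ t z)‖ * (2 * Λ * (b - a) * ‖v‖) := by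
  have h1 : fderiv ℂ (fun z => g (Y t₀ t z)) z
      = (fderiv ℂ g (Y t₀ t z)).comp (fderiv ℂ (Y t₀ t) z) :=
    fderiv_comp z (hg _ (hY.pre.mem ht₀ ht le_rfl hz)) (hY.pre.hol t₀ ht₀ t ht z hz)
  rw [h1, ContinuousLinearMap.comp_apply, ← map_sub]
  exact ContinuousLinearMap.le_opNorm_of_le _ (hY.fderiv_sub_le hU hB hΛ ht₀ ht hz v)

end comp

end

section

variable {J : Set ℝ} {r s : ℝ} {F G : ℝ → E → ℂ} {t : ℝ} {z : E} {ψ : ℝ → E → ℂ}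

/-- The integral of a directional derivative of a periodic function vanishes. -/
theorem integral_pderiv_eq_zero {V : Type*} [NormedAddCommGroup V] [NormedSpace ℝ V]
    [CompleteSpace V] {u : (Fin 3 → ℝ) → V} {u' : (Fin 3 → ℝ) → (Fin 3 → ℝ) →L[ℝ] V}
    (hu : ∀ x, HasFDerivAt u (u' x) x) (hp : ∀ x i, u (x + Pi.single i (2 * π)) = u x) (i : Fin 3)
    (hc : Continuous fun x => u' x (Pi.single i 1)) :
    ∫ x in box3, u' x (Pi.single i 1) = 0 := by
  have h := integral_divergence_of_hasFDerivAt_off_countable' (n := 2) (E := V) 0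
    (fun _ => 2 * π) (fun i => by positivity) (fun j x => if j = i then u x else 0)
    (fun j x => if j = i then u' x else 0) ∅ Set.countable_empty
    (fun j => by
      split_ifs
      · exact (continuous_iff_continuousAt.2 fun x => (hu x).continuousAt).continuousOn
      · exact continuousOn_const)
    (fun x _ j => by
      split_ifs
      · exact hu x
      · exact hasFDerivAt_const _ _) (by
      have : (fun x => ∑ j, (if j = i then u' x else 0) (Pi.single j 1)) =
        fun x => u' x (Pi.single i 1) := by
        ext x
        rw [Finset.sum_eq_single i] <;> simp +contextual
      rw [this]
      exact hc.continuousOn.integrableOn_compact isCompact_Icc)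
  have h1 : ∀ x, ∑ j, (if j = i then u' x else 0) (Pi.single j 1) = u' x (Pi.single i 1) := by
    intro x
    rw [Finset.sum_eq_single i] <;> simp +contextual
  simp only [h1] at h
  rw [box3, h]
  refine Finset.sum_eq_zero fun j _ => ?_
  by_cases hj : j = i
  · subst hj
    simp only [if_true]
    rw [sub_eq_zero]
    refine integral_congr_ae (Eventually.of_forall fun x => ?_)
    simp only [if_true]
    symm
    rw [← hp (j.insertNth ((0 : Fin 3 → ℝ) j) x) j]
    congr 1
    ext k
    refine Fin.succAboveCases j ?_ (fun l => ?_) k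
    · simp
    · simp [Fin.succAbove_ne]
  · simp [hj]

/-- The real points of the complexified plane. -/
def emb : (Fin 3 → ℝ) →L[ℝ] E :=
  ((Complex.ofRealCLM.comp (ContinuousLinearMap.proj (φ := fun _ : Fin 3 => ℝ) 0)) +
    Complex.I • (Complex.ofRealCLM.comp (ContinuousLinearMap.proj (φ := fun _ : Fin 3 => ℝ) 1))).prod
  ((Complex.ofRealCLM.comp (ContinuousLinearMap.proj (φ := fun _ : Fin 3 => ℝ) 0)) -
    Complex.I • (Complex.ofRealCLM.comp (ContinuousLinearMap.proj (φ := fun _ : Fin 3 => ℝ) 1)))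

theorem emb_apply (x : Fin 3 → ℝ) :
    emb x = ((x 0 : ℂ) + Complex.I * x 1, (x 0 : ℂ) - Complex.I * x 1) := by
  simp [emb]

theorem st_emb (x : Fin 3 → ℝ) : st (emb x) = emb x := by
  rw [emb_apply, st]
  simp [sub_eq_add_neg]

theorem emb_mem (hr : 0 < r) (x : Fin 3 → ℝ) : emb x ∈ Strip r := by
  rw [emb_apply, Strip]
  simp [hr, ← sub_eq_add_neg]

theorem emb_per (hF : Rg J r F) (hr : 0 < r) (ht : t ∈ J) (x : Fin 3 → ℝ) (i : Fin 3) :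
    F t (emb (x + Pi.single i (2 * π))) = F t (emb x) := by
  have hm := emb_mem hr x
  rw [map_add]
  fin_cases i
  · have : emb (Pi.single 0 (2 * π)) = p1 := by simp [emb_apply, p1]
    simp only [Fin.zero_eta, this]
    exact (hF.per t ht _ hm).1
  · have : emb (Pi.single 1 (2 * π)) = p2 := by
      simp [emb_apply, p2, mul_comm]
    simp only [Fin.mk_one, this]
    exact (hF.per t ht _ hm).2
  · have : emb (Pi.single 2 (2 * π)) = 0 := by simp [emb_apply]
    simp only [Fin.reduceFinMk, this, add_zero]

theorem Rg.hasFDerivAt_emb (hF : Rg J r F) (hr : 0 < r) (ht : t ∈ J) (x : Fin 3 → ℝ) :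
    HasFDerivAt (fun x => F t (emb x))
      (((fderiv ℂ (F t) (emb x)).restrictScalars ℝ).comp emb) x :=
  HasFDerivAt.comp (g := F t) x
    ((hF.hol t ht _ (emb_mem hr x)).hasFDerivAt.restrictScalars ℝ) emb.hasFDerivAt

theorem Rg.fderiv_emb (hF : Rg J r F) (hr : 0 < r) (ht : t ∈ J) (x v : Fin 3 → ℝ) :
    (((fderiv ℂ (F t) (emb x)).restrictScalars ℝ).comp emb) v =
      (v 0 + Complex.I * v 1) * QG.dz F t (emb x) + (v 0 - Complex.I * v 1) * QG.db F t (emb x) := by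
  rw [ContinuousLinearMap.comp_apply, ContinuousLinearMap.coe_restrictScalars',
    fderiv_eq (hF.hol t ht _ (emb_mem hr x)), emb_apply]

theorem Rg.cont_emb (hF : Rg J r F) (hr : 0 < r) (ht : t ∈ J) :
    Continuous fun x => F t (emb x) :=
  continuous_iff_continuousAt.2 fun x => (hF.hasFDerivAt_emb hr ht x).continuousAt

theorem Rg.int_emb (hF : Rg J r F) (hr : 0 < r) (ht : t ∈ J) :
    IntegrableOn (fun x => F t (emb x)) box3 :=
  (hF.cont_emb hr ht).continuousOn.integrableOn_compact isCompact_Icc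

theorem volume_box3 : (volume box3).toReal = (2 * π) ^ 3 := by
  rw [box3, Real.volume_Icc_pi_toReal (fun i => by positivity)]
  simp

theorem volume_box3_lt : volume box3 < ⊤ := isCompact_Icc.measure_lt_top

/-- Integral over the torus. -/
def av (X : ℝ → E → ℂ) (t : ℝ) : ℂ := ∫ x in box3, X t (emb x)

theorem av_add (hr : 0 < r) (hF : Rg J r F) (hG : Rg J r G) (ht : t ∈ J) :
    av (F + G) t = av F t + av G t :=
  integral_add (hF.int_emb hr ht) (hG.int_emb hr ht)
theorem av_sub (hr : 0 < r) (hF : Rg J r F) (hG : Rg J r G) (ht : t ∈ J) :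
    av (F - G) t = av F t - av G t :=
  integral_sub (hF.int_emb hr ht) (hG.int_emb hr ht)
theorem av_smul (c : ℂ) : av (c • F) t = c * av F t :=
  integral_const_mul c _
theorem av_sum {ι : Type*} {A : Finset ι} {F : ι → ℝ → E → ℂ} (hr : 0 < r)
    (h : ∀ i ∈ A, Rg J r (F i)) (ht : t ∈ J) :
    av (∑ i ∈ A, F i) t = ∑ i ∈ A, av (F i) t := by
  unfold av
  rw [← integral_finsetSum _ fun i hi => (h i hi).int_emb hr ht]
  simp
theorem av_congr (h : ∀ x, F t (emb x) = G t (emb x)) : av F t = av G t := by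
  simp only [av, h]
theorem av_const (c : ℂ) (h : ∀ x, F t (emb x) = c) : av F t = (2 * π) ^ 3 * c := by
  simp only [av, h]
  rw [setIntegral_const, Measure.real, volume_box3]
  simp

theorem norm_av_le {M : ℝ} (h : ∀ x, ‖F t (emb x)‖ ≤ M) : ‖av F t‖ ≤ 8 * π ^ 3 * M := by
  have := norm_setIntegral_le_of_norm_le_const (μ := volume) (s := box3) (C := M)
    (f := fun x => F t (emb x)) volume_box3_lt (fun x _ => h x)
  rw [Measure.real, volume_box3] at this
  rw [av]
  linarith

theorem av_dz (hJ : IsOpen J) (hr : 0 < r) (hF : Rg J r F) (ht : t ∈ J) : av (dz F) t = 0 ∧ av (db F) t = 0 := by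
  have h0 := hF.hasFDerivAt_emb hr ht
  have cz := (hF.dz hJ).cont_emb hr ht
  have cb := (hF.db hJ).cont_emb hr ht
  have key : ∀ i : Fin 3, ∫ x in box3, (((Pi.single i 1 : Fin 3 → ℝ) 0 + Complex.I * (Pi.single i 1 : Fin 3 → ℝ) 1)
      * dz F t (emb x) + ((Pi.single i 1 : Fin 3 → ℝ) 0 - Complex.I * (Pi.single i 1 : Fin 3 → ℝ) 1) * db F t (emb x)) = 0 := by
    intro i
    have := integral_pderiv_eq_zero h0 (emb_per hF hr ht) i (by
      simp only [hF.fderiv_emb hr ht]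
      fun_prop)
    simpa only [hF.fderiv_emb hr ht] using this
  have iz := (hF.dz hJ).int_emb hr ht
  have ib := (hF.db hJ).int_emb hr ht
  have k0 := key 0
  have k1 := key 1
  simp only [Pi.single_eq_same, ne_eq, one_ne_zero, not_false_eq_true, Pi.single_eq_of_ne,
    Complex.ofReal_zero, Complex.ofReal_one, mul_zero, add_zero, sub_zero, one_mul, mul_one,
    zero_add, zero_sub, zero_ne_one] at k0 k1
  rw [integral_add iz ib] at k0
  rw [integral_add (iz.const_mul _) (ib.const_mul _), integral_const_mul, integral_const_mul] at k1
  simp only [av]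
  set a := ∫ x in box3, dz F t (emb x)
  set b := ∫ x in box3, db F t (emb x)
  have k2 : a - b = 0 := by
    have : Complex.I * (a - b) = 0 := by rw [← k1]; ring
    simpa using this
  constructor
  · linear_combination (k0 + k2) / 2
  · linear_combination (k0 - k2) / 2

theorem hasDerivAt_av (hJ : IsOpen J) (hr : 0 < r) (hF : R1 J r F) (ht : t ∈ J) :
    HasDerivAt (av F) (av (dt F) t) t := by
  obtain ⟨ε, hε, hs⟩ := Metric.nhds_basis_closedBall.mem_iff.1 (hJ.mem_nhds ht)
  have hK : IsCompact (closedBall t ε ×ˢ box3) :=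
    (isCompact_closedBall t ε).prod isCompact_Icc
  have hc : ContinuousOn (fun p : ℝ × (Fin 3 → ℝ) => dt F p.1 (emb p.2)) (closedBall t ε ×ˢ box3) := by
    refine ContinuousOn.comp (g := Function.uncurry (dt F)) (f := fun p : ℝ × (Fin 3 → ℝ) => (p.1, emb p.2))
      (t := J ×ˢ Strip r) ?_ (by fun_prop) ?_
    · rintro ⟨a, b⟩ hab
      exact (hF.dt.cont a hab.1 b hab.2).continuousWithinAt
    · rintro ⟨a, b⟩ hab
      exact ⟨hs hab.1, emb_mem hr b⟩
  obtain ⟨C, hC⟩ := hK.exists_bound_of_continuousOn hc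
  refine (hasDerivAt_integral_of_dominated_loc_of_deriv_le (μ := volume.restrict box3)
    (F := fun t x => F t (emb x)) (F' := fun t x => dt F t (emb x)) (bound := fun _ => C)
    (closedBall_mem_nhds t hε) ?_ (hF.toRg.int_emb hr ht) ?_ ?_ ?_ ?_).2
  · filter_upwards [hJ.mem_nhds ht] with s hs
    exact (hF.toRg.cont_emb hr hs).aestronglyMeasurable
  · exact (hF.dt.cont_emb hr ht).aestronglyMeasurable
  · refine (ae_restrict_mem measurableSet_Icc).mono fun x hx s hs => hC (s, x) ⟨hs, hx⟩
  · exact integrableOn_const volume_box3_lt.ne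
  · exact Eventually.of_forall fun x s hs' => hF.hasDt s (hs hs') _ (emb_mem hr x)

theorem av_Dt (hJ : IsOpen J) (hr : 0 < r) (hψ : R1 J r ψ) (hF : R1 J r F) (ht : t ∈ J) :
    av (Dt ψ F) t = av (dt F) t := by
  have a1 := hψ.toRg.dz hJ
  have a2 := hψ.toRg.db hJ
  have b1 := a1.mul hF.toRg
  have b2 := a2.mul hF.toRg
  have h1 := (av_dz hJ hr b1 ht).2
  have h2 := (av_dz hJ hr b2 ht).1
  have h3 : av (dz ψ * db F - db ψ * dz F) t = 0 := by
    have : av (dz ψ * db F - db ψ * dz F) t = av (db (dz ψ * F) - dz (db ψ * F)) t := by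
      refine av_congr fun x => ?_
      have hx := emb_mem hr x
      simp only [Pi.sub_apply, Pi.mul_apply, Rg.db_mul a1 hF.toRg ht hx, Rg.dz_mul a2 hF.toRg ht hx,
        hψ.toRg.dz_db hJ ht hx]
      ring
    rw [this, av_sub hr (b1.db hJ) (b2.dz hJ) ht, h1, h2, sub_zero]
  have b3 := (a1.mul (hF.toRg.db hJ)).sub (a2.mul (hF.toRg.dz hJ))
  rw [show Dt ψ F = dt F - (2 * Complex.I) • (dz ψ * db F - db ψ * dz F) from rfl,
    av_sub hr hF.dt (b3.smul _) ht, av_smul, h3, mul_zero, sub_zero]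

theorem AW.norm_av_le {n η M : ℝ} {κ : ℂ} (hJ : IsOpen J) (hr : 0 < r) (hn : 0 < n)
    (hF : AW n η J r κ M F) (ht : t ∈ J) : ‖κ‖ * ‖av F t‖ ≤ 8 * π ^ 3 * (M * η) := by
  have h1 : av (dz F - (Complex.I * n * κ) • F) t = - ((Complex.I * n * κ) * av F t) := by
    rw [av_sub hr (hF.reg.dz hJ) (hF.reg.smul _) ht, av_smul, (av_dz hJ hr hF.reg ht).1, zero_sub]
  have h2 := QG.norm_av_le (F := dz F - (Complex.I * n * κ) • F) (t := t)
    fun x => hF.z t ht _ (emb_mem hr x)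
  rw [h1, norm_neg, norm_mul, norm_mul, norm_mul, Complex.norm_I, Complex.norm_real,
    Real.norm_of_nonneg hn.le, one_mul] at h2
  refine le_of_mul_le_mul_left ?_ hn
  linarith

end

section

variable {J : Set ℝ} {r s : ℝ} {F G : ℝ → E → ℂ} {t : ℝ} {z : E} {ψ : ℝ → E → ℂ}

/-- Admissible wave vector `κ` with the coefficients of its amplitude. -/
structure Dir (κ : ℂ) (c : ℝ) (m : ℂ) : Prop where
  nk : ‖κ‖ = 5 / 2
  int : ∃ p q : ℤ, 2 * κ = p + q * Complex.I
  cl : 7 / 32 ≤ c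
  cu : c ≤ 25 / 64
  hm : ‖m‖ ≤ 1 / 8

theorem rg_const {g : E → ℂ} (hg : ∀ z ∈ Strip r, DifferentiableAt ℂ g z)
    (hp : ∀ z ∈ Strip r, g (z + p1) = g z ∧ g (z + p2) = g z) :
    Rg Set.univ r (fun _ => g) :=
  ⟨fun t _ z hz => ContinuousAt.comp (x := (t, z)) (f := fun p : ℝ × E => p.2)
    (hg z hz).continuousAt continuousAt_snd, fun _ _ => hg, fun _ _ => hp⟩

theorem norm_fderiv_le {g : E → ℂ} {M ε : ℝ} (hg : ∀ z ∈ Strip r, DifferentiableAt ℂ g z)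
    (hp : ∀ z ∈ Strip r, g (z + p1) = g z ∧ g (z + p2) = g z) (hε : 0 < ε)
    (hM : ∀ z ∈ Strip r, ‖g z‖ ≤ M) (hz : z ∈ Strip (r - ε)) (v : E) :
    ‖fderiv ℂ g z v‖ ≤ 2 * (M / ε) * ‖v‖ := by
  have h1 := (rg_const hg hp).norm_dz_le (Set.mem_univ 0) hε hM hz
  have h2 := (rg_const hg hp).norm_db_le (Set.mem_univ 0) hε hM hz
  have hz' : z ∈ Strip r := strip_mono (by linarith) hz
  rw [fderiv_eq (F := fun _ => g) (t := 0) (hg z hz')]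
  calc _ ≤ ‖v‖ * (M / ε) + ‖v‖ * (M / ε) := by
        refine (norm_add_le _ _).trans ?_
        rw [norm_mul, norm_mul]
        gcongr
        · exact norm_fst_le v
        · exact norm_snd_le v
    _ = _ := by ring

variable {κ m : ℂ} {c : ℝ} {n : ℕ}

/-- The plane wave with wave vector `n κ`. -/
def pw (n : ℕ) (κ : ℂ) (w : E) : ℂ := Complex.exp (Complex.I * n * (κ * w.1 + conj κ * w.2))

theorem pw_st (w : E) : pw n κ w * conj (pw n κ (st w)) = 1 := by
  rw [pw, pw, ← Complex.exp_conj, ← Complex.exp_add, ← Complex.exp_zero]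
  congr 1
  simp [st]
  ring

theorem norm_pw_le (hκ : ‖κ‖ = 5 / 2) (hn : 0 < n) {w : E} (hw : w ∈ Strip (16 / n)) :
    ‖pw n κ w‖ ≤ Real.exp 80 := by
  have hn' : (0 : ℝ) < n := by exact_mod_cast hn
  rw [pw, Complex.norm_exp]
  apply Real.exp_le_exp.2
  have h1 : (Complex.I * n * (κ * w.1 + conj κ * w.2)).re
      = -(n * (conj κ * (w.2 - conj w.1)).im) := by
    simp
    left
    ring
  have h2 : |(conj κ * (w.2 - conj w.1)).im| ≤ 5 / 2 * (2 * (16 / n)) := by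
    refine (Complex.abs_im_le_norm _).trans ?_
    rw [norm_mul, Complex.norm_conj, hκ]
    gcongr
    exact hw.le
  rw [h1]
  have h3 := (abs_le.1 h2).1
  have : (n : ℝ) * (5 / 2 * (2 * (16 / n))) = 80 := by field_simp; norm_num
  nlinarith

theorem pw_per (hκ : ∃ p q : ℤ, 2 * κ = p + q * Complex.I) (w : E) :
    pw n κ (w + p1) = pw n κ w ∧ pw n κ (w + p2) = pw n κ w := by
  obtain ⟨p, q, h⟩ := hκ
  have hc : 2 * conj κ = p - q * Complex.I := by
    have := congrArg conj h
    simpa [Complex.conj_ofNat, sub_eq_add_neg] using this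
  constructor
  · rw [pw, pw, Complex.exp_eq_exp_iff_exists_int]
    refine ⟨n * p, ?_⟩
    simp only [p1, Prod.fst_add, Prod.snd_add]
    push_cast
    linear_combination Complex.I * n * π * (h + hc)
  · rw [pw, pw, Complex.exp_eq_exp_iff_exists_int]
    refine ⟨-(n * q), ?_⟩
    simp only [p2, Prod.fst_add, Prod.snd_add]
    push_cast
    linear_combination Complex.I * n * π * Complex.I * (h - hc) + 2 * Complex.I * n * π * q * Complex.I_sq

theorem pw_hasFDerivAt (w : E) : HasFDerivAt (pw n κ) (pw n κ w • ((Complex.I * n) •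
    (κ • ContinuousLinearMap.fst ℂ ℂ ℂ + conj κ • ContinuousLinearMap.snd ℂ ℂ ℂ))) w := by
  refine HasFDerivAt.cexp ?_
  exact (((hasFDerivAt_fst (𝕜 := ℂ) (p := w)).const_mul κ).add
    ((hasFDerivAt_snd (𝕜 := ℂ) (p := w)).const_mul (conj κ))).const_mul (Complex.I * n)

theorem wave_fun (hd : Dir κ c m) {s0 : E → ℂ} {R : ℝ} (hR : 0 < R) (hn : 0 < n)
    (hnr : 16 / n ≤ r / 2)
    (hs : ∀ z ∈ Strip r, DifferentiableAt ℂ s0 z)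
    (hp : ∀ z ∈ Strip r, s0 (z + p1) = s0 z ∧ s0 (z + p2) = s0 z)
    (hb : ∀ z ∈ Strip r, ‖s0 z‖ ≤ R / 8) :
    ∃ g : E → ℂ, (∀ z ∈ Strip r, DifferentiableAt ℂ g z) ∧
      (∀ z ∈ Strip r, g (z + p1) = g z ∧ g (z + p2) = g z) ∧
      (∀ z ∈ Strip (16 / n), ‖g z‖ ≤ Real.exp 80 * √R) ∧
      (∀ z ∈ Strip (16 / n), ∀ v : E,
        ‖fderiv ℂ g z v - Complex.I * n * (κ * v.1 + conj κ * v.2) * g z‖ ≤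
          Real.exp 80 * √R * (4 / r) * ‖v‖) ∧
      ∀ z ∈ Strip r, g z * conj (g (st z)) = c * R + m * s0 z + conj m * conj (s0 (st z)) := by
  have hn' : (0 : ℝ) < n := by exact_mod_cast hn
  have hr : 0 < r := by
    have : (0 : ℝ) < 16 / n := by positivity
    linarith
  have hsub : Strip (16 / n) ⊆ Strip (r - r / 2) := strip_mono (by linarith)
  have hsub' : Strip (16 / n) ⊆ Strip r := strip_mono (by linarith)
  set γ : E → ℂ := fun z => c * R + m * s0 z + conj m * conj (s0 (st z)) with hγ
  have hγd : ∀ z ∈ Strip r, DifferentiableAt ℂ γ z := fun z hz => by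
    have h1 : DifferentiableAt ℂ (fun z => conj (s0 (st z))) z := by
      obtain ⟨f', h⟩ := hasFDerivAt_conj_st (hs _ (st_mem hz))
      exact h.differentiableAt
    exact ((differentiableAt_const _).add ((hs z hz).const_mul m)).add (h1.const_mul _)
  have hpart : ∀ z ∈ Strip r, ‖γ z - (c * R : ℝ)‖ ≤ R / 32 := fun z hz => by
    have h1 : γ z - (c * R : ℝ) = m * s0 z + conj m * conj (s0 (st z)) := by
      simp only [hγ]; push_cast; ring
    rw [h1]
    calc _ ≤ 1 / 8 * (R / 8) + 1 / 8 * (R / 8) := by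
          refine (norm_add_le _ _).trans ?_
          rw [norm_mul, norm_mul, Complex.norm_conj, Complex.norm_conj]
          have := hd.hm
          gcongr
          · exact hb z hz
          · exact hb _ (st_mem hz)
      _ = _ := by ring
  have hre : ∀ z ∈ Strip r, 0 < (γ z).re := fun z hz => by
    have h1 := (Complex.abs_re_le_norm _).trans (hpart z hz)
    rw [Complex.sub_re, Complex.ofReal_re] at h1
    have := (abs_le.1 h1).1
    nlinarith [hd.cl]
  have hslit : ∀ z ∈ Strip r, γ z ∈ Complex.slitPlane := fun z hz => Or.inl (hre z hz)
  have hnorm : ∀ z ∈ Strip r, ‖γ z‖ ≤ R := fun z hz => by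
    have h1 : ‖γ z‖ ≤ ‖γ z - (c * R : ℝ)‖ + ‖((c * R : ℝ) : ℂ)‖ := by
      simpa using norm_add_le (γ z - (c * R : ℝ)) ((c * R : ℝ) : ℂ)
    have h2 : ‖((c * R : ℝ) : ℂ)‖ = c * R := by
      rw [Complex.norm_real, Real.norm_of_nonneg]
      have := hd.cl
      positivity
    nlinarith [hpart z hz, hd.cu]
  set α : E → ℂ := fun z => Complex.exp (Complex.log (γ z) / 2) with hα
  have hα2 : ∀ z ∈ Strip r, α z * α z = γ z := fun z hz => by
    simp only [hα]
    rw [← Complex.exp_add, add_halves, Complex.exp_log (Complex.slitPlane_ne_zero (hslit z hz))]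
  have hαd : ∀ z ∈ Strip r, DifferentiableAt ℂ α z := fun z hz => by
    simp only [hα, div_eq_mul_inv]
    exact (((hγd z hz).clog (hslit z hz)).mul_const _).cexp
  have hγp : ∀ z ∈ Strip r, γ (z + p1) = γ z ∧ γ (z + p2) = γ z := fun z hz => by
    have h1 := hp z hz
    have h2 := hp _ (st_mem hz)
    simp only [hγ, st_add, st_p1, st_p2, h1.1, h1.2, h2.1, h2.2, and_self]
  have hαp : ∀ z ∈ Strip r, α (z + p1) = α z ∧ α (z + p2) = α z := fun z hz => by
    simp only [hα, (hγp z hz).1, (hγp z hz).2, and_self]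
  have hαn : ∀ z ∈ Strip r, ‖α z‖ ≤ √R := fun z hz => by
    apply Real.le_sqrt_of_sq_le
    rw [sq, ← norm_mul, hα2 z hz]
    exact hnorm z hz
  have hαs : ∀ z ∈ Strip r, conj (α (st z)) = α z := fun z hz => by
    have h1 : γ (st z) = conj (γ z) := by
      simp only [hγ, st_st]
      simp
      ring
    simp only [hα]
    rw [← Complex.exp_conj, h1, map_div₀, Complex.conj_ofNat, ← Complex.log_conj, Complex.conj_conj]
    intro h
    have := Complex.slitPlane_arg_ne_pi (hslit _ (st_mem hz))
    rw [h1] at this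
    exact this h
  refine ⟨fun z => α z * pw n κ z, fun z hz => (hαd z hz).mul (pw_hasFDerivAt z).differentiableAt,
    fun z hz => ?_, fun z hz => ?_, fun z hz v => ?_, fun z hz => ?_⟩
  · simp only [(hαp z hz).1, (hαp z hz).2, (pw_per hd.int z).1, (pw_per hd.int z).2, and_self]
  · rw [norm_mul, mul_comm]
    exact mul_le_mul (norm_pw_le hd.nk hn hz) (hαn z (hsub' hz)) (norm_nonneg _) (by positivity)
  · have h1 := ((hαd z (hsub' hz)).hasFDerivAt.mul (pw_hasFDerivAt (n := n) (κ := κ) z)).fderiv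
    have h2 := norm_fderiv_le hαd hαp (half_pos hr) hαn (hsub hz) v
    have h3 := norm_pw_le hd.nk hn hz
    have h4 : fderiv ℂ (fun z => α z * pw n κ z) z v
        - Complex.I * n * (κ * v.1 + conj κ * v.2) * (α z * pw n κ z)
        = pw n κ z * fderiv ℂ α z v := by
      rw [show (fun z => α z * pw n κ z) = α * pw n κ from rfl, h1]
      simp
      ring
    rw [h4, norm_mul]
    calc _ ≤ Real.exp 80 * (2 * (√R / (r / 2)) * ‖v‖) := by gcongr
      _ = _ := by ring
  · calc _ = (α z * conj (α (st z))) * (pw n κ z * conj (pw n κ (st z))) := by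
          simp only [map_mul]; ring
      _ = _ := by rw [pw_st, hαs z hz, hα2 z hz, mul_one]

/-- The transported plane waves attached to a time `t₀`. -/
theorem exists_packet {S : ℝ → E → ℂ} {t₀ τ L K M R δ : ℝ} (hτ : 0 < τ)
    (hJ : J = Set.Ioo (t₀ - 2 * τ) (t₀ + 2 * τ)) (hψ : Env ψ J r L) (hL : 0 ≤ L)
    (hK : ∀ t ∈ J, ∀ z ∈ Strip r, ‖dz ψ t z‖ ≤ K) (hK0 : 0 ≤ K) (hLτ : 32 * L * τ ≤ 1)
    (hn : 0 < n) (hnr : 16 / n ≤ r / 4) (hS : R1 J r S)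
    (hM : ∀ t ∈ J, ∀ z ∈ Strip r, ‖Dt ψ S t z‖ ≤ M) (hR0 : 0 ≤ R) (hRδ : R ≤ δ)
    (hb : ∀ z ∈ Strip r, ‖S t₀ z‖ ≤ R / 8) :
    ∃ σ : ℝ → E → ℂ, (∀ t ∈ J, ∀ z ∈ Strip (8 / n), ‖S t z - σ t z‖ ≤ M * (2 * τ)) ∧
      ∀ κ c m, Dir κ c m → ∃ b : ℝ → E → ℂ, R1 J (8 / n) b ∧
        (∀ t ∈ J, ∀ z ∈ Strip (8 / n), Dt ψ b t z = 0) ∧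
        AW n (160 * (τ * L + 1 / (n * r))) J (8 / n) κ (Real.exp 80 * √δ) b ∧
        (R = 0 → b = 0) ∧
        ∀ t ∈ J, ∀ z ∈ Strip (8 / n),
          b t z * sm b t z = c * R + m * σ t z + conj m * sm σ t z := by
  subst hJ
  have hn' : (0 : ℝ) < n := by exact_mod_cast hn
  have h16 : (0 : ℝ) < 16 / n := by positivity
  have hr : 0 < r := by linarith
  have h8 : (8 : ℝ) / n = (16 / n) / 2 := by ring
  have hs4 : Strip (8 / n) ⊆ Strip (r / 4) := strip_mono (by rw [h8]; linarith)
  have hs2 : Strip (8 / n) ⊆ Strip (r / 2) := strip_mono (by rw [h8]; linarith)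
  have hVF := hψ.vf isOpen_Ioo hK
  have ht₀ : t₀ ∈ Set.Ioo (t₀ - 2 * τ) (t₀ + 2 * τ) := ⟨by linarith, by linarith⟩
  obtain ⟨Y, hY⟩ := exists_flow hVF (by positivity) (by positivity) (by linarith)
  have hmem : ∀ t ∈ Set.Ioo (t₀ - 2 * τ) (t₀ + 2 * τ), ∀ z ∈ Strip (8 / n),
      Y t₀ t z ∈ Strip (16 / n) := fun t ht z hz =>
    hY.pre.mem ht₀ ht (by linarith) (by rwa [← h8])
  have hst : ∀ t ∈ Set.Ioo (t₀ - 2 * τ) (t₀ + 2 * τ), ∀ z ∈ Strip (8 / n),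
      Y t₀ t (st z) = st (Y t₀ t z) := fun t ht z hz => hY.pre.st _ ht₀ _ ht _ (hs2 hz)
  have hM0 : 0 ≤ M := (norm_nonneg _).trans (hM t₀ ht₀ (0, 0) (by simp [Strip, hr]))
  have hδ : 0 ≤ δ := hR0.trans hRδ
  refine ⟨fun t z => S t₀ (Y t₀ t z), fun t ht z hz => ?_, fun κ c m hd => ?_⟩
  · refine (hY.transport hVF (by positivity) ht₀ hS hM ht (hs2 hz)).trans ?_
    refine mul_le_mul_of_nonneg_left ?_ hM0
    rw [abs_le]
    constructor <;> linarith [ht.1, ht.2]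
  rcases hR0.eq_or_lt with h0 | hRpos
  · subst h0
    have hz0 : ∀ z ∈ Strip (16 / n), S t₀ z = 0 := fun z hz => by
      have := hb z (strip_mono (by linarith) hz)
      simpa using this
    refine ⟨0, R1.zero isOpen_Ioo, fun t ht z hz => by simp [Dt_zero], ⟨Rg.zero, ?_, ?_, ?_⟩,
      fun _ => rfl, ?_⟩
    · intro t ht z hz
      simp only [Pi.zero_apply, norm_zero]
      positivity
    · intro t ht z hz
      simp [dz]
      positivity
    · intro t ht z hz
      simp [db]
      positivity
    · intro t ht z hz
      simp only [sm, hz0 _ (hmem t ht z hz), hz0 _ (hmem t ht _ (st_mem hz))]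
      simp
  obtain ⟨g, g1, g2, g3, g4, g5⟩ := wave_fun hd hRpos hn (by linarith)
    (hS.hol t₀ ht₀) (hS.per t₀ ht₀) hb
  set a := Real.exp 80 * √R with ha
  have haδ : a ≤ Real.exp 80 * √δ := by rw [ha]; gcongr
  have ha0 : 0 ≤ a := by positivity
  obtain ⟨c1, c2⟩ := hY.comp hψ.reg hVF (by positivity) ht₀ g1 g2
  have key : ∀ t ∈ Set.Ioo (t₀ - 2 * τ) (t₀ + 2 * τ), ∀ z ∈ Strip (8 / n), ∀ v : E, ‖v‖ ≤ 1 →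
      ‖fderiv ℂ (fun z => g (Y t₀ t z)) z v
        - Complex.I * n * (κ * v.1 + conj κ * v.2) * g (Y t₀ t z)‖
      ≤ Real.exp 80 * √δ * n * (160 * (τ * L + 1 / (n * r))) := by
    intro t ht z hz v hv
    have hm := hmem t ht z hz
    have k1 := hY.comp_fderiv_le hVF (by positivity) ht₀ (by positivity) ht g1 (hs2 hz) v
    have k2 := g4 _ hm v
    have k3 : ‖fderiv ℂ g (Y t₀ t z)‖ ≤ a * (4 / r) + 5 * n * a := by
      refine ContinuousLinearMap.opNorm_le_bound _ (by positivity) fun v => ?_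
      have k4 := g4 _ hm v
      have k5 : ‖Complex.I * n * (κ * v.1 + conj κ * v.2) * g (Y t₀ t z)‖ ≤ n * (5 * ‖v‖) * a := by
        rw [norm_mul, norm_mul, norm_mul, Complex.norm_I, one_mul, Complex.norm_natCast]
        have : ‖κ * v.1 + conj κ * v.2‖ ≤ 5 / 2 * ‖v‖ + 5 / 2 * ‖v‖ := by
          refine (norm_add_le _ _).trans ?_
          rw [norm_mul, norm_mul, Complex.norm_conj, hd.nk]
          gcongr
          · exact norm_fst_le v
          · exact norm_snd_le v
        gcongr
        · linarith
        · exact g3 _ hm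
      have := norm_add_le (fderiv ℂ g (Y t₀ t z) v - Complex.I * n * (κ * v.1 + conj κ * v.2) * g (Y t₀ t z))
        (Complex.I * n * (κ * v.1 + conj κ * v.2) * g (Y t₀ t z))
      rw [sub_add_cancel] at this
      calc _ ≤ _ := this.trans (add_le_add k4 k5)
        _ = _ := by ring
    have h32 : 2 * (4 * L) * (t₀ + 2 * τ - (t₀ - 2 * τ)) = 32 * L * τ := by ring
    rw [h32] at k1
    have h4r : 0 ≤ 4 / r := by positivity
    calc _ ≤ (a * (4 / r) + 5 * n * a) * (32 * L * τ * 1) + a * (4 / r) * 1 := by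
          refine (norm_sub_le_norm_sub_add_norm_sub _ (fderiv ℂ g (Y t₀ t z) v) _).trans ?_
          refine add_le_add (k1.trans ?_) (k2.trans ?_) <;> gcongr
      _ ≤ a * (4 / r) * 1 + 5 * n * a * (32 * L * τ) + a * (4 / r) := by
          have : a * (4 / r) * (32 * L * τ) ≤ a * (4 / r) * 1 := by gcongr
          linarith
      _ = a * n * (8 * (1 / (n * r)) + 160 * (τ * L)) := by field_simp; ring
      _ ≤ a * n * (160 * (τ * L + 1 / (n * r))) := by
          have : 0 ≤ 1 / (n * r) := by positivity
          gcongr; linarith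
      _ ≤ _ := by gcongr
  refine ⟨fun t z => g (Y t₀ t z), c1.mono (by rw [h8]; linarith), fun t ht z hz => c2 t ht z (hs4 hz),
    ⟨c1.toRg.mono (by rw [h8]; linarith), fun t ht z hz => ?_, fun t ht z hz => ?_, fun t ht z hz => ?_⟩,
    fun h => absurd h hRpos.ne', fun t ht z hz => ?_⟩
  · exact (g3 _ (hmem t ht z hz)).trans haδ
  · have h1 := key t ht z hz (1, 0) (by simp)
    have h2 := fderiv_eq (F := fun t z => g (Y t₀ t z)) (c1.hol t ht z (hs4 hz)) (1, 0)
    rw [h2] at h1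
    simpa using h1
  · have h1 := key t ht z hz (0, 1) (by simp)
    have h2 := fderiv_eq (F := fun t z => g (Y t₀ t z)) (c1.hol t ht z (hs4 hz)) (0, 1)
    rw [h2] at h1
    simpa using h1
  · simp only [sm, hst t ht z hz]
    exact g5 _ (strip_mono (by linarith) (hmem t ht z hz))

end

section

variable {J : Set ℝ} {r s : ℝ} {F G : ℝ → E → ℂ} {t : ℝ} {z : E} {ψ : ℝ → E → ℂ}
variable {L T M N n η a : ℝ} {f : ℝ → E → ℂ}

theorem PB.of_le (hF : PB ψ L J r M F) (hLT : L ≤ T) (hM : 0 ≤ M) : PB ψ T J r M F :=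
  ⟨hF.reg, hF.bd, fun t ht z hz => (hF.dbd t ht z hz).trans (by gcongr)⟩

theorem norm_half_I : ‖(1 / (2 * Complex.I) : ℂ)‖ = 1 / 2 := by simp

/-- The real stream function generated by the complex potential `F`. -/
def pot (F : ℝ → E → ℂ) : ℝ → E → ℂ := (1 / (2 * Complex.I)) • (db F - dz (sm F))

theorem sm_pot (F : ℝ → E → ℂ) : sm (pot F) = pot F := by
  unfold pot
  rw [sm_smul, sm_sub, ← dz_sm, ← db_sm, sm_sm]
  ext t z
  simp [Complex.conj_ofNat]
  ring

theorem PB.pot (hJ : IsOpen J) (hψ : Env ψ J r L) (hF : PB ψ T J r M F) (hLT : L ≤ T)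
    (hT : 0 ≤ T) (hn : 0 < n) (hs : s + 1 / n ≤ r) (hM : 0 ≤ M) :
    PB ψ T J s (5 * n * M) (QG.pot F) := by
  refine (((hF.db hJ hψ hLT hn hs hM).sub hJ
    ((hF.sm hJ hψ.real).dz hJ hψ hLT hn hs hM)).smul hJ _).le hT (le_of_eq ?_)
  rw [norm_half_I]; ring

/-- A stream function whose second derivatives are bounded by `L`, with transport derivatives
bounded by `L ^ 2`. -/
structure Env2 (ψ : ℝ → E → ℂ) (J : Set ℝ) (r L : ℝ) : Prop where
  reg : R1 J r ψ
  real : sm ψ = ψ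
  zz : PB ψ L J r L (dz (dz ψ))
  zb : PB ψ L J r L (dz (db ψ))
  bb : PB ψ L J r L (db (db ψ))

theorem Env2.env (h : Env2 ψ J r L) : Env ψ J r L := ⟨h.reg, h.real, h.zz.bd, h.zb.bd, h.bb.bd⟩

/-- The first corrector of the pressure potential. -/
def prs (ψ f : ℝ → E → ℂ) : ℝ → E → ℂ := Complex.I • (db ψ * f - dz ψ * sm f)

/-- The part of the new stress linear in the perturbation. -/
def lin (ψ f : ℝ → E → ℂ) : ℝ → E → ℂ :=
  (1 / 2 : ℂ) • dz (Dt ψ f) + Complex.I • (dz (dz ψ) * (db f - (2 : ℂ) • dz (sm f))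
    + dz (db ψ) * dz f + dz (dz (db ψ)) * f - dz (dz (dz ψ)) * sm f)

theorem sm_prs (hψ : sm ψ = ψ) (f : ℝ → E → ℂ) : sm (prs ψ f) = prs ψ f := by
  unfold prs
  rw [sm_smul, sm_sub, sm_mul, sm_mul, ← dz_sm, ← db_sm, sm_sm, hψ]
  ext t z
  simp
  ring

theorem Rg.dz_dz_add (hJ : IsOpen J) (hF : Rg J r F) (hG : Rg J r G) (ht : t ∈ J)
    (hz : z ∈ Strip r) :
    QG.dz (QG.dz (F + G)) t z = QG.dz (QG.dz F) t z + QG.dz (QG.dz G) t z := by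
  rw [dz_congr (G := QG.dz F + QG.dz G) (fun w hw => hF.dz_add hG ht hw) hz,
    (hF.dz hJ).dz_add (hG.dz hJ) ht hz]

theorem Rg.dz_dz_sub (hJ : IsOpen J) (hF : Rg J r F) (hG : Rg J r G) (ht : t ∈ J)
    (hz : z ∈ Strip r) :
    QG.dz (QG.dz (F - G)) t z = QG.dz (QG.dz F) t z - QG.dz (QG.dz G) t z := by
  rw [dz_congr (G := QG.dz F - QG.dz G) (fun w hw => hF.dz_sub hG ht hw) hz,
    (hF.dz hJ).dz_sub (hG.dz hJ) ht hz]

theorem Rg.dz_dz_smul (hJ : IsOpen J) (hF : Rg J r F) (c : ℂ) (ht : t ∈ J)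
    (hz : z ∈ Strip r) : QG.dz (QG.dz (c • F)) t z = c * QG.dz (QG.dz F) t z := by
  rw [dz_congr (G := c • QG.dz F) (fun w hw => hF.dz_smul ht hw c) hz,
    (hF.dz hJ).dz_smul ht hz]

theorem Rg.dz_dz_mul (hJ : IsOpen J) (hF : Rg J r F) (hG : Rg J r G) (ht : t ∈ J)
    (hz : z ∈ Strip r) : QG.dz (QG.dz (F * G)) t z =
      QG.dz (QG.dz F) t z * G t z + 2 * QG.dz F t z * QG.dz G t z
        + F t z * QG.dz (QG.dz G) t z := by
  rw [dz_congr (G := QG.dz F * G + F * QG.dz G) (fun w hw => hF.dz_mul hG ht hw) hz,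
    ((hF.dz hJ).mul hG).dz_add (hF.mul (hG.dz hJ)) ht hz, (hF.dz hJ).dz_mul hG ht hz,
    hF.dz_mul (hG.dz hJ) ht hz]
  ring

theorem Rg.dz_pot (hJ : IsOpen J) (hF : Rg J r F) (ht : t ∈ J) (hz : z ∈ Strip r) :
    QG.dz (pot F) t z = 1 / (2 * Complex.I) * (QG.dz (QG.db F) t z - QG.dz (QG.dz (QG.sm F)) t z) := by
  unfold pot
  rw [((hF.db hJ).sub (hF.sm.dz hJ)).dz_smul ht hz, (hF.db hJ).dz_sub (hF.sm.dz hJ) ht hz]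

/-- The linear terms of the new stress are of lower order. -/
theorem lin_eq (hJ : IsOpen J) (hψ : R1 J r ψ) (hf : R1 J r f) (ht : t ∈ J) (hz : z ∈ Strip r) :
    2 * dz ψ t z * dz (pot f) t z + 1 / 2 * dz (dt f) t z + dz (dz (prs ψ f)) t z
      = lin ψ f t z := by
  have a1 := hψ.toRg.dz hJ
  have a2 := hψ.toRg.db hJ
  have b1 := hf.toRg.dz hJ
  have b2 := hf.toRg.db hJ
  have e1 : dz (Dt ψ f) t z = dz (dt f) t z - 2 * Complex.I *
      (dz (dz ψ) t z * db f t z + dz ψ t z * dz (db f) t z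
        - dz (db ψ) t z * dz f t z - db ψ t z * dz (dz f) t z) := by
    rw [show QG.Dt ψ f = QG.dt f - (2 * Complex.I) • (QG.dz ψ * QG.db f - QG.db ψ * QG.dz f)
      from rfl, Rg.dz_sub hf.dt (((a1.mul b2).sub (a2.mul b1)).smul _) ht hz,
      Rg.dz_smul ((a1.mul b2).sub (a2.mul b1)) ht hz, Rg.dz_sub (a1.mul b2) (a2.mul b1) ht hz,
      Rg.dz_mul a1 b2 ht hz, Rg.dz_mul a2 b1 ht hz]
    ring
  have e2 : dz (dz (prs ψ f)) t z = Complex.I * (dz (dz (db ψ)) t z * f t z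
      + 2 * dz (db ψ) t z * dz f t z + db ψ t z * dz (dz f) t z
      - dz (dz (dz ψ)) t z * sm f t z - 2 * dz (dz ψ) t z * dz (sm f) t z
      - dz ψ t z * dz (dz (sm f)) t z) := by
    unfold prs
    rw [((a2.mul hf.toRg).sub (a1.mul hf.toRg.sm)).dz_dz_smul hJ _ ht hz,
      (a2.mul hf.toRg).dz_dz_sub hJ (a1.mul hf.toRg.sm) ht hz, a2.dz_dz_mul hJ hf.toRg ht hz,
      a1.dz_dz_mul hJ hf.toRg.sm ht hz]
    ring
  rw [e2, hf.toRg.dz_pot hJ ht hz]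
  simp only [lin, Pi.add_apply, Pi.sub_apply, Pi.smul_apply, Pi.mul_apply, smul_eq_mul, e1]
  have hI : 1 / (2 * Complex.I) = -Complex.I / 2 := by
    rw [div_eq_div_iff (by simp) (by simp)]; linear_combination (2 : ℂ) * Complex.I_sq
  rw [hI]
  ring

theorem PB.lin (hJ : IsOpen J) (hn : 0 < n) (hψ : Env2 ψ J (8 / n) L) (hL : 0 ≤ L) (hLT : L ≤ T)
    (ha : 0 ≤ a) (hf : PB ψ T J (8 / n) (3 * a / n ^ 2) f)
    (hDf : PB ψ T J (8 / n) (3 * a * T / n ^ 2) (Dt ψ f)) :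
    PB ψ T J (7 / n) (200 * a * T / n) (QG.lin ψ f) := by
  have hT : 0 ≤ T := hL.trans hLT
  have hs : 7 / n + 1 / n ≤ 8 / n := by rw [← add_div]; norm_num
  have hs' : 7 / n ≤ 8 / n := by gcongr; norm_num
  have hzz := (hψ.zz.of_le hLT hL)
  have hzb := (hψ.zb.of_le hLT hL)
  have ha2 : 0 ≤ 3 * a / n ^ 2 := by positivity
  have i1 := (hDf.dz hJ hψ.env hLT hn hs (by positivity)).smul hJ (1 / 2)
  have i2 := (hzz.mono hs').mul hJ ((hf.db hJ hψ.env hLT hn hs ha2).sub hJ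
    (((hf.sm hJ hψ.real).dz hJ hψ.env hLT hn hs ha2).smul hJ 2)) hL (by positivity) hT
  have i3 := (hzb.mono hs').mul hJ (hf.dz hJ hψ.env hLT hn hs ha2) hL (by positivity) hT
  have i4 := (hzb.dz hJ hψ.env hLT hn hs hL).mul hJ (hf.mono hs') (by positivity) (by positivity) hT
  have i5 := (hzz.dz hJ hψ.env hLT hn hs hL).mul hJ ((hf.sm hJ hψ.real).mono hs')
    (by positivity) (by positivity) hT
  refine (i1.add hJ ((((i2.add hJ i3).add hJ i4).sub hJ i5).smul hJ Complex.I)).le hT ?_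
  simp only [Complex.norm_I, one_mul]
  have e1 : ‖(1 / 2 : ℂ)‖ = 1 / 2 := by simp
  have e2 : ‖(2 : ℂ)‖ = 2 := by simp
  rw [e1, e2]
  calc _ = 15 / 2 * (a * T / n) + 180 * (a * L / n) := by field_simp; ring
    _ ≤ 15 / 2 * (a * T / n) + 180 * (a * T / n) := by gcongr
    _ ≤ 15 / 2 * (a * T / n) + 180 * (a * T / n) + 25 / 2 * (a * T / n) := by
        have : 0 ≤ a * T / n := by positivity
        linarith
    _ = _ := by ring

end

section

variable {J : Set ℝ} {r s : ℝ} {F G : ℝ → E → ℂ} {t : ℝ} {z : E} {ψ : ℝ → E → ℂ}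
variable {L T M N n η a : ℝ} {f : ℝ → E → ℂ}

theorem Dt_congr (hJ : IsOpen J) (h : ∀ t ∈ J, ∀ z ∈ Strip r, G t z = F t z) (ht : t ∈ J)
    (hz : z ∈ Strip r) : Dt ψ G t z = Dt ψ F t z := by
  rw [Dt_apply, Dt_apply, dz_congr (h t ht) hz, db_congr (h t ht) hz,
    dt_congr hJ (fun s hs => h s hs z hz) ht]

theorem PB.congr (hJ : IsOpen J) (hF : PB ψ T J r M F)
    (h : ∀ t ∈ J, ∀ z ∈ Strip r, G t z = F t z) : PB ψ T J r M G :=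
  ⟨hF.reg.congr hJ (fun t ht z hz => (h t ht z hz)), fun t ht z hz => by
    rw [h t ht z hz]; exact hF.bd t ht z hz, fun t ht z hz => by
    rw [Dt_congr hJ h ht hz]; exact hF.dbd t ht z hz⟩

/-- Labels of the waves. -/
abbrev Ix := Bool × Fin 3

/-- The label of the conjugate wave. -/
def op (α : Ix × Bool) : Ix × Bool := (α.1, !α.2)

/-- Signed wave vectors. -/
def Kv (κ : Ix → ℂ) (α : Ix × Bool) : ℂ := if α.2 then κ α.1 else -κ α.1

/-- Waves together with their conjugates. -/
def Gv (g : Ix → ℝ → E → ℂ) (α : Ix × Bool) : ℝ → E → ℂ := if α.2 then g α.1 else sm (g α.1)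

theorem Kv_op (κ : Ix → ℂ) (α : Ix × Bool) : Kv κ (op α) = -Kv κ α := by
  obtain ⟨i, b⟩ := α; cases b <;> simp [Kv, op]

theorem Gv_op (g : Ix → ℝ → E → ℂ) (α : Ix × Bool) : Gv g (op α) = sm (Gv g α) := by
  obtain ⟨i, b⟩ := α; cases b <;> simp [Gv, op, sm_sm]

theorem op_op (α : Ix × Bool) : op (op α) = α := by simp [op]

/-- Conjugation of labels as a permutation. -/
def opEquiv : (Ix × Bool) ≃ (Ix × Bool) := ⟨op, op, op_op, op_op⟩

theorem sum_op (h : Ix × Bool → ℂ) : ∑ α, h (op α) = ∑ α, h α := opEquiv.sum_comp h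

theorem sum_signed (h : Ix × Bool → ℂ) : ∑ α, h α = ∑ i, (h (i, true) + h (i, false)) := by
  rw [Fintype.sum_prod_type]
  exact Finset.sum_congr rfl fun i _ => Fintype.sum_bool _

theorem sum_split (h : (Ix × Bool) × (Ix × Bool) → ℂ) :
    ∑ p, h p = ∑ α, h (α, op α) + ∑ p, if p.2 = op p.1 then 0 else h p := by
  rw [Fintype.sum_prod_type h, Fintype.sum_prod_type (fun p => if p.2 = op p.1 then 0 else h p),
    ← Finset.sum_add_distrib]
  refine Finset.sum_congr rfl fun α _ => ?_
  have h1 : h (α, op α) = ∑ β, if β = op α then h (α, β) else 0 := by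
    rw [Finset.sum_ite_eq' Finset.univ (op α) (fun β => h (α, β))]; simp
  rw [h1, ← Finset.sum_add_distrib]
  refine Finset.sum_congr rfl fun β _ => ?_
  by_cases hb : β = op α <;> simp [hb]

/-- Six separated directions of equal length. -/
structure Freq (κ : Ix → ℂ) : Prop where
  nk : ∀ i, ‖κ i‖ = 5 / 2
  gap : ∀ α β, β ≠ op α → 1 / 2 ≤ ‖Kv κ α + Kv κ β‖

theorem Freq.nK {κ : Ix → ℂ} (h : Freq κ) (α : Ix × Bool) : ‖Kv κ α‖ = 5 / 2 := by
  obtain ⟨i, b⟩ := α; cases b <;> simp [Kv, h.nk]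

theorem Freq.mul_conj {κ : Ix → ℂ} (h : Freq κ) (α : Ix × Bool) :
    Kv κ α * conj (Kv κ α) = 25 / 4 := by
  rw [Complex.mul_conj, Complex.normSq_eq_norm_sq, h.nK]; norm_num

/-- All data of one perturbation step. -/
structure Cell (ψ : ℝ → E → ℂ) (J : Set ℝ) (n η L T a : ℝ) (κ : Ix → ℂ)
    (g : Ix → ℝ → E → ℂ) : Prop where
  hJ : IsOpen J
  hn : 0 < n
  hη : 0 ≤ η
  hL : 0 ≤ L
  hLT : L ≤ T
  ha : 0 ≤ a
  fr : Freq κ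
  env : Env2 ψ J (8 / n) L
  aw : ∀ i, AW n η J (8 / n) (κ i) a (g i)
  pb : ∀ i, PB ψ T J (8 / n) a (g i)
  pbd : ∀ i, PB ψ T J (8 / n) (a * T) (Dt ψ (g i))

/-- Perturbation of the complex potential. -/
def pert (n : ℝ) (κ : Ix → ℂ) (g : Ix → ℝ → E → ℂ) : ℝ → E → ℂ :=
  ∑ i, (1 / (n ^ 2 * conj (κ i)) : ℂ) • g i

/-- Coefficients cancelling the non-resonant interactions. -/
def cc (κ : Ix → ℂ) (p : (Ix × Bool) × (Ix × Bool)) : ℂ :=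
  if p.2 = op p.1 then 0 else -(Kv κ p.1 * Kv κ p.2) / (4 * (Kv κ p.1 + Kv κ p.2) ^ 2)

/-- The second corrector of the pressure potential. -/
def prs2 (n : ℝ) (κ : Ix → ℂ) (g : Ix → ℝ → E → ℂ) : ℝ → E → ℂ :=
  (1 / n ^ 2 : ℂ) • ∑ p, cc κ p • (Gv g p.1 * Gv g p.2)

/-- Principal part of the complex velocity. -/
def om (κ : Ix → ℂ) (g : Ix → ℝ → E → ℂ) : ℝ → E → ℂ :=
  (Complex.I / 2) • ∑ α, Kv κ α • Gv g α

theorem Freq.norm_cc {κ : Ix → ℂ} (h : Freq κ) (p : (Ix × Bool) × (Ix × Bool)) :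
    ‖cc κ p‖ ≤ 25 / 4 := by
  unfold cc
  split_ifs with hp
  · simp; norm_num
  · have h1 := h.gap p.1 p.2 hp
    rw [norm_div, norm_neg, norm_mul, norm_mul, norm_pow, h.nK, h.nK]
    have e : ‖(4 : ℂ)‖ = 4 := by simp
    rw [e, div_le_iff₀ (by positivity)]
    nlinarith

theorem Freq.conj_cc {κ : Ix → ℂ} (h : Freq κ) (p : (Ix × Bool) × (Ix × Bool)) :
    conj (cc κ p) = cc κ p := by
  unfold cc
  split_ifs with hp
  · simp
  · have h1 : Kv κ p.1 + Kv κ p.2 ≠ 0 := fun h0 => by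
      have := h.gap p.1 p.2 hp
      rw [h0] at this; simp at this; linarith
    have h2 := h.mul_conj p.1
    have h3 := h.mul_conj p.2
    have k1 : Kv κ p.1 ≠ 0 := by rw [← norm_pos_iff, h.nK]; norm_num
    have k2 : Kv κ p.2 ≠ 0 := by rw [← norm_pos_iff, h.nK]; norm_num
    have c1 : conj (Kv κ p.1) = 25 / 4 / Kv κ p.1 := by rw [eq_div_iff k1, mul_comm, h2]
    have c2 : conj (Kv κ p.2) = 25 / 4 / Kv κ p.2 := by rw [eq_div_iff k2, mul_comm, h3]
    simp only [map_div₀, map_neg, map_mul, map_pow, map_add, c1, c2, Complex.conj_ofNat]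
    have h4 : Kv κ p.2 + Kv κ p.1 ≠ 0 := by rwa [add_comm]
    field_simp
    ring

theorem Freq.cc_op {κ : Ix → ℂ} (p : (Ix × Bool) × (Ix × Bool)) :
    cc κ (op p.1, op p.2) = cc κ p := by
  unfold cc
  have : op p.2 = op (op p.1) ↔ p.2 = op p.1 :=
    ⟨fun h => by rw [op_op] at h; rw [← h, op_op], fun h => by rw [h]⟩
  simp only [this, Kv_op]
  split_ifs
  · rfl
  · congr 1 <;> ring

theorem sm_prs2 {κ : Ix → ℂ} (h : Freq κ) (n : ℝ) (g : Ix → ℝ → E → ℂ) :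
    sm (prs2 n κ g) = prs2 n κ g := by
  unfold prs2
  rw [sm_smul, sm_sum]
  congr 1
  · simp
  · simp only [sm_smul, sm_mul, ← Gv_op, h.conj_cc]
    rw [← (opEquiv.prodCongr opEquiv).sum_comp (fun p => cc κ p • (Gv g p.1 * Gv g p.2))]
    refine Finset.sum_congr rfl fun p _ => ?_
    change _ = cc κ (op p.1, op p.2) • (Gv g (op p.1) * Gv g (op p.2))
    rw [Freq.cc_op]

theorem sm_om (κ : Ix → ℂ) (g : Ix → ℝ → E → ℂ) :
    sm (om κ g) = (Complex.I / 2) • ∑ α, conj (Kv κ α) • Gv g α := by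
  unfold om
  rw [sm_smul, sm_sum]
  ext t z
  have h := sum_op fun α => conj (Kv κ α) * Gv g α t z
  simp only [Pi.smul_apply, Finset.sum_apply, smul_eq_mul, sm_smul, ← Gv_op]
  rw [← h]
  simp [Kv_op, Complex.conj_ofNat, Finset.sum_neg_distrib]
  ring

theorem st87 : 7 / n + 1 / n ≤ 8 / n := by rw [← add_div]; norm_num
theorem st76 : 6 / n + 1 / n ≤ 7 / n := by rw [← add_div]; norm_num
theorem st65 : 5 / n + 1 / n ≤ 6 / n := by rw [← add_div]; norm_num

section
variable {κ : Ix → ℂ} {g : Ix → ℝ → E → ℂ} (W : Cell ψ J n η L T a κ g)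
include W

theorem Cell.hT : 0 ≤ T := W.hL.trans W.hLT

theorem Cell.awG (α : Ix × Bool) : AW n η J (8 / n) (Kv κ α) a (Gv g α) := by
  obtain ⟨i, b⟩ := α
  cases b
  · simpa [Kv, Gv] using (W.aw i).sm
  · simpa [Kv, Gv] using W.aw i

theorem Cell.pbG (α : Ix × Bool) : PB ψ T J (8 / n) a (Gv g α) := by
  obtain ⟨i, b⟩ := α
  cases b
  · simpa [Gv] using (W.pb i).sm W.hJ W.env.real
  · simpa [Gv] using W.pb i

theorem Cell.norm_coef (i : Ix) : ‖(1 / (n ^ 2 * conj (κ i)) : ℂ)‖ = 2 / 5 / n ^ 2 := by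
  rw [norm_div, norm_mul, Complex.norm_conj, W.fr.nk]
  simp; ring

theorem Cell.pb_pert : PB ψ T J (8 / n) (3 * a / n ^ 2) (pert n κ g) := by
  refine (PB.sum W.hJ fun i _ => (W.pb i).smul W.hJ _).le W.hT ?_
  simp only [W.norm_coef, Finset.sum_const, Finset.card_univ]
  have : 0 ≤ a / n ^ 2 := div_nonneg W.ha (sq_nonneg n)
  simp only [Fintype.card_prod, Fintype.card_bool, Fintype.card_fin, nsmul_eq_mul]
  push_cast
  calc _ = 12 / 5 * (a / n ^ 2) := by ring
    _ ≤ 3 * (a / n ^ 2) := by linarith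
    _ = _ := by ring

theorem Cell.Dt_pert : PB ψ T J (8 / n) (3 * a * T / n ^ 2) (Dt ψ (pert n κ g)) := by
  have h := (PB.sum W.hJ (A := Finset.univ) fun i _ =>
    (W.pbd i).smul W.hJ (1 / (n ^ 2 * conj (κ i)) : ℂ))
  have h2 : PB ψ T J (8 / n) (3 * a * T / n ^ 2)
      (∑ i, (1 / (n ^ 2 * conj (κ i)) : ℂ) • Dt ψ (g i)) := by
    refine h.le W.hT ?_
    simp only [W.norm_coef, Finset.sum_const, Finset.card_univ]
    have : 0 ≤ a * T / n ^ 2 := div_nonneg (mul_nonneg W.ha W.hT) (sq_nonneg n)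
    simp only [Fintype.card_prod, Fintype.card_bool, Fintype.card_fin, nsmul_eq_mul]
    push_cast
    calc _ = 12 / 5 * (a * T / n ^ 2) := by ring
      _ ≤ 3 * (a * T / n ^ 2) := by linarith
      _ = _ := by ring
  refine h2.congr W.hJ fun t ht z hz => ?_
  unfold pert
  rw [Dt_sum W.hJ (fun i _ => (W.pb i).reg.smul W.hJ _) ht hz]
  simp only [Finset.sum_apply, Pi.smul_apply, smul_eq_mul]
  exact Finset.sum_congr rfl fun i _ => (W.pb i).reg.Dt_smul ht hz _

theorem Cell.pb_w : PB ψ T J (7 / n) (15 * a / n) (pot (pert n κ g)) := by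
  have hn := W.hn
  have ha := W.ha
  refine (W.pb_pert.pot W.hJ W.env.env W.hLT W.hT hn st87 (by positivity)).le W.hT
    (le_of_eq ?_)
  field_simp; ring

theorem Cell.envs (k : ℝ) (hk : k ≤ 8) : Env ψ J (k / n) L :=
  W.env.env.mono (by have := W.hn; gcongr)

theorem Cell.pb_dzw : PB ψ T J (6 / n) (75 * a) (dz (pot (pert n κ g))) := by
  have hn := W.hn
  have ha := W.ha
  refine (W.pb_w.dz W.hJ (W.envs 7 (by norm_num)) W.hLT hn st76 (by positivity)).le W.hT
    (le_of_eq ?_)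
  field_simp; ring

theorem Cell.pb_dbw : PB ψ T J (6 / n) (75 * a) (db (pot (pert n κ g))) := by
  have hn := W.hn
  have ha := W.ha
  refine (W.pb_w.db W.hJ (W.envs 7 (by norm_num)) W.hLT hn st76 (by positivity)).le W.hT
    (le_of_eq ?_)
  field_simp; ring

theorem Cell.pb_dzzw : PB ψ T J (5 / n) (375 * a * n) (dz (dz (pot (pert n κ g)))) := by
  have ha := W.ha
  refine (W.pb_dzw.dz W.hJ (W.envs 6 (by norm_num)) W.hLT W.hn st65 (by positivity)).le W.hT
    (le_of_eq ?_)
  ring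
theorem Cell.pb_dzbw : PB ψ T J (5 / n) (375 * a * n) (dz (db (pot (pert n κ g)))) := by
  have ha := W.ha
  refine (W.pb_dbw.dz W.hJ (W.envs 6 (by norm_num)) W.hLT W.hn st65 (by positivity)).le W.hT
    (le_of_eq ?_)
  ring
theorem Cell.pb_dbbw : PB ψ T J (5 / n) (375 * a * n) (db (db (pot (pert n κ g)))) := by
  have ha := W.ha
  refine (W.pb_dbw.db W.hJ (W.envs 6 (by norm_num)) W.hLT W.hn st65 (by positivity)).le W.hT
    (le_of_eq ?_)
  ring

theorem Cell.pb_prs2 : PB ψ T J (8 / n) (1800 * a ^ 2 / n ^ 2) (prs2 n κ g) := by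
  have ha := W.ha
  have h1 : ∀ p ∈ (Finset.univ : Finset ((Ix × Bool) × (Ix × Bool))),
      PB ψ T J (8 / n) (25 / 4 * (2 * a * a)) (cc κ p • (Gv g p.1 * Gv g p.2)) := fun p _ =>
    (((W.pbG p.1).mul W.hJ (W.pbG p.2) ha ha W.hT).smul W.hJ (cc κ p)).le W.hT
      (mul_le_mul_of_nonneg_right (W.fr.norm_cc p) (by positivity))
  refine ((PB.sum W.hJ h1).smul W.hJ _).le W.hT (le_of_eq ?_)
  simp only [Finset.sum_const, Finset.card_univ, Fintype.card_prod, Fintype.card_bool,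
    Fintype.card_fin, nsmul_eq_mul]
  rw [norm_div]
  simp
  ring

theorem Cell.pb_dzz_prs2 : PB ψ T J (6 / n) (45000 * a ^ 2) (dz (dz (prs2 n κ g))) := by
  have hn := W.hn
  have h0 : 0 ≤ 1800 * a ^ 2 / n ^ 2 := by positivity
  refine ((W.pb_prs2.dz W.hJ W.env.env W.hLT hn st87 h0).dz W.hJ (W.envs 7 (by norm_num))
    W.hLT hn st76 (by positivity)).le W.hT (le_of_eq ?_)
  field_simp; ring

end

end

section

variable {J : Set ℝ} {r s : ℝ} {F G : ℝ → E → ℂ} {t : ℝ} {z : E} {ψ : ℝ → E → ℂ}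
variable {L T M N n η a : ℝ} {f : ℝ → E → ℂ}

theorem dz_dz_lin (hJ : IsOpen J) {ι : Type*} {A : Finset ι} {c : ι → ℂ} {F : ι → ℝ → E → ℂ}
    (h : ∀ i ∈ A, Rg J r (F i)) (ht : t ∈ J) (hz : z ∈ Strip r) :
    dz (dz (∑ i ∈ A, c i • F i)) t z = ∑ i ∈ A, c i * dz (dz (F i)) t z := by
  have h1 : ∀ w ∈ Strip r, dz (∑ i ∈ A, c i • F i) t w = (∑ i ∈ A, c i • dz (F i)) t w := by
    intro w hw
    rw [dz_sum (fun i hi => (h i hi).smul _) ht hw]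
    simp only [Finset.sum_apply, Pi.smul_apply, smul_eq_mul]
    exact Finset.sum_congr rfl fun i hi => (h i hi).dz_smul ht hw _
  rw [dz_congr h1 hz, dz_sum (fun i hi => ((h i hi).dz hJ).smul _) ht hz]
  exact Finset.sum_congr rfl fun i hi => ((h i hi).dz hJ).dz_smul ht hz _

theorem dz_db_lin (hJ : IsOpen J) {ι : Type*} {A : Finset ι} {c : ι → ℂ} {F : ι → ℝ → E → ℂ}
    (h : ∀ i ∈ A, Rg J r (F i)) (ht : t ∈ J) (hz : z ∈ Strip r) :
    dz (db (∑ i ∈ A, c i • F i)) t z = ∑ i ∈ A, c i * dz (db (F i)) t z := by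
  have h1 : ∀ w ∈ Strip r, db (∑ i ∈ A, c i • F i) t w = (∑ i ∈ A, c i • db (F i)) t w := by
    intro w hw
    rw [db_sum (fun i hi => (h i hi).smul _) ht hw]
    simp only [Finset.sum_apply, Pi.smul_apply, smul_eq_mul]
    exact Finset.sum_congr rfl fun i hi => (h i hi).db_smul ht hw _
  rw [dz_congr h1 hz, dz_sum (fun i hi => ((h i hi).db hJ).smul _) ht hz]
  exact Finset.sum_congr rfl fun i hi => ((h i hi).db hJ).dz_smul ht hz _

theorem card_Ix : Fintype.card Ix = 6 := rfl
theorem card_pairs : Fintype.card ((Ix × Bool) × (Ix × Bool)) = 144 := by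
  simp [Fintype.card_prod]

section
variable {κ : Ix → ℂ} {g : Ix → ℝ → E → ℂ} (W : Cell ψ J n η L T a κ g)
include W

theorem Cell.dzw_om (ht : t ∈ J) (hz : z ∈ Strip (7 / n)) :
    ‖dz (pot (pert n κ g)) t z - om κ g t z‖ ≤ 9 * a * η := by
  have hn := W.hn
  have hz8 : z ∈ Strip (8 / n) := strip_mono (by gcongr; norm_num) hz
  have hsm : sm (pert n κ g) = ∑ i, (1 / (n ^ 2 * κ i) : ℂ) • sm (g i) := by
    unfold pert
    rw [sm_sum]
    simp [sm_smul]
  have hκ : ∀ i, κ i ≠ 0 := fun i => by rw [← norm_pos_iff, W.fr.nk]; norm_num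
  have hκ' : ∀ i, conj (κ i) ≠ 0 := fun i => by simpa using hκ i
  have hn0 : (n : ℂ) ≠ 0 := by exact_mod_cast hn.ne'
  have hI : 1 / (2 * Complex.I) = -Complex.I / 2 := by
    rw [div_eq_div_iff (by simp) (by simp)]; linear_combination (2 : ℂ) * Complex.I_sq
  rw [W.pb_pert.reg.toRg.dz_pot W.hJ ht hz8, hsm]
  unfold pert
  rw [dz_db_lin W.hJ (fun i _ => (W.aw i).reg) ht hz8,
    dz_dz_lin W.hJ (fun i _ => (W.aw i).reg.sm) ht hz8]
  have key : 1 / (2 * Complex.I) * (∑ i, 1 / (n ^ 2 * conj (κ i)) * dz (db (g i)) t z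
      - ∑ i, 1 / (n ^ 2 * κ i) * dz (dz (sm (g i))) t z) - om κ g t z
      = 1 / (2 * Complex.I) * ∑ i, ((1 / (n ^ 2 * conj (κ i)) *
        (dz (db (g i)) t z + n ^ 2 * (κ i * conj (κ i)) * g i t z))
        - 1 / (n ^ 2 * κ i) * (dz (dz (sm (g i))) t z + n ^ 2 * (-κ i) ^ 2 * sm (g i) t z)) := by
    have e1 : om κ g t z = Complex.I / 2 * ∑ i, (κ i * g i t z - κ i * sm (g i) t z) := by
      unfold om
      simp only [Pi.smul_apply, Finset.sum_apply, smul_eq_mul]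
      rw [sum_signed]
      congr 1
      refine Finset.sum_congr rfl fun i _ => ?_
      simp [Kv, Gv]; ring
    rw [e1, ← Finset.sum_sub_distrib, hI, Finset.mul_sum, Finset.mul_sum, Finset.mul_sum,
      ← Finset.sum_sub_distrib]
    refine Finset.sum_congr rfl fun i _ => ?_
    have := hκ i
    have := hκ' i
    field_simp
    ring
  rw [key, norm_mul, norm_half_I]
  have hb : ‖∑ i, ((1 / (n ^ 2 * conj (κ i)) *
        (dz (db (g i)) t z + n ^ 2 * (κ i * conj (κ i)) * g i t z))
        - 1 / (n ^ 2 * κ i) * (dz (dz (sm (g i))) t z + n ^ 2 * (-κ i) ^ 2 * sm (g i) t z))‖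
      ≤ ∑ i : Ix, 14 / 5 * a * η := by
    refine norm_sum_le_of_le _ fun i _ => ?_
    have h1 := (W.aw i).zb W.hJ hn ht st87 hz
    have h2 := (W.aw i).sm.zz W.hJ hn ht st87 hz
    rw [W.fr.nk] at h1
    rw [norm_neg, W.fr.nk] at h2
    have h3 : ‖(1 / (n ^ 2 * κ i) : ℂ)‖ = 2 / 5 / n ^ 2 := by
      rw [← W.norm_coef i, norm_div, norm_div, norm_mul, norm_mul, Complex.norm_conj]
    refine (norm_sub_le _ _).trans ?_
    rw [norm_mul, norm_mul, h3, W.norm_coef]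
    calc _ ≤ 2 / 5 / n ^ 2 * ((1 + 5 / 2) * a * n ^ 2 * η)
          + 2 / 5 / n ^ 2 * ((1 + 5 / 2) * a * n ^ 2 * η) := by gcongr
      _ = _ := by field_simp; ring
  rw [Finset.sum_const, Finset.card_univ, card_Ix] at hb
  have := mul_nonneg W.ha W.hη
  simp only [nsmul_eq_mul] at hb
  push_cast at hb
  linarith

theorem Cell.dbw_om (ht : t ∈ J) (hz : z ∈ Strip (7 / n)) :
    ‖db (pot (pert n κ g)) t z - sm (om κ g) t z‖ ≤ 9 * a * η := by
  have h := W.dzw_om ht (st_mem hz)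
  rw [← Complex.norm_conj, map_sub] at h
  rwa [db_eq_sm, sm_pot]

theorem Cell.norm_om (ht : t ∈ J) (hz : z ∈ Strip (8 / n)) : ‖om κ g t z‖ ≤ 15 * a := by
  unfold om
  simp only [Pi.smul_apply, Finset.sum_apply, smul_eq_mul]
  rw [norm_mul]
  have hb : ‖∑ α, Kv κ α * Gv g α t z‖ ≤ ∑ α : Ix × Bool, 5 / 2 * a := by
    refine norm_sum_le_of_le _ fun α _ => ?_
    rw [norm_mul, W.fr.nK]
    exact mul_le_mul_of_nonneg_left ((W.pbG α).bd t ht z hz) (by norm_num)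
  rw [Finset.sum_const, Finset.card_univ] at hb
  have e : Fintype.card (Ix × Bool) = 12 := rfl
  rw [e, nsmul_eq_mul] at hb
  have e2 : ‖Complex.I / 2‖ = 1 / 2 := by simp
  rw [e2]
  push_cast at hb
  linarith

theorem Cell.norm_sm_om (ht : t ∈ J) (hz : z ∈ Strip (8 / n)) : ‖sm (om κ g) t z‖ ≤ 15 * a := by
  rw [QG.sm, Complex.norm_conj]; exact W.norm_om ht (st_mem hz)

/-- Cancellation of the non-resonant part of the square of the velocity. -/
theorem Cell.quad (ht : t ∈ J) (hz : z ∈ Strip (7 / n)) :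
    ‖om κ g t z ^ 2 + dz (dz (prs2 n κ g)) t z - 1 / 2 * ∑ i, κ i ^ 2 * (g i t z * sm (g i) t z)‖
      ≤ 10800 * a ^ 2 * η := by
  have hn := W.hn
  have ha := W.ha
  have hη := W.hη
  have hz8 : z ∈ Strip (8 / n) := strip_mono (by gcongr; norm_num) hz
  have hn0 : (n : ℂ) ≠ 0 := by exact_mod_cast hn.ne'
  have hR : ∀ p : (Ix × Bool) × (Ix × Bool), Rg J (8 / n) (Gv g p.1 * Gv g p.2) := fun p =>
    (W.awG p.1).reg.mul (W.awG p.2).reg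
  have e1 : dz (dz (prs2 n κ g)) t z =
      ∑ p, 1 / n ^ 2 * (cc κ p * dz (dz (Gv g p.1 * Gv g p.2)) t z) := by
    unfold prs2
    rw [(Rg.sum fun p _ => (hR p).smul (cc κ p)).dz_dz_smul W.hJ _ ht hz8,
      dz_dz_lin W.hJ (fun p _ => hR p) ht hz8, Finset.mul_sum]
  have e2 : om κ g t z ^ 2 = ∑ p : (Ix × Bool) × (Ix × Bool),
      -(1 / 4) * (Kv κ p.1 * Kv κ p.2) * (Gv g p.1 t z * Gv g p.2 t z) := by
    unfold om
    simp only [Pi.smul_apply, Finset.sum_apply, smul_eq_mul]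
    rw [mul_pow, sq (∑ α, Kv κ α * Gv g α t z), Finset.sum_mul_sum, Finset.mul_sum,
      Fintype.sum_prod_type fun p : (Ix × Bool) × (Ix × Bool) =>
        -(1 / 4) * (Kv κ p.1 * Kv κ p.2) * (Gv g p.1 t z * Gv g p.2 t z)]
    refine Finset.sum_congr rfl fun α _ => ?_
    rw [Finset.mul_sum]
    refine Finset.sum_congr rfl fun β _ => ?_
    linear_combination (1 / 4 * (Kv κ α * Gv g α t z * (Kv κ β * Gv g β t z))) * Complex.I_sq
  have e3 : ∑ α, -(1 / 4) * (Kv κ α * Kv κ (op α)) * (Gv g α t z * Gv g (op α) t z)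
      = 1 / 2 * ∑ i, κ i ^ 2 * (g i t z * sm (g i) t z) := by
    rw [sum_signed, Finset.mul_sum]
    refine Finset.sum_congr rfl fun i _ => ?_
    simp [Kv, Gv, op]
    ring
  rw [e2, e1, sum_split fun p : (Ix × Bool) × (Ix × Bool) =>
    -(1 / 4) * (Kv κ p.1 * Kv κ p.2) * (Gv g p.1 t z * Gv g p.2 t z)]
  simp only []
  rw [e3, add_assoc, add_sub_cancel_left, ← Finset.sum_add_distrib]
  have hb : ‖∑ p : (Ix × Bool) × (Ix × Bool), ((if p.2 = op p.1 then 0 else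
      -(1 / 4) * (Kv κ p.1 * Kv κ p.2) * (Gv g p.1 t z * Gv g p.2 t z))
      + 1 / n ^ 2 * (cc κ p * dz (dz (Gv g p.1 * Gv g p.2)) t z))‖
      ≤ ∑ p : (Ix × Bool) × (Ix × Bool), 75 * a ^ 2 * η := by
    refine norm_sum_le_of_le _ fun p _ => ?_
    by_cases hp : p.2 = op p.1
    · simp only [hp, if_true, cc]
      simp
      positivity
    · simp only [hp, if_false]
      have h1 : Kv κ p.1 + Kv κ p.2 ≠ 0 := fun h0 => by
        have := W.fr.gap p.1 p.2 hp
        rw [h0] at this; simp at this; linarith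
      have e4 : -(1 / 4) * (Kv κ p.1 * Kv κ p.2) * (Gv g p.1 t z * Gv g p.2 t z)
          = 1 / n ^ 2 * (cc κ p * (n ^ 2 * (Kv κ p.1 + Kv κ p.2) ^ 2
            * (Gv g p.1 * Gv g p.2) t z)) := by
        simp only [cc, hp, if_false, Pi.mul_apply]
        field_simp
      rw [e4, ← mul_add, ← mul_add, norm_mul, norm_mul]
      have h2 := ((W.awG p.1).mul (W.awG p.2) ha ha).zz W.hJ hn ht st87 hz
      have h3 := W.fr.norm_cc p
      have h4 : ‖Kv κ p.1 + Kv κ p.2‖ ≤ 5 :=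
        (norm_add_le _ _).trans (by rw [W.fr.nK, W.fr.nK]; norm_num)
      have e5 : ‖(1 / n ^ 2 : ℂ)‖ = 1 / n ^ 2 := by simp
      rw [e5, add_comm (_ * _)]
      calc _ ≤ 1 / n ^ 2 * (25 / 4 * ((1 + 5) * (2 * a * a) * n ^ 2 * η)) := by
            gcongr
            refine h2.trans ?_
            gcongr
        _ = _ := by field_simp; ring
  rw [Finset.sum_const, Finset.card_univ, card_pairs, nsmul_eq_mul] at hb
  push_cast at hb
  linarith

theorem Cell.norm_quad (ht : t ∈ J) (hz : z ∈ Strip (6 / n)) :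
    ‖dz (pot (pert n κ g)) t z ^ 2 + dz (dz (prs2 n κ g)) t z
      - 1 / 2 * ∑ i, κ i ^ 2 * (g i t z * sm (g i) t z)‖ ≤ 12000 * a ^ 2 * η := by
  have hn := W.hn
  have ha := W.ha
  have hη := W.hη
  have hz7 : z ∈ Strip (7 / n) := strip_mono (by gcongr; norm_num) hz
  have hz8 : z ∈ Strip (8 / n) := strip_mono (by gcongr; norm_num) hz
  have h1 := W.quad ht hz7
  have h2 := W.dzw_om ht hz7
  have h3 := W.norm_om ht hz8
  have h4 := W.pb_dzw.bd t ht z hz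
  calc _ = ‖(om κ g t z ^ 2 + dz (dz (prs2 n κ g)) t z
          - 1 / 2 * ∑ i, κ i ^ 2 * (g i t z * sm (g i) t z))
        + (dz (pot (pert n κ g)) t z - om κ g t z) * (dz (pot (pert n κ g)) t z + om κ g t z)‖ := by
        congr 1; ring
    _ ≤ 10800 * a ^ 2 * η + 9 * a * η * (75 * a + 15 * a) := by
        refine (norm_add_le _ _).trans (add_le_add h1 ?_)
        rw [norm_mul]
        exact mul_le_mul h2 ((norm_add_le _ _).trans (add_le_add h4 h3)) (norm_nonneg _)
          (by positivity)
    _ = 11610 * (a ^ 2 * η) := by ring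
    _ ≤ 12000 * (a ^ 2 * η) := by gcongr; norm_num
    _ = _ := by ring

/-- Energy of the principal part. -/
theorem Cell.av_om (ht : t ∈ J) :
    ‖av (om κ g * sm (om κ g)) t - 25 / 8 * ∑ i, av (g i * sm (g i)) t‖
      ≤ 8 * π ^ 3 * (900 * a ^ 2 * η) := by
  have hn := W.hn
  have ha := W.ha
  have hη := W.hη
  have hr : 0 < 8 / n := by positivity
  have hR : ∀ p : (Ix × Bool) × (Ix × Bool), Rg J (8 / n) (Gv g p.1 * Gv g p.2) := fun p =>
    (W.awG p.1).reg.mul (W.awG p.2).reg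
  have e2 : om κ g * sm (om κ g) = ∑ p : (Ix × Bool) × (Ix × Bool),
      (-(1 / 4) * (Kv κ p.1 * conj (Kv κ p.2))) • (Gv g p.1 * Gv g p.2) := by
    rw [sm_om]
    unfold om
    ext t z
    simp only [Pi.smul_apply, Finset.sum_apply, smul_eq_mul, Pi.mul_apply]
    rw [mul_mul_mul_comm, Finset.sum_mul_sum, Finset.mul_sum,
      Fintype.sum_prod_type fun p : (Ix × Bool) × (Ix × Bool) =>
        -(1 / 4) * (Kv κ p.1 * conj (Kv κ p.2)) * (Gv g p.1 t z * Gv g p.2 t z)]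
    refine Finset.sum_congr rfl fun α _ => ?_
    rw [Finset.mul_sum]
    refine Finset.sum_congr rfl fun β _ => ?_
    linear_combination (1 / 4 * (Kv κ α * Gv g α t z * (conj (Kv κ β) * Gv g β t z))) * Complex.I_sq
  have e4 : av (om κ g * sm (om κ g)) t = ∑ p : (Ix × Bool) × (Ix × Bool),
      -(1 / 4) * (Kv κ p.1 * conj (Kv κ p.2)) * av (Gv g p.1 * Gv g p.2) t := by
    rw [e2, av_sum hr (fun p _ => (hR p).smul _) ht]
    exact Finset.sum_congr rfl fun p _ => av_smul _
  have e3 : ∑ α, -(1 / 4) * (Kv κ α * conj (Kv κ (op α))) * av (Gv g α * Gv g (op α)) t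
      = 25 / 8 * ∑ i, av (g i * sm (g i)) t := by
    rw [sum_signed, Finset.mul_sum]
    refine Finset.sum_congr rfl fun i _ => ?_
    have := W.fr.mul_conj (i, true)
    simp only [Kv, if_true] at this
    simp only [Kv, Gv, op, Bool.not_true, Bool.not_false, if_true, Bool.false_eq_true, if_false,
      map_neg, mul_comm (sm (g i))]
    linear_combination (1 / 2 * av (g i * sm (g i)) t) * this
  rw [e4, sum_split fun p : (Ix × Bool) × (Ix × Bool) =>
    -(1 / 4) * (Kv κ p.1 * conj (Kv κ p.2)) * av (Gv g p.1 * Gv g p.2) t]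
  simp only []
  rw [e3, add_sub_cancel_left]
  have hb : ‖∑ p : (Ix × Bool) × (Ix × Bool), (if p.2 = op p.1 then 0 else
      -(1 / 4) * (Kv κ p.1 * conj (Kv κ p.2)) * av (Gv g p.1 * Gv g p.2) t)‖
      ≤ ∑ p : (Ix × Bool) × (Ix × Bool), 8 * π ^ 3 * (25 / 4 * a ^ 2 * η) := by
    refine norm_sum_le_of_le _ fun p _ => ?_
    split_ifs with hp
    · simp; positivity
    · have h1 := ((W.awG p.1).mul (W.awG p.2) ha ha).norm_av_le W.hJ hr hn ht
      have h2 := W.fr.gap p.1 p.2 hp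
      rw [norm_mul, norm_mul, norm_mul, Complex.norm_conj, W.fr.nK, W.fr.nK]
      have e : ‖(-(1 / 4) : ℂ)‖ = 1 / 4 := by simp
      rw [e]
      have h3 := norm_nonneg (av (Gv g p.1 * Gv g p.2) t)
      have h4 : 1 / 2 * ‖av (Gv g p.1 * Gv g p.2) t‖ ≤ 8 * π ^ 3 * (2 * a * a * η) :=
        (mul_le_mul_of_nonneg_right h2 h3).trans h1
      calc _ = 25 / 8 * (1 / 2 * ‖av (Gv g p.1 * Gv g p.2) t‖) := by ring
        _ ≤ 25 / 8 * (8 * π ^ 3 * (2 * a * a * η)) := by gcongr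
        _ = _ := by ring
  rw [Finset.sum_const, Finset.card_univ, card_pairs, nsmul_eq_mul] at hb
  push_cast at hb
  linarith

end

end

section

variable {J : Set ℝ} {r s : ℝ} {F G : ℝ → E → ℂ} {t : ℝ} {z : E} {ψ : ℝ → E → ℂ}
variable {L T M N n η a : ℝ} {f : ℝ → E → ℂ}

/-- The new stress. -/
def newS (ψ S : ℝ → E → ℂ) (n : ℝ) (κ : Ix → ℂ) (g : Ix → ℝ → E → ℂ) : ℝ → E → ℂ :=
  (S + dz (pot (pert n κ g)) * dz (pot (pert n κ g)) + dz (dz (prs2 n κ g)))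
    + lin ψ (pert n κ g)

/-- Density of the energy increment. -/
def incr (ψ w : ℝ → E → ℂ) : ℝ → E → ℂ := dz w * db w - (2 : ℂ) • (w * dz (db ψ))

theorem R1.Dt_add_stream {w : ℝ → E → ℂ} (hψ : R1 J r ψ) (hw : R1 J r w) (ht : t ∈ J)
    (hz : z ∈ Strip r) : QG.Dt (ψ + w) F t z =
      QG.Dt ψ F t z - 2 * Complex.I * (QG.dz w t z * QG.db F t z - QG.db w t z * QG.dz F t z) := by
  rw [Dt_apply, Dt_apply, hψ.toRg.dz_add hw.toRg ht hz, hψ.toRg.db_add hw.toRg ht hz]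
  ring

/-- Bounds for the transport derivative along the new flow. -/
theorem norm_Dt_add_stream {w : ℝ → E → ℂ} {B X₀ X₁ : ℝ} (hψ : R1 J r ψ) (hw : R1 J r w)
    (hF : Rg J r F) (hn : 0 < n) (hs : s + 1 / n ≤ r)
    (hwz : ∀ t ∈ J, ∀ z ∈ Strip r, ‖dz w t z‖ ≤ B) (hwb : ∀ t ∈ J, ∀ z ∈ Strip r, ‖db w t z‖ ≤ B)
    (hX : ∀ t ∈ J, ∀ z ∈ Strip r, ‖F t z‖ ≤ X₀)
    (hX₁ : ∀ t ∈ J, ∀ z ∈ Strip r, ‖Dt ψ F t z‖ ≤ X₁) (ht : t ∈ J) (hz : z ∈ Strip s) :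
    ‖Dt (ψ + w) F t z‖ ≤ X₁ + 4 * B * n * X₀ := by
  have hn' : (0 : ℝ) < 1 / n := by positivity
  have hz' : z ∈ Strip r := strip_mono (by linarith) hz
  have hz'' : z ∈ Strip (r - 1 / n) := strip_mono (by linarith) hz
  have h1 := hF.norm_dz_le ht hn' (hX t ht) hz''
  have h2 := hF.norm_db_le ht hn' (hX t ht) hz''
  have e : X₀ / (1 / n) = n * X₀ := by field_simp
  rw [e] at h1 h2
  have hB : 0 ≤ B := (norm_nonneg _).trans (hwz t ht z hz')
  rw [hψ.Dt_add_stream hw ht hz']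
  refine (norm_sub_le _ _).trans ?_
  have e2 : ‖(2 * Complex.I : ℂ)‖ = 2 := by simp
  rw [norm_mul, e2]
  have h3 : ‖dz w t z * db F t z - db w t z * dz F t z‖ ≤ B * (n * X₀) + B * (n * X₀) := by
    refine (norm_sub_le _ _).trans ?_
    rw [norm_mul, norm_mul]
    exact add_le_add (mul_le_mul (hwz t ht z hz') h2 (norm_nonneg _) hB)
      (mul_le_mul (hwb t ht z hz') h1 (norm_nonneg _) hB)
  linarith [hX₁ t ht z hz']

theorem newS_eq {κ : Ix → ℂ} {g : Ix → ℝ → E → ℂ} {F H S : ℝ → E → ℂ} (W : Cell ψ J n η L T a κ g)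
    (hF : R1 J (8 / n) F) (hH : Rg J (8 / n) H) (ht : t ∈ J) (hz : z ∈ Strip (7 / n))
    (hS : S t z = dz ψ t z ^ 2 + 1 / 2 * dz (dt F) t z + dz (dz H) t z) :
    newS ψ S n κ g t z = dz (ψ + pot (pert n κ g)) t z ^ 2
      + 1 / 2 * dz (dt (F + pert n κ g)) t z
      + dz (dz (H + (prs ψ (pert n κ g) + prs2 n κ g))) t z := by
  have hn := W.hn
  have hle : 7 / n ≤ 8 / n := by gcongr; norm_num
  have hz8 : z ∈ Strip (8 / n) := strip_mono hle hz
  have hf := W.pb_pert.reg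
  have hψ := W.env.reg
  have hp : Rg J (8 / n) (prs ψ (pert n κ g)) :=
    (((hψ.toRg.db W.hJ).mul hf.toRg).sub ((hψ.toRg.dz W.hJ).mul hf.toRg.sm)).smul _
  have hp2 := W.pb_prs2.reg.toRg
  rw [hψ.toRg.mono hle |>.dz_add W.pb_w.reg.toRg ht hz, hH.dz_dz_add W.hJ (hp.add hp2) ht hz8,
    hp.dz_dz_add W.hJ hp2 ht hz8,
    dz_congr (F := dt (F + pert n κ g)) (G := dt F + dt (pert n κ g))
      (fun w hw => hF.dt_add hf ht hw) hz8, hF.dt.dz_add hf.dt ht hz8]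
  simp only [newS, Pi.add_apply, Pi.mul_apply, hS, ← lin_eq W.hJ hψ hf ht hz8]
  ring

section
variable {κ : Ix → ℂ} {g : Ix → ℝ → E → ℂ} (W : Cell ψ J n η L T a κ g)
include W

theorem Cell.pb_lin : PB ψ T J (7 / n) (200 * a * T / n) (lin ψ (pert n κ g)) :=
  PB.lin W.hJ W.hn W.env W.hL W.hLT W.ha W.pb_pert W.Dt_pert

theorem Cell.pb_newS {S : ℝ → E → ℂ} (hS : PB ψ T J (8 / n) (a ^ 2) S) :
    PB ψ T J (6 / n) (60000 * a ^ 2 + 200 * a * T / n) (newS ψ S n κ g) := by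
  have hn := W.hn
  have ha := W.ha
  have h8 : 6 / n ≤ 8 / n := by gcongr; norm_num
  have h7 : 6 / n ≤ 7 / n := by gcongr; norm_num
  refine ((((hS.mono h8).add W.hJ (W.pb_dzw.mul W.hJ W.pb_dzw (by positivity) (by positivity)
    W.hT)).add W.hJ W.pb_dzz_prs2).add W.hJ (W.pb_lin.mono h7)).le W.hT ?_
  have := sq_nonneg a
  linarith

theorem Cell.norm_newS {S : ℝ → E → ℂ} {E₁ : ℝ} (ht : t ∈ J) (hz : z ∈ Strip (6 / n))
    (hE : ‖S t z + 1 / 2 * ∑ i, κ i ^ 2 * (g i t z * sm (g i) t z)‖ ≤ E₁) :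
    ‖newS ψ S n κ g t z‖ ≤ E₁ + 12000 * a ^ 2 * η + 200 * a * T / n := by
  have hn := W.hn
  have h7 : 6 / n ≤ 7 / n := by gcongr; norm_num
  have h1 := W.norm_quad ht hz
  have h2 := W.pb_lin.bd t ht z (strip_mono h7 hz)
  have e : newS ψ S n κ g t z = (S t z + 1 / 2 * ∑ i, κ i ^ 2 * (g i t z * sm (g i) t z))
      + (dz (pot (pert n κ g)) t z ^ 2 + dz (dz (prs2 n κ g)) t z
      - 1 / 2 * ∑ i, κ i ^ 2 * (g i t z * sm (g i) t z)) + lin ψ (pert n κ g) t z := by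
    simp only [newS, Pi.add_apply, Pi.mul_apply]; ring
  rw [e]
  exact (norm_add_le _ _).trans (add_le_add ((norm_add_le _ _).trans (add_le_add hE h1)) h2)

theorem Cell.norm_Dt_newS {S : ℝ → E → ℂ} {s₀ : ℝ} (hS : PB ψ T J (8 / n) (a ^ 2) S)
    (hs₀ : ∀ t ∈ J, ∀ z ∈ Strip (6 / n), ‖newS ψ S n κ g t z‖ ≤ s₀) (ht : t ∈ J)
    (hz : z ∈ Strip (5 / n)) : ‖Dt (ψ + pot (pert n κ g)) (newS ψ S n κ g) t z‖ ≤
      (60000 * a ^ 2 + 200 * a * T / n) * T + 300 * a * n * s₀ := by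
  have hn := W.hn
  have h8 : 6 / n ≤ 8 / n := by gcongr; norm_num
  have h7 : 6 / n ≤ 7 / n := by gcongr; norm_num
  have h := W.pb_newS hS
  refine (norm_Dt_add_stream (W.env.reg.mono h8) (W.pb_w.reg.mono h7) h.reg.toRg hn st65
    W.pb_dzw.bd W.pb_dbw.bd hs₀ h.dbd ht hz).trans (le_of_eq (by ring))

theorem Cell.new_real : sm (ψ + pot (pert n κ g)) = ψ + pot (pert n κ g) := by
  rw [sm_add, sm_pot, W.env.real]

theorem Cell.new_second {X Y : ℝ → E → ℂ} {L' : ℝ} (hX : PB ψ L J (5 / n) L X)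
    (hY : PB ψ T J (5 / n) (375 * a * n) Y) (h1 : L + 375 * a * n ≤ L')
    (h2 : L ^ 2 + 375 * a * n * T + 300 * a * n * (L + 375 * a * n) ≤ L' ^ 2)
    (hG : ∀ t ∈ J, ∀ z ∈ Strip (4 / n), G t z = (X + Y) t z) :
    PB (ψ + pot (pert n κ g)) L' J (4 / n) L' G := by
  have hn := W.hn
  have h8 : 5 / n ≤ 8 / n := by gcongr; norm_num
  have h7 : 5 / n ≤ 7 / n := by gcongr; norm_num
  have h6 : 5 / n ≤ 6 / n := by gcongr; norm_num
  have h45 : 4 / n ≤ 5 / n := by gcongr; norm_num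
  have hst : 4 / n + 1 / n ≤ 5 / n := by rw [← add_div]; norm_num
  have b : ∀ t ∈ J, ∀ z ∈ Strip (5 / n), ‖(X + Y) t z‖ ≤ L + 375 * a * n := fun t ht z hz =>
    (norm_add_le _ _).trans (add_le_add (hX.bd t ht z hz) (hY.bd t ht z hz))
  have c : ∀ t ∈ J, ∀ z ∈ Strip (5 / n), ‖Dt ψ (X + Y) t z‖ ≤ L * L + 375 * a * n * T :=
    fun t ht z hz => by
    rw [hX.reg.Dt_add hY.reg ht hz]
    exact (norm_add_le _ _).trans (add_le_add (hX.dbd t ht z hz) (hY.dbd t ht z hz))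
  have hXY := hX.reg.add W.hJ hY.reg
  refine PB.congr W.hJ (F := X + Y) ⟨hXY.mono h45, fun t ht z hz =>
    (b t ht z (strip_mono h45 hz)).trans h1, fun t ht z hz => ?_⟩ hG
  refine (norm_Dt_add_stream (W.env.reg.mono h8) (W.pb_w.reg.mono h7) hXY.toRg hn hst
    (W.pb_dzw.mono h6).bd (W.pb_dbw.mono h6).bd b c ht hz).trans ?_
  linarith

theorem Cell.new_env {L' : ℝ} (h1 : L + 375 * a * n ≤ L')
    (h2 : L ^ 2 + 375 * a * n * T + 300 * a * n * (L + 375 * a * n) ≤ L' ^ 2) :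
    Env2 (ψ + pot (pert n κ g)) J (4 / n) L' := by
  have hn := W.hn
  have h8 : 4 / n ≤ 8 / n := by gcongr; norm_num
  have h7 : 4 / n ≤ 7 / n := by gcongr; norm_num
  have h58 : 5 / n ≤ 8 / n := by gcongr; norm_num
  have h47 := W.pb_w.reg.mono h7
  have h48 := W.env.reg.mono h8
  have hJ := W.hJ
  refine ⟨h48.add hJ h47, W.new_real,
    W.new_second (W.env.zz.mono h58) W.pb_dzzw h1 h2 fun t ht z hz => ?_,
    W.new_second (W.env.zb.mono h58) W.pb_dzbw h1 h2 fun t ht z hz => ?_,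
    W.new_second (W.env.bb.mono h58) W.pb_dbbw h1 h2 fun t ht z hz => ?_⟩
  · exact h48.toRg.dz_dz_add hJ h47.toRg ht hz
  · rw [dz_congr (F := db (ψ + pot (pert n κ g))) (G := db ψ + db (pot (pert n κ g)))
      (fun w hw => h48.toRg.db_add h47.toRg ht hw) hz,
      (h48.toRg.db hJ).dz_add (h47.toRg.db hJ) ht hz]; rfl
  · rw [db_congr (F := db (ψ + pot (pert n κ g))) (G := db ψ + db (pot (pert n κ g)))
      (fun w hw => h48.toRg.db_add h47.toRg ht hw) hz,
      (h48.toRg.db hJ).db_add (h47.toRg.db hJ) ht hz]; rfl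

theorem Cell.pb_incr : PB ψ T J (6 / n) (11250 * a ^ 2 + 60 * a * L / n)
    (incr ψ (pot (pert n κ g))) := by
  have hn := W.hn
  have ha := W.ha
  have h8 : 6 / n ≤ 8 / n := by gcongr; norm_num
  have h7 : 6 / n ≤ 7 / n := by gcongr; norm_num
  refine ((W.pb_dzw.mul W.hJ W.pb_dbw (by positivity) (by positivity) W.hT).sub W.hJ
    (((W.pb_w.mono h7).mul W.hJ ((W.env.zb.mono h8).of_le W.hLT W.hL) (by positivity) W.hL
      W.hT).smul W.hJ 2)).le W.hT (le_of_eq ?_)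
  have e : ‖(2 : ℂ)‖ = 2 := by simp
  rw [e]; ring

/-- The energy increment. -/
theorem Cell.av_incr_eq (ht : t ∈ J) :
    av (dz (ψ + pot (pert n κ g)) * db (ψ + pot (pert n κ g))) t
      = av (dz ψ * db ψ) t + av (incr ψ (pot (pert n κ g))) t := by
  have hn := W.hn
  have hJ := W.hJ
  have hr : 0 < 7 / n := by positivity
  have h8 : 7 / n ≤ 8 / n := by gcongr; norm_num
  have hψ := (W.env.reg.mono h8).toRg
  have hw := W.pb_w.reg.toRg
  set w := pot (pert n κ g)
  have a1 := hψ.dz hJ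
  have a2 := hψ.db hJ
  have b1 := hw.dz hJ
  have b2 := hw.db hJ
  have c2 := a2.dz hJ
  have e1 := (av_dz hJ hr (a1.mul hw) ht).2
  have e2 := (av_dz hJ hr (a2.mul hw) ht).1
  have f1 : av (db (dz ψ * w)) t = av (dz (db ψ) * w + dz ψ * db w) t := av_congr fun x => by
    have hz := emb_mem hr x
    rw [a1.db_mul hw ht hz, hψ.dz_db hJ ht hz]; rfl
  have f2 : av (dz (db ψ * w)) t = av (dz (db ψ) * w + db ψ * dz w) t := av_congr fun x => by
    have hz := emb_mem hr x
    rw [a2.dz_mul hw ht hz]; rfl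
  have f3 : av (dz (ψ + w) * db (ψ + w)) t
      = av ((dz ψ * db ψ + dz ψ * db w) + (db ψ * dz w + dz w * db w)) t := av_congr fun x => by
    have hz := emb_mem hr x
    simp only [Pi.add_apply, Pi.mul_apply]
    rw [hψ.dz_add hw ht hz, hψ.db_add hw ht hz]; ring
  have f4 : av (incr ψ w) t = av (dz w * db w) t - 2 * av (dz (db ψ) * w) t := by
    unfold incr
    rw [av_sub hr (b1.mul b2) ((hw.mul c2).smul _) ht, av_smul, mul_comm w]
  rw [f1, av_add hr (c2.mul hw) (a1.mul b2) ht] at e1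
  rw [f2, av_add hr (c2.mul hw) (a2.mul b1) ht] at e2
  rw [f3, f4, av_add hr ((a1.mul a2).add (a1.mul b2)) ((a2.mul b1).add (b1.mul b2)) ht,
    av_add hr (a1.mul a2) (a1.mul b2) ht, av_add hr (a2.mul b1) (b1.mul b2) ht]
  linear_combination e1 + e2

theorem Cell.av_incr (ht : t ∈ J) :
    ‖av (incr ψ (pot (pert n κ g))) t - 25 / 8 * ∑ i, av (g i * sm (g i)) t‖
      ≤ 8 * π ^ 3 * (1710 * a ^ 2 * η + 30 * a * L / n) := by
  have hn := W.hn
  have ha := W.ha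
  have hη := W.hη
  have hr : 0 < 6 / n := by positivity
  have h8 : 6 / n ≤ 8 / n := by gcongr; norm_num
  have h7 : 6 / n ≤ 7 / n := by gcongr; norm_num
  have hom : Rg J (6 / n) (om κ g) :=
    ((Rg.sum fun α _ => (W.awG α).reg.smul _).smul _).mono h8
  have h1 := W.av_om ht
  have h2 : ‖av (incr ψ (pot (pert n κ g)) - om κ g * sm (om κ g)) t‖
      ≤ 8 * π ^ 3 * (810 * a ^ 2 * η + 30 * a * L / n) := by
    refine norm_av_le fun x => ?_
    have hz := emb_mem hr x
    have hz7 := strip_mono h7 hz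
    have hz8 := strip_mono h8 hz
    have i1 := W.dzw_om ht hz7
    have i2 := W.dbw_om ht hz7
    have i3 := W.norm_sm_om ht hz8
    have i4 := W.pb_dzw.bd t ht _ hz
    have i5 := W.pb_w.bd t ht _ hz7
    have i6 := W.env.zb.bd t ht _ hz8
    set w := pot (pert n κ g)
    set o := om κ g
    set x' := emb x
    calc _ = ‖dz w t x' * (db w t x' - sm o t x') + (dz w t x' - o t x') * sm o t x'
          - 2 * (w t x' * dz (db ψ) t x')‖ := by
          congr 1
          simp only [incr, Pi.sub_apply, Pi.mul_apply, Pi.smul_apply, smul_eq_mul]; ring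
      _ ≤ 75 * a * (9 * a * η) + 9 * a * η * (15 * a) + 2 * (15 * a / n * L) := by
          refine (norm_sub_le _ _).trans (add_le_add ((norm_add_le _ _).trans (add_le_add ?_ ?_)) ?_)
          · rw [norm_mul]; exact mul_le_mul i4 i2 (norm_nonneg _) (by positivity)
          · rw [norm_mul]; exact mul_le_mul i1 i3 (norm_nonneg _) (by positivity)
          · have e : ‖(2 : ℂ)‖ = 2 := by simp
            rw [norm_mul, norm_mul, e]
            exact mul_le_mul_of_nonneg_left (mul_le_mul i5 i6 (norm_nonneg _) (by positivity))
              (by norm_num)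
      _ = _ := by ring
  rw [av_sub hr W.pb_incr.reg.toRg (hom.mul hom.sm) ht] at h2
  calc _ = ‖(av (incr ψ (pot (pert n κ g))) t - av (om κ g * sm (om κ g)) t)
        + (av (om κ g * sm (om κ g)) t - 25 / 8 * ∑ i, av (g i * sm (g i)) t)‖ := by
        congr 1; ring
    _ ≤ _ := (norm_add_le _ _).trans (add_le_add h2 h1)
    _ = _ := by ring

theorem Cell.deriv_incr (ht : t ∈ J) : ∃ d : ℂ,
    HasDerivAt (av (incr ψ (pot (pert n κ g)))) d t
      ∧ ‖d‖ ≤ 8 * π ^ 3 * ((11250 * a ^ 2 + 60 * a * L / n) * T) := by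
  have hn := W.hn
  have hr : 0 < 6 / n := by positivity
  have h8 : 6 / n ≤ 8 / n := by gcongr; norm_num
  have h := W.pb_incr
  refine ⟨_, hasDerivAt_av W.hJ hr h.reg ht, ?_⟩
  rw [← av_Dt W.hJ hr (W.env.reg.mono h8) h.reg ht]
  exact norm_av_le fun x => h.dbd t ht _ (emb_mem hr x)

end

end

section

variable {J : Set ℝ} {r s : ℝ} {F G : ℝ → E → ℂ} {t : ℝ} {z : E} {ψ : ℝ → E → ℂ}
variable {L T M N n η a : ℝ} {f : ℝ → E → ℂ}

/-- Doubled integer coordinates of the six directions. -/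
def kp (i : Ix) : ℤ × ℤ :=
  if i.1 then ![(0, -5), (-4, -3), (4, -3)] i.2 else ![(5, 0), (3, -4), (3, 4)] i.2

/-- The six directions. -/
def kap (i : Ix) : ℂ := ((kp i).1 + (kp i).2 * Complex.I) / 2

/-- Weights of the directions. -/
def cw (i : Ix) : ℝ := ![7 / 32, 25 / 64, 25 / 64] i.2

/-- Stress coefficients of the directions. -/
def mw (i : Ix) : ℂ :=
  (if i.1 then -1 else 1) * ![-1 / 8, 1 / 16 - Complex.I / 12, 1 / 16 + Complex.I / 12] i.2

theorem norm_half_int (p q : ℤ) : ‖((p : ℂ) + q * Complex.I) / 2‖ = √(p ^ 2 + q ^ 2) / 2 := by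
  rw [norm_div, Complex.norm_ofNat]
  have := Complex.norm_add_mul_I (p : ℝ) (q : ℝ)
  push_cast at this
  rw [this]

theorem kp_sq : ∀ i : Ix, (kp i).1 ^ 2 + (kp i).2 ^ 2 = 25 := by decide

theorem kp_gap : ∀ i j : Ix, (i ≠ j → (kp i).1 ≠ (kp j).1 ∨ (kp i).2 ≠ (kp j).2) ∧
    ((kp i).1 + (kp j).1 ≠ 0 ∨ (kp i).2 + (kp j).2 ≠ 0) := by decide

theorem half_le_norm_int {p q : ℤ} (h : p ≠ 0 ∨ q ≠ 0) :
    1 / 2 ≤ ‖((p : ℂ) + q * Complex.I) / 2‖ := by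
  rw [norm_half_int]
  have h1 : (1 : ℝ) ≤ p ^ 2 + q ^ 2 := by
    have : 1 ≤ p ^ 2 + q ^ 2 := by
      rcases h with h | h
      · nlinarith [sq_nonneg q, Int.one_le_abs h, sq_abs p]
      · nlinarith [sq_nonneg p, Int.one_le_abs h, sq_abs q]
    exact_mod_cast this
  have := Real.one_le_sqrt.2 h1
  linarith

theorem freq_kap : Freq kap where
  nk i := by
    rw [kap, norm_half_int]
    have h : (((kp i).1 : ℝ) ^ 2 + ((kp i).2 : ℝ) ^ 2) = 5 ^ 2 := by
      have := kp_sq i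
      have h2 : (((kp i).1 ^ 2 + (kp i).2 ^ 2 : ℤ) : ℝ) = ((25 : ℤ) : ℝ) := by rw [this]
      push_cast at h2
      rw [h2]; norm_num
    rw [h, Real.sqrt_sq (by norm_num)]
  gap α β h := by
    obtain ⟨i, u⟩ := α
    obtain ⟨j, v⟩ := β
    have key : ∀ u' v' : ℤ, ((u' * (kp i).1 + v' * (kp j).1 : ℤ) ≠ 0 ∨
        (u' * (kp i).2 + v' * (kp j).2 : ℤ) ≠ 0) →
        1 / 2 ≤ ‖(u' : ℂ) * kap i + v' * kap j‖ := fun u' v' h => by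
      have h1 := half_le_norm_int h
      convert! h1 using 2
      simp only [kap]; push_cast; ring
    have h1 := (kp_gap i j).2
    have h2 := (kp_gap i j).1
    cases u <;> cases v
    · simpa [Kv] using key (-1) (-1) (by omega)
    · have hij : i ≠ j := fun h' => h (by simp [op, h'])
      simpa [Kv] using key (-1) 1 (by have := h2 hij; omega)
    · have hij : i ≠ j := fun h' => h (by simp [op, h'])
      simpa [Kv] using key 1 (-1) (by have := h2 hij; omega)
    · simpa [Kv] using key 1 1 (by omega)

theorem dir_kap (i : Ix) : Dir (kap i) (cw i) (mw i) where
  nk := freq_kap.nk i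
  int := ⟨(kp i).1, (kp i).2, by simp only [kap]; ring⟩
  cl := by obtain ⟨p, k⟩ := i; fin_cases k <;> norm_num [cw]
  cu := by obtain ⟨p, k⟩ := i; fin_cases k <;> norm_num [cw]
  hm := by
    have h : ∀ s : ℝ, s ^ 2 = 1 → ‖(1 / 16 + s * Complex.I / 12 : ℂ)‖ ≤ 1 / 8 := fun s hs => by
      have h1 := Complex.norm_add_mul_I (1 / 16 : ℝ) (s / 12)
      have h2 : (1 / 16 + s * Complex.I / 12 : ℂ)
          = ((1 / 16 : ℝ) : ℂ) + ((s / 12 : ℝ) : ℂ) * Complex.I := by push_cast; ring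
      rw [h2, h1]
      apply Real.sqrt_le_iff.2 ⟨by norm_num, by nlinarith⟩
    have h1 : ‖(![-1 / 8, 1 / 16 - Complex.I / 12, 1 / 16 + Complex.I / 12] i.2 : ℂ)‖ ≤ 1 / 8 := by
      obtain ⟨p, k⟩ := i
      fin_cases k
      · simp
      · have := h (-1) (by norm_num)
        simpa [sub_eq_add_neg, neg_div] using this
      · simpa using h 1 (by norm_num)
    rw [mw, norm_mul]
    split_ifs <;> simpa using h1

theorem kap_sums (p : Bool) (R σ σ' : ℂ) :
    ∑ k, (cw (p, k) * R + mw (p, k) * σ + conj (mw (p, k)) * σ') = R ∧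
    ∑ k, kap (p, k) ^ 2 * (cw (p, k) * R + mw (p, k) * σ + conj (mw (p, k)) * σ') = -2 * σ := by
  have hI := Complex.I_sq
  constructor
  · cases p <;> simp [Fin.sum_univ_three, cw, mw, Complex.conj_ofNat] <;> ring
  · have hI3 : Complex.I ^ 3 = -Complex.I := by rw [pow_succ, hI]; ring
    cases p <;>
    simp [Fin.sum_univ_three, cw, mw, kap, kp, Complex.conj_ofNat] <;> ring_nf <;>
      simp only [hI] <;> ring

/-- Smooth step. -/
def stp (x : ℝ) : ℝ := Real.smoothTransition (2 * x - 1 / 2)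

/-- Quadratic partition of unity in time. -/
def chi (x : ℝ) : ℝ := Real.sin (π / 2 * stp (x + 1)) * Real.cos (π / 2 * stp x)

theorem chi_smooth : ContDiff ℝ (⊤ : ℕ∞) chi := by
  have h : ContDiff ℝ (⊤ : ℕ∞) stp := Real.smoothTransition.contDiff.comp (by fun_prop)
  unfold chi
  have h2 : ContDiff ℝ (⊤ : ℕ∞) fun x => stp (x + 1) := h.comp (by fun_prop)
  exact (contDiff_const.mul h2).sin.mul (contDiff_const.mul h).cos

theorem chi_zero {x : ℝ} (h : 3 / 4 ≤ |x|) : chi x = 0 := by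
  rcases le_abs.1 h with h | h
  · have : stp x = 1 := Real.smoothTransition.one_of_one_le (by linarith)
    rw [chi, this]; simp
  · have : stp (x + 1) = 0 := Real.smoothTransition.zero_of_nonpos (by linarith)
    rw [chi, this]; simp

theorem abs_chi_le (x : ℝ) : |chi x| ≤ 1 := by
  rw [chi, abs_mul]
  exact mul_le_one₀ (Real.abs_sin_le_one _) (abs_nonneg _) (Real.abs_cos_le_one _)

theorem chi_pair {x : ℝ} (h0 : 0 ≤ x) (h1 : x ≤ 1) : chi x ^ 2 + chi (x - 1) ^ 2 = 1 := by
  have e1 : stp (x + 1) = 1 := Real.smoothTransition.one_of_one_le (by linarith)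
  have e2 : stp (x - 1) = 0 := Real.smoothTransition.zero_of_nonpos (by linarith)
  rw [chi, chi, e1, e2, sub_add_cancel]
  simp

theorem chi_bounds : ∃ C : ℝ, 1 ≤ C ∧ ∀ x, |deriv chi x| ≤ C ∧ |deriv (deriv chi) x| ≤ C ^ 2 := by
  have hs : HasCompactSupport chi := by
    refine HasCompactSupport.of_support_subset_isCompact (isCompact_Icc (a := (-1 : ℝ)) (b := 1)) ?_
    intro x hx
    by_contra h
    apply hx
    apply chi_zero
    rw [Set.mem_Icc, not_and_or, not_le, not_le] at h
    rcases h with h | h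
    · rw [abs_of_neg (by linarith)]; linarith
    · rw [abs_of_pos (by linarith)]; linarith
  have hd : ContDiff ℝ (⊤ : ℕ∞) (deriv chi) := (contDiff_infty_iff_deriv.1 chi_smooth).2
  have hdd : ContDiff ℝ (⊤ : ℕ∞) (deriv (deriv chi)) := (contDiff_infty_iff_deriv.1 hd).2
  obtain ⟨C1, h1⟩ := hs.deriv.exists_bound_of_continuous hd.continuous
  obtain ⟨C2, h2⟩ := hs.deriv.deriv.exists_bound_of_continuous hdd.continuous
  refine ⟨max 1 (max C1 C2), le_max_left _ _, fun x => ⟨(h1 x).trans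
    ((le_max_left _ _).trans (le_max_right _ _)), (h2 x).trans ?_⟩⟩
  have h3 : C2 ≤ max 1 (max C1 C2) := (le_max_right _ _).trans (le_max_right _ _)
  have h4 : 1 ≤ max 1 (max C1 C2) := le_max_left _ _
  nlinarith

/-- A bound for the first two derivatives of the cutoff. -/
def Cχ : ℝ := chi_bounds.choose

theorem one_le_Cχ : 1 ≤ Cχ := chi_bounds.choose_spec.1
theorem deriv_chi_le (x : ℝ) : |deriv chi x| ≤ Cχ ∧ |deriv (deriv chi) x| ≤ Cχ ^ 2 :=
  chi_bounds.choose_spec.2 x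

/-- The node of given parity closest to a (rescaled) time. -/
def nd (p : Bool) (x : ℝ) : ℤ := if p then 2 * ⌊x / 2⌋ + 1 else 2 * ⌊(x + 1) / 2⌋

theorem nd_dist (p : Bool) (x : ℝ) : -1 ≤ x - nd p x ∧ x - nd p x < 1 := by
  cases p
  · have h1 := Int.floor_le ((x + 1) / 2)
    have h2 := Int.lt_floor_add_one ((x + 1) / 2)
    simp only [nd]; push_cast
    constructor <;> linarith
  · have h1 := Int.floor_le (x / 2)
    have h2 := Int.lt_floor_add_one (x / 2)
    simp only [nd]; push_cast
    constructor <;> linarith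

theorem nd_near {p : Bool} {x y : ℝ} (h : |x - nd p y| < 5 / 4) (hne : nd p x ≠ nd p y) :
    chi (x - nd p x) = 0 ∧ chi (x - nd p y) = 0 := by
  obtain ⟨h1, h2⟩ := nd_dist p x
  obtain ⟨h3, h4⟩ := abs_lt.1 h
  have h5 : ((nd p x - nd p y : ℤ) : ℝ) < 3 := by push_cast; linarith
  have h6 : (-3 : ℝ) < ((nd p x - nd p y : ℤ) : ℝ) := by push_cast; linarith
  have h5' : nd p x - nd p y < 3 := by exact_mod_cast h5
  have h6' : -3 < nd p x - nd p y := by exact_mod_cast h6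
  have h7 : (2 : ℤ) ∣ nd p x - nd p y := by cases p <;> simp only [nd] <;> simp <;> omega
  have h8 : nd p x = nd p y + 2 ∨ nd p x = nd p y - 2 := by omega
  rcases h8 with h8 | h8
  · have h9 : (nd p x : ℝ) = nd p y + 2 := by exact_mod_cast h8
    constructor <;> apply chi_zero <;> rw [le_abs] <;> first | (left; linarith) | (right; linarith)
  · have h9 : (nd p x : ℝ) = nd p y - 2 := by exact_mod_cast h8
    constructor <;> apply chi_zero <;> rw [le_abs] <;> first | (left; linarith) | (right; linarith)

theorem nd_pair (x : ℝ) :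
    chi (x - nd false x) ^ 2 + chi (x - nd true x) ^ 2 = 1 := by
  obtain ⟨h1, h2⟩ := nd_dist false x
  obtain ⟨h3, h4⟩ := nd_dist true x
  have h5 : ((nd false x - nd true x : ℤ) : ℝ) < 2 := by push_cast; linarith
  have h6 : (-2 : ℝ) < ((nd false x - nd true x : ℤ) : ℝ) := by push_cast; linarith
  have h5' : nd false x - nd true x < 2 := by exact_mod_cast h5
  have h6' : -2 < nd false x - nd true x := by exact_mod_cast h6
  have h8 : nd true x = nd false x + 1 ∨ nd true x = nd false x - 1 := by
    simp only [nd] at *; simp at *; omega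
  rcases h8 with h8 | h8
  · have h9 : (nd true x : ℝ) = nd false x + 1 := by exact_mod_cast h8
    have h := chi_pair (x := x - nd false x) (by linarith) (by linarith)
    rw [h9, ← sub_sub]; exact h
  · have h9 : (nd false x : ℝ) = nd true x + 1 := by
      have : nd false x = nd true x + 1 := by omega
      exact_mod_cast this
    have h := chi_pair (x := x - nd true x) (by linarith) (by linarith)
    rw [h9, ← sub_sub, add_comm]; exact h

end

section

variable {J : Set ℝ} {r s : ℝ} {F G : ℝ → E → ℂ} {t : ℝ} {z : E} {ψ : ℝ → E → ℂ}
variable {L T M N n η a : ℝ} {f : ℝ → E → ℂ}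

theorem PB.of_local (h : ∀ t₀ : ℝ, ∃ J : Set ℝ, IsOpen J ∧ t₀ ∈ J ∧ PB ψ T J r M F) :
    PB ψ T Set.univ r M F := by
  refine ⟨R1.of_local fun t₀ => ?_, fun t _ => ?_, fun t _ => ?_⟩
  · obtain ⟨J, hJ, ht, hF⟩ := h t₀
    exact ⟨J, hJ, ht, F, hF.reg, fun _ _ _ _ => rfl⟩
  · obtain ⟨J, hJ, ht, hF⟩ := h t
    exact hF.bd t ht
  · obtain ⟨J, hJ, ht, hF⟩ := h t
    exact hF.dbd t ht

theorem AW.of_local {κ : ℂ} (hF : Rg Set.univ r F)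
    (h : ∀ t₀ : ℝ, ∃ J : Set ℝ, IsOpen J ∧ t₀ ∈ J ∧ AW n η J r κ M F) :
    AW n η Set.univ r κ M F := by
  refine ⟨hF, fun t _ => ?_, fun t _ => ?_, fun t _ => ?_⟩
  · obtain ⟨J, hJ, ht, hF⟩ := h t
    exact hF.bd t ht
  · obtain ⟨J, hJ, ht, hF⟩ := h t
    exact hF.z t ht
  · obtain ⟨J, hJ, ht, hF⟩ := h t
    exact hF.b t ht

theorem AW.congr {κ : ℂ} (hJ : IsOpen J) (hF : AW n η J r κ M F)
    (h : ∀ t ∈ J, ∀ z ∈ Strip r, G t z = F t z) : AW n η J r κ M G :=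
  ⟨hF.reg.congr hJ h, fun t ht z hz => by rw [h t ht z hz]; exact hF.bd t ht z hz,
    fun t ht z hz => by
      rw [h t ht z hz, dz_congr (h t ht) hz]; exact hF.z t ht z hz,
    fun t ht z hz => by
      rw [h t ht z hz, db_congr (h t ht) hz]; exact hF.b t ht z hz⟩

theorem dz_tf (c : ℝ → ℂ) : dz (tf c) t z = 0 := by simp [dz, tf]
theorem db_tf (c : ℝ → ℂ) : db (tf c) t z = 0 := by simp [db, tf]

theorem AW.tf_mul {κ : ℂ} {c : ℝ → ℂ} (hc : Continuous c) (h1 : ∀ t, ‖c t‖ ≤ 1)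
    (hF : AW n η J r κ M F) : AW n η J r κ M (tf c * F) := by
  have hr : Rg J r (tf c) := Rg.tf hc
  have key : ∀ t (w : ℂ) {A : ℝ}, ‖w‖ ≤ A → ‖c t * w‖ ≤ A := fun t w A hw => by
    rw [norm_mul]
    exact (mul_le_of_le_one_left (norm_nonneg _) (h1 t)).trans hw
  refine ⟨hr.mul hF.reg, fun t ht z hz => key t _ (hF.bd t ht z hz), fun t ht z hz => ?_,
    fun t ht z hz => ?_⟩
  · convert! key t _ (hF.z t ht z hz) using 2
    rw [hr.dz_mul hF.reg ht hz, dz_tf]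
    simp only [Pi.mul_apply, tf]
    ring
  · convert! key t _ (hF.b t ht z hz) using 2
    rw [hr.db_mul hF.reg ht hz, db_tf]
    simp only [Pi.mul_apply, tf]
    ring

theorem Dt_tf_mul {c d : ℝ → ℂ} (hJ : IsOpen J) (hd : Continuous d)
    (hc : ∀ t, HasDerivAt c (d t) t) (hF : R1 J r F)
    (h0 : ∀ t ∈ J, ∀ z ∈ Strip r, Dt ψ F t z = 0) (ht : t ∈ J) (hz : z ∈ Strip r) :
    Dt ψ (tf c * F) t z = (tf d * F) t z := by
  have hr : R1 J r (tf c) := R1.tf hJ hd hc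
  have h1 : Dt ψ (tf c) t z = d t := by
    rw [Dt_apply, dz_tf, db_tf]
    have : dt (tf c) t z = d t := (hc t).deriv
    rw [this]; ring
  rw [hr.Dt_mul hF ht hz, h0 t ht z hz, h1]
  simp [tf]

theorem PB.tf_mul {c d : ℝ → ℂ} {A : ℝ} (hJ : IsOpen J) (hd : Continuous d)
    (hc : ∀ t, HasDerivAt c (d t) t) (hcA : ∀ t, ‖c t‖ ≤ A) (hdA : ∀ t, ‖d t‖ ≤ A * T)
    (hF : R1 J r F) (hM : ∀ t ∈ J, ∀ z ∈ Strip r, ‖F t z‖ ≤ M)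
    (h0 : ∀ t ∈ J, ∀ z ∈ Strip r, Dt ψ F t z = 0) : PB ψ T J r (M * A) (tf c * F) := by
  refine ⟨(R1.tf hJ hd hc).mul hJ hF, fun t ht z hz => ?_, fun t ht z hz => ?_⟩
  · rw [Pi.mul_apply, Pi.mul_apply, norm_mul, mul_comm]
    exact mul_le_mul (hM t ht z hz) (hcA t) (norm_nonneg _) ((norm_nonneg _).trans (hM t ht z hz))
  · rw [Dt_tf_mul hJ hd hc hF h0 ht hz, Pi.mul_apply, Pi.mul_apply, norm_mul, mul_comm, mul_assoc]
    exact mul_le_mul (hM t ht z hz) (hdA t) (norm_nonneg _) ((norm_nonneg _).trans (hM t ht z hz))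

/-- Gluing of the packets attached to the nodes. -/
def glue (τ : ℝ) (b : ℤ → Ix → ℝ → E → ℂ) (i : Ix) : ℝ → E → ℂ := fun t z =>
  chi (t / τ - nd i.1 (t / τ)) * b (nd i.1 (t / τ)) i t z

/-- The time interval around a node. -/
def Iv (τ : ℝ) (j : ℤ) : Set ℝ := Set.Ioo (j * τ - 2 * τ) (j * τ + 2 * τ)

variable {τ : ℝ} {b : ℤ → Ix → ℝ → E → ℂ}

/-- The smaller time interval around a node. -/
def Iw (τ : ℝ) (j : ℤ) : Set ℝ := Set.Ioo (j * τ - 5 / 4 * τ) (j * τ + 5 / 4 * τ)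

theorem Iw_sub (hτ : 0 < τ) (j : ℤ) : Iw τ j ⊆ Iv τ j := fun x hx => by
  simp only [Iw, Iv, Set.mem_Ioo] at *
  constructor <;> linarith [hx.1, hx.2]

theorem mem_Iw {j : ℤ} (hτ : 0 < τ) : t ∈ Iw τ j ↔ |t / τ - j| < 5 / 4 := by
  have e : t / τ * τ = t := div_mul_cancel₀ _ hτ.ne'
  rw [Iw, Set.mem_Ioo, abs_lt]
  constructor <;> rintro ⟨h1, h2⟩ <;> constructor <;> nlinarith

theorem mem_Iw_nd (hτ : 0 < τ) (p : Bool) (t : ℝ) : t ∈ Iw τ (nd p (t / τ)) := by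
  rw [mem_Iw hτ]
  obtain ⟨h1, h2⟩ := nd_dist p (t / τ)
  rw [abs_lt]; constructor <;> linarith

theorem isOpen_Iw (j : ℤ) : IsOpen (Iw τ j) := isOpen_Ioo

theorem glue_eq (hτ : 0 < τ) (i : Ix) (t₀ : ℝ) (ht : t ∈ Iw τ (nd i.1 (t₀ / τ))) (z : E) :
    glue τ b i t z = (tf (fun t => (chi (t / τ - nd i.1 (t₀ / τ)) : ℂ)) * b (nd i.1 (t₀ / τ)) i) t z := by
  rw [mem_Iw hτ] at ht
  simp only [glue, tf, Pi.mul_apply]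
  by_cases h : nd i.1 (t / τ) = nd i.1 (t₀ / τ)
  · rw [h]
  · obtain ⟨h1, h2⟩ := nd_near ht h
    rw [h1, h2]; simp

theorem chi_time {g g' : ℝ → ℝ} (hg : ∀ x, HasDerivAt g (g' x) x) (j : ℤ) (A : ℝ) (t : ℝ) :
    HasDerivAt (fun t : ℝ => (A * g (t / τ - j) : ℂ)) (((A / τ : ℝ) : ℂ) * g' (t / τ - j)) t := by
  have h1 : HasDerivAt (fun t : ℝ => t / τ - j) (1 / τ) t :=
    ((hasDerivAt_id t).div_const τ).sub_const _
  have h2 := ((hg (t / τ - j)).comp t h1).ofReal_comp.const_mul (A : ℂ)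
  convert! h2 using 1
  push_cast; ring

theorem glue_cell (hn : 0 < n) (hη : 0 ≤ η) (hL : 0 ≤ L) (hτ : 0 < τ) (hLT : L ≤ Cχ / τ)
    (ha : 0 ≤ a) (hψ : Env2 ψ Set.univ (8 / n) L) (hb : ∀ j i, R1 (Iv τ j) (8 / n) (b j i))
    (h0 : ∀ j i, ∀ t ∈ Iv τ j, ∀ z ∈ Strip (8 / n), Dt ψ (b j i) t z = 0)
    (haw : ∀ j i, AW n η (Iv τ j) (8 / n) (kap i) a (b j i)) :
    Cell ψ Set.univ n η L (Cχ / τ) a kap (glue τ b) := by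
  have hd : ContDiff ℝ (⊤ : ℕ∞) (deriv chi) := (contDiff_infty_iff_deriv.1 chi_smooth).2
  have hdd : Continuous (deriv (deriv chi)) := (contDiff_infty_iff_deriv.1 hd).2.continuous
  have hdc : Continuous (deriv chi) := hd.continuous
  have hcc : Continuous chi := chi_smooth.continuous
  have e1 : ∀ x, HasDerivAt chi (deriv chi x) x := fun x =>
    (chi_smooth.differentiable (by simp) x).hasDerivAt
  have e2 : ∀ x, HasDerivAt (deriv chi) (deriv (deriv chi) x) x := fun x =>
    (hd.differentiable (by simp) x).hasDerivAt
  have C1 := one_le_Cχ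
  have hT : 0 ≤ Cχ / τ := by positivity
  have c1 : ∀ j : ℤ, ∀ t, HasDerivAt (fun t : ℝ => (chi (t / τ - j) : ℂ))
      (((1 / τ : ℝ) : ℂ) * deriv chi (t / τ - j)) t := fun j t => by
    simpa using chi_time e1 j 1 t
  have c2 : ∀ j : ℤ, ∀ t, HasDerivAt (fun t : ℝ => (((1 / τ : ℝ) : ℂ) * deriv chi (t / τ - j)))
      (((1 / τ / τ : ℝ) : ℂ) * deriv (deriv chi) (t / τ - j)) t := fun j t => chi_time e2 j _ t
  have n0 : ∀ (j : ℤ) (t : ℝ), ‖(chi (t / τ - j) : ℂ)‖ ≤ 1 := fun j t => by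
    rw [Complex.norm_real]; exact abs_chi_le _
  have n1 : ∀ (j : ℤ) (t : ℝ), ‖((1 / τ : ℝ) : ℂ) * deriv chi (t / τ - j)‖ ≤ Cχ / τ := fun j t => by
    rw [norm_mul, Complex.norm_real, Complex.norm_real, Real.norm_of_nonneg (by positivity),
      one_div_mul_eq_div]
    exact div_le_div_of_nonneg_right (deriv_chi_le _).1 hτ.le
  have n2 : ∀ (j : ℤ) (t : ℝ), ‖((1 / τ / τ : ℝ) : ℂ) * deriv (deriv chi) (t / τ - j)‖
      ≤ Cχ / τ * (Cχ / τ) := fun j t => by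
    rw [norm_mul, Complex.norm_real, Complex.norm_real, Real.norm_of_nonneg (by positivity)]
    calc _ ≤ 1 / τ / τ * Cχ ^ 2 := by gcongr; exact (deriv_chi_le _).2
      _ = _ := by ring
  have k1 : ∀ j : ℤ, Continuous fun t : ℝ => ((1 / τ : ℝ) : ℂ) * deriv chi (t / τ - j) := by
    intro j; fun_prop
  have k2 : ∀ j : ℤ, Continuous fun t : ℝ =>
      ((1 / τ / τ : ℝ) : ℂ) * deriv (deriv chi) (t / τ - j) := by intro j; fun_prop
  have hbw : ∀ j i, R1 (Iw τ j) (8 / n) (b j i) := fun j i => (hb j i).monoJ (Iw_sub hτ j)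
  have h0w : ∀ j i, ∀ t ∈ Iw τ j, ∀ z ∈ Strip (8 / n), Dt ψ (b j i) t z = 0 :=
    fun j i t ht => h0 j i t (Iw_sub hτ j ht)
  have hbd : ∀ j i, ∀ t ∈ Iw τ j, ∀ z ∈ Strip (8 / n), ‖b j i t z‖ ≤ a :=
    fun j i t ht => (haw j i).bd t (Iw_sub hτ j ht)
  have hpb : ∀ i, PB ψ (Cχ / τ) Set.univ (8 / n) a (glue τ b i) := fun i =>
    PB.of_local fun t₀ => ⟨Iw τ (nd i.1 (t₀ / τ)), isOpen_Iw _, mem_Iw_nd hτ _ _, by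
      have := PB.tf_mul (T := Cχ / τ) (isOpen_Iw (nd i.1 (t₀ / τ))) (k1 (nd i.1 (t₀ / τ))) (c1 _) (n0 _) (by simpa using n1 _)
        (hbw (nd i.1 (t₀ / τ)) i) (hbd _ i) (h0w _ i)
      rw [mul_one] at this
      exact this.congr (isOpen_Iw _) fun t ht z hz => glue_eq hτ i t₀ ht z⟩
  refine ⟨isOpen_univ, hn, hη, hL, hLT, ha, freq_kap, hψ, fun i => ?_, hpb, fun i => ?_⟩
  · refine AW.of_local (hpb i).reg.toRg fun t₀ =>
      ⟨Iw τ (nd i.1 (t₀ / τ)), isOpen_Iw _, mem_Iw_nd hτ _ _, ?_⟩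
    have h1 : AW n η (Iw τ (nd i.1 (t₀ / τ))) (8 / n) (kap i) a (b (nd i.1 (t₀ / τ)) i) :=
      ⟨(hbw _ _).toRg, hbd _ _, fun t ht => (haw _ i).z t (Iw_sub hτ _ ht),
        fun t ht => (haw _ i).b t (Iw_sub hτ _ ht)⟩
    exact (h1.tf_mul (c := fun t => (chi (t / τ - nd i.1 (t₀ / τ)) : ℂ)) (by fun_prop) (n0 _)).congr
      (isOpen_Iw _) fun t ht z hz => glue_eq hτ i t₀ ht z
  · refine PB.of_local fun t₀ =>
      ⟨Iw τ (nd i.1 (t₀ / τ)), isOpen_Iw _, mem_Iw_nd hτ _ _, ?_⟩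
    have := PB.tf_mul (T := Cχ / τ) (isOpen_Iw (nd i.1 (t₀ / τ))) (k2 (nd i.1 (t₀ / τ))) (c2 _) (n1 _) (n2 _)
        (hbw (nd i.1 (t₀ / τ)) i) (hbd _ i) (h0w _ i)
    refine this.congr (isOpen_Iw _) fun t ht z hz => ?_
    rw [Dt_congr (isOpen_Iw _) (fun t ht z _ => glue_eq hτ i t₀ ht z) ht hz,
      Dt_tf_mul (isOpen_Iw _) (k1 _) (c1 _) (hbw _ i) (h0w _ i) ht hz]

/-- Weighted sum over the two nodes around a time. -/
def nodeSum {A : Type*} [AddCommMonoid A] [Module ℝ A] (τ : ℝ) (h : ℤ → A) (t : ℝ) : A :=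
  ∑ p, (chi (t / τ - nd p (t / τ)) ^ 2) • h (nd p (t / τ))

theorem glue_sums (hτ : 0 < τ) {R : ℤ → ℝ} {σ : ℤ → ℝ → E → ℂ}
    (h : ∀ j i, ∀ t ∈ Iv τ j, ∀ z ∈ Strip r, b j i t z * sm (b j i) t z
      = cw i * R j + mw i * σ j t z + conj (mw i) * sm (σ j) t z) (hz : z ∈ Strip r) :
    ∑ i, glue τ b i t z * sm (glue τ b i) t z = (nodeSum τ R t : ℝ) ∧
    1 / 2 * ∑ i, kap i ^ 2 * (glue τ b i t z * sm (glue τ b i) t z)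
      = -nodeSum τ (fun j => σ j t z) t := by
  have h1 : ∀ i : Ix, glue τ b i t z * sm (glue τ b i) t z
      = (chi (t / τ - nd i.1 (t / τ)) : ℂ) ^ 2 * (cw i * R (nd i.1 (t / τ)) +
        mw i * σ (nd i.1 (t / τ)) t z + conj (mw i) * sm (σ (nd i.1 (t / τ))) t z) := fun i => by
    rw [← h _ i t (Iw_sub hτ _ (mem_Iw_nd hτ _ _)) z hz]
    simp only [glue, sm, map_mul, Complex.conj_ofReal]
    ring
  constructor
  · simp only [h1]
    rw [Fintype.sum_prod_type, nodeSum]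
    push_cast
    refine Finset.sum_congr rfl fun p _ => ?_
    rw [← Finset.mul_sum, (kap_sums p _ _ _).1]
    simp
  · simp only [h1]
    rw [Fintype.sum_prod_type, nodeSum, ← Finset.sum_neg_distrib, Finset.mul_sum]
    refine Finset.sum_congr rfl fun p _ => ?_
    have h2 : ∀ k, kap (p, k) ^ 2 * ((chi (t / τ - nd p (t / τ)) : ℂ) ^ 2 *
        (cw (p, k) * R (nd p (t / τ)) + mw (p, k) * σ (nd p (t / τ)) t z
          + conj (mw (p, k)) * sm (σ (nd p (t / τ))) t z))
        = (chi (t / τ - nd p (t / τ)) : ℂ) ^ 2 * (kap (p, k) ^ 2 *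
        (cw (p, k) * R (nd p (t / τ)) + mw (p, k) * σ (nd p (t / τ)) t z
          + conj (mw (p, k)) * sm (σ (nd p (t / τ))) t z)) := fun k => by ring
    simp only [h2]
    rw [← Finset.mul_sum, (kap_sums p _ _ _).2, Complex.real_smul]
    push_cast
    ring

theorem nodeSum_const {A : Type*} [AddCommGroup A] [Module ℝ A] (x : A) (t : ℝ) :
    nodeSum τ (fun _ => x) t = x := by
  rw [nodeSum, Fintype.sum_bool, ← add_smul, add_comm, nd_pair, one_smul]

theorem norm_nodeSum_sub_le {A : Type*} [NormedAddCommGroup A] [NormedSpace ℝ A] {h : ℤ → A}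
    {x : A} {ε : ℝ} (hh : ∀ p, ‖x - h (nd p (t / τ))‖ ≤ ε) : ‖x - nodeSum τ h t‖ ≤ ε := by
  have h1 : x - nodeSum τ h t = nodeSum τ (fun j => x - h j) t := by
    conv_lhs => rw [← nodeSum_const (τ := τ) x t]
    simp only [nodeSum, smul_sub, Finset.sum_sub_distrib]
  rw [h1, nodeSum]
  calc _ ≤ ∑ p : Bool, chi (t / τ - nd p (t / τ)) ^ 2 * ε := by
        refine norm_sum_le_of_le _ fun p _ => ?_
        rw [norm_smul, Real.norm_of_nonneg (sq_nonneg _)]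
        exact mul_le_mul_of_nonneg_left (hh p) (sq_nonneg _)
    _ = ε := by
        rw [← Finset.sum_mul, Fintype.sum_bool, add_comm, nd_pair, one_mul]

end

section

variable {J : Set ℝ} {r s : ℝ} {F G : ℝ → E → ℂ} {t : ℝ} {z : E} {ψ : ℝ → E → ℂ}
variable {L T M N n η a : ℝ} {f : ℝ → E → ℂ}

theorem Env2.mono (h : Env2 ψ J r L) (hs : s ≤ r) : Env2 ψ J s L :=
  ⟨h.reg.mono hs, h.real, h.zz.mono hs, h.zb.mono hs, h.bb.mono hs⟩

theorem exists_cell {S : ℝ → E → ℂ} {ρ τ K δ : ℝ} {n : ℕ} {R : ℤ → ℝ} (hτ : 0 < τ)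
    (hψ : Env2 ψ Set.univ ρ L) (hL : 0 ≤ L) (hK : ∀ t, ∀ z ∈ Strip ρ, ‖dz ψ t z‖ ≤ K)
    (hK0 : 0 ≤ K) (hLτ : 32 * L * τ ≤ 1) (hn : 0 < n) (hnr : 16 / n ≤ ρ / 4)
    (hS : R1 Set.univ ρ S) (hM : ∀ t, ∀ z ∈ Strip ρ, ‖Dt ψ S t z‖ ≤ M)
    (hR : ∀ j, 0 ≤ R j ∧ R j ≤ δ) (hb : ∀ j : ℤ, ∀ z ∈ Strip ρ, ‖S (j * τ) z‖ ≤ R j / 8) :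
    ∃ g : Ix → ℝ → E → ℂ,
      Cell ψ Set.univ n (160 * (τ * L + 1 / (n * ρ))) L (Cχ / τ) (Real.exp 80 * √δ) kap g ∧
      (∀ t, ∀ z ∈ Strip (8 / n),
        ‖S t z + 1 / 2 * ∑ i, kap i ^ 2 * (g i t z * sm (g i) t z)‖ ≤ M * (2 * τ)) ∧
      (∀ t, ∀ z ∈ Strip (8 / n), ∑ i, g i t z * sm (g i) t z = (nodeSum τ R t : ℝ)) ∧
      ∀ t₀, (∀ p, R (nd p (t₀ / τ)) = 0) → ∀ᶠ t in 𝓝 t₀, ∀ i z, g i t z = 0 := by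
  have hn' : (0 : ℝ) < n := by exact_mod_cast hn
  have h16 : (0 : ℝ) < 16 / n := by positivity
  have hρ : 0 < ρ := by linarith
  have h8 : (8 : ℝ) / n ≤ ρ := by
    have : (8 : ℝ) / n = (16 / n) / 2 := by ring
    linarith
  have P := fun j : ℤ => exists_packet (J := Iv τ j) (t₀ := j * τ) hτ rfl (hψ.env.monoJ
    (Set.subset_univ _)) hL (fun t _ => hK t) hK0 hLτ hn hnr (hS.monoJ (Set.subset_univ _))
    (fun t _ => hM t) (hR j).1 (hR j).2 (hb j)
  choose σ hσ hP using P
  have hP' := fun (j : ℤ) (i : Ix) => hP j _ _ _ (dir_kap i)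
  choose b hb1 hb2 hb3 hb4 hb5 using hP'
  have hLT : L ≤ Cχ / τ := by
    rw [le_div_iff₀ hτ]
    have := one_le_Cχ
    nlinarith [mul_nonneg hL hτ.le]
  have hsum := fun t z (hz : z ∈ Strip (8 / n)) => glue_sums (t := t) hτ hb5 hz
  refine ⟨glue τ b, glue_cell hn' (by positivity) hL hτ hLT (by positivity)
    (hψ.mono h8) hb1 hb2 hb3, fun t z hz => ?_,
    fun t z hz => (hsum t z hz).1, fun t₀ h0 => ?_⟩
  · rw [(hsum t z hz).2, ← sub_eq_add_neg]
    exact norm_nodeSum_sub_le fun p =>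
      hσ _ t (Iw_sub hτ _ (mem_Iw_nd hτ p t)) z hz
  · have : ∀ᶠ t in 𝓝 t₀, ∀ p, t ∈ Iw τ (nd p (t₀ / τ)) := by
      rw [eventually_all]
      exact fun p => (isOpen_Iw _).mem_nhds (mem_Iw_nd hτ p t₀)
    filter_upwards [this] with t ht i z
    rw [glue_eq hτ i t₀ (ht i.1), hb4 _ i (h0 i.1)]
    simp

theorem dz_eq_zero (h : F t = 0) : dz F t = 0 := by
  ext z; simp [dz, h]
theorem db_eq_zero (h : F t = 0) : db F t = 0 := by
  ext z; simp [db, h]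
theorem sm_eq_zero (h : F t = 0) : sm F t = 0 := by
  ext z; simp [sm, h]
theorem dt_eq_zero (h : ∀ᶠ s in 𝓝 t, F s = 0) : dt F t = 0 := by
  ext z
  have : (fun s => F s z) =ᶠ[𝓝 t] fun _ => 0 := by
    filter_upwards [h] with s hs
    simp [hs]
  simpa [dt] using this.deriv_eq

theorem pert_eq_zero {κ : Ix → ℂ} {g : Ix → ℝ → E → ℂ} (h : ∀ i z, g i t z = 0) :
    pert n κ g t = 0 := by
  ext z; simp [pert, h]

theorem prs2_eq_zero {κ : Ix → ℂ} {g : Ix → ℝ → E → ℂ} (h : ∀ i z, g i t z = 0) :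
    prs2 n κ g t = 0 := by
  have h' : ∀ i, sm (g i) t = 0 := fun i => sm_eq_zero (by ext z; simp [h])
  have h2 : ∀ α z, Gv g α t z = 0 := by
    rintro ⟨i, b⟩ z
    cases b <;> simp [Gv, h, h']
  ext z
  simp [prs2, h2]

theorem pot_eq_zero (h : F t = 0) : pot F t = 0 := by
  have h1 := db_eq_zero h
  have h2 := dz_eq_zero (sm_eq_zero h)
  ext z
  simp [pot, h1, h2]

theorem newS_eq_self {κ : Ix → ℂ} {g : Ix → ℝ → E → ℂ} {S : ℝ → E → ℂ}
    (h : ∀ᶠ s in 𝓝 t, ∀ i z, g i s z = 0) : newS ψ S n κ g t = S t := by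
  have h1 : ∀ᶠ s in 𝓝 t, pert n κ g s = 0 := h.mono fun s hs => pert_eq_zero hs
  have p0 := h1.self_of_nhds
  have e1 := dt_eq_zero h1
  have e2 := dz_eq_zero p0
  have e3 := db_eq_zero p0
  have e4 := dz_eq_zero (pot_eq_zero p0)
  have e5 := dz_eq_zero (dz_eq_zero (prs2_eq_zero (n := n) (κ := κ) h.self_of_nhds))
  have e6 := dz_eq_zero (sm_eq_zero p0)
  have e8 := sm_eq_zero p0
  have e7 : Dt ψ (pert n κ g) t = 0 := by
    ext z; simp [Dt_apply, e1, e2, e3]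
  have e9 := dz_eq_zero e7
  ext z
  simp [newS, lin, e2, e3, e4, e5, e6, e8, e9, p0]

/-- The parameters of one step of the iteration. -/
structure Par (A X C s d τ n L ρ Ke : ℝ) : Prop where
  hA : 1 ≤ A
  hX : 1 ≤ X
  hC : C = 10 ^ 15 * A ^ 2 * X ^ 2
  hs : 0 < s
  hd : 0 < d
  hds : d ≤ s ^ 2 / 8
  hτ : 0 < τ
  hn : 0 < n
  hL : 0 ≤ L
  hLn : L ≤ s * n
  hρ : 0 < ρ
  hKe : 0 ≤ Ke
  h1 : C * (s ^ 2 * τ * L) ≤ d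
  h2 : C * s ^ 2 ≤ d * n * ρ
  h3 : C * s ≤ d * n * τ
  h4 : C * Ke * τ ≤ d

section
variable {A X C d τ ρ Ke : ℝ} (P : Par A X C s d τ n L ρ Ke)
include P

theorem Par.C0 : 10 ^ 15 ≤ C := by
  rw [P.hC]
  nlinarith [one_le_pow₀ P.hA (n := 2), one_le_pow₀ P.hX (n := 2)]
theorem Par.CA : 10 ^ 15 * A ^ 2 ≤ C := by
  rw [P.hC]
  exact le_mul_of_one_le_right (by positivity) (one_le_pow₀ P.hX)
theorem Par.CX : 10 ^ 15 * X ^ 2 ≤ C := by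
  rw [P.hC]
  nlinarith [one_le_pow₀ P.hA (n := 2), sq_nonneg X]
theorem Par.CAX : 10 ^ 15 * (A * X) ≤ C := by
  rw [P.hC]
  have h : 1 ≤ A * X := by nlinarith [P.hA, P.hX]
  nlinarith

/-- `1 / τ` -/
theorem Par.T1 : C * s * τ⁻¹ ≤ d * n := by
  have := P.h3
  rw [← div_eq_mul_inv, div_le_iff₀ P.hτ]
  exact this

theorem Par.T2 : C * τ⁻¹ ≤ s * n / 8 := by
  have h := P.T1
  have := P.hs
  have hn := P.hn
  refine le_of_mul_le_mul_left ?_ P.hs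
  calc s * (C * τ⁻¹) ≤ d * n := by linarith
    _ ≤ s ^ 2 / 8 * n := by gcongr; exact P.hds
    _ = _ := by ring

theorem Par.sL : C * (C * (s * L)) ≤ d * n / 8 := by
  have h := P.T2
  have hτ := P.hτ
  have hs := P.hs
  have hL := P.hL
  have hC : 0 ≤ C := le_trans (by norm_num) P.C0
  have e : s * (C * (C * (s * L))) = (C * (s ^ 2 * τ * L)) * (C * τ⁻¹) := by
    field_simp
  refine le_of_mul_le_mul_left ?_ hs
  rw [e]
  calc _ ≤ d * (s * n / 8) := mul_le_mul P.h1 h (by positivity) P.hd.le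
    _ = _ := by ring

end

end

section

variable {L T M N n η a s : ℝ}
variable {A X C d τ ρ Ke : ℝ} (P : Par A X C s d τ n L ρ Ke)
include P

theorem Par.pos : 0 ≤ C := le_trans (by norm_num) P.C0

/-- The phase error. -/
theorem Par.eta : C * (s ^ 2 * (160 * (τ * L + 1 / (n * ρ)))) ≤ 320 * d := by
  have hn := P.hn
  have hρ := P.hρ
  have h2 : C * s ^ 2 * (1 / (n * ρ)) ≤ d := by
    rw [mul_one_div, div_le_iff₀ (by positivity), ← mul_assoc]; exact P.h2
  have h1 := P.h1
  linarith

theorem Par.eta' : 10 ^ 15 * ((A * s) ^ 2 * (160 * (τ * L + 1 / (n * ρ)))) ≤ 320 * d := by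
  have hn := P.hn
  have hρ := P.hρ
  have hτ := P.hτ
  have hL := P.hL
  refine le_trans ?_ P.eta
  have := P.CA
  calc _ = 10 ^ 15 * A ^ 2 * (s ^ 2 * (160 * (τ * L + 1 / (n * ρ)))) := by ring
    _ ≤ _ := by gcongr

theorem Par.aT : 10 ^ 15 * (A * s * (X / τ) / n) ≤ d := by
  have hn := P.hn
  have h := P.T1
  have hs := P.hs
  have hτ := P.hτ
  rw [← mul_div_assoc, div_le_iff₀ hn]
  refine le_trans ?_ h
  have := P.CAX
  calc _ = 10 ^ 15 * (A * X) * (s * τ⁻¹) := by ring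
    _ ≤ C * (s * τ⁻¹) := by gcongr
    _ = _ := by ring

theorem Par.tL : 10 ^ 15 * (s ^ 2 * τ * L) ≤ d := by
  have hτ := P.hτ
  have hL := P.hL
  exact (mul_le_mul_of_nonneg_right P.C0 (by positivity)).trans P.h1

theorem Par.T_le : X / τ ≤ s * n := by
  have h := P.T2
  have hs := P.hs
  have hn := P.hn
  have hτ := P.hτ
  have hXC : X ≤ C := by
    have := P.CX
    nlinarith [P.hX]
  rw [div_eq_mul_inv]
  calc X * τ⁻¹ ≤ C * τ⁻¹ := by gcongr
    _ ≤ s * n / 8 := h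
    _ ≤ s * n := by nlinarith [mul_pos hs hn]

/-- Size of the new stress. -/
theorem Par.stress : s ^ 2 * L * (2 * τ) + 12000 * (A * s) ^ 2 * (160 * (τ * L + 1 / (n * ρ)))
    + 200 * (A * s) * (X / τ) / n ≤ 1 / 10 ^ 5 * d := by
  have h1 := P.tL
  have h2 := P.eta'
  have h3 := P.aT
  have hd := P.hd
  have e : 200 * (A * s) * (X / τ) / n = 200 * (A * s * (X / τ) / n) := by ring
  rw [e]
  linarith

/-- Transport of the new stress. -/
theorem Par.transport : (60000 * (A * s) ^ 2 + 200 * (A * s) * (X / τ) / n) * (X / τ)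
    + 300 * (A * s) * n * (1 / 10 ^ 5 * d) ≤ d * (C * s * n) := by
  have h3 := P.aT
  have hd := P.hd
  have hs := P.hs
  have hn := P.hn
  have hτ := P.hτ
  have hX := P.hX
  have hA := P.hA
  have e : 200 * (A * s) * (X / τ) / n = 200 * (A * s * (X / τ) / n) := by ring
  have hA2 : 1 ≤ A ^ 2 := one_le_pow₀ hA
  have h5 : 200 * (A * s) * (X / τ) / n ≤ (A * s) ^ 2 := by
    rw [e, mul_pow]
    nlinarith [P.hds, sq_nonneg s, mul_le_mul_of_nonneg_right hA2 (sq_nonneg s)]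
  have h6 : 10 ^ 15 * ((A * s) ^ 2 * (X / τ)) ≤ A * s * n * d := by
    have := mul_le_mul_of_nonneg_left h3 (by positivity : 0 ≤ A * s * n)
    calc _ = A * s * n * (10 ^ 15 * (A * s * (X / τ) / n)) := by field_simp
      _ ≤ _ := this
  have h7 : (200 * (A * s) * (X / τ) / n) * (X / τ) ≤ (A * s) ^ 2 * (X / τ) := by
    have : 0 ≤ X / τ := by positivity
    gcongr
  have h8 : A * s * n * d ≤ d * (C * s * n) := by
    have : A ≤ C := by nlinarith [P.CA]
    calc A * s * n * d ≤ C * s * n * d := by gcongr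
      _ = _ := by ring
  have h9 : 0 ≤ A * s * n * d := by positivity
  linarith

theorem Par.env1 : L + 375 * (A * s) * n ≤ C * s * n := by
  have hs := P.hs
  have hn := P.hn
  have hA := P.hA
  have : 376 * A ≤ C := by nlinarith [P.CA, P.hA]
  have h := P.hLn
  calc _ ≤ s * n + 375 * (A * s) * n := by gcongr
    _ ≤ 376 * A * (s * n) := by nlinarith [mul_pos hs hn]
    _ ≤ C * (s * n) := by gcongr
    _ = _ := by ring

theorem Par.env2 : L ^ 2 + 375 * (A * s) * n * (X / τ)
    + 300 * (A * s) * n * (L + 375 * (A * s) * n) ≤ (C * s * n) ^ 2 := by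
  have hs := P.hs
  have hn := P.hn
  have hA := P.hA
  have hL := P.hL
  have h := P.hLn
  have hT := P.T_le
  have hC : 10 ^ 6 * A ^ 2 ≤ C ^ 2 := by
    have h1 := P.CA
    have h2 := P.C0
    have : 1 ≤ A ^ 2 := one_le_pow₀ hA
    nlinarith
  have hx : 0 < s * n := by positivity
  set x := s * n
  calc _ ≤ x ^ 2 + 375 * (A * s) * n * x + 300 * (A * s) * n * (x + 375 * (A * s) * n) := by gcongr
    _ = (1 + 675 * A + 112500 * A ^ 2) * x ^ 2 := by simp only [x]; ring
    _ ≤ (10 ^ 6 * A ^ 2) * x ^ 2 := by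
      gcongr; nlinarith
    _ ≤ C ^ 2 * x ^ 2 := by gcongr
    _ = _ := by simp only [x]; ring

theorem Par.sL' : 10 ^ 15 * (A * s * L / n) ≤ d := by
  have hs := P.hs
  have hn := P.hn
  have hA := P.hA
  have hL := P.hL
  have hC0 := P.C0
  have hC := P.pos
  have h := P.sL
  have hAC : A ≤ C := by nlinarith [P.CA]
  have hd := P.hd
  rw [← mul_div_assoc, div_le_iff₀ hn]
  calc 10 ^ 15 * (A * s * L) = 10 ^ 15 * (A * (s * L)) := by ring
    _ ≤ C * (C * (s * L)) := by gcongr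
    _ ≤ d * n / 8 := h
    _ ≤ d * n := by nlinarith [mul_pos hd hn]

theorem Par.energy : 1024 * (1710 * (A * s) ^ 2 * (160 * (τ * L + 1 / (n * ρ)))
    + 30 * (A * s) * L / n) ≤ d / 8 := by
  have h1 := P.eta'
  have h2 := P.sL'
  have hd := P.hd
  have e : 30 * (A * s) * L / n = 30 * (A * s * L / n) := by ring
  rw [e]
  linarith

theorem Par.energy_lip : s ^ 2 * L + 1024 * ((11250 * (A * s) ^ 2 + 60 * (A * s) * L / n) * (X / τ))
    ≤ d * (C * s * n) := by
  have h3 := P.aT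
  have hd := P.hd
  have hs := P.hs
  have hn := P.hn
  have hτ := P.hτ
  have hX := P.hX
  have hA := P.hA
  have hL := P.hL
  have hA2 : 1 ≤ A ^ 2 := one_le_pow₀ hA
  have h5 : 60 * (A * s) * L / n ≤ (A * s) ^ 2 := by
    have e : 60 * (A * s) * L / n = 60 * (A * s * L / n) := by ring
    rw [e, mul_pow]
    nlinarith [P.hds, P.sL', sq_nonneg s, mul_le_mul_of_nonneg_right hA2 (sq_nonneg s)]
  have h6 : 10 ^ 15 * ((A * s) ^ 2 * (X / τ)) ≤ A * s * n * d := by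
    have := mul_le_mul_of_nonneg_left h3 (by positivity : 0 ≤ A * s * n)
    calc _ = A * s * n * (10 ^ 15 * (A * s * (X / τ) / n)) := by field_simp
      _ ≤ _ := this
  have h7 : (60 * (A * s) * L / n) * (X / τ) ≤ (A * s) ^ 2 * (X / τ) := by
    have : 0 ≤ X / τ := by positivity
    gcongr
  have h8 : 10 * (A * s * n * d) ≤ d * (C * s * n) := by
    have : 10 * A ≤ C := by nlinarith [P.CA]
    calc 10 * (A * s * n * d) = 10 * A * s * n * d := by ring
      _ ≤ C * s * n * d := by gcongr
      _ = _ := by ring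
  have h9 : 0 < A * s * n * d := by positivity
  have h10 : s ^ 2 * L ≤ A * s * n * d := by
    have h11 := P.sL'
    rw [← mul_div_assoc, div_le_iff₀ hn] at h11
    have h12 : s * (A * s * L) ≤ s * (d * n) := by
      refine mul_le_mul_of_nonneg_left ?_ hs.le
      have : 0 ≤ A * s * L := by positivity
      linarith
    have h13 : s ^ 2 * L ≤ A * (s ^ 2 * L) := le_mul_of_one_le_left (by positivity) hA
    have h14 : s * (d * n) ≤ A * (s * (d * n)) := le_mul_of_one_le_left (by positivity) hA
    linarith
  linarith

theorem Par.var : Ke * τ + s ^ 2 * L * τ ≤ d / 8 := by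
  have h1 := P.tL
  have h2 := P.h4
  have hK := P.hKe
  have hτ := P.hτ
  have hd := P.hd
  have : 10 ^ 15 * (Ke * τ) ≤ d := by
    refine le_trans ?_ h2
    rw [mul_assoc]
    exact mul_le_mul_of_nonneg_right P.C0 (by positivity)
  linarith

theorem Par.small : 32 * L * τ ≤ 1 := by
  have h1 := P.tL
  have hs := P.hs
  have h2 := P.hds
  have hL := P.hL
  have hτ := P.hτ
  have : 10 ^ 15 * (s ^ 2 * τ * L) ≤ s ^ 2 / 8 := h1.trans h2
  have h3 : s ^ 2 * (8 * 10 ^ 15 * (τ * L)) ≤ s ^ 2 * 1 := by linarith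
  have := le_of_mul_le_mul_left h3 (by positivity)
  nlinarith [mul_nonneg hτ.le hL]

theorem Par.coef {k : ℝ} (hk0 : 0 ≤ k) (hk : k ≤ 10 ^ 15) : k * (A * s) ≤ C * s := by
  have hA := P.hA
  have hs := P.hs
  rw [← mul_assoc]
  have : k * A ≤ C := by
    refine le_trans ?_ P.CA
    have : A ≤ A ^ 2 := by nlinarith
    gcongr
  gcongr

theorem Par.coefT : 75 * (A * s) * (X / τ) ≤ C * s * n * s := by
  have hs := P.hs
  have hn := P.hn
  have hA := P.hA
  calc _ ≤ 75 * (A * s) * (s * n) := by gcongr; exact P.T_le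
    _ ≤ C * s * (s * n) := mul_le_mul_of_nonneg_right (P.coef (by norm_num) (by norm_num)) (by positivity)
    _ = _ := by ring

theorem Par.widths : 64 ≤ n * ρ → 16 / n ≤ ρ / 4 := fun h => by
  rw [div_le_div_iff₀ P.hn (by norm_num)]
  linarith

end

section

variable {J : Set ℝ} {r s : ℝ} {F G : ℝ → E → ℂ} {t : ℝ} {z : E} {ψ : ℝ → E → ℂ}
variable {L T M N n η a τ : ℝ} {f : ℝ → E → ℂ}

/-- The energy of a stream function. -/
def En (ψ : ℝ → E → ℂ) (t : ℝ) : ℝ := 4 * (av (dz ψ * db ψ) t).re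

/-- The state of the iteration. -/
structure Hyp (e : ℝ → ℝ) (ρ L δ K : ℝ) (ψ F H S : ℝ → E → ℂ) : Prop where
  regS : R1 Set.univ ρ S
  regF : R1 Set.univ ρ F
  regH : Rg Set.univ ρ H
  realH : sm H = H
  env : Env2 ψ Set.univ ρ L
  pot : ∀ t, ∀ z ∈ Strip ρ, ψ t z = pot F t z
  eqn : ∀ t, ∀ z ∈ Strip ρ, S t z = dz ψ t z ^ 2 + 1 / 2 * dz (dt F) t z + dz (dz H) t z
  bdz : ∀ t, ∀ z ∈ Strip ρ, ‖dz ψ t z‖ ≤ K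
  bdS : ∀ t, ∀ z ∈ Strip ρ, ‖S t z‖ ≤ 1 / 10 ^ 5 * δ
  bdDS : ∀ t, ∀ z ∈ Strip ρ, ‖Dt ψ S t z‖ ≤ δ * L
  en : ∀ t, |e t - En ψ t| ≤ 2 * δ
  alt : ∀ t, δ / 2 ≤ e t - En ψ t ∨ ∀ z ∈ Strip ρ, ψ t z = 0 ∧ S t z = 0
  lip : ∀ t t', |En ψ t - En ψ t'| ≤ δ * L * |t - t'|

/-- Bounds for the increment of the stream function. -/
structure Inc (n B D : ℝ) (w : ℝ → E → ℂ) : Prop where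
  reg : R1 Set.univ (1 / n) w
  b0 : ∀ t, ∀ z ∈ Strip (1 / n), ‖w t z‖ ≤ B / n
  bz : ∀ t, ∀ z ∈ Strip (1 / n), ‖dz w t z‖ ≤ B
  bb : ∀ t, ∀ z ∈ Strip (1 / n), ‖db w t z‖ ≤ B
  bzz : ∀ t, ∀ z ∈ Strip (1 / n), ‖dz (dz w) t z‖ ≤ B * n
  bzb : ∀ t, ∀ z ∈ Strip (1 / n), ‖dz (db w) t z‖ ≤ B * n
  bt : ∀ t, ∀ z ∈ Strip (1 / n), ‖dt (dz w) t z‖ ≤ B * n * D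

theorem norm_db_of_real (h : sm ψ = ψ) (hK : ∀ z ∈ Strip r, ‖dz ψ t z‖ ≤ M) :
    ∀ z ∈ Strip r, ‖db ψ t z‖ ≤ M := fun z hz => by
  rw [db_eq_sm, h, sm]
  simpa using hK _ (st_mem hz)

theorem av_nodeSum {R : ℤ → ℝ} {g : Ix → ℝ → E → ℂ} (hr : 0 < r)
    (hg : ∀ i, Rg Set.univ r (g i))
    (h : ∀ z ∈ Strip r, ∑ i, g i t z * sm (g i) t z = (nodeSum τ R t : ℝ)) :
    ∑ i, av (g i * sm (g i)) t = ((2 * π) ^ 3 * nodeSum τ R t : ℝ) := by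
  rw [← av_sum hr (fun i _ => (hg i).mul (hg i).sm) (Set.mem_univ t), av_const
    ((nodeSum τ R t : ℝ) : ℂ)]
  · push_cast; ring
  · intro x
    have := h _ (emb_mem hr x)
    simpa using this

theorem En_add {κ : Ix → ℂ} {g : Ix → ℝ → E → ℂ} (W : Cell ψ Set.univ n η L T a κ g) (t : ℝ) :
    En (ψ + QG.pot (pert n κ g)) t = En ψ t + 4 * (av (incr ψ (QG.pot (pert n κ g))) t).re := by
  rw [En, W.av_incr_eq (Set.mem_univ t), Complex.add_re, En]
  ring

theorem pi_cube_le : π ^ 3 ≤ 32 := by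
  have h1 := Real.pi_lt_d2
  have h2 := Real.pi_pos
  calc π ^ 3 ≤ 3.15 ^ 3 := by gcongr
    _ ≤ 32 := by norm_num

theorem le_pi_cube : 27 ≤ π ^ 3 := by
  have h1 := Real.pi_gt_three
  calc (27 : ℝ) = 3 ^ 3 := by norm_num
    _ ≤ π ^ 3 := by gcongr

theorem Cell.en_step {R : ℤ → ℝ} {κ : Ix → ℂ} {g : Ix → ℝ → E → ℂ} {x : ℝ}
    (W : Cell ψ Set.univ n η L T a κ g)
    (h : ∀ z ∈ Strip (8 / n), ∑ i, g i t z * sm (g i) t z = (nodeSum τ R t : ℝ))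
    (hx : 1024 * (1710 * a ^ 2 * η + 30 * a * L / n) ≤ x) :
    |En (ψ + QG.pot (pert n κ g)) t - En ψ t - 100 * π ^ 3 * nodeSum τ R t| ≤ x := by
  have hn := W.hn
  have ha := W.ha
  have hη := W.hη
  have hL := W.hL
  have h1 := W.av_incr (Set.mem_univ t)
  rw [av_nodeSum (r := 8 / n) (by positivity) (fun i => (W.aw i).reg) h] at h1
  have h2 := (Complex.abs_re_le_norm _).trans h1
  have e : (av (incr ψ (QG.pot (pert n κ g))) t
      - 25 / 8 * (((2 * π) ^ 3 * nodeSum τ R t : ℝ) : ℂ)).re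
      = (av (incr ψ (QG.pot (pert n κ g))) t).re - 25 / 8 * ((2 * π) ^ 3 * nodeSum τ R t) := by
    rw [Complex.sub_re]
    congr 1
    have : (25 / 8 : ℂ) = ((25 / 8 : ℝ) : ℂ) := by push_cast; rfl
    rw [this, ← Complex.ofReal_mul, Complex.ofReal_re]
  rw [e] at h2
  rw [En_add W, show ∀ u v w : ℝ, u + 4 * v - u - w = 4 * (v - w / 4) by intros; ring, abs_mul,
    show 100 * π ^ 3 * nodeSum τ R t / 4 = 25 / 8 * ((2 * π) ^ 3 * nodeSum τ R t) by ring,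
    abs_of_pos (by norm_num : (0 : ℝ) < 4)]
  have h3 := pi_cube_le
  have h4 : 0 ≤ 1710 * a ^ 2 * η + 30 * a * L / n := by positivity
  nlinarith

theorem Cell.en_lip {κ : Ix → ℂ} {g : Ix → ℝ → E → ℂ} {x y : ℝ}
    (W : Cell ψ Set.univ n η L T a κ g)
    (h : ∀ t t', |En ψ t - En ψ t'| ≤ y * |t - t'|)
    (hx : y + 1024 * ((11250 * a ^ 2 + 60 * a * L / n) * T) ≤ x) (t t' : ℝ) :
    |En (ψ + QG.pot (pert n κ g)) t - En (ψ + QG.pot (pert n κ g)) t'| ≤ x * |t - t'| := by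
  have hn := W.hn
  have ha := W.ha
  have hL := W.hL
  have hT := W.hT
  choose d hd hd' using fun t => W.deriv_incr (Set.mem_univ t)
  have h1 := Convex.norm_image_sub_le_of_norm_hasDerivWithin_le (s := Set.univ)
    (fun t _ => (hd t).hasDerivWithinAt) (fun t _ => hd' t) convex_univ (Set.mem_univ t')
    (Set.mem_univ t)
  have h2 := (Complex.abs_re_le_norm _).trans h1
  rw [En_add W, En_add W]
  rw [Complex.sub_re, Real.norm_eq_abs] at h2
  have h3 := pi_cube_le
  have h4 : 0 ≤ (11250 * a ^ 2 + 60 * a * L / n) * T := by positivity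
  have h5 := abs_add_le (En ψ t - En ψ t') (4 * ((av (incr ψ (QG.pot (pert n κ g))) t).re
    - (av (incr ψ (QG.pot (pert n κ g))) t').re))
  rw [abs_mul, abs_of_pos (by norm_num : (0 : ℝ) < 4)] at h5
  rw [show ∀ p q u v : ℝ, p + 4 * u - (q + 4 * v) = p - q + 4 * (u - v) by intros; ring]
  refine h5.trans ?_
  have h6 := h t t'
  have h7 : 8 * π ^ 3 * ((11250 * a ^ 2 + 60 * a * L / n) * T) * |t - t'| ≤
      256 * ((11250 * a ^ 2 + 60 * a * L / n) * T) * |t - t'| := by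
    gcongr; linarith
  have h8 := mul_le_mul_of_nonneg_right hx (abs_nonneg (t - t'))
  linarith

theorem Cell.inc {κ : Ix → ℂ} {g : Ix → ℝ → E → ℂ} {K B D : ℝ}
    (W : Cell ψ Set.univ n η L T a κ g) (hK : ∀ t, ∀ z ∈ Strip (8 / n), ‖dz ψ t z‖ ≤ K)
    (hB : 2000 * a ≤ B) (hT : 75 * a * T ≤ B * n * D) :
    Inc n B (D + K) (QG.pot (pert n κ g)) := by
  have hn := W.hn
  have ha := W.ha
  have h18 : 1 / n ≤ 8 / n := by gcongr; norm_num
  have h17 : 1 / n ≤ 7 / n := by gcongr; norm_num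
  have h16 : 1 / n ≤ 6 / n := by gcongr; norm_num
  have h15 : 1 / n ≤ 5 / n := by gcongr; norm_num
  refine ⟨W.pb_w.reg.mono h17, fun t z hz => ?_, fun t z hz => ?_, fun t z hz => ?_,
    fun t z hz => ?_, fun t z hz => ?_, fun t z hz => ?_⟩
  · refine (W.pb_w.bd t (Set.mem_univ t) z (strip_mono h17 hz)).trans ?_
    gcongr; linarith
  · exact (W.pb_dzw.bd t (Set.mem_univ t) z (strip_mono h16 hz)).trans (by linarith)
  · exact (W.pb_dbw.bd t (Set.mem_univ t) z (strip_mono h16 hz)).trans (by linarith)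
  · refine (W.pb_dzzw.bd t (Set.mem_univ t) z (strip_mono h15 hz)).trans ?_
    gcongr; linarith
  · refine (W.pb_dzbw.bd t (Set.mem_univ t) z (strip_mono h15 hz)).trans ?_
    gcongr; linarith
  · have h1 := W.pb_dzw.dbd t (Set.mem_univ t) z (strip_mono h16 hz)
    have h2 := W.pb_dzzw.bd t (Set.mem_univ t) z (strip_mono h15 hz)
    have h3 := W.pb_dzbw.bd t (Set.mem_univ t) z (strip_mono h15 hz)
    rw [← W.pb_w.reg.toRg.dz_db W.hJ (Set.mem_univ t) (strip_mono h17 hz)] at h3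
    have h4 := hK t z (strip_mono h18 hz)
    have h5 := norm_db_of_real W.env.real (hK t) z (strip_mono h18 hz)
    have hK0 := (norm_nonneg _).trans h4
    set w := QG.pot (pert n κ g)
    have e : dt (dz w) t z = Dt ψ (dz w) t z
        + 2 * Complex.I * (dz ψ t z * db (dz w) t z - db ψ t z * dz (dz w) t z) := by
      rw [Dt_apply]; ring
    rw [e]
    refine (norm_add_le _ _).trans ?_
    rw [norm_mul, norm_mul, Complex.norm_I, Complex.norm_ofNat]
    have h6 : ‖dz ψ t z * db (dz w) t z - db ψ t z * dz (dz w) t z‖ ≤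
        K * (375 * a * n) + K * (375 * a * n) := by
      refine (norm_sub_le _ _).trans ?_
      rw [norm_mul, norm_mul]
      gcongr
    have h7 : 1500 * a * (n * K) ≤ B * (n * K) := by gcongr; linarith
    linarith

end

section

variable {J : Set ℝ} {r s : ℝ} {F G : ℝ → E → ℂ} {t : ℝ} {z : E} {ψ : ℝ → E → ℂ}
variable {L T M N n η a τ : ℝ} {f : ℝ → E → ℂ}

/-- Amplitude assigned to a node with energy gap `D`. -/
def nodeR (d D : ℝ) : ℝ := if 3 / 2 * d ≤ D then (D - d) / (100 * π ^ 3) else 0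

theorem nodeR_bounds {d D δ : ℝ} (hd : 0 < d) (hδ : 0 < δ) (hD : D ≤ 2 * δ) :
    0 ≤ nodeR d D ∧ nodeR d D ≤ δ := by
  have h1 := le_pi_cube
  unfold nodeR
  split_ifs with h
  · refine ⟨div_nonneg (by linarith) (by linarith), ?_⟩
    rw [div_le_iff₀ (by linarith)]
    nlinarith
  · exact ⟨le_rfl, hδ.le⟩

theorem nodeR_stress {d D δ x : ℝ} (hδ : 0 < δ) (hdδ : d ≤ δ / 8) (hx : x ≤ 1 / 10 ^ 5 * δ)
    (h : δ / 2 ≤ D ∨ x = 0) (hd : 0 < d) : x ≤ nodeR d D / 8 := by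
  have h1 := pi_cube_le
  have h2 := le_pi_cube
  unfold nodeR
  split_ifs with h3
  · have h4 : 0 ≤ (D - d) / (100 * π ^ 3) := div_nonneg (by linarith) (by linarith)
    rcases h with h | h
    · have : 8 / 10 ^ 5 * δ ≤ (D - d) / (100 * π ^ 3) := by
        rw [le_div_iff₀ (by linarith)]
        nlinarith
      linarith
    · linarith
  · rcases h with h | h
    · exact absurd (by linarith) h3
    · linarith

theorem nodeR_gap {d D D' : ℝ} (hD : |D - D'| ≤ d / 8) (h : 11 / 8 * d ≤ D) :
    |D - 5 / 4 * d - 100 * π ^ 3 * nodeR d D'| ≤ 3 / 8 * d := by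
  have h2 := le_pi_cube
  obtain ⟨h3, h4⟩ := abs_le.1 hD
  unfold nodeR
  split_ifs with h5
  · rw [mul_div_cancel₀ _ (by linarith), abs_le]
    constructor <;> linarith
  · rw [abs_le]
    constructor <;> linarith

theorem nodeR_eq_zero {d D : ℝ} (h : nodeR d D = 0) (hd : 0 < d) : D < 3 / 2 * d := by
  have h2 := le_pi_cube
  unfold nodeR at h
  split_ifs at h with h3
  · rw [div_eq_zero_iff] at h
    rcases h with h | h <;> linarith
  · linarith

theorem En_eq_zero (h : ∀ z ∈ Strip r, ψ t z = 0) (hr : 0 < r) : En ψ t = 0 := by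
  have h1 : ∀ x, (dz ψ * db ψ) t (emb x) = ((0 : ℝ) : ℂ) := fun x => by
    have : dz ψ t (emb x) = dz (0 : ℝ → E → ℂ) t (emb x) :=
      dz_congr (F := ψ) (G := 0) (fun w hw => by simpa using h w hw) (emb_mem hr x)
    rw [Pi.mul_apply, Pi.mul_apply, this]
    simp [dz]
  have h2 := av_const (0 : ℂ) (F := dz ψ * db ψ) (t := t) (by simpa using h1)
  rw [En, h2]; simp

/-- The constant in the iteration. -/
def Cq : ℝ := 10 ^ 15 * Real.exp 80 ^ 2 * Cχ ^ 2

theorem stage {e : ℝ → ℝ} {ρ L δ K δ'' τ Ke : ℝ} {n : ℕ} {ψ F H S : ℝ → E → ℂ}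
    (he : ∀ t t', |e t - e t'| ≤ Ke * |t - t'|) (he0 : ∀ t, 0 ≤ e t)
    (hδ : 0 < δ) (P : Par (Real.exp 80) Cχ Cq (√δ) δ'' τ n L ρ Ke) (hnρ : 64 ≤ n * ρ)
    (hK : 0 ≤ K) (Y : Hyp e ρ L δ K ψ F H S) :
    ∃ ψ' F' H' S' : ℝ → E → ℂ,
      Hyp e (1 / n) (Cq * √δ * n) δ'' (K + Cq * √δ) ψ' F' H' S' ∧
      Inc n (Cq * √δ) (√δ + K) (ψ' - ψ) := by
  have hs2 : √δ ^ 2 = δ := Real.sq_sqrt hδ.le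
  have hn : (0 : ℝ) < n := P.hn
  have hn' : 0 < n := by exact_mod_cast hn
  have hτ := P.hτ
  have hd := P.hd
  have hs := P.hs
  have hdδ : δ'' ≤ δ / 8 := by have := P.hds; rwa [hs2] at this
  set D : ℝ → ℝ := fun t => e t - En ψ t with hD
  set R : ℤ → ℝ := fun j => nodeR δ'' (D (j * τ)) with hR
  have hDδ : ∀ t, D t ≤ 2 * δ := fun t => (le_abs_self _).trans (Y.en t)
  have hw := P.widths hnρ
  have hL := P.hL
  have hρ := P.hρ
  have h8ρ : 8 / (n : ℝ) ≤ ρ := by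
    have e1 : 8 / (n : ℝ) = 16 / n / 2 := by ring
    linarith
  have ub : ∀ j : ℤ, ∀ z ∈ Strip ρ, ‖S (j * τ) z‖ ≤ R j / 8 := fun j z hz =>
    nodeR_stress hδ hdδ (Y.bdS _ z hz)
      ((Y.alt (j * τ)).imp id fun h => by rw [(h z hz).2, norm_zero]) hd
  obtain ⟨g, W, hg1, hg2, hg3⟩ := exists_cell hτ Y.env hL Y.bdz hK P.small hn' hw Y.regS Y.bdDS
    (fun j => nodeR_bounds hd hδ (hDδ (j * τ))) ub
  set A := Real.exp 80 with hA
  set a := A * √δ with ha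
  set η := 160 * (τ * L + 1 / (n * ρ)) with hη
  set T := Cχ / τ with hT
  have ha2 : δ ≤ a ^ 2 := by
    rw [ha, mul_pow, hs2]
    exact le_mul_of_one_le_left hδ.le (one_le_pow₀ P.hA)
  have hun := fun t : ℝ => Set.mem_univ t
  have hJ : IsOpen (Set.univ : Set ℝ) := isOpen_univ
  have h48 : 4 / (n : ℝ) ≤ 8 / n := by gcongr; norm_num
  have h1n4 : 1 / (n : ℝ) ≤ 4 / n := by gcongr; norm_num
  have h1n5 : 1 / (n : ℝ) ≤ 5 / n := by gcongr; norm_num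
  have h1n6 : 1 / (n : ℝ) ≤ 6 / n := by gcongr; norm_num
  have h1n7 : 1 / (n : ℝ) ≤ 7 / n := by gcongr; norm_num
  have h1n8 : 1 / (n : ℝ) ≤ 8 / n := by gcongr; norm_num
  have hS8 : PB ψ T Set.univ (8 / n) (a ^ 2) S := by
    refine ⟨Y.regS.mono h8ρ, fun t _ z hz => (Y.bdS t z (strip_mono h8ρ hz)).trans (by linarith),
      fun t _ z hz => (Y.bdDS t z (strip_mono h8ρ hz)).trans ?_⟩
    exact mul_le_mul ha2 W.hLT hL (by positivity)
  have key : ∀ t, |En (ψ + QG.pot (pert n kap g)) t - En ψ t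
      - 100 * π ^ 3 * nodeSum τ R t| ≤ δ'' / 8 := fun t => W.en_step (hg2 t) P.energy
  set w := QG.pot (pert n kap g) with hwdef
  set S' := newS ψ S n kap g with hS'
  have nS' : ∀ t ∈ Set.univ, ∀ z ∈ Strip (6 / (n : ℝ)), ‖S' t z‖ ≤ 1 / 10 ^ 5 * δ'' :=
    fun t ht z hz => by
      have h1 := hg1 t z (strip_mono (by gcongr; norm_num) hz)
      have h2 := W.norm_newS ht hz h1
      have h3 := P.stress
      rw [hs2] at h3
      exact h2.trans h3
  have var : ∀ t p, |D t - D (nd p (t / τ) * τ)| ≤ δ'' / 8 := fun t p => by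
    have h1 : |t - nd p (t / τ) * τ| ≤ τ := by
      obtain ⟨h2, h3⟩ := nd_dist p (t / τ)
      have e1 : t - nd p (t / τ) * τ = (t / τ - nd p (t / τ)) * τ := by field_simp
      rw [e1, abs_mul, abs_of_pos hτ]
      exact mul_le_of_le_one_left hτ.le (abs_le.2 ⟨by linarith, by linarith⟩)
    have h2 := P.var
    rw [hs2] at h2
    have h3 := abs_sub (e t - e (nd p (t / τ) * τ)) (En ψ t - En ψ (nd p (t / τ) * τ))
    have h4 := he t (nd p (t / τ) * τ)
    have h5 := Y.lip t (nd p (t / τ) * τ)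
    have h6 := mul_le_mul_of_nonneg_left h1 P.hKe
    have h7 := mul_le_mul_of_nonneg_left h1 (mul_nonneg hδ.le hL)
    rw [show D t - D (nd p (t / τ) * τ) = (e t - e (nd p (t / τ) * τ))
      - (En ψ t - En ψ (nd p (t / τ) * τ)) by simp only [hD]; ring]
    linarith
  have main : ∀ t, |e t - En (ψ + w) t| ≤ 2 * δ'' ∧ (δ'' / 2 ≤ e t - En (ψ + w) t ∨
      ∀ z ∈ Strip (1 / (n : ℝ)), (ψ + w) t z = 0 ∧ S' t z = 0) := fun t => by
    by_cases h : ∀ p, R (nd p (t / τ)) = 0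
    · have h1 := hg3 t h
      have h2 := nodeR_eq_zero (h true) hd
      have h3 := (abs_le.1 (var t true)).2
      have h4 : ∀ z ∈ Strip ρ, ψ t z = 0 ∧ S t z = 0 :=
        (Y.alt t).resolve_left fun h5 => by
          have : δ / 2 ≤ D t := h5
          linarith
      have h5 : w t = 0 := pot_eq_zero (pert_eq_zero h1.self_of_nhds)
      have h6 : S' t = S t := newS_eq_self h1
      have h7 : En ψ t = 0 := En_eq_zero (fun z hz => (h4 z hz).1) hρ
      have h8 : En (ψ + w) t = 0 := En_eq_zero (fun z hz => by simp [h5, (h4 z hz).1]) hρ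
      refine ⟨?_, Or.inr fun z hz => ?_⟩
      · have h9 : D t = e t := by simp [hD, h7]
        rw [h8, sub_zero, abs_of_nonneg (he0 t)]
        linarith
      · have h9 := h4 z (strip_mono (h1n8.trans h8ρ) hz)
        rw [h6]
        exact ⟨by simp [h5, h9.1], h9.2⟩
    · push Not at h
      obtain ⟨p, hp⟩ := h
      have h1 : 3 / 2 * δ'' ≤ D (nd p (t / τ) * τ) := by
        by_contra h2
        exact hp (by simp only [hR, nodeR]; rw [if_neg h2])
      have h2 := (abs_le.1 (var t p)).1
      have h3 := norm_nodeSum_sub_le (τ := τ) (t := t) (h := fun j => 100 * π ^ 3 * R j)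
        (x := D t - 5 / 4 * δ'') (ε := 3 / 8 * δ'')
        fun q => nodeR_gap (var t q) (by linarith)
      have h4 : nodeSum τ (fun j => 100 * π ^ 3 * R j) t = 100 * π ^ 3 * nodeSum τ R t := by
        simp only [nodeSum, smul_eq_mul, Finset.mul_sum]
        exact Finset.sum_congr rfl fun _ _ => by ring
      rw [h4, Real.norm_eq_abs, abs_le] at h3
      obtain ⟨h5, h6⟩ := abs_le.1 (key t)
      have h7 : D t = e t - En ψ t := rfl
      refine ⟨abs_le.2 ⟨by linarith [h3.2], by linarith [h3.1]⟩, Or.inl (by linarith [h3.2])⟩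
  have hfr := W.pb_pert.reg
  refine ⟨ψ + w, F + pert n kap g, H + (prs ψ (pert n kap g) + prs2 n kap g), S', ?_, ?_⟩
  · refine ⟨(W.pb_newS hS8).reg.mono h1n6, (Y.regF.mono (h1n8.trans h8ρ)).add hJ (hfr.mono h1n8),
      ?_, ?_, ?_, ?_, ?_, ?_, ?_, ?_, fun t => (main t).1, fun t => (main t).2, ?_⟩
    · have hψ := W.env.reg
      have hp : Rg Set.univ (8 / n) (prs ψ (pert n kap g)) :=
        (((hψ.toRg.db W.hJ).mul hfr.toRg).sub ((hψ.toRg.dz W.hJ).mul hfr.toRg.sm)).smul _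
      exact (Y.regH.mono (h1n8.trans h8ρ)).add ((hp.add W.pb_prs2.reg.toRg).mono h1n8)
    · rw [sm_add, sm_add, sm_prs Y.env.real, sm_prs2 freq_kap, Y.realH]
    · exact (W.new_env P.env1 P.env2).mono h1n4
    · intro t z hz
      have hz8 := strip_mono h1n8 hz
      have e1 := (Y.regF.mono h8ρ).toRg.db_add hfr.toRg (hun t) hz8
      have e2 := (Y.regF.mono h8ρ).toRg.sm.dz_add hfr.toRg.sm (hun t) hz8
      have e3 := Y.pot t z (strip_mono h8ρ hz8)
      rw [Pi.add_apply, Pi.add_apply, e3, hwdef]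
      simp only [QG.pot, Pi.smul_apply, Pi.sub_apply, sm_add, e1, e2]
      simp only [smul_eq_mul]
      ring
    · intro t z hz
      exact newS_eq W (Y.regF.mono h8ρ) (Y.regH.mono h8ρ) (hun t) (strip_mono h1n7 hz)
        (Y.eqn t z (strip_mono (h1n8.trans h8ρ) hz))
    · intro t z hz
      rw [(W.env.reg.mono h1n8).toRg.dz_add (W.pb_w.reg.mono h1n7).toRg (hun t) hz]
      refine (norm_add_le _ _).trans (add_le_add (Y.bdz t z (strip_mono (h1n8.trans h8ρ) hz)) ?_)
      exact (W.pb_dzw.bd t (hun t) z (strip_mono h1n6 hz)).trans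
        (P.coef (by norm_num) (by norm_num))
    · exact fun t z hz => nS' t (hun t) z (strip_mono h1n6 hz)
    · exact fun t z hz => (W.norm_Dt_newS hS8 nS' (hun t) (strip_mono h1n5 hz)).trans P.transport
    · have := W.en_lip Y.lip (x := δ'' * (Cq * √δ * n)) ?_
      · exact this
      · have := P.energy_lip
        rwa [hs2] at this
  · rw [add_sub_cancel_left]
    exact W.inc (fun t z hz => Y.bdz t z (strip_mono h8ρ hz)) (P.coef (by norm_num) (by norm_num))
      P.coefT

end

section

theorem eventually_mul_rpow_le (c : ℝ) {p q : ℝ} (h : p < q) :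
    ∀ᶠ x : ℝ in atTop, c * x ^ p ≤ x ^ q := by
  filter_upwards [(tendsto_rpow_atTop (sub_pos.2 h)).eventually_ge_atTop c,
    eventually_gt_atTop 0] with x hx hx0
  have : x ^ q = x ^ (q - p) * x ^ p := by rw [← Real.rpow_add hx0]; ring_nf
  rw [this]
  gcongr

theorem exists_base {β b : ℝ} (hβ : 0 < β) (hb : 1 < b) (hbβ : β * (4 * b + 1) < 1) (C Ke : ℝ) :
    ∃ Λ : ℝ, 1 ≤ Λ ∧ ∀ x, Λ ≤ x →
      8 * (x ^ (-(β * b * b))) ^ 2 ≤ (x ^ (-(β * b))) ^ 2 ∧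
      2 * C * x ^ (-β) * x ≤ x ^ (-(β * b)) * x ^ b ∧
      2 * C ^ 3 * (x ^ (-(β * b))) ^ 3 * x ^ (-β) * x ≤ (x ^ (-(β * b * b))) ^ 4 * x ^ b ∧
      2 * C * (x ^ (-(β * b))) ^ 2 * x ≤ (x ^ (-(β * b * b))) ^ 2 * x ^ b ∧
      C ^ 2 * Ke * x ^ (-(β * b)) ≤ (x ^ (-(β * b * b))) ^ 4 * x ^ b ∧
      128 * x ≤ x ^ b := by
  have hb' : 0 < b - 1 := sub_pos.2 hb
  have h1 := eventually_mul_rpow_le 8 (p := -(β * b * b) * 2) (q := -(β * b) * 2) (by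
    nlinarith [mul_pos (mul_pos hβ hb') (zero_lt_one.trans hb)])
  have h2 := eventually_mul_rpow_le (2 * C) (p := -β + 1) (q := -(β * b) + b) (by
    nlinarith [mul_pos hb' (show 0 < 1 - β by nlinarith)])
  have h3 := eventually_mul_rpow_le (2 * C ^ 3) (p := -(β * b) * 3 + -β + 1)
    (q := -(β * b * b) * 4 + b) (by nlinarith [mul_pos hb' (sub_pos.2 hbβ)])
  have h4 := eventually_mul_rpow_le (2 * C) (p := -(β * b) * 2 + 1)
    (q := -(β * b * b) * 2 + b) (by
      nlinarith [mul_pos hb' (show 0 < 1 - β * (2 * b) by nlinarith [mul_pos hβ hb'])])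
  have h5 := eventually_mul_rpow_le (C ^ 2 * Ke) (p := -(β * b))
    (q := -(β * b * b) * 4 + b) (by
      nlinarith [mul_pos hb' (sub_pos.2 hbβ), mul_pos hβ hb'])
  have h6 := eventually_mul_rpow_le 128 (p := 1) (q := b) hb
  obtain ⟨Λ, hΛ⟩ := eventually_atTop.1
    (h1.and (h2.and (h3.and (h4.and (h5.and (h6.and (eventually_ge_atTop 1)))))))
  refine ⟨max Λ 1, le_max_right _ _, fun x hx => ?_⟩
  obtain ⟨h1, h2, h3, h4, h5, h6, h0⟩ := hΛ x ((le_max_left _ _).trans hx)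
  have hx0 : 0 < x := by linarith
  have pw : ∀ (p : ℝ) (k : ℕ), x ^ (p * k) = (x ^ p) ^ k := fun p k =>
    Real.rpow_mul_natCast hx0.le p k
  have pw2 := fun p => pw p 2
  have pw3 := fun p => pw p 3
  have pw4 := fun p => pw p 4
  push_cast at pw2 pw3 pw4
  simp only [Real.rpow_add hx0, pw2, pw3, pw4, Real.rpow_one] at h1 h2 h3 h4 h5 h6
  exact ⟨h1, by linarith, by linarith, by linarith, h5, h6⟩

theorem par_of_base {x y p p1 p2 u Ke : ℝ} {n₀ n₁ : ℕ} (hx : 1 ≤ x) (hp : 0 < p) (hp1 : 0 < p1)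
    (hp2 : 0 < p2) (hu : 1 ≤ u) (hKe : 0 ≤ Ke) (hn0 : x ≤ n₀) (hn0' : n₀ ≤ 2 * x) (hn1 : y ≤ n₁)
    (h1 : 8 * p2 ^ 2 ≤ p1 ^ 2) (h2 : 2 * Cq * p * x ≤ p1 * y)
    (h3 : 2 * Cq ^ 3 * p1 ^ 3 * p * x ≤ p2 ^ 4 * y) (h4 : 2 * Cq * p1 ^ 2 * x ≤ p2 ^ 2 * y)
    (h5 : Cq ^ 2 * Ke * p1 ≤ p2 ^ 4 * y) (h6 : 128 * x ≤ y) :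
    Par (Real.exp 80) Cχ Cq (u * p1) ((u * p2) ^ 2) (Cq * (u * p1) / ((u * p2) ^ 2 * n₁)) n₁
      (Cq * (u * p) * n₀) (1 / n₀) Ke ∧ 64 ≤ n₁ * (1 / (n₀ : ℝ)) := by
  have hX := one_le_Cχ
  have hC : 0 < Cq := by unfold Cq; positivity
  have hn0p : (0 : ℝ) < n₀ := by linarith
  have hn1p : (0 : ℝ) < n₁ := by linarith
  have hup : 0 < u := by linarith
  refine ⟨⟨Real.one_le_exp (by norm_num), hX, rfl, by positivity, by positivity, ?_, by positivity,
    hn1p, by positivity, ?_, by positivity, hKe, ?_, ?_, ?_, ?_⟩, ?_⟩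
  · rw [mul_pow, mul_pow]
    have : u ^ 2 * p2 ^ 2 ≤ u ^ 2 * (p1 ^ 2 / 8) := by gcongr; linarith
    linarith
  · calc Cq * (u * p) * n₀ ≤ Cq * (u * p) * (2 * x) := by gcongr
      _ = u * (2 * Cq * p * x) := by ring
      _ ≤ u * (p1 * y) := by gcongr
      _ ≤ u * (p1 * n₁) := by gcongr
      _ = _ := by ring
  · have e : Cq * ((u * p1) ^ 2 * (Cq * (u * p1) / ((u * p2) ^ 2 * n₁)) * (Cq * (u * p) * n₀))
        = u ^ 4 * (Cq ^ 3 * p1 ^ 3 * p * n₀) / ((u * p2) ^ 2 * n₁) := by ring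
    rw [e, div_le_iff₀ (by positivity)]
    calc u ^ 4 * (Cq ^ 3 * p1 ^ 3 * p * n₀) ≤ u ^ 4 * (Cq ^ 3 * p1 ^ 3 * p * (2 * x)) := by gcongr
      _ = u ^ 4 * (2 * Cq ^ 3 * p1 ^ 3 * p * x) := by ring
      _ ≤ u ^ 4 * (p2 ^ 4 * y) := by gcongr
      _ ≤ u ^ 4 * (p2 ^ 4 * n₁) := by gcongr
      _ = _ := by ring
  · rw [mul_one_div, le_div_iff₀ hn0p]
    calc Cq * (u * p1) ^ 2 * n₀ ≤ Cq * (u * p1) ^ 2 * (2 * x) := by gcongr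
      _ = u ^ 2 * (2 * Cq * p1 ^ 2 * x) := by ring
      _ ≤ u ^ 2 * (p2 ^ 2 * y) := by gcongr
      _ ≤ u ^ 2 * (p2 ^ 2 * n₁) := by gcongr
      _ = _ := by ring
  · exact le_of_eq (by field_simp)
  · have e : Cq * Ke * (Cq * (u * p1) / ((u * p2) ^ 2 * n₁))
        = u * (Cq ^ 2 * Ke * p1) / ((u * p2) ^ 2 * n₁) := by ring
    rw [e, div_le_iff₀ (by positivity)]
    have hu4 : u ≤ u ^ 4 := le_self_pow₀ hu (by norm_num)
    calc u * (Cq ^ 2 * Ke * p1) ≤ u ^ 4 * (Cq ^ 2 * Ke * p1) := by gcongr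
      _ ≤ u ^ 4 * (p2 ^ 4 * y) := by gcongr
      _ ≤ u ^ 4 * (p2 ^ 4 * n₁) := by gcongr
      _ = _ := by ring
  · rw [mul_one_div, le_div_iff₀ hn0p]
    linarith

theorem exists_seq {ζ : ℝ} (hζ0 : 0 < ζ) (hζ : ζ < 1 / 5) {Ke : ℝ} (hKe : 0 ≤ Ke) (M : ℝ) :
    ∃ (δ τ : ℕ → ℝ) (n : ℕ → ℕ), (∀ q, 0 < δ q) ∧ (∀ q, 0 < n q) ∧
      (∀ q, Par (Real.exp 80) Cχ Cq (√(δ (q + 1))) (δ (q + 2)) (τ q) (n (q + 1))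
        (Cq * √(δ q) * n q) (1 / n q) Ke ∧ 64 ≤ n (q + 1) * (1 / (n q : ℝ))) ∧
      M ≤ 2 * δ 1 ∧ Summable fun q => √(δ q) * (n q : ℝ) ^ ζ := by
  obtain ⟨β, hβ1, hβ2⟩ := exists_between hζ
  have hβ : 0 < β := hζ0.trans hβ1
  obtain ⟨b, hb, hbβ⟩ : ∃ b, 1 < b ∧ β * (4 * b + 1) < 1 := by
    refine ⟨1 + (1 / β - 5) / 8, ?_, ?_⟩
    · have : 5 < 1 / β := by rw [lt_div_iff₀ hβ]; linarith
      linarith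
    · field_simp
      nlinarith
  obtain ⟨Λ, hΛ1, hΛ⟩ := exists_base hβ hb hbβ Cq Ke
  set x : ℕ → ℝ := fun q => Λ ^ (b ^ q) with hx
  have hΛ0 : 0 < Λ := by linarith
  have hxs : ∀ q, x (q + 1) = x q ^ b := fun q => by
    simp only [hx]; rw [← Real.rpow_mul hΛ0.le, pow_succ]
  have hxΛ : ∀ q, Λ ≤ x q := fun q => by
    simpa using Real.rpow_le_rpow_of_exponent_le hΛ1 (one_le_pow₀ hb.le (n := q))
  have hx0 : ∀ q, 0 < x q := fun q => hΛ0.trans_le (hxΛ q)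
  have hx128 : ∀ q, (128 : ℝ) ^ q ≤ x q := fun q => by
    induction q with
    | zero => simpa [hx] using hΛ1
    | succ q ih =>
      rw [hxs, pow_succ]
      have := (hΛ _ (hxΛ q)).2.2.2.2.2
      linarith
  have hc : ∀ q, (⌈x q⌉₊ : ℝ) ≤ 2 * x q := fun q => by
    have := (Nat.ceil_lt_add_one (hx0 q).le).le
    have := (hΛ1.trans (hxΛ q))
    linarith
  obtain ⟨u, hu1, hu⟩ : ∃ u : ℝ, 1 ≤ u ∧ M ≤ 2 * (u * x 1 ^ (-β)) ^ 2 := by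
    set c := x 1 ^ (-β) with hc
    have hc0 : 0 < c := Real.rpow_pos_of_pos (hx0 1) _
    refine ⟨max 1 (max 1 M / c), le_max_left _ _, ?_⟩
    have h1 : max 1 M ≤ max 1 (max 1 M / c) * c := by
      rw [← div_le_iff₀ hc0]; exact le_max_right _ _
    have h2 := le_max_left 1 M
    have h3 := le_max_right 1 M
    nlinarith
  have hs : ∀ q, √((u * x q ^ (-β)) ^ 2) = u * x q ^ (-β) := fun q =>
    Real.sqrt_sq (mul_nonneg (by linarith) (Real.rpow_nonneg (hx0 q).le _))
  have hpos : ∀ q, 0 < x q ^ (-β) := fun q => Real.rpow_pos_of_pos (hx0 q) _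
  refine ⟨fun q => (u * x q ^ (-β)) ^ 2, fun q => Cq * (u * x (q + 1) ^ (-β)) /
    ((u * x (q + 2) ^ (-β)) ^ 2 * ⌈x (q + 1)⌉₊), fun q => ⌈x q⌉₊, fun q => ?_, fun q => ?_,
    fun q => ?_, hu, ?_⟩
  · have := hpos q
    positivity
  · exact Nat.ceil_pos.2 (hx0 q)
  · obtain ⟨h1, h2, h3, h4, h5, h6⟩ := hΛ _ (hxΛ q)
    have e1 : x (q + 1) ^ (-β) = x q ^ (-(β * b)) := by
      rw [hxs, ← Real.rpow_mul (hx0 q).le]; ring_nf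
    have e2 : x (q + 2) ^ (-β) = x q ^ (-(β * b * b)) := by
      rw [hxs, hxs, ← Real.rpow_mul (hx0 q).le, ← Real.rpow_mul (hx0 q).le]; ring_nf
    simp only [hs]
    rw [← e1, ← e2] at h1
    rw [← e1, ← hxs] at h2
    rw [← e1, ← e2, ← hxs] at h3
    rw [← e1, ← e2, ← hxs] at h4
    rw [← e1, ← e2, ← hxs] at h5
    rw [← hxs] at h6
    exact par_of_base (hΛ1.trans (hxΛ q)) (hpos q) (hpos _) (hpos _) hu1 hKe (Nat.le_ceil _) (hc q)
      (Nat.le_ceil _) h1 h2 h3 h4 h5 h6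
  · have hg : 0 < β - ζ := by linarith
    have hsum : Summable fun q : ℕ => (2 * u) * ((128 : ℝ) ^ (-(β - ζ))) ^ q :=
      (summable_geometric_of_lt_one (by positivity)
        (Real.rpow_lt_one_of_one_lt_of_neg (by norm_num) (by linarith))).mul_left _
    refine Summable.of_nonneg_of_le (fun q => by positivity) (fun q => ?_) hsum
    simp only [hs]
    have h1 : (⌈x q⌉₊ : ℝ) ^ ζ ≤ 2 * x q ^ ζ := by
      calc (⌈x q⌉₊ : ℝ) ^ ζ ≤ (2 * x q) ^ ζ := by
            gcongr; exact hc q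
        _ = 2 ^ ζ * x q ^ ζ := Real.mul_rpow (by norm_num) (hx0 q).le
        _ ≤ 2 * x q ^ ζ := by
            have : (2 : ℝ) ^ ζ ≤ 2 ^ (1 : ℝ) :=
              Real.rpow_le_rpow_of_exponent_le (by norm_num) (by linarith)
            rw [Real.rpow_one] at this
            have := Real.rpow_nonneg (hx0 q).le ζ
            gcongr
    have h2 : x q ^ (-β) * x q ^ ζ = x q ^ (-(β - ζ)) := by
      rw [← Real.rpow_add (hx0 q)]; ring_nf
    have h3 : x q ^ (-(β - ζ)) ≤ ((128 : ℝ) ^ (-(β - ζ))) ^ q := by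
      have e : ((128 : ℝ) ^ (-(β - ζ))) ^ q = ((128 : ℝ) ^ q) ^ (-(β - ζ)) := by
        rw [← Real.rpow_natCast, ← Real.rpow_mul (by norm_num), mul_comm _ (q : ℝ),
          Real.rpow_mul (by norm_num), Real.rpow_natCast]
      rw [e]
      exact Real.rpow_le_rpow_of_nonpos (by positivity) (hx128 q) (by linarith)
    have hp := hpos q
    calc u * x q ^ (-β) * (⌈x q⌉₊ : ℝ) ^ ζ ≤ u * x q ^ (-β) * (2 * x q ^ ζ) := by gcongr
      _ = 2 * u * (x q ^ (-β) * x q ^ ζ) := by ring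
      _ ≤ _ := by rw [h2]; gcongr

end

section

variable {J : Set ℝ} {r s : ℝ} {F G : ℝ → E → ℂ} {t : ℝ} {z : E} {ψ : ℝ → E → ℂ}
variable {L T M N n η a : ℝ} {f : ℝ → E → ℂ}

theorem exists_dependent_seq {T : Type*} {P : ℕ → T → Prop} {R : ℕ → T → T → Prop} {x : T}
    (h0 : P 0 x) (h : ∀ q x, P q x → ∃ y, P (q + 1) y ∧ R q x y) :
    ∃ f : ℕ → T, f 0 = x ∧ ∀ q, P q (f q) ∧ R q (f q) (f (q + 1)) := by
  choose! g hg using h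
  let f : ℕ → T := fun q => Nat.rec x (fun q y => g q y) q
  have hf : ∀ q, P q (f q) := fun q => by
    induction q with
    | zero => exact h0
    | succ q ih => exact (hg q _ ih).1
  exact ⟨f, rfl, fun q => ⟨hf q, (hg q _ (hf q)).2⟩⟩

theorem dz_zero : dz 0 = 0 := funext fun _ => dz_eq_zero rfl
theorem db_zero : db 0 = 0 := funext fun _ => db_eq_zero rfl
theorem dt_zero : dt 0 = 0 := funext fun _ => dt_eq_zero (Eventually.of_forall fun _ => rfl)
theorem sm_zero : sm 0 = 0 := funext fun _ => sm_eq_zero rfl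

theorem Env2.zero (hL : 0 ≤ L) : Env2 0 Set.univ r L where
  reg := R1.zero isOpen_univ
  real := sm_zero
  zz := by rw [dz_zero, dz_zero]; exact (PB.zero isOpen_univ).le hL hL
  zb := by rw [db_zero, dz_zero]; exact (PB.zero isOpen_univ).le hL hL
  bb := by rw [db_zero, db_zero]; exact (PB.zero isOpen_univ).le hL hL

theorem Hyp.zero {e : ℝ → ℝ} {ρ L δ : ℝ} (hρ : 0 < ρ) (hL : 0 ≤ L) (hδ : 0 ≤ δ)
    (he0 : ∀ t, 0 ≤ e t) (he : ∀ t, e t ≤ 2 * δ) : Hyp e ρ L δ 0 0 0 0 0 := by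
  have hE : ∀ t, En 0 t = 0 := fun t => En_eq_zero (r := ρ) (fun _ _ => rfl) hρ
  exact
  { regS := R1.zero isOpen_univ
    regF := R1.zero isOpen_univ
    regH := Rg.zero
    realH := sm_zero
    env := Env2.zero hL
    pot := fun t z _ => by simp [QG.pot, db_zero, dz_zero, sm_zero]
    eqn := fun t z _ => by simp [dz_zero, dt_zero]
    bdz := fun t z _ => by simp [dz_zero]
    bdS := fun t z _ => by simpa using by positivity
    bdDS := fun t z _ => by rw [Dt_zero]; simpa using by positivity
    en := fun t => by rw [hE, sub_zero, abs_of_nonneg (he0 t)]; exact he t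
    alt := fun t => Or.inr fun _ _ => ⟨rfl, rfl⟩
    lip := fun t t' => by rw [hE, hE]; simpa using by positivity }

theorem Inc.mono {B D D' : ℝ} {w : ℝ → E → ℂ} (h : Inc n B D w) (hB : 0 ≤ B) (hn : 0 ≤ n)
    (hD : D ≤ D') : Inc n B D' w where
  reg := h.reg
  b0 := h.b0
  bz := h.bz
  bb := h.bb
  bzz := h.bzz
  bzb := h.bzb
  bt := fun t z hz => (h.bt t z hz).trans (by gcongr)

/-- The convex integration sequence. -/
theorem exists_iteration {e : ℝ → ℝ} {ζ Ke M : ℝ} (hζ0 : 0 < ζ) (hζ : ζ < 1 / 5) (hKe : 0 ≤ Ke)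
    (he : ∀ t t', |e t - e t'| ≤ Ke * |t - t'|) (he0 : ∀ t, 0 ≤ e t) (heM : ∀ t, e t ≤ M) :
    ∃ (ψ F H S : ℕ → ℝ → E → ℂ) (δ B L K : ℕ → ℝ) (n : ℕ → ℕ) (D : ℝ),
      ψ 0 = 0 ∧ (∀ q, 0 < n q) ∧ (∀ q, 0 ≤ B q) ∧ 0 ≤ D ∧
      (∀ q, Hyp e (1 / n q) (L q) (δ q) (K q) (ψ q) (F q) (H q) (S q)) ∧
      (∀ q, Inc (n (q + 1)) (B q) D (ψ (q + 1) - ψ q)) ∧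
      Tendsto δ atTop (𝓝 0) ∧ Summable fun q => B q * (n (q + 1) : ℝ) ^ ζ := by
  obtain ⟨δ, τ, n, hδ, hn, P, hM, hsum⟩ := exists_seq hζ0 hζ hKe M
  have hCq : 1 ≤ Cq := by
    have h1 := (P 0).1.hA
    have h2 := (P 0).1.hX
    rw [Cq]
    have h3 := one_le_pow₀ h1 (n := 2)
    have h4 := one_le_pow₀ h2 (n := 2)
    nlinarith
  have hB0 : ∀ q, 0 ≤ Cq * √(δ (q + 1)) := fun q => by positivity
  have hn1 : ∀ q, (1 : ℝ) ≤ n q := fun q => by exact_mod_cast hn q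
  have hs0 : Summable fun q => √(δ q) :=
    Summable.of_nonneg_of_le (fun q => by positivity) (fun q => le_mul_of_one_le_right (by positivity)
      (Real.one_le_rpow (hn1 q) hζ0.le)) hsum
  have hs1 : Summable fun q => Cq * √(δ (q + 1)) := ((summable_nat_add_iff 1).2 hs0).mul_left Cq
  set K : ℕ → ℝ := fun q => ∑ i ∈ Finset.range q, Cq * √(δ (i + 1)) with hK
  have hK0 : ∀ q, 0 ≤ K q := fun q => Finset.sum_nonneg fun i _ => hB0 i
  have hKD : ∀ q, √(δ (q + 1)) + K q ≤ ∑' q, Cq * √(δ (q + 1)) := fun q => by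
    refine le_trans ?_ (hs1.sum_le_tsum (Finset.range (q + 1)) fun i _ => hB0 i)
    rw [Finset.sum_range_succ, add_comm]
    gcongr
    exact le_mul_of_one_le_left (by positivity) hCq
  have key := exists_dependent_seq (T := (ℝ → E → ℂ) × (ℝ → E → ℂ) × (ℝ → E → ℂ) × (ℝ → E → ℂ))
    (P := fun q p => Hyp e (1 / n q) (Cq * √(δ q) * n q) (δ (q + 1)) (K q) p.1 p.2.1 p.2.2.1 p.2.2.2)
    (R := fun q p p' => Inc (n (q + 1)) (Cq * √(δ (q + 1))) (√(δ (q + 1)) + K q) (p'.1 - p.1))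
    (x := (0, 0, 0, 0)) (by
      have h1 := hn1 0
      have : K 0 = 0 := by simp [hK]
      simp only [this]
      exact Hyp.zero (by positivity) (by positivity) (hδ _).le he0 fun t => (heM t).trans hM)
    (fun q p hp => by
      obtain ⟨ψ', F', H', S', h1, h2⟩ := stage he he0 (hδ _) (P q).1 (P q).2 (hK0 q) hp
      refine ⟨(ψ', F', H', S'), ?_, h2⟩
      have : K (q + 1) = K q + Cq * √(δ (q + 1)) := Finset.sum_range_succ _ _
      rw [this]
      exact h1)
  obtain ⟨f, hf0, hf⟩ := key
  refine ⟨fun q => (f q).1, fun q => (f q).2.1, fun q => (f q).2.2.1, fun q => (f q).2.2.2,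
    fun q => δ (q + 1), fun q => Cq * √(δ (q + 1)), fun q => Cq * √(δ q) * n q, K, n,
    ∑' q, Cq * √(δ (q + 1)), by simp only [hf0], hn, hB0, tsum_nonneg hB0, fun q => (hf q).1, fun q =>
      (hf q).2.mono (hB0 q) (by positivity) (hKD q), ?_, ?_⟩
  · have h1 := (hs0.tendsto_atTop_zero.comp (tendsto_add_atTop_nat 1)).pow 2
    simp only [ne_eq, OfNat.ofNat_ne_zero, not_false_eq_true, zero_pow] at h1
    refine h1.congr fun q => ?_
    simp [Real.sq_sqrt (hδ _).le]
  · have := ((summable_nat_add_iff 1).2 hsum).mul_left Cq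
    refine this.congr fun q => by ring

end

section

variable {J : Set ℝ} {r s : ℝ} {F G : ℝ → E → ℂ} {t : ℝ} {z : E} {ψ : ℝ → E → ℂ}
variable {L T M N n η a : ℝ} {f : ℝ → E → ℂ}

/-- Continuous functions on space-time that are compactly supported in time. -/
structure Nice (k : ℝ → (Fin 3 → ℝ) → ℂ) : Prop where
  cont : Continuous (Function.uncurry k)
  supp : ∃ T, ∀ t, T < |t| → ∀ x, k t x = 0

/-- The space-time integral. -/
def tot (k : ℝ → (Fin 3 → ℝ) → ℂ) : ℂ := ∫ t, ∫ x in box3, k t x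

variable {k l : ℝ → (Fin 3 → ℝ) → ℂ}

theorem isCompact_box3 : IsCompact box3 := isCompact_Icc

theorem integrable_of_time_supp {V : Type*} [NormedAddCommGroup V] {u : ℝ → V} (hu : Continuous u)
    {T : ℝ} (h : ∀ t, T < |t| → u t = 0) : Integrable u :=
  hu.integrable_of_hasCompactSupport (HasCompactSupport.intro (isCompact_closedBall 0 T)
    fun t ht => h t (by simpa using ht))

theorem Nice.intX (hk : Nice k) (t : ℝ) : IntegrableOn (k t) box3 :=
  (hk.cont.comp (Continuous.prodMk_right t)).continuousOn.integrableOn_compact isCompact_box3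

theorem Nice.intT (hk : Nice k) : Integrable fun t => ∫ x in box3, k t x := by
  obtain ⟨T, hT⟩ := hk.supp
  refine integrable_of_time_supp (continuous_parametric_integral_of_continuous hk.cont
    isCompact_box3) (T := T) fun t ht => ?_
  simp [hT t ht]

theorem Nice.add (hk : Nice k) (hl : Nice l) : Nice (k + l) where
  cont := hk.cont.add hl.cont
  supp := by
    obtain ⟨T, hT⟩ := hk.supp
    obtain ⟨T', hT'⟩ := hl.supp
    exact ⟨max T T', fun t ht x => by
      simp [hT t ((le_max_left _ _).trans_lt ht), hT' t ((le_max_right _ _).trans_lt ht)]⟩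

theorem Nice.smul (hk : Nice k) (c : ℂ) : Nice (c • k) where
  cont := hk.cont.const_smul c
  supp := hk.supp.imp fun T hT t ht x => by simp [hT t ht]

theorem tot_add (hk : Nice k) (hl : Nice l) : tot (k + l) = tot k + tot l := by
  rw [tot, tot, tot, ← integral_add hk.intT hl.intT]
  exact integral_congr_ae (Eventually.of_forall fun t => integral_add (hk.intX t) (hl.intX t))

theorem tot_smul (c : ℂ) (k : ℝ → (Fin 3 → ℝ) → ℂ) : tot (c • k) = c * tot k := by
  simp only [tot, Pi.smul_apply, smul_eq_mul, integral_const_mul]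

theorem tot_conj (k : ℝ → (Fin 3 → ℝ) → ℂ) : tot (fun t x => conj (k t x)) = conj (tot k) := by
  simp only [tot, integral_conj]

theorem tot_re (hk : Nice k) : ∫ t, ∫ x in box3, (k t x).re = (tot k).re := by
  have h1 : ∀ t, ∫ x in box3, (k t x).re = (∫ x in box3, k t x).re := fun t => integral_re (hk.intX t)
  simp only [h1]
  exact integral_re hk.intT

theorem tot_tendsto {k : ℕ → ℝ → (Fin 3 → ℝ) → ℂ} {T c : ℝ} (hk : ∀ q, Nice (k q))
    (hT : ∀ q t, T < |t| → ∀ x, k q t x = 0) (hc : ∀ q t, ∀ x ∈ box3, ‖k q t x‖ ≤ c)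
    (hl : ∀ t x, Tendsto (fun q => k q t x) atTop (𝓝 (l t x))) :
    Tendsto (fun q => tot (k q)) atTop (𝓝 (tot l)) := by
  refine tendsto_integral_of_dominated_convergence
    ((closedBall 0 T).indicator fun _ => c * (volume box3).toReal) (fun q => (hk q).intT.1)
    ((integrable_indicator_iff measurableSet_closedBall).2
      (integrableOn_const measure_closedBall_lt_top.ne)) (fun q => Eventually.of_forall fun t => ?_)
    (Eventually.of_forall fun t => ?_)
  · by_cases ht : T < |t|
    · rw [Set.indicator_of_notMem (by simpa using ht)]
      simp [hT q t ht]
    · rw [Set.indicator_of_mem (by simpa using ht)]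
      exact norm_setIntegral_le_of_norm_le_const volume_box3_lt (hc q t)
  · refine tendsto_integral_of_dominated_convergence (fun _ => c) (fun q => ((hk q).intX t).1)
      (integrableOn_const volume_box3_lt.ne) (fun q => ?_) (Eventually.of_forall fun x => hl t x)
    exact (ae_restrict_mem measurableSet_Icc).mono fun x hx => hc q t x hx

theorem tot_deriv (hk : Nice k) (hl : Nice l) (h : ∀ t x, HasDerivAt (fun t => k t x) (l t x) t) :
    tot l = 0 := by
  obtain ⟨T, hT⟩ := hl.supp
  obtain ⟨T', hT'⟩ := hk.supp
  have hi : Integrable (Function.uncurry l) (volume.prod (volume.restrict box3)) := by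
    have h1 : IntegrableOn (Function.uncurry l) (closedBall 0 T ×ˢ box3)
        ((volume : Measure ℝ).prod volume) :=
      hl.cont.continuousOn.integrableOn_compact ((isCompact_closedBall 0 T).prod isCompact_box3)
    have h2 : (volume : Measure ℝ).prod ((volume : Measure (Fin 3 → ℝ)).restrict box3) =
        ((volume : Measure ℝ).prod volume).restrict (Set.univ ×ˢ box3) := by
      rw [← Measure.prod_restrict, Measure.restrict_univ]
    rw [h2]
    refine h1.of_forall_sdiff_eq_zero (MeasurableSet.univ.prod measurableSet_Icc) ?_
    rintro ⟨t, x⟩ ⟨hx, hx'⟩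
    refine hT t ?_ x
    by_contra hc
    exact hx' ⟨by simpa using hc, hx.2⟩
  rw [tot, integral_integral_swap hi]
  refine integral_eq_zero_of_ae (Eventually.of_forall fun x => ?_)
  exact integral_eq_zero_of_hasDerivAt_of_integrable (fun t => h t x)
    (integrable_of_time_supp (hl.cont.comp (Continuous.prodMk_left x)) fun t ht => hT t ht x)
    (integrable_of_time_supp (hk.cont.comp (Continuous.prodMk_left x)) fun t ht => hT' t ht x)

/-- Directional derivative in space-time. -/
def dd {V : Type*} [NormedAddCommGroup V] [NormedSpace ℝ V] (v : ℝ × (Fin 3 → ℝ))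
    (g : ℝ × (Fin 3 → ℝ) → V) (p : ℝ × (Fin 3 → ℝ)) : V := fderiv ℝ g p v

/-- The spatial coordinate directions. -/
def ex (i : Fin 3) : ℝ × (Fin 3 → ℝ) := (0, Pi.single i 1)
/-- The time direction. -/
def et : ℝ × (Fin 3 → ℝ) := (1, 0)

/-- Test functions. -/
structure Tst (g : ℝ × (Fin 3 → ℝ) → ℂ) : Prop where
  smooth : ContDiff ℝ (⊤ : ℕ∞) g
  per : ∀ t x i, g (t, x + Pi.single i (2 * π)) = g (t, x)
  supp : ∃ T, ∀ t, T < |t| → ∀ x, g (t, x) = 0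

variable {g h : ℝ × (Fin 3 → ℝ) → ℂ} {v w : ℝ × (Fin 3 → ℝ)}

theorem Tst.diff (hg : Tst g) : Differentiable ℝ g := hg.smooth.differentiable (by simp)

theorem Tst.dd (hg : Tst g) (v : ℝ × (Fin 3 → ℝ)) : Tst (dd v g) where
  smooth := (hg.smooth.fderiv_right (m := (⊤ : ℕ∞)) (by simp)).clm_apply contDiff_const
  per := fun t x i => by
    have h1 : (fun p : ℝ × (Fin 3 → ℝ) => g (p + (0, Pi.single i (2 * π)))) = g := by
      ext ⟨t, x⟩
      simpa using hg.per t x i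
    have h2 := fderiv_comp_add_right (𝕜 := ℝ) (f := g) (x := (t, x)) (0, Pi.single i (2 * π))
    rw [h1] at h2
    simp only [QG.dd]
    rw [h2]
    simp
  supp := by
    obtain ⟨T, hT⟩ := hg.supp
    refine ⟨T, fun t ht x => ?_⟩
    have h1 : g =ᶠ[𝓝 (t, x)] fun _ => 0 := by
      have : ∀ᶠ p : ℝ × (Fin 3 → ℝ) in 𝓝 (t, x), T < |p.1| :=
        (isOpen_lt continuous_const (continuous_fst.abs)).mem_nhds ht
      filter_upwards [this] with p hp
      exact hT p.1 hp p.2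
    simp [QG.dd, h1.fderiv_eq]

theorem Tst.add (hg : Tst g) (hh : Tst h) : Tst (g + h) where
  smooth := hg.smooth.add hh.smooth
  per := fun t x i => by simp [hg.per, hh.per]
  supp := by
    obtain ⟨T, hT⟩ := hg.supp
    obtain ⟨T', hT'⟩ := hh.supp
    exact ⟨max T T', fun t ht x => by
      simp [hT t ((le_max_left _ _).trans_lt ht), hT' t ((le_max_right _ _).trans_lt ht)]⟩

theorem Tst.smul (hg : Tst g) (c : ℂ) : Tst (c • g) where
  smooth := hg.smooth.const_smul c
  per := fun t x i => by simp [hg.per]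
  supp := hg.supp.imp fun T hT t ht x => by simp [hT t ht]

theorem Tst.dd_add (hg : Tst g) (hh : Tst h) : QG.dd v (g + h) = QG.dd v g + QG.dd v h := by
  ext p
  simp [QG.dd, fderiv_add (hg.diff p) (hh.diff p)]

theorem Tst.dd_smul (hg : Tst g) (c : ℂ) : QG.dd v (c • g) = c • QG.dd v g := by
  ext p
  simp [QG.dd, fderiv_const_smul (hg.diff p)]

theorem Tst.dd_comm (hg : Tst g) : QG.dd v (QG.dd w g) = QG.dd w (QG.dd v g) := by
  have key : ∀ v w, ∀ p, QG.dd v (QG.dd w g) p = fderiv ℝ (fderiv ℝ g) p v w := fun v w p => by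
    have h1 : DifferentiableAt ℝ (fderiv ℝ g) p :=
      (hg.smooth.fderiv_right (m := (⊤ : ℕ∞)) (by simp)).differentiable (by simp) p
    have : QG.dd v (fun p => fderiv ℝ g p w) p = fderiv ℝ (fderiv ℝ g) p v w := by
      rw [QG.dd, fderiv_clm_apply h1 (by fun_prop)]
      simp
    exact this
  ext p
  rw [key, key]
  exact (hg.smooth.contDiffAt.isSymmSndFDerivAt (by
    rw [minSmoothness_of_isRCLikeNormedField]
    exact WithTop.coe_le_coe.2 (le_top : (2 : ℕ∞) ≤ ⊤))).eq v w

theorem Tst.dd_conj (hg : Tst g) : QG.dd v (fun p => conj (g p)) = fun p => conj (QG.dd v g p) := by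
  ext p
  have := (Complex.conjCLE.toContinuousLinearMap.hasFDerivAt.comp p (hg.diff p).hasFDerivAt).fderiv
  exact congrArg (fun T => T v) this

/-- Wirtinger derivatives of test functions. -/
def gz (g : ℝ × (Fin 3 → ℝ) → ℂ) : ℝ × (Fin 3 → ℝ) → ℂ :=
  (1 / 2 : ℂ) • (dd (ex 0) g + (-Complex.I) • dd (ex 1) g)
/-- Wirtinger derivatives of test functions. -/
def gb (g : ℝ × (Fin 3 → ℝ) → ℂ) : ℝ × (Fin 3 → ℝ) → ℂ :=
  (1 / 2 : ℂ) • (dd (ex 0) g + Complex.I • dd (ex 1) g)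

theorem Tst.gz (hg : Tst g) : Tst (gz g) := ((hg.dd _).add ((hg.dd _).smul _)).smul _
theorem Tst.gb (hg : Tst g) : Tst (gb g) := ((hg.dd _).add ((hg.dd _).smul _)).smul _

theorem Tst.dd_gz (hg : Tst g) : QG.dd v (QG.gz g) = QG.gz (QG.dd v g) := by
  rw [QG.gz, QG.gz, ((hg.dd _).add ((hg.dd _).smul _)).dd_smul, (hg.dd _).dd_add ((hg.dd _).smul _),
    (hg.dd _).dd_smul, hg.dd_comm, hg.dd_comm (v := v)]
theorem Tst.dd_gb (hg : Tst g) : QG.dd v (QG.gb g) = QG.gb (QG.dd v g) := by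
  rw [QG.gb, QG.gb, ((hg.dd _).add ((hg.dd _).smul _)).dd_smul, (hg.dd _).dd_add ((hg.dd _).smul _),
    (hg.dd _).dd_smul, hg.dd_comm, hg.dd_comm (v := v)]

theorem Tst.gz_gb (hg : Tst g) : QG.gz (QG.gb g) = QG.gb (QG.gz g) := by
  conv_lhs => rw [QG.gz, hg.dd_gb, hg.dd_gb]
  conv_rhs => rw [QG.gb, hg.dd_gz, hg.dd_gz]
  simp only [QG.gz, QG.gb]
  rw [hg.dd_comm (v := ex 1) (w := ex 0)]
  ext p
  simp
  ring

theorem Tst.conj_gz (hg : Tst g) : (fun p => conj (QG.gz g p)) = QG.gb fun p => conj (g p) := by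
  rw [QG.gb, hg.dd_conj, hg.dd_conj]
  ext p
  simp [QG.gz, Complex.conj_ofNat]
theorem Tst.conj_gb (hg : Tst g) : (fun p => conj (QG.gb g p)) = QG.gz fun p => conj (g p) := by
  rw [QG.gz, hg.dd_conj, hg.dd_conj]
  ext p
  simp [QG.gb, Complex.conj_ofNat]

/-- Pairing with a test function. -/
def pr (F : ℝ → E → ℂ) (g : ℝ × (Fin 3 → ℝ) → ℂ) : ℂ := tot fun t x => F t (emb x) * g (t, x)

theorem Rg.nice (hF : Rg Set.univ r F) (hr : 0 < r) (hg : Tst g) :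
    Nice fun t x => F t (emb x) * g (t, x) where
  cont := by
    refine Continuous.mul (f := fun p : ℝ × (Fin 3 → ℝ) => F p.1 (emb p.2)) ?_ hg.smooth.continuous
    refine continuous_iff_continuousAt.2 fun p => ?_
    have h1 := hF.cont p.1 trivial _ (emb_mem hr p.2)
    exact ContinuousAt.comp (g := Function.uncurry F)
      (f := fun p : ℝ × (Fin 3 → ℝ) => (p.1, emb p.2)) h1 (by fun_prop)
  supp := hg.supp.imp fun T hT t ht x => by simp [hT t ht]

theorem pr_conj (hF : Rg Set.univ r F) (g : ℝ × (Fin 3 → ℝ) → ℂ) :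
    conj (pr F g) = pr (sm F) fun p => conj (g p) := by
  rw [pr, pr, ← tot_conj]
  congr 1
  ext t x
  simp [sm, st_emb]

theorem pr_dt (hF : R1 Set.univ r F) (hr : 0 < r) (hg : Tst g) : pr (dt F) g = -pr F (dd et g) := by
  have h1 := hF.dt.nice hr hg
  have h2 := hF.toRg.nice hr (hg.dd et)
  rw [eq_neg_iff_add_eq_zero, pr, pr, ← tot_add h1 h2]
  refine tot_deriv (hF.toRg.nice hr hg) (h1.add h2) fun t x => ?_
  refine (hF.hasDt t trivial _ (emb_mem hr x)).mul ?_
  have := (hg.diff (t, x)).hasFDerivAt.comp_hasDerivAt t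
    ((hasDerivAt_id t).prodMk (hasDerivAt_const t x))
  exact this

theorem integral_add_add {a b c : (Fin 3 → ℝ) → ℂ} {A : Set (Fin 3 → ℝ)} (ha : IntegrableOn a A)
    (hb : IntegrableOn b A) (hc : IntegrableOn c A) :
    ∫ x in A, (a x + (b x + c x)) = (∫ x in A, a x) + ((∫ x in A, b x) + ∫ x in A, c x) := by
  rw [integral_add ha (g := fun x => b x + c x) (hb.add hc), integral_add hb hc]

theorem av_mul_dd (hF : Rg Set.univ r F) (hr : 0 < r) (hg : Tst g) (t : ℝ) :
    ∫ x in box3, dz F t (emb x) * g (t, x) = -∫ x in box3, F t (emb x) * gz g (t, x) ∧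
    ∫ x in box3, db F t (emb x) * g (t, x) = -∫ x in box3, F t (emb x) * gb g (t, x) := by
  have ht := Set.mem_univ t
  have h0 := hF.hasFDerivAt_emb hr ht
  have hG : ∀ x, HasFDerivAt (fun x => g (t, x))
      ((fderiv ℝ g (t, x)).comp (ContinuousLinearMap.inr ℝ ℝ (Fin 3 → ℝ))) x := fun x =>
    (hg.diff (t, x)).hasFDerivAt.comp x (hasFDerivAt_prodMk_right t x)
  have nz := ((hF.dz isOpen_univ).nice hr hg)
  have nb := ((hF.db isOpen_univ).nice hr hg)
  have nd := fun i => hF.nice hr (hg.dd (ex i))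
  have key : ∀ i : Fin 3, ∫ x in box3,
      (F t (emb x) * dd (ex i) g (t, x) +
      (((Pi.single i 1 : Fin 3 → ℝ) 0 + Complex.I * (Pi.single i 1 : Fin 3 → ℝ) 1)
      * (dz F t (emb x) * g (t, x)) + ((Pi.single i 1 : Fin 3 → ℝ) 0 - Complex.I * (Pi.single i 1 : Fin 3 → ℝ) 1)
        * (db F t (emb x) * g (t, x)))) = 0 := by
    intro i
    have e : ∀ x, (F t (emb x) • (fderiv ℝ g (t, x)).comp (ContinuousLinearMap.inr ℝ ℝ (Fin 3 → ℝ)) +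
        g (t, x) • ((fderiv ℂ (F t) (emb x)).restrictScalars ℝ).comp emb) (Pi.single i 1) =
        F t (emb x) * dd (ex i) g (t, x) +
      (((Pi.single i 1 : Fin 3 → ℝ) 0 + Complex.I * (Pi.single i 1 : Fin 3 → ℝ) 1)
      * (dz F t (emb x) * g (t, x)) + ((Pi.single i 1 : Fin 3 → ℝ) 0 - Complex.I * (Pi.single i 1 : Fin 3 → ℝ) 1)
        * (db F t (emb x) * g (t, x))) := fun x => by
      rw [add_apply, smul_apply, smul_apply, hF.fderiv_emb hr ht, dd, ex]
      simp only [ContinuousLinearMap.comp_apply, ContinuousLinearMap.inr_apply, smul_eq_mul]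
      ring
    have := integral_pderiv_eq_zero (fun x => (h0 x).mul (hG x)) (fun x i => by
      rw [Pi.mul_apply, Pi.mul_apply, emb_per hF hr ht, hg.per]) i (by
        simp only [e]
        have c1 := (nd i).cont.comp (Continuous.prodMk_right t)
        have c2 := nz.cont.comp (Continuous.prodMk_right t)
        have c3 := nb.cont.comp (Continuous.prodMk_right t)
        exact c1.add ((c2.const_mul _).add (c3.const_mul _)))
    simpa only [e] using this
  have k0 := key 0
  have k1 := key 1
  simp only [Pi.single_eq_same, ne_eq, one_ne_zero, not_false_eq_true, Pi.single_eq_of_ne,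
    Complex.ofReal_zero, Complex.ofReal_one, mul_zero, add_zero, sub_zero, one_mul, mul_one,
    zero_add, zero_sub, zero_ne_one] at k0 k1
  have iz := nz.intX t
  have ib := nb.intX t
  have i0 := (nd 0).intX t
  have i1 := (nd 1).intX t
  rw [integral_add_add i0 iz ib] at k0
  rw [integral_add_add i1 (iz.const_mul _) (ib.const_mul _), integral_const_mul, integral_const_mul] at k1
  have e1 : ∫ x in box3, F t (emb x) * gz g (t, x) = 1 / 2 * ((∫ x in box3, F t (emb x) * dd (ex 0) g (t, x))
      + (-Complex.I) * ∫ x in box3, F t (emb x) * dd (ex 1) g (t, x)) := by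
    rw [← integral_const_mul (-Complex.I), ← integral_add i0 (i1.const_mul _), ← integral_const_mul]
    refine integral_congr_ae (Eventually.of_forall fun x => ?_)
    simp [gz]
    ring
  have e2 : ∫ x in box3, F t (emb x) * gb g (t, x) = 1 / 2 * ((∫ x in box3, F t (emb x) * dd (ex 0) g (t, x))
      + Complex.I * ∫ x in box3, F t (emb x) * dd (ex 1) g (t, x)) := by
    rw [← integral_const_mul Complex.I, ← integral_add i0 (i1.const_mul _), ← integral_const_mul]
    refine integral_congr_ae (Eventually.of_forall fun x => ?_)
    simp [gb]
    ring
  rw [e1, e2]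
  have hI := Complex.I_mul_I
  constructor
  · linear_combination 1 / 2 * k0 - Complex.I / 2 * k1 + 1 / 2 * ((∫ x in box3, dz F t (emb x) * g (t, x))
      - ∫ x in box3, db F t (emb x) * g (t, x)) * hI
  · linear_combination 1 / 2 * k0 + Complex.I / 2 * k1 - 1 / 2 * ((∫ x in box3, dz F t (emb x) * g (t, x))
      - ∫ x in box3, db F t (emb x) * g (t, x)) * hI

theorem pr_dz (hF : Rg Set.univ r F) (hr : 0 < r) (hg : Tst g) : pr (dz F) g = -pr F (gz g) := by
  rw [pr, pr, tot, tot, ← integral_neg]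
  exact integral_congr_ae (Eventually.of_forall fun t => (av_mul_dd hF hr hg t).1)
theorem pr_db (hF : Rg Set.univ r F) (hr : 0 < r) (hg : Tst g) : pr (db F) g = -pr F (gb g) := by
  rw [pr, pr, tot, tot, ← integral_neg]
  exact integral_congr_ae (Eventually.of_forall fun t => (av_mul_dd hF hr hg t).2)

end

section

variable {J : Set ℝ} {r s : ℝ} {F G : ℝ → E → ℂ} {t : ℝ} {z : E} {ψ : ℝ → E → ℂ}
variable {L T M N n η a : ℝ} {f : ℝ → E → ℂ}
variable {k l : ℝ → (Fin 3 → ℝ) → ℂ}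
variable {g h φ : ℝ × (Fin 3 → ℝ) → ℂ} {v w : ℝ × (Fin 3 → ℝ)}

theorem pr_congr (h : ∀ t x, F t (emb x) = G t (emb x)) : pr F g = pr G g := by
  simp only [pr, h]

theorem pr_add (hF : Rg Set.univ r F) (hG : Rg Set.univ r G) (hr : 0 < r) (hg : Tst g) :
    pr (F + G) g = pr F g + pr G g := by
  rw [pr, pr, pr, ← tot_add (hF.nice hr hg) (hG.nice hr hg)]
  congr 1
  ext t x
  simp
  ring

theorem pr_smul_left (c : ℂ) (F : ℝ → E → ℂ) (g : ℝ × (Fin 3 → ℝ) → ℂ) :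
    pr (c • F) g = c * pr F g := by
  rw [pr, pr, ← tot_smul]
  congr 1
  ext t x
  simp
  ring

/-- The pressure potential does not contribute to the weak formulation. -/
theorem pr_dz_dz_im {H : ℝ → E → ℂ} (hH : Rg Set.univ r H) (hr : 0 < r) (hs : sm H = H)
    (hφ : Tst φ) (hc : (fun p => conj (φ p)) = φ) : (pr (dz (dz H)) (gb (gb φ))).im = 0 := by
  have b2 := hφ.gb.gb
  rw [pr_dz (hH.dz isOpen_univ) hr b2, pr_dz hH hr b2.gz, neg_neg]
  have h1 := pr_conj hH (gz (gz (gb (gb φ))))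
  have h2 : (fun p => conj (gz (gz (gb (gb φ))) p)) = gz (gz (gb (gb φ))) := by
    rw [b2.gz.conj_gz, b2.conj_gz, hφ.gb.conj_gb, hφ.conj_gb, hc, hφ.gb.gz_gb, hφ.gz_gb,
      hφ.gz.gb.gz_gb, hφ.gz.gz_gb]
  rw [h2, hs] at h1
  exact Complex.conj_eq_iff_im.1 h1

theorem pr_pot (hF : R1 Set.univ r F) (hr : 0 < r)
    (h : ∀ t, ∀ z ∈ Strip r, ψ t z = pot F t z) (hψ : Rg Set.univ r ψ)
    (hφ : Tst φ) (hc : (fun p => conj (φ p)) = φ) :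
    (pr (dz ψ) (gb (dd et φ)) + Complex.I * pr (dz (dt F)) (gb (gb φ))).re = 0 := by
  have hT := hφ.dd et
  have b1 := hT.gb
  have b2 := hφ.gb.gb
  have hF' := hF.toRg
  have hJ : IsOpen (Set.univ : Set ℝ) := isOpen_univ
  have hTc : (fun p => conj (dd et φ p)) = dd et φ := by rw [← hφ.dd_conj, hc]
  set X := pr F (gb (gz (gb (dd et φ)))) with hX
  have e1 : pr (dz ψ) (gb (dd et φ)) = 1 / (2 * Complex.I) * (X - conj X) := by
    rw [pr_dz hψ hr b1, pr_congr (F := ψ) (G := (1 / (2 * Complex.I)) • (db F + (-1 : ℂ) • dz (sm F)))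
      (fun t x => by rw [h t _ (emb_mem hr x), pot]; simp [sub_eq_add_neg]), pr_smul_left,
      pr_add (hF'.db hJ) ((hF'.sm.dz hJ).smul _) hr b1.gz, pr_smul_left, pr_db hF' hr b1.gz,
      pr_dz hF'.sm hr b1.gz, hX, pr_conj hF', b1.gz.conj_gb, b1.conj_gz, hT.conj_gb, hTc, hT.gz_gb]
    ring
  have e2 : pr (dz (dt F)) (gb (gb φ)) = X := by
    rw [pr_dz hF.dt hr b2, pr_dt hF hr b2.gz, neg_neg, b2.dd_gz, hφ.gb.dd_gb, hφ.dd_gb, hX, b1.gz_gb]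
  have e3 : 1 / (2 * Complex.I) * (X - conj X) = (X.im : ℂ) := by
    rw [Complex.sub_conj]
    field_simp
    push_cast
    ring
  rw [e1, e2, e3]
  simp

/-- The weak formulation for a subsolution. -/
theorem Hyp.weak {e : ℝ → ℝ} {ρ δ K : ℝ} {H S : ℝ → E → ℂ} (Y : Hyp e ρ L δ K ψ F H S)
    (hρ : 0 < ρ) (hφ : Tst φ) (hc : (fun p => conj (φ p)) = φ) :
    (4 * pr (QG.dz ψ) (gb (dd et φ)) - 8 * Complex.I * pr (QG.dz ψ * QG.dz ψ) (gb (gb φ))).re =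
      (-8 * Complex.I * pr S (gb (gb φ))).re := by
  have hJ : IsOpen (Set.univ : Set ℝ) := isOpen_univ
  have hψ := Y.env.reg.toRg
  have b2 := hφ.gb.gb
  have h1 := pr_dz_dz_im Y.regH hρ Y.realH hφ hc
  have h2 := pr_pot Y.regF hρ Y.pot hψ hφ hc
  have hz := hψ.dz hJ
  have r1 := hz.mul hz
  have r2 := (Y.regF.dt.dz hJ).smul (1 / 2)
  have r3 := (Y.regH.dz hJ).dz hJ
  have e1 : pr S (gb (gb φ)) = pr (QG.dz ψ * QG.dz ψ) (gb (gb φ))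
      + 1 / 2 * pr (QG.dz (QG.dt F)) (gb (gb φ)) + pr (QG.dz (QG.dz H)) (gb (gb φ)) := by
    rw [← pr_smul_left, ← pr_add r1 r2 hρ b2, ← pr_add (r1.add r2) r3 hρ b2]
    refine pr_congr fun t x => ?_
    rw [Y.eqn t _ (emb_mem hρ x)]
    simp
    ring
  rw [e1]
  have h3 : (8 * Complex.I * pr (QG.dz (QG.dz H)) (gb (gb φ))).re = 0 := by
    simp [h1]
  rw [← sub_eq_zero, ← Complex.sub_re]
  have : 4 * pr (QG.dz ψ) (gb (dd et φ)) - 8 * Complex.I * pr (QG.dz ψ * QG.dz ψ) (gb (gb φ))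
      - (-8 * Complex.I * (pr (QG.dz ψ * QG.dz ψ) (gb (gb φ)) +
        1 / 2 * pr (QG.dz (QG.dt F)) (gb (gb φ)) + pr (QG.dz (QG.dz H)) (gb (gb φ)))) =
      ((4 : ℝ) : ℂ) * (pr (QG.dz ψ) (gb (dd et φ)) + Complex.I * pr (QG.dz (QG.dt F)) (gb (gb φ)))
      + 8 * Complex.I * pr (QG.dz (QG.dz H)) (gb (gb φ)) := by
    push_cast; ring
  rw [this, Complex.add_re, h3, Complex.re_ofReal_mul, h2]
  simp

end

section

variable {J : Set ℝ} {r s : ℝ} {F G : ℝ → E → ℂ} {t : ℝ} {z : E} {ψ : ℝ → E → ℂ}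
variable {L T M N n η a : ℝ} {f : ℝ → E → ℂ}
variable {k l : ℝ → (Fin 3 → ℝ) → ℂ}
variable {g h φ : ℝ × (Fin 3 → ℝ) → ℂ} {v w : ℝ × (Fin 3 → ℝ)}

theorem Rg.cont_uncurry_emb (hF : Rg Set.univ r F) (hr : 0 < r) :
    Continuous fun p : ℝ × (Fin 3 → ℝ) => F p.1 (emb p.2) := by
  refine continuous_iff_continuousAt.2 fun p => ?_
  have h1 := hF.cont p.1 trivial _ (emb_mem hr p.2)
  exact ContinuousAt.comp (g := Function.uncurry F)
    (f := fun p : ℝ × (Fin 3 → ℝ) => (p.1, emb p.2)) h1 (by fun_prop)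

theorem Rg.lipschitz_emb (hF : Rg Set.univ r F) (hr : 0 < r) (hM : 0 ≤ M)
    (h1 : ∀ z ∈ Strip r, ‖QG.dz F t z‖ ≤ M) (h2 : ∀ z ∈ Strip r, ‖QG.db F t z‖ ≤ M)
    (x x' : Fin 3 → ℝ) : ‖F t (emb x) - F t (emb x')‖ ≤ 4 * M * ‖x - x'‖ := by
  refine convex_univ.norm_image_sub_le_of_norm_hasFDerivWithin_le
    (f := fun x => F t (emb x))
    (fun y _ => (hF.hasFDerivAt_emb hr (Set.mem_univ t) y).hasFDerivWithinAt) (fun y _ => ?_)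
    (Set.mem_univ _) (Set.mem_univ _)
  refine ContinuousLinearMap.opNorm_le_bound _ (by positivity) fun v => ?_
  rw [hF.fderiv_emb hr (Set.mem_univ t)]
  have k0 := norm_le_pi_norm v 0
  have k1 := norm_le_pi_norm v 1
  have c1 : ‖(v 0 : ℂ) + Complex.I * v 1‖ ≤ 2 * ‖v‖ := by
    refine (norm_add_le _ _).trans ?_
    rw [norm_mul, Complex.norm_I, Complex.norm_real, Complex.norm_real]
    linarith
  have c2 : ‖(v 0 : ℂ) - Complex.I * v 1‖ ≤ 2 * ‖v‖ := by
    refine (norm_sub_le _ _).trans ?_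
    rw [norm_mul, Complex.norm_I, Complex.norm_real, Complex.norm_real]
    linarith
  refine (norm_add_le _ _).trans ?_
  rw [norm_mul, norm_mul]
  have d1 := mul_le_mul c1 (h1 _ (emb_mem hr y)) (norm_nonneg _) (by positivity)
  have d2 := mul_le_mul c2 (h2 _ (emb_mem hr y)) (norm_nonneg _) (by positivity)
  linarith

theorem Inc.lipschitz {B D : ℝ} {w : ℝ → E → ℂ} (h : Inc n B D w) (hn : 0 < n) (hB : 0 ≤ B)
    (hD : 0 ≤ D) (t t' : ℝ) (x x' : Fin 3 → ℝ) :
    ‖dz w t (emb x) - dz w t' (emb x')‖ ≤ B * (n * ((4 + D) * (|t - t'| + ‖x - x'‖))) := by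
  have hJ : IsOpen (Set.univ : Set ℝ) := isOpen_univ
  have hr : 0 < 1 / n := by positivity
  have h1 : ‖dz w t (emb x) - dz w t (emb x')‖ ≤ 4 * (B * n) * ‖x - x'‖ :=
    (h.reg.toRg.dz hJ).lipschitz_emb hr (by positivity) (h.bzz t) (fun z hz => by
      have := h.bzb t z hz
      rwa [← h.reg.toRg.dz_db hJ (Set.mem_univ t) hz] at this) x x'
  have h2 : ‖dz w t (emb x') - dz w t' (emb x')‖ ≤ B * n * D * ‖t - t'‖ :=
    convex_univ.norm_image_sub_le_of_norm_hasDerivWithin_le (f := fun t => dz w t (emb x'))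
      (fun s _ => ((h.reg.dz hJ).hasDt s trivial _ (emb_mem hr x')).hasDerivWithinAt)
      (fun s _ => h.bt s _ (emb_mem hr x')) (Set.mem_univ _) (Set.mem_univ _)
  rw [Real.norm_eq_abs] at h2
  have h3 := norm_sub_le_norm_sub_add_norm_sub (dz w t (emb x)) (dz w t (emb x')) (dz w t' (emb x'))
  have h4 : 0 ≤ B * n := by positivity
  nlinarith [mul_nonneg h4 (abs_nonneg (t - t')), mul_nonneg h4 (norm_nonneg (x - x')),
    mul_nonneg hD (mul_nonneg h4 (norm_nonneg (x - x')))]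

theorem le_rpow_of_le_min {ζ u y B : ℝ} (hζ0 : 0 < ζ) (hζ : ζ ≤ 1) (hB : 0 ≤ B) (hy : 0 ≤ y)
    (h1 : u ≤ 2 * B) (h2 : u ≤ B * y) : u ≤ 2 * B * y ^ ζ := by
  by_cases h : y ≤ 1
  · have h3 : y ≤ y ^ ζ := by
      rcases hy.eq_or_lt with rfl | hy'
      · exact Real.rpow_nonneg le_rfl _
      · simpa using Real.rpow_le_rpow_of_exponent_ge hy' h hζ
    have := Real.rpow_nonneg hy ζ
    nlinarith [mul_le_mul_of_nonneg_left h3 hB, mul_nonneg hB this]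
  · have := Real.one_le_rpow (not_le.1 h).le hζ0.le
    nlinarith

theorem Inc.holder {B D ζ : ℝ} {w : ℝ → E → ℂ} (h : Inc n B D w) (hn : 0 < n) (hB : 0 ≤ B)
    (hD : 0 ≤ D) (hζ0 : 0 < ζ) (hζ : ζ ≤ 1) (t t' : ℝ) (x x' : Fin 3 → ℝ) :
    ‖dz w t (emb x) - dz w t' (emb x')‖ ≤
      2 * (4 + D) * (|t - t'| + ‖x - x'‖) ^ ζ * (B * n ^ ζ) := by
  have hr : 0 < 1 / n := by positivity
  have hd : 0 ≤ |t - t'| + ‖x - x'‖ := by positivity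
  have h1 := h.lipschitz hn hB hD t t' x x'
  have h2 : ‖dz w t (emb x) - dz w t' (emb x')‖ ≤ 2 * B := by
    refine (norm_sub_le _ _).trans ?_
    have := h.bz t _ (emb_mem hr x)
    have := h.bz t' _ (emb_mem hr x')
    linarith
  refine (le_rpow_of_le_min hζ0 hζ hB (by positivity) h2 h1).trans ?_
  rw [Real.mul_rpow hn.le (by positivity), Real.mul_rpow (by positivity) hd]
  have h3 : (4 + D) ^ ζ ≤ 4 + D := by
    simpa using Real.rpow_le_rpow_of_exponent_le (by linarith : 1 ≤ 4 + D) hζ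
  have h4 := Real.rpow_nonneg hn.le ζ
  have h5 := Real.rpow_nonneg hd ζ
  calc _ = 2 * (4 + D) ^ ζ * (|t - t'| + ‖x - x'‖) ^ ζ * (B * n ^ ζ) := by ring
    _ ≤ _ := by gcongr

/-- The real differential with Wirtinger derivative `c`. -/
def gr : ℂ →L[ℝ] (Fin 3 → ℝ) →L[ℝ] ℝ :=
  Complex.reCLM.smulRight ((2 : ℝ) • (ContinuousLinearMap.proj 0 : (Fin 3 → ℝ) →L[ℝ] ℝ)) -
    Complex.imCLM.smulRight ((2 : ℝ) • (ContinuousLinearMap.proj 1 : (Fin 3 → ℝ) →L[ℝ] ℝ))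

theorem gr_apply (c : ℂ) (v : Fin 3 → ℝ) : gr c v = 2 * c.re * v 0 - 2 * c.im * v 1 := by
  simp [gr]
  ring

theorem db_emb_of_real (h : sm ψ = ψ) (x : Fin 3 → ℝ) :
    db ψ t (emb x) = conj (dz ψ t (emb x)) := by
  rw [db_eq_sm, h, sm, st_emb]

theorem Rg.hasFDerivAt_re (hF : Rg Set.univ r F) (hr : 0 < r) (h : QG.sm F = F)
    (x : Fin 3 → ℝ) :
    HasFDerivAt (fun x => (F t (emb x)).re) (gr (QG.dz F t (emb x))) x := by
  refine (Complex.reCLM.hasFDerivAt.comp x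
    (hF.hasFDerivAt_emb hr (Set.mem_univ t) x)).congr_fderiv ?_
  refine ContinuousLinearMap.ext fun v => ?_
  rw [ContinuousLinearMap.comp_apply, hF.fderiv_emb hr (Set.mem_univ t) x v, db_emb_of_real h,
    gr_apply]
  simp
  ring

end

section

variable {J : Set ℝ} {r s : ℝ} {F G : ℝ → E → ℂ} {t : ℝ} {z : E} {ψ : ℝ → E → ℂ}
variable {L T M N n η a : ℝ} {f : ℝ → E → ℂ}
variable {k l : ℝ → (Fin 3 → ℝ) → ℂ}
variable {g h φ : ℝ × (Fin 3 → ℝ) → ℂ} {v w : ℝ × (Fin 3 → ℝ)}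

theorem exists_limit {e : ℝ → ℝ} {ζ Ke M : ℝ} (hζ0 : 0 < ζ) (hζ : ζ < 1 / 5) (hKe : 0 ≤ Ke)
    (he : ∀ t t', |e t - e t'| ≤ Ke * |t - t'|) (he0 : ∀ t, 0 ≤ e t) (heM : ∀ t, e t ≤ M) :
    ∃ (ψ F H S : ℕ → ℝ → E → ℂ) (δ ρ L K : ℕ → ℝ) (U : ℝ → (Fin 3 → ℝ) → ℝ)
      (A : ℝ → (Fin 3 → ℝ) → ℂ) (c C : ℝ), 0 ≤ c ∧ 0 ≤ C ∧ (∀ q, 0 < ρ q) ∧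
      (∀ q, Hyp e (ρ q) (L q) (δ q) (K q) (ψ q) (F q) (H q) (S q)) ∧ Tendsto δ atTop (𝓝 0) ∧
      Continuous (Function.uncurry A) ∧ (∀ q t x, ‖dz (ψ q) t (emb x)‖ ≤ c) ∧
      (∀ t x, Tendsto (fun q => dz (ψ q) t (emb x)) atTop (𝓝 (A t x))) ∧
      (∀ t x, ‖A t x‖ ≤ c) ∧
      (∀ t t' x x', ‖A t x - A t' x'‖ ≤ C * (|t - t'| + ‖x - x'‖) ^ ζ) ∧
      (∀ t x, HasFDerivAt (U t) (gr (A t x)) x) ∧ ∀ t, Periodic3 (U t) := by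
  obtain ⟨ψ, F, H, S, δ, B, L, K, n, D, h0, hn, hB, hD, Y, I, hδ, hs⟩ :=
    exists_iteration hζ0 hζ hKe he he0 heM
  have hJ : IsOpen (Set.univ : Set ℝ) := isOpen_univ
  have hn' : ∀ q, (0 : ℝ) < n q := fun q => by exact_mod_cast hn q
  have hn1 : ∀ q, (1 : ℝ) ≤ n q := fun q => by exact_mod_cast hn q
  have hr : ∀ q, 0 < 1 / (n q : ℝ) := fun q => by have := hn' q; positivity
  have sB : Summable B := Summable.of_nonneg_of_le hB (fun q =>
    le_mul_of_one_le_right (hB q) (Real.one_le_rpow (hn1 _) hζ0.le)) hs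
  set α : ℕ → ℝ → (Fin 3 → ℝ) → ℂ := fun q t x => dz (ψ (q + 1) - ψ q) t (emb x) with hα
  have bα : ∀ q t x, ‖α q t x‖ ≤ B q := fun q t x => (I q).bz t _ (emb_mem (hr _) x)
  have sα : ∀ t x, Summable fun q => α q t x := fun t x =>
    Summable.of_norm_bounded sB fun q => bα q t x
  have sum : ∀ q t x, dz (ψ q) t (emb x) = ∑ i ∈ Finset.range q, α i t x := by
    intro q t x
    induction q with
    | zero => simp [h0, dz_zero]
    | succ q ih =>
      rw [Finset.sum_range_succ, ← ih, hα]
      have hm : 0 < min (1 / (n q : ℝ)) (1 / (n (q + 1) : ℝ)) := lt_min (hr _) (hr _)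
      have := Rg.dz_sub ((Y (q + 1)).env.reg.toRg.mono (min_le_right _ _))
        ((Y q).env.reg.toRg.mono (min_le_left _ _)) (Set.mem_univ t) (emb_mem hm x)
      simp only [this]
      ring
  have real : ∀ q, sm (ψ (q + 1) - ψ q) = ψ (q + 1) - ψ q := fun q => by
    rw [sm_sub, (Y _).env.real, (Y _).env.real]
  have hw : ∀ q t x, HasFDerivAt (fun x => ((ψ (q + 1) - ψ q) t (emb x)).re) (gr (α q t x)) x :=
    fun q t x => (I q).reg.toRg.hasFDerivAt_re (hr _) (real q) x
  have bw : ∀ q t x, ‖((ψ (q + 1) - ψ q) t (emb x)).re‖ ≤ B q := fun q t x => by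
    refine (Complex.abs_re_le_norm _).trans (((I q).b0 t _ (emb_mem (hr _) x)).trans ?_)
    exact div_le_self (hB q) (hn1 _)
  have sw : ∀ t x, Summable fun q => ((ψ (q + 1) - ψ q) t (emb x)).re := fun t x =>
    Summable.of_norm_bounded sB fun q => bw q t x
  refine ⟨ψ, F, H, S, δ, fun q => 1 / n q, L, K,
    fun t x => ∑' q, ((ψ (q + 1) - ψ q) t (emb x)).re, fun t x => ∑' q, α q t x,
    ∑' q, B q, 2 * (4 + D) * ∑' q, B q * (n (q + 1) : ℝ) ^ ζ, tsum_nonneg hB,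
    mul_nonneg (by positivity) (tsum_nonneg fun q => mul_nonneg (hB q)
      (Real.rpow_nonneg (hn' _).le _)), hr, Y, hδ, ?_, ?_, ?_, ?_, ?_, ?_, ?_⟩
  · exact continuous_tsum (f := fun q (p : ℝ × (Fin 3 → ℝ)) => α q p.1 p.2)
      (fun q => ((I q).reg.toRg.dz hJ).cont_uncurry_emb (hr _)) sB fun q p => bα q _ _
  · intro q t x
    rw [sum]
    exact (norm_sum_le_of_le _ fun i _ => bα i t x).trans (sB.sum_le_tsum _ fun i _ => hB i)
  · intro t x
    simp only [sum]
    exact (sα t x).hasSum.tendsto_sum_nat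
  · exact fun t x => tsum_of_norm_bounded sB.hasSum fun q => bα q t x
  · intro t t' x x'
    rw [← (sα t x).tsum_sub (sα t' x'), mul_right_comm, ← tsum_mul_left]
    exact tsum_of_norm_bounded (hs.mul_left _).hasSum fun q =>
      (I q).holder (hn' _) (hB q) hD hζ0 (by linarith) t t' x x'
  · intro t x
    have h1 := hasFDerivAt_tsum (f := fun q x => ((ψ (q + 1) - ψ q) t (emb x)).re)
      (f' := fun q x => gr (α q t x)) (sB.mul_left ‖gr‖) (fun q y => hw q t y)
      (fun q y => (gr.le_opNorm _).trans
        (mul_le_mul_of_nonneg_left (bα q t y) (norm_nonneg _))) (sw t x) x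
    refine h1.congr_fderiv ?_
    rw [gr.map_tsum (sα t x)]
  · intro t x i
    refine tsum_congr fun q => ?_
    rw [emb_per (I q).reg.toRg (hr _) (Set.mem_univ t)]

theorem pd3_of_gr {U : (Fin 3 → ℝ) → ℝ} {c : ℂ} {x : Fin 3 → ℝ} (h : HasFDerivAt U (gr c) x) :
    pd3 0 U x = 2 * c.re ∧ pd3 1 U x = -2 * c.im ∧ pd3 2 U x = 0 := by
  simp only [pd3, h.fderiv, gr_apply]
  simp

theorem norm_le_of_gr {c : ℂ} {u : Fin 3 → ℝ} (h0 : u 0 = 2 * c.re) (h1 : u 1 = -2 * c.im)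
    (h2 : u 2 = 0) : ‖u‖ ≤ 2 * ‖c‖ := by
  refine (pi_norm_le_iff_of_nonneg (by positivity)).2 fun i => ?_
  have k1 := Complex.abs_re_le_norm c
  have k2 := Complex.abs_im_le_norm c
  fin_cases i
  · simp [h0]; exact k1
  · simp [h1]; exact k2
  · simp [h2]

theorem energy_eq {e : ℝ → ℝ} {ψ F H S : ℕ → ℝ → E → ℂ} {δ ρ L K : ℕ → ℝ}
    {A : ℝ → (Fin 3 → ℝ) → ℂ} {c : ℝ} (hρ : ∀ q, 0 < ρ q)
    (Y : ∀ q, Hyp e (ρ q) (L q) (δ q) (K q) (ψ q) (F q) (H q) (S q))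
    (hδ : Tendsto δ atTop (𝓝 0)) (hb : ∀ q t x, ‖dz (ψ q) t (emb x)‖ ≤ c)
    (hl : ∀ t x, Tendsto (fun q => dz (ψ q) t (emb x)) atTop (𝓝 (A t x))) (t : ℝ) :
    4 * (∫ x in box3, A t x * conj (A t x)).re = e t := by
  have hJ : IsOpen (Set.univ : Set ℝ) := isOpen_univ
  have h1 : Tendsto (fun q => av (dz (ψ q) * db (ψ q)) t) atTop
      (𝓝 (∫ x in box3, A t x * conj (A t x))) := by
    refine tendsto_integral_of_dominated_convergence (fun _ => c * c) (fun q => ?_) ?_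
      (fun q => Eventually.of_forall fun x => ?_) (Eventually.of_forall fun x => ?_)
    · have := (((Y q).env.reg.toRg.dz hJ).mul ((Y q).env.reg.toRg.db hJ)).cont_uncurry_emb (hρ q)
      exact (this.comp (Continuous.prodMk_right t)).aestronglyMeasurable
    · exact (continuous_const.continuousOn.integrableOn_compact isCompact_box3)
    · rw [Pi.mul_apply, Pi.mul_apply, db_emb_of_real (Y q).env.real, norm_mul, RCLike.norm_conj]
      have := hb q t x
      have := norm_nonneg (dz (ψ q) t (emb x))
      gcongr
      linarith
    · simp only [Pi.mul_apply, db_emb_of_real (Y _).env.real]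
      exact (hl t x).mul ((Complex.continuous_conj.tendsto _).comp (hl t x))
  have h2 : Tendsto (fun q => En (ψ q) t) atTop
      (𝓝 (4 * (∫ x in box3, A t x * conj (A t x)).re)) :=
    ((Complex.continuous_re.tendsto _).comp h1).const_mul 4
  have h3 : Tendsto (fun q => e t - En (ψ q) t) atTop (𝓝 0) :=
    squeeze_zero_norm (fun q => (Y q).en t) (by simpa using hδ.const_mul 2)
  have h4 : Tendsto (fun q => En (ψ q) t) atTop (𝓝 (e t)) := by
    simpa using tendsto_const_nhds (x := e t) |>.sub h3
  exact tendsto_nhds_unique h2 h4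

end

section

variable {J : Set ℝ} {r s : ℝ} {F G : ℝ → E → ℂ} {t : ℝ} {z : E} {ψ : ℝ → E → ℂ}
variable {L T M N n η a : ℝ} {f : ℝ → E → ℂ}
variable {k l : ℝ → (Fin 3 → ℝ) → ℂ}
variable {g h φ : ℝ × (Fin 3 → ℝ) → ℂ} {v w : ℝ × (Fin 3 → ℝ)}

theorem Tst.bounded (hg : Tst g) : ∃ c, 0 ≤ c ∧ ∀ t, ∀ x ∈ box3, ‖g (t, x)‖ ≤ c := by
  obtain ⟨T, hT⟩ := hg.supp
  obtain ⟨c, hc⟩ := ((isCompact_closedBall (0 : ℝ) T).prod isCompact_box3).exists_bound_of_continuousOn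
    hg.smooth.continuous.continuousOn
  refine ⟨max c 0, le_max_right _ _, fun t x hx => ?_⟩
  by_cases h : |t| ≤ T
  · exact (hc (t, x) ⟨by simpa using h, hx⟩).trans (le_max_left _ _)
  · rw [hT t (not_le.1 h)]
    simp

/-- The weak formulation as a density: linear plus quadratic in the field. -/
def wd (A : ℝ → (Fin 3 → ℝ) → ℂ) (φ : ℝ × (Fin 3 → ℝ) → ℂ) (t : ℝ) (x : Fin 3 → ℝ) : ℂ :=
  4 * (A t x * gb (dd et φ) (t, x)) - 8 * Complex.I * (A t x * A t x * gb (gb φ) (t, x))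

theorem nice_wd {A : ℝ → (Fin 3 → ℝ) → ℂ} (hA : Continuous (Function.uncurry A)) (hφ : Tst φ) :
    Nice (wd A φ) where
  cont := by
    have h1 := (hφ.dd et).gb.smooth.continuous
    have h2 := hφ.gb.gb.smooth.continuous
    have : Function.uncurry (wd A φ) = fun p => 4 * (Function.uncurry A p * gb (dd et φ) p) -
      8 * Complex.I * (Function.uncurry A p * Function.uncurry A p * gb (gb φ) p) := rfl
    rw [this]
    fun_prop
  supp := by
    obtain ⟨T1, h1⟩ := (hφ.dd et).gb.supp
    obtain ⟨T2, h2⟩ := hφ.gb.gb.supp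
    refine ⟨max T1 T2, fun t ht x => ?_⟩
    rw [wd, h1 t ((le_max_left _ _).trans_lt ht), h2 t ((le_max_right _ _).trans_lt ht)]
    simp

theorem tot_wd (hF : Rg Set.univ r F) (hr : 0 < r) (hφ : Tst φ) :
    tot (wd (fun t x => F t (emb x)) φ) =
      4 * pr F (gb (dd et φ)) - 8 * Complex.I * pr (F * F) (gb (gb φ)) := by
  have h1 := hF.nice hr (hφ.dd et).gb
  have h2 := (hF.mul hF).nice hr hφ.gb.gb
  rw [pr, pr, ← tot_smul, sub_eq_add_neg, ← neg_mul, ← tot_smul, ← tot_add (h1.smul _) (h2.smul _)]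
  congr 1
  funext t x
  simp only [wd, Pi.add_apply, Pi.smul_apply, Pi.mul_apply, smul_eq_mul]
  ring

theorem norm_wd_le {A : ℝ → (Fin 3 → ℝ) → ℂ} {c c1 c2 : ℝ} {x : Fin 3 → ℝ} (hA : ‖A t x‖ ≤ c)
    (h1 : ‖gb (dd et φ) (t, x)‖ ≤ c1) (h2 : ‖gb (gb φ) (t, x)‖ ≤ c2) :
    ‖wd A φ t x‖ ≤ 4 * (c * c1) + 8 * (c * c * c2) := by
  have hc := (norm_nonneg _).trans hA
  refine (norm_sub_le _ _).trans ?_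
  simp only [norm_mul, Complex.norm_I, mul_one, RCLike.norm_ofNat]
  gcongr

theorem pr_tendsto_zero {S : ℕ → ℝ → E → ℂ} {ρ δ : ℕ → ℝ} (hS : ∀ q, Rg Set.univ (ρ q) (S q))
    (hρ : ∀ q, 0 < ρ q) (hb : ∀ q t x, ‖S q t (emb x)‖ ≤ δ q) (hδ : Tendsto δ atTop (𝓝 0))
    (hg : Tst g) : Tendsto (fun q => pr (S q) g) atTop (𝓝 0) := by
  obtain ⟨T, hT⟩ := hg.supp
  obtain ⟨c, hc0, hc⟩ := hg.bounded
  obtain ⟨D, hD⟩ := hδ.bddAbove_range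
  have := tot_tendsto (k := fun q t x => S q t (emb x) * g (t, x)) (l := 0) (T := T) (c := D * c)
    (fun q => (hS q).nice (hρ q) hg) (fun q t ht x => by simp [hT t ht]) (fun q t x hx => ?_)
    (fun t x => ?_)
  · simpa [tot, pr] using this
  · rw [norm_mul]
    exact mul_le_mul ((hb q t x).trans (hD ⟨q, rfl⟩)) (hc t x hx) (norm_nonneg _)
      ((norm_nonneg _).trans ((hb q t x).trans (hD ⟨q, rfl⟩)))
  · have h1 : Tendsto (fun q => S q t (emb x)) atTop (𝓝 0) :=
      squeeze_zero_norm (fun q => hb q t x) hδ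
    simpa using h1.mul_const (g (t, x))

theorem weak_eq {e : ℝ → ℝ} {ψ F H S : ℕ → ℝ → E → ℂ} {δ ρ L K : ℕ → ℝ}
    {A : ℝ → (Fin 3 → ℝ) → ℂ} {c : ℝ} (hρ : ∀ q, 0 < ρ q)
    (Y : ∀ q, Hyp e (ρ q) (L q) (δ q) (K q) (ψ q) (F q) (H q) (S q))
    (hδ : Tendsto δ atTop (𝓝 0)) (hb : ∀ q t x, ‖dz (ψ q) t (emb x)‖ ≤ c)
    (hl : ∀ t x, Tendsto (fun q => dz (ψ q) t (emb x)) atTop (𝓝 (A t x)))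
    (hA : Continuous (Function.uncurry A)) (hφ : Tst φ) (hc : (fun p => conj (φ p)) = φ) :
    ∫ t, ∫ x in box3, (wd A φ t x).re = 0 := by
  have hJ : IsOpen (Set.univ : Set ℝ) := isOpen_univ
  rw [tot_re (nice_wd hA hφ)]
  have hR : ∀ q, Rg Set.univ (ρ q) (dz (ψ q)) := fun q => (Y q).env.reg.toRg.dz hJ
  obtain ⟨T1, hT1⟩ := (hφ.dd et).gb.supp
  obtain ⟨T2, hT2⟩ := hφ.gb.gb.supp
  obtain ⟨c1, -, hc1⟩ := (hφ.dd et).gb.bounded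
  obtain ⟨c2, -, hc2⟩ := hφ.gb.gb.bounded
  have h1 := tot_tendsto (k := fun q => wd (fun t x => dz (ψ q) t (emb x)) φ) (l := wd A φ)
    (T := max T1 T2) (fun q => nice_wd ((hR q).cont_uncurry_emb (hρ q)) hφ)
    (fun q t ht x => by
      rw [wd, hT1 t ((le_max_left _ _).trans_lt ht), hT2 t ((le_max_right _ _).trans_lt ht)]
      simp)
    (fun q t x hx => norm_wd_le (hb q t x) (hc1 t x hx) (hc2 t x hx))
    (fun t x => (((hl t x).mul_const _).const_mul _).sub
      ((((hl t x).mul (hl t x)).mul_const _).const_mul _))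
  have h2 := (Complex.continuous_re.tendsto _).comp h1
  have h3 := pr_tendsto_zero (fun q => (Y q).regS.toRg) hρ
    (fun q t x => (Y q).bdS t _ (emb_mem (hρ q) x)) (by have := hδ.const_mul ((1 : ℝ) / 10 ^ 5); rwa [mul_zero] at this)
    hφ.gb.gb
  have h4 := (Complex.continuous_re.tendsto _).comp (h3.const_mul (-8 * Complex.I))
  refine tendsto_nhds_unique h2 ?_
  simp only [mul_zero, Complex.zero_re] at h4
  refine h4.congr fun q => ?_
  simp only [Function.comp_apply]
  rw [tot_wd (hR q) (hρ q) hφ, (Y q).weak (hρ q) hφ hc]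

end

section

theorem pd3_slice {u : ℝ × (Fin 3 → ℝ) → ℝ} (hu : Differentiable ℝ u) (i : Fin 3) (t : ℝ)
    (x : Fin 3 → ℝ) : pd3 i (fun y => u (t, y)) x = dd (ex i) u (t, x) := by
  have := ((hu (t, x)).hasFDerivAt.comp x (hasFDerivAt_prodMk_right t x)).fderiv
  rw [pd3, dd, ex]
  change fderiv ℝ (u ∘ fun y => (t, y)) x _ = _
  rw [this]
  rfl

theorem deriv_slice {u : ℝ × (Fin 3 → ℝ) → ℝ} (hu : Differentiable ℝ u) (t : ℝ)
    (x : Fin 3 → ℝ) : deriv (fun s => u (s, x)) t = dd et u (t, x) := by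
  have := ((hu (t, x)).hasFDerivAt.comp t (hasFDerivAt_prodMk_left t x)).hasDerivAt.deriv
  rw [dd, et]
  change deriv (u ∘ fun s => (s, x)) t = _
  rw [this]
  rfl

theorem dd_ofReal {u : ℝ × (Fin 3 → ℝ) → ℝ} (hu : Differentiable ℝ u) (v : ℝ × (Fin 3 → ℝ)) :
    dd v (fun p => (u p : ℂ)) = fun p => ((dd v u p : ℝ) : ℂ) := by
  funext p
  have := (Complex.ofRealCLM.hasFDerivAt.comp p (hu p).hasFDerivAt).fderiv
  rw [dd, dd]
  change fderiv ℝ (Complex.ofRealCLM ∘ u) p v = _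
  rw [this]
  rfl

theorem contDiff_dd {u : ℝ × (Fin 3 → ℝ) → ℝ} (hu : ContDiff ℝ (⊤ : ℕ∞) u)
    (v : ℝ × (Fin 3 → ℝ)) : ContDiff ℝ (⊤ : ℕ∞) (dd v u) :=
  (hu.fderiv_right (by simp)).clm_apply contDiff_const

theorem qgWeakIntegrand_eq {Ψ φ : ℝ → (Fin 3 → ℝ) → ℝ} {A : ℝ → (Fin 3 → ℝ) → ℂ}
    (hΨ : ∀ t x, HasFDerivAt (Ψ t) (gr (A t x)) x)
    (hφ : ContDiff ℝ (⊤ : ℕ∞) (fun p : ℝ × (Fin 3 → ℝ) => φ p.1 p.2))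
    (hT : Tst fun p => (φ p.1 p.2 : ℂ)) (t : ℝ) (x : Fin 3 → ℝ) :
    qgWeakIntegrand Ψ φ t x = (wd A (fun p => (φ p.1 p.2 : ℂ)) t x).re := by
  set u : ℝ × (Fin 3 → ℝ) → ℝ := fun p => φ p.1 p.2 with hu
  have du : Differentiable ℝ u := hφ.differentiable (by simp)
  have d1 : ∀ v, Differentiable ℝ (dd v u) := fun v => (contDiff_dd hφ v).differentiable (by simp)
  have e1 : ∀ i s, pd3 i (φ s) = fun y => dd (ex i) u (s, y) := fun i s =>
    funext fun y => pd3_slice du i s y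
  have e2 : ∀ i j, pd3 j (fun y => dd (ex i) u (t, y)) x = dd (ex j) (dd (ex i) u) (t, x) :=
    fun i j => pd3_slice (d1 _) j t x
  have e3 : ∀ i, deriv (fun s => dd (ex i) u (s, x)) t = dd et (dd (ex i) u) (t, x) :=
    fun i => deriv_slice (d1 _) t x
  have e4 : ∀ v w, dd v (dd w fun p => (u p : ℂ)) = fun p => ((dd v (dd w u) p : ℝ) : ℂ) :=
    fun v w => by rw [dd_ofReal du, dd_ofReal (d1 w)]
  obtain ⟨h0, h1, h2⟩ := pd3_of_gr (hΨ t x)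
  have g1 : gb (dd et fun p => (u p : ℂ)) (t, x) =
      1 / 2 * (((dd et (dd (ex 0) u) (t, x) : ℝ) : ℂ) + Complex.I * ((dd et (dd (ex 1) u) (t, x) : ℝ) : ℂ)) := by
    simp only [gb, Pi.smul_apply, Pi.add_apply, smul_eq_mul]
    rw [hT.dd_comm (v := ex 0), hT.dd_comm (v := ex 1), e4, e4]
  have g2 : gb (gb fun p => (u p : ℂ)) (t, x) =
      1 / 4 * (((dd (ex 0) (dd (ex 0) u) (t, x) : ℝ) : ℂ) - ((dd (ex 1) (dd (ex 1) u) (t, x) : ℝ) : ℂ) +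
        Complex.I * (((dd (ex 1) (dd (ex 0) u) (t, x) : ℝ) : ℂ) + ((dd (ex 0) (dd (ex 1) u) (t, x) : ℝ) : ℂ))) := by
    have : gb (gb fun p => (u p : ℂ)) = (1 / 2 : ℂ) • (gb (dd (ex 0) fun p => (u p : ℂ)) +
        Complex.I • gb (dd (ex 1) fun p => (u p : ℂ))) := by
      rw [← hT.dd_gb, ← hT.dd_gb, gb]
    rw [this]
    simp only [gb, Pi.smul_apply, Pi.add_apply, smul_eq_mul]
    rw [e4, e4, e4, e4]
    linear_combination (1 / 4 * ((dd (ex 1) (dd (ex 1) u) (t, x) : ℝ) : ℂ)) * Complex.I_mul_I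
  have c1 : dd (ex 1) (dd (ex 0) u) (t, x) = dd (ex 0) (dd (ex 1) u) (t, x) := by
    have := congrFun (hT.dd_comm (v := ex 1) (w := ex 0)) (t, x)
    rw [e4, e4] at this
    exact Complex.ofReal_injective this
  simp only [qgWeakIntegrand, Fin.sum_univ_three, e1, e2, e3, h0, h1, h2]
  rw [wd, g1, g2, c1]
  simp [Complex.mul_re, Complex.mul_im]
  ring

end

end QG

/-- **Non-uniqueness and anomalous energy profiles for 3D QG.**
Given a smooth, compactly supported, non-negative energy profile `e` and `ζ ∈ (0,1/5)`,
there exist `Ψ` with `∇Ψ ∈ C^ζ(ℝ × 𝕋³)` and `Q ∈ L^∞(ℝ; C^{2ζ}(𝕋³;ℝ³))` such that `∇Ψ` is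
a weak solution of the 3D quasi-geostrophic system with energy profile `e`. -/
theorem qg_convex_integration
    (e : ℝ → ℝ) (he_smooth : ContDiff ℝ (⊤ : ℕ∞) e) (he_supp : HasCompactSupport e)
    (he_nonneg : ∀ t, 0 ≤ e t) (ζ : ℝ) (hζ : ζ ∈ Set.Ioo (0 : ℝ) (1 / 5)) :
    ∃ (Ψ : ℝ → (Fin 3 → ℝ) → ℝ) (Q : ℝ → (Fin 3 → ℝ) → (Fin 3 → ℝ)),
      (∀ t, Differentiable ℝ (Ψ t)) ∧
      (∀ t, Periodic3 (Ψ t)) ∧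
      -- ∇Ψ ∈ C^ζ(ℝ × 𝕋³): bounded and ζ-Hölder jointly in time and space
      (∃ C : ℝ, 0 < C ∧
        (∀ t x, ‖(fun i => pd3 i (Ψ t) x : Fin 3 → ℝ)‖ ≤ C) ∧
        (∀ t t' x x', ‖(fun i => pd3 i (Ψ t) x - pd3 i (Ψ t') x' : Fin 3 → ℝ)‖ ≤
          C * (|t - t'| + ‖x - x'‖) ^ ζ)) ∧
      -- Q ∈ L^∞(ℝ; C^{2ζ}(𝕋³; ℝ³))
      (∀ t, Periodic3 (Q t)) ∧
      (∃ C : ℝ, 0 < C ∧ ∀ t,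
        (∀ x, ‖Q t x‖ ≤ C) ∧
        (∀ x x', ‖Q t x - Q t x'‖ ≤ C * ‖x - x'‖ ^ (2 * ζ))) ∧
      -- ∇Ψ is a weak solution of 3D QG
      (∀ φ : ℝ → (Fin 3 → ℝ) → ℝ,
        ContDiff ℝ (⊤ : ℕ∞) (fun p : ℝ × (Fin 3 → ℝ) => φ p.1 p.2) →
        (∀ t, Periodic3 (φ t)) →
        (∃ T : ℝ, ∀ t, T ≤ |t| → ∀ x, φ t x = 0) →
        (∫ t : ℝ, ∫ x in box3, qgWeakIntegrand Ψ φ t x) = 0) ∧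
      -- prescribed energy profile
      (∀ t, (∫ x in box3, ∑ i, (pd3 i (Ψ t) x) ^ 2) = e t) := by
  open QG ComplexConjugate in
  obtain ⟨hζ0, hζ1⟩ := hζ
  obtain ⟨Ke, hKe⟩ := he_smooth.lipschitzWith_of_hasCompactSupport he_supp (by simp)
  obtain ⟨M, hM⟩ := he_supp.exists_bound_of_continuous he_smooth.continuous
  obtain ⟨ψ, F, H, S, δ, ρ, L, K, U, A, c, C, hc, hC, hρ, Y, hδ, hA, hb, hl, hAc, hAC, hU, hper⟩ :=
    exists_limit hζ0 hζ1 Ke.2 (fun t t' => by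
      simpa [Real.dist_eq] using hKe.dist_le_mul t t') he_nonneg
      (fun t => (le_abs_self _).trans (hM t))
  have hp := fun t x => pd3_of_gr (hU t x)
  refine ⟨U, 0, fun t x => (hU t x).differentiableAt, hper, ⟨2 * c + 2 * C + 1, by positivity, ?_, ?_⟩,
    fun t x i => rfl, ⟨1, one_pos, fun t => ⟨fun x => by simp, fun x x' => ?_⟩⟩, ?_, ?_⟩
  · intro t x
    have := norm_le_of_gr (u := fun i => pd3 i (U t) x) (hp t x).1 (hp t x).2.1 (hp t x).2.2
    have := hAc t x
    linarith
  · intro t t' x x'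
    have h1 := norm_le_of_gr (c := A t x - A t' x') (u := fun i => pd3 i (U t) x - pd3 i (U t') x')
      (by simp only [(hp _ _).1, Complex.sub_re]; ring)
      (by simp only [(hp _ _).2.1, Complex.sub_im]; ring)
      (by simp only [(hp _ _).2.2]; ring)
    have h2 : 0 ≤ (|t - t'| + ‖x - x'‖) ^ ζ := by positivity
    nlinarith [hAC t t' x x', mul_nonneg hc h2]
  · simpa using Real.rpow_nonneg (norm_nonneg (x - x')) (2 * ζ)
  · rintro φ hφ hφp ⟨T, hT⟩
    have tst : Tst fun p => (φ p.1 p.2 : ℂ) :=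
      ⟨Complex.ofRealCLM.contDiff.comp hφ, fun t x i => by rw [hφp t x i],
        T, fun t ht x => by simp [hT t ht.le]⟩
    simp only [qgWeakIntegrand_eq hU hφ tst]
    exact weak_eq hρ Y hδ hb hl hA tst (by simp)
  · intro t
    rw [← energy_eq hρ Y hδ hb hl t]
    have h1 : ∀ x, ∑ i, (pd3 i (U t) x) ^ 2 = 4 * (A t x * conj (A t x)).re := fun x => by
      rw [Fin.sum_univ_three, (hp t x).1, (hp t x).2.1, (hp t x).2.2]
      simp
      ring
    simp only [h1]
    rw [integral_const_mul]
    congr 1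
    have h2 : Continuous (A t) := hA.comp (Continuous.prodMk_right t)
    have h3 : IntegrableOn (fun x => A t x * conj (A t x)) box3 :=
      ((h2.mul (Complex.continuous_conj.comp h2)).continuousOn).integrableOn_compact isCompact_box3
    exact integral_re h3

end
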